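/- Let (C_n) and (C'_n) be sequences where C_n and C'_n are conjugacy classes of the symmetric group S_n, with cycle counts c_j(n) and c'_j(n) respectively, and assume c_1(n) = c'_1(n) and c_2(n) = c'_2(n) for all n. Let P_n be the probability that two independent uniformly random elements π ∈ C_n, π' ∈ C'_n generate a subgroup containing A_n. Then: (1) P_n → 1 as n → ∞ if and only if c_1(n) = o(n^{1/2}) and c_2(n) = o(n); (2) liminf_{n→∞} P_n > 0 if and only if c_1(n) = O(n^{1/2}) and limsup_{n→∞} c_2(n)/n < 1/2. -/

import Mathlib

open Filter Asymptotics

/-- The number of `j`-cycles in the cycle decomposition of `π` (fixed points are `1`-cycles). -/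
noncomputable def cycleCount {n : ℕ} (π : Equiv.Perm (Fin n)) (j : ℕ) : ℕ :=
  if j = 1 then Nat.card (Function.fixedPoints ⇑π) else Multiset.count j π.cycleType

/-- The probability that, for `π₁` uniform in the conjugacy class of `π` and `π₂` uniform and
independent in the conjugacy class of `π'`, the subgroup `⟨π₁, π₂⟩` contains `A_n`. -/
noncomputable def genProb (n : ℕ) (π π' : Equiv.Perm (Fin n)) : ℝ :=
  (Nat.card {p : Equiv.Perm (Fin n) × Equiv.Perm (Fin n) //
      IsConj π p.1 ∧ IsConj π' p.2 ∧
      alternatingGroup (Fin n) ≤ Subgroup.closure {p.1, p.2}} : ℝ) /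
  ((Nat.card {σ : Equiv.Perm (Fin n) // IsConj π σ} : ℝ) *
   (Nat.card {σ : Equiv.Perm (Fin n) // IsConj π' σ} : ℝ))

namespace RandGen

open Equiv Equiv.Perm Finset

section Counting

variable {α : Type*} [Fintype α] [DecidableEq α]

theorem card_perm_fixing (s : Finset α) :
    #(univ.filter fun σ : Perm α => ∀ x ∈ s, σ x = x) = (Fintype.card α - #s).factorial := by
  have h := Fintype.card_congr (Perm.subtypeEquivSubtypePerm (fun a => a ∉ s))
  rw [Fintype.card_perm, Fintype.card_subtype_compl, Fintype.card_coe] at h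
  rw [h, Fintype.card_subtype]
  simp

theorem card_perm_extending (s : Finset α) {f : α → α} (hf : Set.InjOn f s) :
    #(univ.filter fun σ : Perm α => ∀ x ∈ s, σ x = f x) = (Fintype.card α - #s).factorial := by
  obtain ⟨g, hg⟩ := Finset.exists_equiv_extend_of_card_eq (t := (univ : Finset α)) (by simp)
    (subset_univ (s.image f)) hf
  set σ₀ : Perm α := g.trans (Equiv.subtypeUnivEquiv (by simp)) with hσ₀
  have hσ : ∀ x ∈ s, σ₀ x = f x := fun x hx => hg x hx
  rw [← card_perm_fixing s]
  refine card_bij (fun σ _ => σ₀⁻¹ * σ) ?_ (fun _ _ _ _ h => mul_left_cancel h) ?_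
  · intro σ h
    simp only [mem_filter, mem_univ, true_and] at h ⊢
    intro x hx
    rw [Perm.mul_apply, Perm.inv_eq_iff_eq, h x hx, hσ x hx]
  · intro σ h
    simp only [mem_filter, mem_univ, true_and] at h
    refine ⟨σ₀ * σ, ?_, by group⟩
    simp only [mem_filter, mem_univ, true_and]
    intro x hx
    rw [Perm.mul_apply, h x hx, hσ x hx]

theorem card_perm_image_eq {s t : Finset α} (h : #s = #t) :
    #(univ.filter fun σ : Perm α => s.image σ = t) * (Fintype.card α).choose #s =
      (Fintype.card α).factorial := by
  have key : ∀ t' ∈ powersetCard #s univ, #(univ.filter fun σ : Perm α => s.image σ = t') =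
      #(univ.filter fun σ : Perm α => s.image σ = t) := by
    intro t' ht'
    rw [mem_powersetCard] at ht'
    obtain ⟨g, hg⟩ : ∃ g : Perm α, t'.image g = t := by
      have e : {x // x ∈ t'} ≃ {x // x ∈ t} := Fintype.equivOfCardEq (by simp [ht'.2, h])
      refine ⟨e.extendSubtype, ?_⟩
      refine eq_of_subset_of_card_le ?_ ?_
      · intro y hy
        obtain ⟨x, hx, rfl⟩ := mem_image.1 hy
        exact e.extendSubtype_mem x hx
      · rw [card_image_of_injective _ (Equiv.injective _), ht'.2, h]
    refine card_bij (fun σ _ => g * σ) ?_ (fun _ _ _ _ h => mul_left_cancel h) ?_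
    · intro σ hσ
      simp only [mem_filter, mem_univ, true_and] at hσ ⊢
      rw [← hg, ← hσ, image_image]; rfl
    · intro σ hσ
      simp only [mem_filter, mem_univ, true_and] at hσ
      refine ⟨g⁻¹ * σ, ?_, by group⟩
      simp only [mem_filter, mem_univ, true_and]
      rw [Perm.coe_mul, ← image_image, hσ, ← hg, image_image, ← Perm.coe_mul]
      simp
  have h3 := card_eq_sum_card_fiberwise (s := (univ : Finset (Perm α)))
    (t := powersetCard #s univ) (f := fun σ : Perm α => s.image σ) (by
      intro σ _
      simp [card_image_of_injective _ σ.injective])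
  rw [sum_congr rfl key, sum_const, card_powersetCard, card_univ, card_univ, Fintype.card_perm,
    smul_eq_mul] at h3
  rw [h3, mul_comm]

end Counting

section Prob

variable {n : ℕ}

/-- Expectation over a uniformly random permutation. -/
noncomputable def ex (f : Perm (Fin n) → ℝ) : ℝ := (∑ σ, f σ) / n.factorial

open Classical in
/-- Probability of an event for a uniformly random permutation. -/
noncomputable def pr (p : Perm (Fin n) → Prop) : ℝ := ex fun σ => if p σ then 1 else 0

theorem ex_mono {f g : Perm (Fin n) → ℝ} (h : ∀ σ, f σ ≤ g σ) : ex f ≤ ex g := by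
  unfold ex; gcongr; exact h _

theorem ex_nonneg {f : Perm (Fin n) → ℝ} (h : ∀ σ, 0 ≤ f σ) : 0 ≤ ex f :=
  div_nonneg (sum_nonneg fun σ _ => h σ) (Nat.cast_nonneg _)

theorem ex_add (f g : Perm (Fin n) → ℝ) : ex (fun σ => f σ + g σ) = ex f + ex g := by
  simp only [ex, sum_add_distrib, add_div]

theorem ex_sub (f g : Perm (Fin n) → ℝ) : ex (fun σ => f σ - g σ) = ex f - ex g := by
  simp only [ex, sum_sub_distrib, sub_div]

theorem ex_const_mul (c : ℝ) (f : Perm (Fin n) → ℝ) : ex (fun σ => c * f σ) = c * ex f := by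
  simp only [ex, ← mul_sum, mul_div_assoc]

theorem ex_sum {ι : Type*} (s : Finset ι) (f : ι → Perm (Fin n) → ℝ) :
    ex (fun σ => ∑ i ∈ s, f i σ) = ∑ i ∈ s, ex (f i) := by
  simp only [ex, ← sum_div]; rw [sum_comm]

theorem ex_const (c : ℝ) : ex (fun _ : Perm (Fin n) => c) = c := by
  have : ((n.factorial : ℕ) : ℝ) ≠ 0 := Nat.cast_ne_zero.2 (Nat.factorial_ne_zero n)
  simp only [ex, sum_const, card_univ, Fintype.card_perm, Fintype.card_fin, nsmul_eq_mul]
  field_simp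

open Classical in
theorem pr_eq_card (p : Perm (Fin n) → Prop) :
    pr p = #(univ.filter fun σ => p σ) / n.factorial := by
  rw [pr, ex, ← sum_filter, sum_const, nsmul_eq_mul, mul_one]

theorem pr_mono {p q : Perm (Fin n) → Prop} (h : ∀ σ, p σ → q σ) : pr p ≤ pr q := by
  refine ex_mono fun σ => ?_
  by_cases hp : p σ
  · simp [hp, h σ hp]
  · simp only [hp, if_false]; split_ifs <;> norm_num

theorem pr_nonneg (p : Perm (Fin n) → Prop) : 0 ≤ pr p :=
  ex_nonneg fun σ => by split_ifs <;> norm_num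

theorem pr_le_one (p : Perm (Fin n) → Prop) : pr p ≤ 1 := by
  rw [← ex_const (n := n) 1]
  exact ex_mono fun σ => by split_ifs <;> norm_num

theorem pr_or_le (p q : Perm (Fin n) → Prop) : pr (fun σ => p σ ∨ q σ) ≤ pr p + pr q := by
  rw [pr, pr, pr, ← ex_add]
  refine ex_mono fun σ => ?_
  by_cases hp : p σ <;> by_cases hq : q σ <;> simp [hp, hq]

theorem pr_not (p : Perm (Fin n) → Prop) : pr (fun σ => ¬ p σ) = 1 - pr p := by
  rw [pr, pr]
  nth_rewrite 2 [← ex_const (n := n) 1]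
  rw [← ex_sub]
  congr 1
  funext σ
  by_cases hp : p σ <;> simp [hp]

theorem pr_exists_le {ι : Type*} (s : Finset ι) (p : ι → Perm (Fin n) → Prop) :
    pr (fun σ => ∃ i ∈ s, p i σ) ≤ ∑ i ∈ s, pr (p i) := by
  classical
  simp only [pr]
  rw [← ex_sum]
  refine ex_mono fun σ => ?_
  have hnn : ∀ i ∈ s, (0 : ℝ) ≤ if p i σ then 1 else 0 := fun i _ => by split_ifs <;> norm_num
  split_ifs with h
  · obtain ⟨i, hi, hp⟩ := h
    refine le_trans ?_ (single_le_sum hnn hi)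
    simp [hp]
  · exact sum_nonneg hnn

theorem pr_le_ex_div {p : Perm (Fin n) → Prop} {f : Perm (Fin n) → ℝ} {c : ℝ} (hc : 0 < c)
    (hf : ∀ σ, 0 ≤ f σ) (h : ∀ σ, p σ → c ≤ f σ) : pr p ≤ ex f / c := by
  rw [div_eq_inv_mul, ← ex_const_mul]
  refine ex_mono fun σ => ?_
  split_ifs with hp
  · rw [← div_eq_inv_mul, le_div_iff₀ hc, one_mul]; exact h σ hp
  · exact mul_nonneg (inv_nonneg.2 hc.le) (hf σ)

theorem pr_extending (s : Finset (Fin n)) {f : Fin n → Fin n} (hf : Set.InjOn f s) :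
    pr (fun σ => ∀ x ∈ s, σ x = f x) = (n - #s).factorial / n.factorial := by
  classical
  rw [pr_eq_card]
  congr 2
  have := card_perm_extending s hf
  rw [Fintype.card_fin] at this
  rw [← this]
  congr

theorem pr_image_eq {s t : Finset (Fin n)} (h : #s = #t) :
    pr (fun σ => s.image σ = t) = 1 / n.choose #s := by
  classical
  rw [pr_eq_card]
  have := card_perm_image_eq h
  rw [Fintype.card_fin] at this
  have h2 : (n.choose #s : ℝ) ≠ 0 := by
    have := Nat.choose_pos (card_le_univ s)
    rw [Fintype.card_fin] at this
    positivity
  have h3 : ((n.factorial : ℕ) : ℝ) ≠ 0 := Nat.cast_ne_zero.2 (Nat.factorial_ne_zero n)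
  rw [div_eq_div_iff h3 h2]
  rw [← this]; push_cast
  rw [one_mul]
  congr!

/-- The group generated by `σ τ σ⁻¹` and `τ'`. -/
def genGroup (τ τ' σ : Perm (Fin n)) : Subgroup (Perm (Fin n)) :=
  Subgroup.closure {σ * τ * σ⁻¹, τ'}

theorem closure_conj_pair_le {a b g : Perm (Fin n)} :
    alternatingGroup (Fin n) ≤ Subgroup.closure {a, b} →
    alternatingGroup (Fin n) ≤ Subgroup.closure {g * a * g⁻¹, g * b * g⁻¹} := by
  intro h x hx
  have h1 : g⁻¹ * x * g ∈ alternatingGroup (Fin n) := by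
    have := (alternatingGroup (Fin n)).normal_of_characteristic.conj_mem x hx g⁻¹
    simpa using this
  have h2 := Subgroup.mem_map_of_mem (MulAut.conj g).toMonoidHom (h h1)
  rw [MonoidHom.map_closure, Set.image_pair] at h2
  simpa [mul_assoc] using h2

open Classical in
set_option maxHeartbeats 1000000 in
theorem genProb_eq_pr (τ τ' : Perm (Fin n)) :
    genProb n τ τ' = pr fun σ => alternatingGroup (Fin n) ≤ genGroup τ τ' σ := by
  set Q : Perm (Fin n) → Perm (Fin n) → Prop := fun a b =>
    alternatingGroup (Fin n) ≤ Subgroup.closure {a, b} with hQ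
  have hQc : ∀ g a b, Q a b → Q (g * a * g⁻¹) (g * b * g⁻¹) :=
    fun g a b h => closure_conj_pair_le h
  set C : Finset (Perm (Fin n)) := univ.filter fun p => IsConj τ p with hC
  set C' : Finset (Perm (Fin n)) := univ.filter fun p => IsConj τ' p with hC'
  set D : Finset (Perm (Fin n)) := univ.filter fun p => IsConj τ p ∧ Q p τ' with hD
  have e1 : ∀ ρ : Perm (Fin n), Nat.card {σ : Perm (Fin n) // IsConj ρ σ} =
      #(univ.filter fun p => IsConj ρ p) := fun ρ => by
    rw [Nat.card_eq_fintype_card, Fintype.card_subtype]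
  have e3 : Nat.card {p : Perm (Fin n) × Perm (Fin n) // IsConj τ p.1 ∧ IsConj τ' p.2 ∧
      alternatingGroup (Fin n) ≤ Subgroup.closure {p.1, p.2}} = #C' * #D := by
    rw [Nat.card_eq_fintype_card, Fintype.card_subtype,
      card_eq_sum_card_fiberwise (t := C') (f := fun p => p.2), ← smul_eq_mul, ← sum_const]
    · refine sum_congr rfl fun b hb => ?_
      obtain ⟨g, hg⟩ := isConj_iff.1 (mem_filter.1 hb).2
      symm
      refine card_bij (fun p _ => (g * p * g⁻¹, b)) ?_ ?_ ?_
      · intro p hp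
        simp only [hD, mem_filter, mem_univ, true_and] at hp
        simp only [mem_filter, mem_univ, true_and, and_true]
        refine ⟨hp.1.trans (isConj_iff.2 ⟨g, rfl⟩), isConj_iff.2 ⟨g, hg⟩, ?_⟩
        rw [← hg]
        exact hQc g _ _ hp.2
      · intro p _ p' _ h
        simp only [Prod.mk.injEq, and_true] at h
        exact mul_left_cancel (mul_right_cancel h)
      · rintro ⟨p, b'⟩ hp
        simp only [mem_filter, mem_univ, true_and] at hp
        obtain ⟨⟨h1, _, h3⟩, rfl⟩ := hp
        refine ⟨g⁻¹ * p * g, ?_, Prod.ext (by simp only; group) rfl⟩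
        simp only [hD, mem_filter, mem_univ, true_and]
        refine ⟨h1.trans (isConj_iff.2 ⟨g⁻¹, by simp⟩), ?_⟩
        have h4 := hQc g⁻¹ _ _ h3
        rw [← hg] at h4
        have e4 : g⁻¹ * (g * τ' * g⁻¹) * g⁻¹⁻¹ = τ' := by group
        rw [e4, inv_inv] at h4
        exact h4
    · intro p hp
      simp only [coe_filter, mem_univ, true_and, Set.mem_setOf_eq] at hp
      exact mem_filter.2 ⟨mem_univ _, hp.2.1⟩
  set z := #(univ.filter fun σ : Perm (Fin n) => σ * τ * σ⁻¹ = τ) with hz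
  have hfib : ∀ p ∈ C, #(univ.filter fun σ : Perm (Fin n) => σ * τ * σ⁻¹ = p) = z := by
    intro p hp
    obtain ⟨g, hg⟩ := isConj_iff.1 (mem_filter.1 hp).2
    refine card_bij (fun σ _ => g⁻¹ * σ) ?_ (fun _ _ _ _ h => mul_left_cancel h) ?_
    · intro σ hσ
      simp only [mem_filter, mem_univ, true_and] at hσ ⊢
      calc g⁻¹ * σ * τ * (g⁻¹ * σ)⁻¹ = g⁻¹ * (σ * τ * σ⁻¹) * g := by group
        _ = τ := by rw [hσ, ← hg]; group
    · intro σ hσ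
      simp only [mem_filter, mem_univ, true_and] at hσ
      refine ⟨g * σ, ?_, by group⟩
      simp only [mem_filter, mem_univ, true_and]
      calc g * σ * τ * (g * σ)⁻¹ = g * (σ * τ * σ⁻¹) * g⁻¹ := by group
        _ = p := by rw [hσ, ← hg]
  have e4 : n.factorial = #C * z := by
    have : #(univ : Finset (Perm (Fin n))) = n.factorial := by
      rw [card_univ, Fintype.card_perm, Fintype.card_fin]
    rw [← this, card_eq_sum_card_fiberwise (t := C) (f := fun σ => σ * τ * σ⁻¹),
      sum_congr rfl hfib, sum_const, smul_eq_mul]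
    intro σ _
    simp only [hC, coe_filter, mem_univ, true_and, Set.mem_setOf_eq]
    exact isConj_iff.2 ⟨σ, rfl⟩
  have e5 : #(univ.filter fun σ : Perm (Fin n) => alternatingGroup (Fin n) ≤ genGroup τ τ' σ)
      = #D * z := by
    rw [card_eq_sum_card_fiberwise (t := D) (f := fun σ => σ * τ * σ⁻¹), ← smul_eq_mul,
      ← sum_const]
    · refine sum_congr rfl fun p hp => ?_
      have hp' := hp
      simp only [hD, mem_filter, mem_univ, true_and] at hp
      rw [← hfib p (mem_filter.2 ⟨mem_univ _, hp.1⟩), filter_filter]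
      congr 1
      ext σ
      simp only [mem_filter, mem_univ, true_and, and_iff_right_iff_imp]
      rintro h
      rw [genGroup, h]
      exact hp.2
    · intro σ hσ
      simp only [coe_filter, mem_univ, true_and, Set.mem_setOf_eq] at hσ
      simp only [hD, coe_filter, mem_univ, true_and, Set.mem_setOf_eq]
      exact ⟨isConj_iff.2 ⟨σ, rfl⟩, hσ⟩
  have hz0 : (z : ℝ) ≠ 0 := Nat.cast_ne_zero.2 (card_ne_zero.2 ⟨1, by simp⟩)
  have hC0 : (#C : ℝ) ≠ 0 := Nat.cast_ne_zero.2 (card_ne_zero.2 ⟨τ, mem_filter.2 ⟨mem_univ _, .refl _⟩⟩)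
  have hC0' : (#C' : ℝ) ≠ 0 := Nat.cast_ne_zero.2 (card_ne_zero.2 ⟨τ', mem_filter.2 ⟨mem_univ _, .refl _⟩⟩)
  rw [genProb, e1, e1, ← hC, ← hC', e3, pr_eq_card, e4, e5]
  push_cast
  field_simp

end Prob

end RandGen

namespace RandGen

open Equiv Equiv.Perm Finset
open scoped Fin.NatCast Fin.CommRing

section Pattern

variable {n : ℕ}

/-- The product `σ τ σ⁻¹ τ'`. -/
def word (τ τ' σ : Perm (Fin n)) : Perm (Fin n) := σ * τ * σ⁻¹ * τ'

theorem pr_forall_eq {ι : Type*} [Fintype ι] {a b : ι → Fin n} (ha : Function.Injective a)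
    (hb : Function.Injective b) :
    pr (fun σ => ∀ i, σ (a i) = b i) = (n - Fintype.card ι).factorial / n.factorial := by
  classical
  have h := pr_extending (univ.image a) (f := Function.extend a b id) (by
    rintro _ hx _ hy hxy
    simp only [coe_image, coe_univ, Set.image_univ, Set.mem_range] at hx hy
    obtain ⟨i, rfl⟩ := hx
    obtain ⟨j, rfl⟩ := hy
    rw [ha.extend_apply, ha.extend_apply] at hxy
    rw [hb hxy])
  rw [card_image_of_injective _ ha, card_univ] at h
  rw [← h]
  congr 1
  funext σ
  simp [ha.extend_apply]

/-- Sequences of points of `U` with pairwise well separated positions along the cycles of `τ`. -/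
def GoodSeq (τ : Perm (Fin n)) (U : Finset (Fin n)) {k : ℕ} (z : Fin k → Fin n) : Prop :=
  (∀ i, z i ∈ U) ∧ ∀ i j, i ≠ j → z j ≠ z i ∧ z j ≠ τ (z i) ∧ z j ≠ τ (τ (z i))

theorem GoodSeq.injective {τ : Perm (Fin n)} {U : Finset (Fin n)} {k : ℕ} {z : Fin k → Fin n}
    (h : GoodSeq τ U z) : Function.Injective z := by
  intro i j hij
  by_contra hne
  exact (h.2 i j hne).1 hij.symm

open Classical in
theorem prod_le_card_goodSeq (τ : Perm (Fin n)) (U : Finset (Fin n)) (k : ℕ) :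
    ∏ i ∈ range k, (#U - 5 * i) ≤ #(univ.filter fun z : Fin k → Fin n => GoodSeq τ U z) := by
  induction k with
  | zero =>
    rw [prod_range_zero, Nat.one_le_iff_ne_zero, Ne, card_eq_zero, ← Ne, ← nonempty_iff_ne_empty]
    exact ⟨Fin.elim0, mem_filter.2 ⟨mem_univ _, fun i => i.elim0, fun i => i.elim0⟩⟩
  | succ k ih =>
    set bad : (Fin k → Fin n) → Finset (Fin n) := fun z =>
      univ.biUnion fun i => {z i, τ (z i), τ (τ (z i)), τ⁻¹ (z i), τ⁻¹ (τ⁻¹ (z i))} with hbad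
    have hbadc : ∀ z, #(bad z) ≤ 5 * k := by
      intro z
      have := card_biUnion_le_card_mul (univ : Finset (Fin k))
        (fun i => ({z i, τ (z i), τ (τ (z i)), τ⁻¹ (z i), τ⁻¹ (τ⁻¹ (z i))} : Finset (Fin n))) 5
        (fun i _ => card_le_five)
      rw [card_univ, Fintype.card_fin] at this
      linarith
    calc ∏ i ∈ range (k + 1), (#U - 5 * i)
        = (∏ i ∈ range k, (#U - 5 * i)) * (#U - 5 * k) := prod_range_succ _ _
      _ ≤ #(univ.filter fun z : Fin k → Fin n => GoodSeq τ U z) * (#U - 5 * k) :=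
          Nat.mul_le_mul_right _ ih
      _ = ∑ z ∈ univ.filter fun z : Fin k → Fin n => GoodSeq τ U z, (#U - 5 * k) := by
          rw [sum_const, smul_eq_mul]
      _ ≤ ∑ z ∈ univ.filter fun z : Fin k → Fin n => GoodSeq τ U z, #(U \ bad z) := by
          refine sum_le_sum fun z _ => ?_
          have := le_card_sdiff (bad z) U
          have := hbadc z
          omega
      _ = #((univ.filter fun z : Fin k → Fin n => GoodSeq τ U z).sigma fun z => U \ bad z) := by
          rw [card_sigma]
      _ ≤ _ := by
          refine card_le_card_of_injOn (fun p => Fin.cons p.2 p.1) ?_ ?_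
          · rintro ⟨z, v⟩ hp
            rw [mem_coe, mem_sigma, mem_filter] at hp
            dsimp only at hp
            obtain ⟨⟨_, hz⟩, hp⟩ := hp
            obtain ⟨hvU, hv⟩ := Finset.mem_sdiff.1 hp
            simp only [hbad, mem_biUnion, mem_univ, true_and, mem_insert, mem_singleton,
              not_exists, not_or] at hv
            simp only [mem_coe, mem_filter, mem_univ, true_and]
            refine ⟨fun i => ?_, fun i j => ?_⟩
            · refine Fin.cases ?_ (fun i => ?_) i
              · exact hvU
              · exact hz.1 i
            · refine Fin.cases ?_ (fun i => ?_) i <;> refine Fin.cases ?_ (fun j => ?_) j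
              · exact fun h => absurd rfl h
              · intro _
                simp only [Fin.cons_zero, Fin.cons_succ]
                obtain ⟨h1, h2, h3, h4, h5⟩ := hv j
                refine ⟨fun h => h1 h.symm, fun h => h4 ?_, fun h => h5 ?_⟩
                · rw [h, Perm.eq_inv_iff_eq]
                · rw [h, Perm.eq_inv_iff_eq, Perm.eq_inv_iff_eq]
              · intro _
                simp only [Fin.cons_zero, Fin.cons_succ]
                obtain ⟨h1, h2, h3, h4, h5⟩ := hv i
                exact ⟨h1, h2, h3⟩
              · intro hij
                simp only [Fin.cons_succ]
                exact hz.2 i j (fun h => hij (by rw [h]))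
          · rintro ⟨z, v⟩ _ ⟨z', v'⟩ _ h
            have := Fin.cons_inj.1 h
            obtain ⟨rfl, rfl⟩ : v = v' ∧ z = z' := this
            rfl

/-- The permutation `σ` realises the closed pattern `(x, q)`. -/
def Realizes (τ τ' : Perm (Fin n)) {k : ℕ} (x q : Fin (k + 1) → Fin n) (σ : Perm (Fin n)) : Prop :=
  ∀ i, σ (q i) = τ' (x i) ∧ σ (τ (q i)) = x (i + 1)

/-- The positions prescribed by a pattern. -/
def posOf (τ : Perm (Fin n)) {k : ℕ} (q : Fin (k + 1) → Fin n) : Fin (k + 1) × Bool → Fin n :=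
  fun p => if p.2 then τ (q p.1) else q p.1

/-- The values prescribed by a pattern. -/
def valOf (τ' : Perm (Fin n)) {k : ℕ} (x : Fin (k + 1) → Fin n) : Fin (k + 1) × Bool → Fin n :=
  fun p => if p.2 then x (p.1 + 1) else τ' (x p.1)

theorem realizes_iff {τ τ' : Perm (Fin n)} {k : ℕ} {x q : Fin (k + 1) → Fin n}
    {σ : Perm (Fin n)} : Realizes τ τ' x q σ ↔ ∀ p, σ (posOf τ q p) = valOf τ' x p := by
  constructor
  · rintro h ⟨i, b⟩
    cases b
    · exact (h i).1
    · exact (h i).2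
  · intro h i
    exact ⟨h (i, false), h (i, true)⟩

variable {τ τ' : Perm (Fin n)} {U U' : Finset (Fin n)} {k : ℕ} {x q : Fin (k + 1) → Fin n}

theorem posOf_injective (hU : ∀ y ∈ U, τ y ≠ y) (hq : GoodSeq τ U q) :
    Function.Injective (posOf τ q) := by
  have key : ∀ i j, q i ≠ τ (q j) := by
    intro i j
    by_cases hij : j = i
    · subst hij; exact (hU _ (hq.1 j)).symm
    · exact (hq.2 j i hij).2.1
  rintro ⟨i, b⟩ ⟨j, b'⟩ h
  cases b <;> cases b' <;> simp only [posOf] at h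
  · simp at h; rw [hq.injective h]
  · simp at h; exact absurd h (key _ _)
  · simp at h; exact absurd h.symm (key _ _)
  · simp at h; rw [hq.injective h]

theorem valOf_injective (hU : ∀ y ∈ U', τ' y ≠ y) (hx : GoodSeq τ' U' x) :
    Function.Injective (valOf τ' x) := by
  have key : ∀ i j, x i ≠ τ' (x j) := by
    intro i j
    by_cases hij : j = i
    · subst hij; exact (hU _ (hx.1 j)).symm
    · exact (hx.2 j i hij).2.1
  rintro ⟨i, b⟩ ⟨j, b'⟩ h
  cases b <;> cases b' <;> simp only [valOf] at h
  · simp at h; rw [hx.injective h]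
  · simp at h; exact absurd h.symm (key _ _)
  · simp at h; exact absurd h (key _ _)
  · simp only [if_true] at h
    rw [add_right_cancel (hx.injective h)]

theorem pr_realizes (hU : ∀ y ∈ U, τ y ≠ y) (hU' : ∀ y ∈ U', τ' y ≠ y)
    (hq : GoodSeq τ U q) (hx : GoodSeq τ' U' x) :
    pr (Realizes τ τ' x q) = (n - 2 * (k + 1)).factorial / n.factorial := by
  have h := pr_forall_eq (posOf_injective hU hq) (valOf_injective hU' hx)
  have e : Fintype.card (Fin (k + 1) × Bool) = 2 * (k + 1) := by simp [mul_comm]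
  rw [e] at h
  rw [← h]
  congr 1
  funext σ
  exact propext realizes_iff

theorem Realizes.word_apply {σ : Perm (Fin n)} (h : Realizes τ τ' x q σ) (i : Fin (k + 1)) :
    word τ τ' σ (x i) = x (i + 1) := by
  have h1 : σ⁻¹ (τ' (x i)) = q i := by rw [Perm.inv_eq_iff_eq]; exact (h i).1.symm
  simp only [word, Perm.mul_apply, h1]
  exact (h i).2

theorem iterate_apply_fin {β : Type*} {f : β → β} {k : ℕ} {z : Fin (k + 1) → β}
    (hf : ∀ i, f (z i) = z (i + 1)) (i : Fin (k + 1)) (m : ℕ) : f^[m] (z i) = z (i + ((m : ℕ) : Fin (k + 1))) := by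
  induction m with
  | zero => simp
  | succ m ih => rw [Function.iterate_succ_apply', ih, hf, Nat.cast_succ, add_assoc]

theorem minimalPeriod_of_fin {β : Type*} {f : β → β} {k : ℕ} {z : Fin (k + 1) → β}
    (hz : Function.Injective z) (hf : ∀ i, f (z i) = z (i + 1)) (i : Fin (k + 1)) :
    Function.minimalPeriod f (z i) = k + 1 := by
  apply Nat.dvd_antisymm
  · apply Function.IsPeriodicPt.minimalPeriod_dvd
    rw [Function.IsPeriodicPt, Function.IsFixedPt, iterate_apply_fin hf]
    simp
  · have h := Function.iterate_minimalPeriod (f := f) (x := z i)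
    rw [iterate_apply_fin hf] at h
    have h2 := hz h
    rw [add_eq_left] at h2
    rwa [Fin.natCast_eq_zero] at h2

theorem eq_of_fin_orbit {β : Type*} {f : β → β} {k : ℕ} {z z' : Fin (k + 1) → β}
    (hf : ∀ i, f (z i) = z (i + 1)) (hf' : ∀ i, f (z' i) = z' (i + 1)) (h : z 0 = z' 0) :
    z = z' := by
  funext i
  have h1 := iterate_apply_fin hf 0 i
  have h2 := iterate_apply_fin hf' 0 i
  rw [h, h2] at h1
  simpa using h1.symm

theorem Realizes.eq_of_zero_eq {σ : Perm (Fin n)} {x' q' : Fin (k + 1) → Fin n}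
    (h : Realizes τ τ' x q σ) (h' : Realizes τ τ' x' q' σ) (h0 : x 0 = x' 0) :
    x = x' ∧ q = q' := by
  have hx : x = x' := eq_of_fin_orbit h.word_apply h'.word_apply h0
  refine ⟨hx, funext fun i => σ.injective ?_⟩
  rw [(h i).1, (h' i).1, hx]

end Pattern

end RandGen

namespace RandGen

open Equiv Equiv.Perm Finset
open scoped Pointwise

section Intransitive

variable {n : ℕ}

/-- `Y` is invariant under `σ τ σ⁻¹` and `τ'`. -/
def Inv (τ τ' σ : Perm (Fin n)) (Y : Finset (Fin n)) : Prop :=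
  ∀ y ∈ Y, σ (τ (σ⁻¹ y)) ∈ Y ∧ τ' y ∈ Y

/-- There is a nontrivial invariant set. -/
def Intrans (τ τ' σ : Perm (Fin n)) : Prop :=
  ∃ Y : Finset (Fin n), Y.Nonempty ∧ Y ≠ univ ∧ Inv τ τ' σ Y

theorem perm_apply_mem_iff {g : Perm (Fin n)} {Y : Finset (Fin n)} (h : ∀ y ∈ Y, g y ∈ Y)
    (y : Fin n) : g y ∈ Y ↔ y ∈ Y := by
  have h1 : Y.image g = Y := by
    refine eq_of_subset_of_card_le ?_ (by rw [card_image_of_injective _ g.injective])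
    intro z hz
    obtain ⟨y, hy, rfl⟩ := mem_image.1 hz
    exact h y hy
  constructor
  · intro hy
    rw [← h1] at hy
    obtain ⟨z, hz, hzy⟩ := mem_image.1 hy
    rwa [← g.injective hzy]
  · exact h y

theorem Inv.mem_iff {τ τ' σ : Perm (Fin n)} {Y : Finset (Fin n)} (h : Inv τ τ' σ Y)
    {g : Perm (Fin n)} (hg : g ∈ genGroup τ τ' σ) (y : Fin n) : g y ∈ Y ↔ y ∈ Y := by
  have h1 : genGroup τ τ' σ ≤ MulAction.stabilizer (Perm (Fin n)) (Y : Set (Fin n)) := by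
    rw [genGroup, Subgroup.closure_le]
    have key : ∀ g : Perm (Fin n), (∀ y ∈ Y, g y ∈ Y) →
        g ∈ MulAction.stabilizer (Perm (Fin n)) (Y : Set (Fin n)) := by
      intro g hg
      rw [MulAction.mem_stabilizer_set]
      intro y
      exact perm_apply_mem_iff hg y
    rintro g (rfl | rfl)
    · exact key _ fun y hy => (h y hy).1
    · exact key _ fun y hy => (h y hy).2
  have := h1 hg
  rw [MulAction.mem_stabilizer_set] at this
  exact this y

theorem Intrans.not_alternatingGroup_le {τ τ' σ : Perm (Fin n)} (h : Intrans τ τ' σ) (hn : 3 ≤ n) :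
    ¬ alternatingGroup (Fin n) ≤ genGroup τ τ' σ := by
  obtain ⟨Y, ⟨y, hy⟩, hne, hinv⟩ := h
  intro hle
  obtain ⟨z, hz⟩ : ∃ z, z ∉ Y := by
    by_contra! hcon
    exact hne (eq_univ_of_forall hcon)
  have hyz : y ≠ z := fun h => hz (h ▸ hy)
  obtain ⟨t, ht⟩ : ∃ t, t ∉ ({y, z} : Finset (Fin n)) := by
    by_contra! hcon
    have := card_le_card (fun t _ => hcon t : (univ : Finset (Fin n)) ⊆ {y, z})
    rw [card_univ, Fintype.card_fin] at this
    have := card_le_two (a := y) (b := z)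
    omega
  simp only [mem_insert, mem_singleton, not_or] at ht
  have hmem : swap y z * swap y t ∈ alternatingGroup (Fin n) := by
    rw [mem_alternatingGroup, Perm.sign_mul, sign_swap hyz, sign_swap (Ne.symm ht.1)]; simp
  have hG := hinv.mem_iff (hle hmem)
  have h1 : (swap y z * swap y t) t = z := by simp
  have h2 : (swap y z * swap y t) y = t := by
    simp [swap_apply_of_ne_of_ne ht.1 ht.2]
  have e1 := hG t
  have e2 := hG y
  rw [h1] at e1
  rw [h2] at e2
  tauto

theorem isPretransitive_of_not_intrans {τ τ' σ : Perm (Fin n)} (h : ¬ Intrans τ τ' σ) :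
    MulAction.IsPretransitive (genGroup τ τ' σ) (Fin n) := by
  classical
  constructor
  intro a b
  set Y : Finset (Fin n) := univ.filter fun y => ∃ g ∈ genGroup τ τ' σ, g a = y with hY
  have hinv : Inv τ τ' σ Y := by
    intro y hy
    obtain ⟨g, hg, rfl⟩ := (mem_filter.1 hy).2
    constructor
    · refine mem_filter.2 ⟨mem_univ _, (σ * τ * σ⁻¹) * g, ?_, rfl⟩
      exact mul_mem (Subgroup.subset_closure (Or.inl rfl)) hg
    · refine mem_filter.2 ⟨mem_univ _, τ' * g, ?_, rfl⟩
      exact mul_mem (Subgroup.subset_closure (Or.inr rfl)) hg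
  have hYu : Y = univ := by
    by_contra hne
    exact h ⟨Y, ⟨a, mem_filter.2 ⟨mem_univ _, 1, one_mem _, rfl⟩⟩, hne, hinv⟩
  obtain ⟨g, hg, hgb⟩ := (mem_filter.1 (hYu ▸ mem_univ b : b ∈ Y)).2
  exact ⟨⟨g, hg⟩, hgb⟩

end Intransitive

section SecondMoment

theorem pr_eq_ex {n : ℕ} (p : Perm (Fin n) → Prop) [DecidablePred p] :
    pr p = ex fun σ => if p σ then 1 else 0 := by
  unfold pr; congr!

variable {n : ℕ} {ι : Type*}

theorem pr_and_extending_le {S T : Finset (Fin n)} (hST : _root_.Disjoint S T)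
    (f g : Fin n → Fin n) :
    pr (fun σ => (∀ x ∈ S, σ x = f x) ∧ ∀ x ∈ T, σ x = g x) ≤
      (n - #S - #T).factorial / n.factorial := by
  by_cases h : ∃ σ₀ : Perm (Fin n), (∀ x ∈ S, σ₀ x = f x) ∧ ∀ x ∈ T, σ₀ x = g x
  · obtain ⟨σ₀, h1, h2⟩ := h
    have := pr_extending (S ∪ T) (f := σ₀) σ₀.injective.injOn
    rw [card_union_of_disjoint hST, ← Nat.sub_sub] at this
    rw [← this]
    refine pr_mono ?_
    rintro σ ⟨h3, h4⟩ x hx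
    rcases mem_union.1 hx with hx | hx
    · rw [h3 x hx, h1 x hx]
    · rw [h4 x hx, h2 x hx]
  · have : (fun σ : Perm (Fin n) => (∀ x ∈ S, σ x = f x) ∧ ∀ x ∈ T, σ x = g x) =
        fun _ => False := by
      funext σ
      exact propext ⟨fun h' => h ⟨σ, h'⟩, False.elim⟩
    rw [this]
    simp only [pr, ex, if_false, sum_const_zero, zero_div]
    positivity

open Classical in
/-- Weighted second moment bound for families of partial assignments. -/
theorem second_moment_le (I : Finset ι) (w : ι → ℝ) (hw : ∀ i ∈ I, 0 ≤ w i)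
    (S : ι → Finset (Fin n)) (f : ι → Fin n → Fin n) {γ μ : ℝ}
    (hinj : ∀ i ∈ I, Set.InjOn (f i) (S i))
    (hclose : ∀ σ : Perm (Fin n), ∀ i ∈ I, (∀ x ∈ S i, σ x = f i x) →
      ∑ j ∈ I.filter fun j => (∀ x ∈ S j, σ x = f j x) ∧ ¬ _root_.Disjoint (S i) (S j), w j ≤ 1)
    (hγ : ∀ i ∈ I, ∀ j ∈ I, ((n - #(S i) - #(S j)).factorial : ℝ) * n.factorial ≤
      (1 + γ) * ((n - #(S i)).factorial * (n - #(S j)).factorial))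
    (hμ : μ = ∑ i ∈ I, w i * ((n - #(S i)).factorial / n.factorial)) :
    μ ≤ pr (fun σ => ∃ i ∈ I, ∀ x ∈ S i, σ x = f i x) * (1 + (1 + γ) * μ) := by
  set ev : ι → Perm (Fin n) → Prop := fun i σ => ∀ x ∈ S i, σ x = f i x with hev
  set ind : ι → Perm (Fin n) → ℝ := fun i σ => if ev i σ then 1 else 0 with hind
  set X : Perm (Fin n) → ℝ := fun σ => ∑ i ∈ I, w i * ind i σ with hX
  have hind0 : ∀ i σ, 0 ≤ ind i σ := fun i σ => by simp only [hind]; split_ifs <;> norm_num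
  have hfac : (0 : ℝ) < n.factorial := by exact_mod_cast Nat.factorial_pos n
  have hEX : ex X = μ := by
    rw [hX, ex_sum, hμ]
    refine sum_congr rfl fun i hi => ?_
    rw [ex_const_mul]
    congr 1
    exact (pr_eq_ex _).symm.trans (pr_extending (S i) (hinj i hi))
  have hμ0 : 0 ≤ μ := by
    rw [← hEX]
    exact ex_nonneg fun σ => sum_nonneg fun i hi => mul_nonneg (hw i hi) (hind0 i σ)
  have hpt : ∀ σ, X σ ^ 2 ≤ X σ + ∑ i ∈ I, ∑ j ∈ I.filter fun j => _root_.Disjoint (S i) (S j),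
      w i * w j * (if ev i σ ∧ ev j σ then 1 else 0) := by
    intro σ
    rw [sq, hX]
    dsimp only
    rw [sum_mul, ← sum_add_distrib]
    refine sum_le_sum fun i hi => ?_
    by_cases hi' : ev i σ
    · have h1 : ind i σ = 1 := by simp [hind, hi']
      rw [h1, mul_one]
      have h2 := sum_filter_add_sum_filter_not I (fun j => _root_.Disjoint (S i) (S j))
        (fun j => w j * ind j σ)
      rw [← h2, mul_add, add_comm]
      refine add_le_add ?_ ?_
      · have h3 := hclose σ i hi hi'
        have h4 : ∑ j ∈ I.filter (fun j => ¬ _root_.Disjoint (S i) (S j)), w j * ind j σ ≤ 1 := by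
          refine le_trans (le_of_eq ?_) h3
          have h5 : (I.filter fun j => (∀ x ∈ S j, σ x = f j x) ∧ ¬ _root_.Disjoint (S i) (S j)) =
              (I.filter fun j => ¬ _root_.Disjoint (S i) (S j)).filter fun j => ev j σ := by
            ext j; simp only [mem_filter, hev]; tauto
          rw [h5, sum_filter (fun j => ev j σ)]
          refine sum_congr rfl fun j _ => ?_
          simp only [hind, mul_ite, mul_one, mul_zero]
        nlinarith [hw i hi]
      · rw [mul_sum]
        refine le_of_eq (sum_congr rfl fun j _ => ?_)
        simp only [hind, hi', true_and]; ring
    · have h1 : ind i σ = 0 := by simp [hind, hi']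
      rw [h1, mul_zero, zero_mul, zero_add]
      exact sum_nonneg fun j hj => mul_nonneg
        (mul_nonneg (hw i hi) (hw j (mem_filter.1 hj).1)) (by split_ifs <;> norm_num)
  have hE2 : ex (fun σ => X σ ^ 2) ≤ μ + (1 + γ) * μ ^ 2 := by
    refine (ex_mono hpt).trans ?_
    rw [ex_add, hEX, ex_sum]
    gcongr
    have h5 : (1 + γ) * μ ^ 2 = ∑ i ∈ I, ∑ j ∈ I, (1 + γ) * (w i * w j *
        ((n - #(S i)).factorial / n.factorial * ((n - #(S j)).factorial / n.factorial))) := by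
      rw [sq, hμ, sum_mul_sum, mul_sum]
      refine sum_congr rfl fun i _ => ?_
      rw [mul_sum]
      refine sum_congr rfl fun j _ => ?_
      ring
    rw [h5]
    refine sum_le_sum fun i hi => ?_
    rw [ex_sum]
    have hb : ∀ j ∈ I, ((n - #(S i) - #(S j)).factorial : ℝ) / n.factorial ≤
        (1 + γ) * ((n - #(S i)).factorial / n.factorial *
          ((n - #(S j)).factorial / n.factorial)) := by
      intro j hj
      have := hγ i hi j hj
      rw [div_mul_div_comm, ← mul_div_assoc, div_le_div_iff₀ hfac (by positivity)]
      nlinarith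
    refine (sum_le_sum (g := fun j => (1 + γ) * (w i * w j *
        ((n - #(S i)).factorial / n.factorial * ((n - #(S j)).factorial / n.factorial))))
        fun j hj => ?_).trans ?_
    · obtain ⟨hj, hd⟩ := mem_filter.1 hj
      rw [ex_const_mul]
      have h6 : ex (fun σ => if ev i σ ∧ ev j σ then (1 : ℝ) else 0) ≤
        (n - #(S i) - #(S j)).factorial / n.factorial :=
        (pr_eq_ex _).symm.le.trans (pr_and_extending_le hd (f i) (f j))
      have h7 := mul_le_mul_of_nonneg_left (h6.trans (hb j hj)) (mul_nonneg (hw i hi) (hw j hj))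
      linarith
    · refine sum_le_sum_of_subset_of_nonneg (filter_subset _ _) fun j hj _ => ?_
      have h8 := mul_le_mul_of_nonneg_left (hb j hj) (mul_nonneg (hw i hi) (hw j hj))
      have h9 : 0 ≤ w i * w j * (((n - #(S i) - #(S j)).factorial : ℝ) / n.factorial) :=
        mul_nonneg (mul_nonneg (hw i hi) (hw j hj)) (by positivity)
      linarith
  set A := fun σ : Perm (Fin n) => ∃ i ∈ I, ev i σ with hA
  have hCS : μ ^ 2 ≤ pr A * ex (fun σ => X σ ^ 2) := by
    have h10 := sum_mul_sq_le_sq_mul_sq univ (fun σ => if A σ then (1 : ℝ) else 0) X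
    have h11 : ∀ σ, (if A σ then (1 : ℝ) else 0) * X σ = X σ := by
      intro σ
      by_cases hσ : A σ
      · simp [hσ]
      · have : X σ = 0 := by
          refine sum_eq_zero fun i hi => ?_
          have : ¬ ev i σ := fun h => hσ ⟨i, hi, h⟩
          simp [hind, this]
        simp [this]
    have h12 : ∀ σ, (if A σ then (1 : ℝ) else 0) ^ 2 = if A σ then (1 : ℝ) else 0 := by
      intro σ; split_ifs <;> norm_num
    simp only [h11, h12] at h10
    rw [← hEX, pr_eq_ex, ex, ex, ex, div_pow, div_mul_div_comm, ← sq]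
    gcongr
  rcases hμ0.eq_or_lt with h0 | h0
  · rw [← h0]
    simp only [mul_zero, add_zero, mul_one]
    exact pr_nonneg _
  · have h13 := hCS.trans (mul_le_mul_of_nonneg_left hE2 (pr_nonneg A))
    have h14 : μ * μ ≤ μ * (pr A * (1 + (1 + γ) * μ)) := by nlinarith
    exact le_of_mul_le_mul_left h14 h0

end SecondMoment

end RandGen

namespace RandGen

open Equiv Equiv.Perm Finset
open scoped Fin.NatCast Fin.CommRing

section Points

variable {n : ℕ}

open Classical in
/-- The set of fixed points. -/
noncomputable def fixSet (τ : Perm (Fin n)) : Finset (Fin n) := univ.filter fun x => τ x = x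

open Classical in
/-- The set of points on 2-cycles. -/
noncomputable def twoSet (τ : Perm (Fin n)) : Finset (Fin n) :=
  univ.filter fun x => τ x ≠ x ∧ τ (τ x) = x

theorem mem_fixSet {τ : Perm (Fin n)} {x : Fin n} : x ∈ fixSet τ ↔ τ x = x := by simp [fixSet]

theorem mem_twoSet {τ : Perm (Fin n)} {x : Fin n} : x ∈ twoSet τ ↔ τ x ≠ x ∧ τ (τ x) = x := by
  simp [twoSet]

theorem card_fixSet (τ : Perm (Fin n)) : #(fixSet τ) = cycleCount τ 1 := by
  classical
  rw [cycleCount, if_pos rfl, Nat.card_eq_fintype_card, Fintype.card_subtype]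
  simp only [fixSet, Function.mem_fixedPoints, Function.IsFixedPt]

theorem mem_twoSet_iff_card {τ : Perm (Fin n)} {x : Fin n} :
    x ∈ twoSet τ ↔ #(τ.cycleOf x).support = 2 := by
  rw [mem_twoSet]
  constructor
  · rintro ⟨h1, h2⟩
    have hs : (τ.cycleOf x).support = {x, τ x} := by
      ext y
      rw [mem_support_cycleOf_iff' h1]
      simp only [mem_insert, mem_singleton]
      constructor
      · intro h
        obtain ⟨i, hi, rfl⟩ := h.exists_pow_eq'
        have : ∀ i : ℕ, (τ ^ i) x = x ∨ (τ ^ i) x = τ x := by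
          intro i
          induction i with
          | zero => simp
          | succ i ih =>
            rw [pow_succ', Perm.mul_apply]
            rcases ih with ih | ih <;> rw [ih]
            · exact Or.inr rfl
            · exact Or.inl h2
        exact this i
      · rintro (rfl | rfl)
        · exact SameCycle.refl _ _
        · exact (SameCycle.refl _ _).apply_right
    rw [hs, card_pair h1.symm]
  · intro h
    have h1 : τ x ≠ x := by
      intro hx
      rw [(cycleOf_eq_one_iff τ).2 hx] at h
      simp at h
    refine ⟨h1, ?_⟩
    have := pow_mod_card_support_cycleOf_self_apply τ 2 x
    rw [h] at this
    simpa [sq] using this.symm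

theorem card_twoSet (τ : Perm (Fin n)) : #(twoSet τ) = 2 * cycleCount τ 2 := by
  classical
  have h1 : cycleCount τ 2 = #(τ.cycleFactorsFinset.filter fun c => #c.support = 2) := by
    rw [cycleCount, if_neg (by norm_num), cycleType_def, Multiset.count_map, ← filter_val,
      card_val]
    congr 1
    ext c
    simp [eq_comm]
  rw [h1]
  have h2 : ∀ x ∈ twoSet τ, τ.cycleOf x ∈ τ.cycleFactorsFinset.filter fun c => #c.support = 2 := by
    intro x hx
    rw [mem_filter, cycleOf_mem_cycleFactorsFinset_iff, mem_support]
    exact ⟨(mem_twoSet.1 hx).1, mem_twoSet_iff_card.1 hx⟩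
  rw [card_eq_sum_card_fiberwise (f := fun x => τ.cycleOf x) h2, mul_comm, ← smul_eq_mul]
  refine sum_const_nat (m := 2) ?_ |>.trans rfl
  intro c hc
  obtain ⟨hc, hc2⟩ := mem_filter.1 hc
  rw [← hc2]
  congr 1
  ext x
  simp only [mem_filter]
  constructor
  · rintro ⟨hx, rfl⟩
    rw [mem_support_cycleOf_iff' (mem_twoSet.1 hx).1]
  · intro hx
    have := cycle_is_cycleOf hx hc
    exact ⟨mem_twoSet_iff_card.2 (this ▸ hc2), this.symm⟩

end Points

theorem factorial_ratio {n a b : ℕ} (h : a + b ≤ n) :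
    (1 - b * (a + b) / n : ℝ) * ((n - a - b).factorial * n.factorial) ≤
      (n - a).factorial * (n - b).factorial := by
  rcases Nat.eq_zero_or_pos n with rfl | hn
  · have : a = 0 := by omega
    have : b = 0 := by omega
    subst_vars; simp
  have hn' : (0 : ℝ) < n := Nat.cast_pos.2 hn
  have e1 : ((n - b).factorial * n.descFactorial b : ℝ) = n.factorial := by
    exact_mod_cast Nat.factorial_mul_descFactorial (show b ≤ n by omega)
  have e2 : ((n - a - b).factorial * (n - a).descFactorial b : ℝ) = (n - a).factorial := by
    exact_mod_cast Nat.factorial_mul_descFactorial (show b ≤ n - a by omega)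
  rw [← e1, ← e2]
  have h1 : (n.descFactorial b : ℝ) ≤ n ^ b := by exact_mod_cast Nat.descFactorial_le_pow n b
  have h2 : ((n - a - b : ℝ)) ^ b ≤ (n - a).descFactorial b := by
    have := Nat.pow_sub_le_descFactorial (n - a) b
    have h3 : ((n - a + 1 - b : ℕ) ^ b : ℝ) ≤ (n - a).descFactorial b := by exact_mod_cast this
    refine le_trans ?_ h3
    have h4 : ((n - a + 1 - b : ℕ) : ℝ) = n - a + 1 - b := by
      rw [Nat.cast_sub (by omega)]; push_cast [Nat.cast_sub (show a ≤ n by omega)]; ring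
    rw [h4]
    have : (a : ℝ) + b ≤ n := by exact_mod_cast h
    exact pow_le_pow_left₀ (by linarith) (by linarith) _
  have h3 : (1 - b * (a + b) / n : ℝ) * n ^ b ≤ (n - a - b : ℝ) ^ b := by
    have hle : ((a : ℝ) + b) / n ≤ 1 := by
      rw [div_le_one hn']; exact_mod_cast h
    have := one_add_mul_le_pow (a := -(((a : ℝ) + b) / n)) (by linarith) b
    have e : (n - a - b : ℝ) = (1 + -(((a : ℝ) + b) / n)) * n := by field_simp; ring
    rw [e, mul_pow]
    refine mul_le_mul_of_nonneg_right ?_ (by positivity)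
    refine le_trans (le_of_eq ?_) this
    ring
  by_cases hs : (1 - b * (a + b) / n : ℝ) ≤ 0
  · refine le_trans (mul_nonpos_of_nonpos_of_nonneg hs (by positivity)) (by positivity)
  push Not at hs
  have h4 := (mul_le_mul_of_nonneg_left h1 hs.le).trans (h3.trans h2)
  have := mul_le_mul_of_nonneg_left h4
    (show (0 : ℝ) ≤ (n - a - b).factorial * (n - b).factorial by positivity)
  linarith

theorem ge_of_second_moment {P μ m γ : ℝ} (hγ : 0 ≤ γ) (hm : 0 < m) (hmμ : m ≤ μ)
    (h : μ ≤ P * (1 + (1 + γ) * μ)) : m / (1 + (1 + γ) * m) ≤ P := by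
  have hμ : 0 < μ := hm.trans_le hmμ
  have h1 : μ / (1 + (1 + γ) * μ) ≤ P := by rwa [div_le_iff₀ (by positivity)]
  refine le_trans ?_ h1
  rw [div_le_div_iff₀ (by positivity) (by positivity)]
  nlinarith

section Fixed

variable {n : ℕ}

theorem second_moment_fixed (hn : 2 ≤ n) (τ τ' : Perm (Fin n)) {γ : ℝ}
    (hγ : (n : ℝ) ≤ (1 + γ) * (n - 1)) :
    (cycleCount τ 1 * cycleCount τ' 1 / n : ℝ) ≤
      pr (Intrans τ τ') * (1 + (1 + γ) * (cycleCount τ 1 * cycleCount τ' 1 / n)) := by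
  classical
  obtain ⟨m, rfl⟩ : ∃ m, n = m + 2 := ⟨n - 2, by omega⟩
  have h := second_moment_le (n := m + 2) (fixSet τ ×ˢ fixSet τ') (fun _ => 1)
    (fun _ _ => zero_le_one) (fun i => {i.1}) (fun i _ => i.2) (γ := γ) (μ := _)
    (fun i _ => by simp) ?_ ?_ rfl
  · have hμ : ∑ i ∈ fixSet τ ×ˢ fixSet τ', (1 : ℝ) * ((m + 2 - #({i.1} : Finset (Fin (m + 2)))).factorial /
        (m + 2).factorial) = cycleCount τ 1 * cycleCount τ' 1 / (m + 2 : ℕ) := by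
      simp only [card_singleton, sum_const, card_product, card_fixSet, nsmul_eq_mul]
      have : ((m + 2).factorial : ℝ) = (m + 2 : ℕ) * (m + 2 - 1).factorial := by
        exact_mod_cast Nat.factorial_succ (m + 1)
      rw [this]
      have h0 : ((m + 2 - 1).factorial : ℝ) ≠ 0 := by positivity
      have h0' : ((m + 2 : ℕ) : ℝ) ≠ 0 := by positivity
      push_cast at h0' ⊢
      field_simp
    rw [hμ] at h
    refine h.trans (mul_le_mul_of_nonneg_right (pr_mono ?_) ?_)
    · rintro σ ⟨⟨p, y⟩, hi, hσ⟩
      obtain ⟨h1, h2⟩ := mem_product.1 hi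
      rw [mem_fixSet] at h1 h2
      have hσ : σ p = y := hσ p (mem_singleton_self p)
      refine ⟨{y}, singleton_nonempty y, ?_, ?_⟩
      · intro h
        have := congr_arg card h
        rw [card_singleton, card_univ, Fintype.card_fin] at this
        omega
      · intro z hz
        rw [mem_singleton] at hz
        subst hz
        rw [mem_singleton, mem_singleton]
        refine ⟨?_, h2⟩
        have : σ⁻¹ z = p := by rw [Perm.inv_eq_iff_eq]; exact hσ.symm
        rw [this]
        dsimp only at h1
        rw [h1, hσ]
    · have : 0 ≤ 1 + γ := by
        have : (0 : ℝ) < (m + 2 : ℕ) - 1 := by push_cast; linarith [(Nat.cast_nonneg m : (0 : ℝ) ≤ m)]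
        by_contra! hcon
        have h2 : (0 : ℝ) ≤ (m + 2 : ℕ) := Nat.cast_nonneg _
        nlinarith
      positivity
  · rintro σ ⟨p, y⟩ hi hσ
    rw [sum_const, nsmul_eq_mul, mul_one]
    have : #({j ∈ fixSet τ ×ˢ fixSet τ' | (∀ x ∈ ({j.1} : Finset (Fin (m + 2))), σ x = j.2) ∧
        ¬ _root_.Disjoint ({p} : Finset (Fin (m + 2))) {j.1}}) ≤ #({(p, y)} : Finset (Fin (m + 2) × Fin (m + 2))) := by
      refine card_le_card ?_
      rintro ⟨p', y'⟩ hj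
      obtain ⟨_, h1, h2⟩ := mem_filter.1 hj
      rw [disjoint_singleton, not_not] at h2
      have h3 := h1 p' (mem_singleton_self _)
      have h4 := hσ p (mem_singleton_self _)
      dsimp only at h2 h3 h4
      subst h2
      rw [mem_singleton, ← h3, ← h4]
    rw [card_singleton] at this
    exact_mod_cast this
  · rintro ⟨p, y⟩ _ ⟨p', y'⟩ _
    simp only [card_singleton]
    have e1 : m + 2 - 1 = m + 1 := by omega
    have e2 : m + 1 - 1 = m := by omega
    rw [e1, e2]
    have f1 : ((m + 2).factorial : ℝ) = (m + 2 : ℕ) * (m + 1).factorial := by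
      exact_mod_cast Nat.factorial_succ (m + 1)
    have f2 : ((m + 1).factorial : ℝ) = (m + 1 : ℕ) * m.factorial := by
      exact_mod_cast Nat.factorial_succ m
    rw [f1, f2]
    push_cast at hγ ⊢
    have : (0 : ℝ) ≤ m.factorial * ((m + 1) * m.factorial) := by positivity
    nlinarith

end Fixed

section Rings

variable {n : ℕ}

/-- Alternating rings of 2-cycles. -/
theorem Realizes.symm_word {τ τ' : Perm (Fin n)} {σ : Perm (Fin n)} {k : ℕ}
    {x q : Fin (k + 1) → Fin n} (h : Realizes τ τ' x q σ) (hx : ∀ i, x i ∈ twoSet τ')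
    (hq : ∀ i, q i ∈ twoSet τ) (i : Fin (k + 1)) :
    word τ τ' σ (τ' (x (i + 1))) = τ' (x i) := by
  have h1 : σ⁻¹ (x (i + 1)) = τ (q i) := by rw [Perm.inv_eq_iff_eq]; exact (h i).2.symm
  simp only [word, Perm.mul_apply]
  rw [(mem_twoSet.1 (hx (i + 1))).2, h1, (mem_twoSet.1 (hq i)).2]
  exact (h i).1

theorem Realizes.minimalPeriod_word {τ τ' : Perm (Fin n)} {σ : Perm (Fin n)} {k : ℕ}
    {x q : Fin (k + 1) → Fin n} (h : Realizes τ τ' x q σ) (hx : ∀ i, x i ∈ twoSet τ')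
    (hq : ∀ i, q i ∈ twoSet τ) (hinj : Function.Injective x) {y : Fin n}
    (hy : ∃ i, y = x i ∨ y = τ' (x i)) : Function.minimalPeriod (word τ τ' σ) y = k + 1 := by
  obtain ⟨i, rfl | rfl⟩ := hy
  · exact minimalPeriod_of_fin hinj h.word_apply i
  · have := minimalPeriod_of_fin (f := word τ τ' σ) (z := fun i => τ' (x (-i)))
      (fun a b hab => neg_injective (hinj (τ'.injective hab))) (fun i => by
        have := h.symm_word hx hq (-(i + 1))
        rw [← this]; congr 3; ring) (-i)
    simpa using this

theorem Realizes.closed_word {τ τ' : Perm (Fin n)} {σ : Perm (Fin n)} {k : ℕ}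
    {x q : Fin (k + 1) → Fin n} (h : Realizes τ τ' x q σ) (hx : ∀ i, x i ∈ twoSet τ')
    (hq : ∀ i, q i ∈ twoSet τ) {y : Fin n}
    (hy : ∃ i, y = x i ∨ y = τ' (x i)) :
    ∃ i, word τ τ' σ y = x i ∨ word τ τ' σ y = τ' (x i) := by
  obtain ⟨i, rfl | rfl⟩ := hy
  · exact ⟨i + 1, Or.inl (h.word_apply i)⟩
  · refine ⟨i - 1, Or.inr ?_⟩
    have := h.symm_word hx hq (i - 1)
    rwa [sub_add_cancel] at this

theorem Realizes.intrans {τ τ' : Perm (Fin n)} {σ : Perm (Fin n)} {k : ℕ}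
    {x q : Fin (k + 1) → Fin n} (h : Realizes τ τ' x q σ) (hx : ∀ i, x i ∈ twoSet τ')
    (hq : ∀ i, q i ∈ twoSet τ) (hk : 2 * (k + 1) < n) : Intrans τ τ' σ := by
  classical
  set Y := univ.image x ∪ univ.image (fun i => τ' (x i)) with hY
  have hmem : ∀ y, y ∈ Y ↔ ∃ i, y = x i ∨ y = τ' (x i) := by
    intro y
    simp only [hY, mem_union, mem_image, mem_univ, true_and, exists_or, eq_comm]
  refine ⟨Y, ⟨x 0, (hmem _).2 ⟨0, Or.inl rfl⟩⟩, ?_, ?_⟩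
  · intro hu
    have h1 : #Y ≤ (k + 1) + (k + 1) := by
      refine (card_union_le _ _).trans (add_le_add ?_ ?_) <;>
      · refine card_image_le.trans ?_
        rw [card_univ, Fintype.card_fin]
    rw [hu, card_univ, Fintype.card_fin] at h1
    omega
  · have h' : ∀ y ∈ Y, τ' y ∈ Y := by
      intro y hy
      obtain ⟨i, rfl | rfl⟩ := (hmem y).1 hy
      · exact (hmem _).2 ⟨i, Or.inr rfl⟩
      · exact (hmem _).2 ⟨i, Or.inl (mem_twoSet.1 (hx i)).2⟩
    intro y hy
    refine ⟨?_, h' y hy⟩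
    have h1 : τ'⁻¹ y ∈ Y := by
      rw [← perm_apply_mem_iff h']
      simpa using hy
    have h2 := h.closed_word hx hq ((hmem _).1 h1)
    simp only [word, Perm.mul_apply] at h2
    rw [show τ' (τ'⁻¹ y) = y from τ'.apply_symm_apply y] at h2
    exact (hmem _).2 h2

theorem card_fin_seq_le {ι : Type*} [DecidableEq ι] (s : Finset ι) (φ : ι → Fin n) {k : ℕ} (x : Fin (k + 1) → Fin n)
    (τ' : Perm (Fin n)) (hinj : Set.InjOn φ s) (hφ : ∀ j ∈ s, ∃ i, φ j = x i ∨ φ j = τ' (x i)) :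
    #s ≤ 2 * (k + 1) := by
  classical
  calc #s = #(s.image φ) := (card_image_of_injOn hinj).symm
    _ ≤ #(univ.image x ∪ univ.image (fun i => τ' (x i))) := by
        refine card_le_card ?_
        intro y hy
        obtain ⟨j, hj, rfl⟩ := mem_image.1 hy
        obtain ⟨i, hi | hi⟩ := hφ j hj <;> rw [hi]
        · exact mem_union_left _ (mem_image_of_mem _ (mem_univ _))
        · exact mem_union_right _ (mem_image.2 ⟨i, mem_univ _, rfl⟩)
    _ ≤ (k + 1) + (k + 1) := by
        refine (card_union_le _ _).trans (add_le_add ?_ ?_) <;>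
        · refine card_image_le.trans ?_
          rw [card_univ, Fintype.card_fin]
    _ = 2 * (k + 1) := by ring

open Classical in
/-- Good sequences in `U`. -/
noncomputable def goodSeqs (τ : Perm (Fin n)) (U : Finset (Fin n)) (k : ℕ) :
    Finset (Fin k → Fin n) := univ.filter fun z => GoodSeq τ U z

theorem mem_goodSeqs {τ : Perm (Fin n)} {U : Finset (Fin n)} {k : ℕ} {z : Fin k → Fin n} :
    z ∈ goodSeqs τ U k ↔ GoodSeq τ U z := by simp [goodSeqs]

theorem card_goodSeqs_ge (τ : Perm (Fin n)) (U : Finset (Fin n)) (k : ℕ) :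
    (#U - 5 * k) ^ k ≤ #(goodSeqs τ U k) := by
  refine le_trans ?_ (prod_le_card_goodSeq τ U k)
  rw [← card_range k, ← prod_const, card_range]
  refine prod_le_prod' fun i hi => ?_
  have := mem_range.1 hi
  omega

open Classical in
/-- The set of positions prescribed by a pattern. -/
noncomputable def posSet (τ : Perm (Fin n)) {k : ℕ} (q : Fin (k + 1) → Fin n) : Finset (Fin n) :=
  univ.image (posOf τ q)

/-- The partial assignment prescribed by a pattern. -/
noncomputable def assign (τ τ' : Perm (Fin n)) {k : ℕ} (x q : Fin (k + 1) → Fin n) :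
    Fin n → Fin n := Function.extend (posOf τ q) (valOf τ' x) id

theorem forall_assign_iff {τ τ' : Perm (Fin n)} {k : ℕ} {x q : Fin (k + 1) → Fin n}
    (hq : Function.Injective (posOf τ q)) {σ : Perm (Fin n)} :
    (∀ y ∈ posSet τ q, σ y = assign τ τ' x q y) ↔ Realizes τ τ' x q σ := by
  rw [realizes_iff]
  simp only [posSet, forall_mem_image, mem_univ, true_imp_iff, assign, hq.extend_apply]

theorem card_posSet {τ : Perm (Fin n)} {k : ℕ} {q : Fin (k + 1) → Fin n}
    (hq : Function.Injective (posOf τ q)) : #(posSet τ q) = 2 * (k + 1) := by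
  classical
  rw [posSet, card_image_of_injective _ hq, card_univ]
  simp [mul_comm]

theorem injOn_assign {τ τ' : Perm (Fin n)} {k : ℕ} {x q : Fin (k + 1) → Fin n}
    (hq : Function.Injective (posOf τ q)) (hx : Function.Injective (valOf τ' x)) :
    Set.InjOn (assign τ τ' x q) (posSet τ q) := by
  rintro _ ha _ hb hab
  simp only [posSet, coe_image, coe_univ, Set.image_univ, Set.mem_range] at ha hb
  obtain ⟨i, rfl⟩ := ha
  obtain ⟨j, rfl⟩ := hb
  rw [assign, hq.extend_apply, hq.extend_apply] at hab
  rw [hx hab]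

theorem exists_shared_of_not_disjoint {τ τ' σ : Perm (Fin n)} {k k' : ℕ}
    {x q : Fin (k + 1) → Fin n} {x' q' : Fin (k' + 1) → Fin n} (h : Realizes τ τ' x q σ)
    (h' : Realizes τ τ' x' q' σ) (hd : ¬ _root_.Disjoint (posSet τ q) (posSet τ q')) :
    ∃ p p', valOf τ' x p = valOf τ' x' p' := by
  classical
  rw [not_disjoint_iff] at hd
  obtain ⟨y, h1, h2⟩ := hd
  simp only [posSet, mem_image, mem_univ, true_and] at h1 h2
  obtain ⟨p, hp⟩ := h1
  obtain ⟨p', hp'⟩ := h2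
  refine ⟨p, p', ?_⟩
  rw [← realizes_iff.1 h p, ← realizes_iff.1 h' p', hp, hp']

theorem second_moment_rings (K : ℕ) (τ τ' : Perm (Fin n)) {γ : ℝ} (hγ0 : 0 ≤ γ)
    (hK : 2 * K < n)
    (hγ : ∀ a ≤ 2 * K, ∀ b ≤ 2 * K, ((n - a - b).factorial : ℝ) * n.factorial ≤
      (1 + γ) * ((n - a).factorial * (n - b).factorial)) :
    ∃ μ : ℝ, μ ≤ pr (Intrans τ τ') * (1 + (1 + γ) * μ) ∧
      ∑ k ∈ range K, (1 / (2 * (k + 1)) : ℝ) *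
        ((((2 * cycleCount τ 2 - 5 * (k + 1) : ℕ) : ℝ) / n) *
        (((2 * cycleCount τ' 2 - 5 * (k + 1) : ℕ) : ℝ) / n)) ^ (k + 1) ≤ μ := by
  classical
  set I : Finset (Σ k : ℕ, (Fin (k + 1) → Fin n) × (Fin (k + 1) → Fin n)) :=
    (range K).sigma fun k => goodSeqs τ' (twoSet τ') (k + 1) ×ˢ goodSeqs τ (twoSet τ) (k + 1)
    with hI
  have hmemI : ∀ i ∈ I, i.1 < K ∧ GoodSeq τ' (twoSet τ') i.2.1 ∧ GoodSeq τ (twoSet τ) i.2.2 := by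
    intro i hi
    rw [hI, mem_sigma, mem_product, mem_goodSeqs, mem_goodSeqs, mem_range] at hi
    exact hi
  have hU : ∀ τ : Perm (Fin n), ∀ y ∈ twoSet τ, τ y ≠ y := fun τ y hy => (mem_twoSet.1 hy).1
  have hpos : ∀ i ∈ I, Function.Injective (posOf τ i.2.2) := fun i hi =>
    posOf_injective (hU τ) (hmemI i hi).2.2
  have hval : ∀ i ∈ I, Function.Injective (valOf τ' i.2.1) := fun i hi =>
    valOf_injective (hU τ') (hmemI i hi).2.1
  have h := second_moment_le I (fun i => (1 / (2 * (i.1 + 1)) : ℝ)) (fun i _ => by positivity)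
    (fun i => posSet τ i.2.2) (fun i => assign τ τ' i.2.1 i.2.2) (γ := γ) (μ := _)
    (fun i hi => injOn_assign (hpos i hi) (hval i hi)) ?_ ?_ rfl
  · refine ⟨_, h.trans (mul_le_mul_of_nonneg_right (pr_mono ?_) ?_), ?_⟩
    · rintro σ ⟨i, hi, hσ⟩
      have hr := (forall_assign_iff (hpos i hi)).1 hσ
      have := hmemI i hi
      exact hr.intrans this.2.1.1 this.2.2.1 (by omega)
    · have : (0 : ℝ) ≤ ∑ i ∈ I, (1 / (2 * (i.1 + 1)) : ℝ) *
        ((n - #(posSet τ i.2.2)).factorial / n.factorial) :=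
        sum_nonneg fun i _ => by positivity
      positivity
    · rw [hI, sum_sigma]
      refine sum_le_sum fun k hk => ?_
      dsimp only
      rw [← mul_sum]
      refine mul_le_mul_of_nonneg_left ?_ (by positivity)
      have hkK := mem_range.1 hk
      have e1 : ∀ p ∈ goodSeqs τ' (twoSet τ') (k + 1) ×ˢ goodSeqs τ (twoSet τ) (k + 1),
          ((n - #(posSet τ p.2)).factorial / n.factorial : ℝ) =
            (n - 2 * (k + 1)).factorial / n.factorial := by
        intro p hp
        rw [card_posSet]
        exact hpos ⟨k, p⟩ (mem_sigma.2 ⟨hk, hp⟩)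
      rw [sum_congr rfl e1, sum_const, card_product, nsmul_eq_mul]
      have hn0 : (0 : ℝ) < n := Nat.cast_pos.2 (by omega)
      have e2 : (1 / (n : ℝ) ^ (2 * (k + 1))) ≤ (n - 2 * (k + 1)).factorial / n.factorial := by
        rw [div_le_div_iff₀ (by positivity) (by positivity), one_mul]
        have := Nat.factorial_mul_descFactorial (show 2 * (k + 1) ≤ n by omega)
        have h2 := Nat.descFactorial_le_pow n (2 * (k + 1))
        have : n.factorial ≤ (n - 2 * (k + 1)).factorial * n ^ (2 * (k + 1)) := by
          rw [← this]; gcongr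
        exact_mod_cast this
      have e3 := card_goodSeqs_ge τ (twoSet τ) (k + 1)
      have e4 := card_goodSeqs_ge τ' (twoSet τ') (k + 1)
      rw [card_twoSet] at e3 e4
      calc _ = ((2 * cycleCount τ' 2 - 5 * (k + 1) : ℕ) ^ (k + 1) : ℝ) *
            ((2 * cycleCount τ 2 - 5 * (k + 1) : ℕ) ^ (k + 1) : ℝ) * (1 / (n : ℝ) ^ (2 * (k + 1))) := by
            rw [mul_pow, div_pow, div_pow, pow_mul', sq]; field_simp
        _ ≤ _ := by
            refine mul_le_mul ?_ e2 (by positivity) (by positivity)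
            rw [Nat.cast_mul]
            exact mul_le_mul (by exact_mod_cast e4) (by exact_mod_cast e3) (by positivity)
              (by positivity)
  · intro σ i hi hσ
    obtain ⟨hiK, hix, hiq⟩ := hmemI i hi
    have hr := (forall_assign_iff (hpos i hi)).1 hσ
    set J := I.filter fun j => (∀ x ∈ posSet τ j.2.2, σ x = assign τ τ' j.2.1 j.2.2 x) ∧
      ¬ _root_.Disjoint (posSet τ i.2.2) (posSet τ j.2.2) with hJ
    have key : ∀ j ∈ J, Realizes τ τ' j.2.1 j.2.2 σ ∧ j.1 = i.1 ∧
        ∃ a, j.2.1 0 = i.2.1 a ∨ j.2.1 0 = τ' (i.2.1 a) := by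
      intro j hj
      obtain ⟨hjI, hjσ, hd⟩ := mem_filter.1 hj
      obtain ⟨hjK, hjx, hjq⟩ := hmemI j hjI
      have hr' := (forall_assign_iff (hpos j hjI)).1 hjσ
      have h1 : ∃ b, ∃ a, j.2.1 b = i.2.1 a ∨ j.2.1 b = τ' (i.2.1 a) := by
        obtain ⟨⟨a, s⟩, ⟨b, s'⟩, hab⟩ := exists_shared_of_not_disjoint hr hr' hd
        cases s <;> cases s' <;> simp only [valOf, if_true] at hab
        · exact ⟨b, a, Or.inl (τ'.injective hab).symm⟩
        · exact ⟨b + 1, a, Or.inr hab.symm⟩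
        · exact ⟨b, a + 1, Or.inr (by rw [hab]; exact (mem_twoSet.1 (hjx.1 b)).2.symm)⟩
        · exact ⟨b + 1, a + 1, Or.inl hab.symm⟩
      obtain ⟨b, hb⟩ := h1
      have h2 : ∀ m : ℕ, ∃ a, (word τ τ' σ)^[m] (j.2.1 b) = i.2.1 a ∨
          (word τ τ' σ)^[m] (j.2.1 b) = τ' (i.2.1 a) := by
        intro m
        induction m with
        | zero => exact hb
        | succ m ih =>
          rw [Function.iterate_succ_apply']
          exact hr.closed_word hix.1 hiq.1 ih
      have h3 : ∃ a, j.2.1 0 = i.2.1 a ∨ j.2.1 0 = τ' (i.2.1 a) := by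
        have := h2 ((-b : Fin (j.1 + 1)) : ℕ)
        rw [iterate_apply_fin hr'.word_apply] at this
        simpa using this
      refine ⟨hr', ?_, h3⟩
      have h4 := hr.minimalPeriod_word hix.1 hiq.1 hix.injective h3
      have h5 := minimalPeriod_of_fin hjx.injective hr'.word_apply 0
      omega
    have hw : ∀ j ∈ J, (1 / (2 * (j.1 + 1)) : ℝ) = 1 / (2 * (i.1 + 1)) := by
      intro j hj
      rw [(key j hj).2.1]
    have hc : #J ≤ 2 * (i.1 + 1) := by
      refine card_fin_seq_le J (fun j => j.2.1 0) i.2.1 τ' ?_ fun j hj => (key j hj).2.2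
      rintro ⟨k, x, q⟩ hj ⟨k', x', q'⟩ hj' h0
      obtain ⟨r1, e1, _⟩ := key _ hj
      obtain ⟨r2, e2, _⟩ := key _ hj'
      dsimp only at *
      obtain rfl : k = k' := e1.trans e2.symm
      obtain ⟨rfl, rfl⟩ := r1.eq_of_zero_eq r2 h0
      rfl
    rw [sum_congr rfl hw, sum_const, nsmul_eq_mul, mul_one_div, div_le_one (by positivity)]
    exact_mod_cast hc
  · intro i hi j hj
    rw [card_posSet (hpos i hi), card_posSet (hpos j hj)]
    exact hγ _ (by have := (hmemI i hi).1; omega) _ (by have := (hmemI j hj).1; omega)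

end Rings

end RandGen

namespace RandGen

open Equiv Equiv.Perm Finset

theorem eventually_le_natCast (c : ℝ) : ∀ᶠ n : ℕ in atTop, c ≤ n :=
  tendsto_natCast_atTop_atTop.eventually_ge_atTop c

theorem intrans_ge_of_fixed {δ : ℝ} (hδ : 0 < δ) :
    ∃ M : ℝ, 0 < M ∧ ∀ᶠ n : ℕ in atTop, ∀ τ τ' : Perm (Fin n),
      M ≤ (cycleCount τ 1 * cycleCount τ' 1 / n : ℝ) → 1 - δ ≤ pr (Intrans τ τ') := by
  refine ⟨2 / δ, by positivity, ?_⟩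
  filter_upwards [eventually_le_natCast (1 + 2 / δ), eventually_ge_atTop 2] with n hn hn2 τ τ' hM
  have hγ : (n : ℝ) ≤ (1 + δ / 2) * (n - 1) := by
    have : δ / 2 * (2 / δ) = 1 := by field_simp
    nlinarith
  refine le_trans ?_ (ge_of_second_moment (by positivity) (by positivity) hM
    (second_moment_fixed hn2 τ τ' hγ))
  rw [le_div_iff₀ (by positivity)]
  have : δ * (2 / δ) = 2 := by field_simp
  have h3 : 0 < 2 / δ := by positivity
  nlinarith

theorem intrans_ge_of_fixed' {η : ℝ} (hη : 0 < η) :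
    ∃ δ : ℝ, 0 < δ ∧ ∀ᶠ n : ℕ in atTop, ∀ τ τ' : Perm (Fin n),
      η ≤ (cycleCount τ 1 * cycleCount τ' 1 / n : ℝ) → δ ≤ pr (Intrans τ τ') := by
  refine ⟨η / (1 + (1 + 1) * η), by positivity, ?_⟩
  filter_upwards [eventually_ge_atTop 2] with n hn2 τ τ' hM
  have : (2 : ℝ) ≤ n := by exact_mod_cast hn2
  exact ge_of_second_moment (by positivity) (by positivity) hM
    (second_moment_fixed hn2 τ τ' (by linarith))

theorem eventually_factorial_ratio (B : ℕ) {γ : ℝ} (hγ : 0 < γ) :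
    ∀ᶠ n : ℕ in atTop, ∀ a ≤ B, ∀ b ≤ B, ((n - a - b).factorial : ℝ) * n.factorial ≤
      (1 + γ) * ((n - a).factorial * (n - b).factorial) := by
  filter_upwards [eventually_le_natCast (B * (B + B) * (1 + γ) / γ), eventually_ge_atTop (2 * B + 1)] with n hn hn2 a ha b hb
  have h := factorial_ratio (n := n) (a := a) (b := b) (by omega)
  have hn0 : (0 : ℝ) < n := Nat.cast_pos.2 (by omega)
  have ha' : (a : ℝ) ≤ B := by exact_mod_cast ha
  have hb' : (b : ℝ) ≤ B := by exact_mod_cast hb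
  have h2 : (b * (a + b) / n : ℝ) ≤ γ / (1 + γ) := by
    rw [div_le_div_iff₀ hn0 (by positivity)]
    rw [div_le_iff₀ hγ] at hn
    have : (b : ℝ) * (a + b) ≤ B * (B + B) := by gcongr
    nlinarith
  have h3 : (1 : ℝ) / (1 + γ) ≤ 1 - b * (a + b) / n := by
    have : (1 : ℝ) - γ / (1 + γ) = 1 / (1 + γ) := by field_simp; ring
    linarith
  have h4 := (mul_le_mul_of_nonneg_right h3
    (show (0 : ℝ) ≤ (n - a - b).factorial * n.factorial by positivity)).trans h
  rw [one_div, inv_mul_le_iff₀ (by positivity)] at h4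
  exact h4

theorem natCast_sub_le (a b : ℕ) : (a : ℝ) - b ≤ (a - b : ℕ) := by
  rw [sub_le_iff_le_add]; exact_mod_cast le_tsub_add

theorem intrans_ge_of_two {δ : ℝ} (hδ : 0 < δ) :
    ∃ η : ℝ, 0 < η ∧ ∀ᶠ n : ℕ in atTop, ∀ τ τ' : Perm (Fin n),
      (1 / 2 - η) * n ≤ cycleCount τ 2 → (1 / 2 - η) * n ≤ cycleCount τ' 2 →
        1 - δ ≤ pr (Intrans τ τ') := by
  obtain ⟨K, hK⟩ := (Real.tendsto_sum_range_one_div_nat_succ_atTop.eventually_ge_atTop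
    (8 / δ)).exists
  have hK0 : 0 < K := by
    rcases Nat.eq_zero_or_pos K with rfl | h
    · simp at hK
      have : 0 < 8 / δ := by positivity
      linarith
    · exact h
  have hK' : (0 : ℝ) < K := Nat.cast_pos.2 hK0
  set η : ℝ := 1 / (12 * K) with hη
  refine ⟨η, by positivity, ?_⟩
  filter_upwards [eventually_le_natCast (5 * K / η), eventually_ge_atTop (2 * K + 1),
    eventually_factorial_ratio (2 * K) (show (0 : ℝ) < δ / 2 by positivity)] with n hn hn2 hr τ τ' h2 h2'
  obtain ⟨μ, h3, h4⟩ := second_moment_rings K τ τ' (by positivity) (by omega) hr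
  have hn0 : (0 : ℝ) < n := Nat.cast_pos.2 (by omega)
  have hη3 : 3 * η ≤ 1 := by
    rw [hη, mul_one_div, div_le_one (by positivity)]
    have : (1 : ℝ) ≤ K := by exact_mod_cast hK0
    linarith
  have hb : ∀ τ : Perm (Fin n), (1 / 2 - η) * n ≤ cycleCount τ 2 → ∀ k ∈ range K,
      1 - 3 * η ≤ (((2 * cycleCount τ 2 - 5 * (k + 1) : ℕ) : ℝ) / n) := by
    intro τ hτ k hk
    rw [le_div_iff₀ hn0]
    have h5 := natCast_sub_le (2 * cycleCount τ 2) (5 * (k + 1))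
    have h6 : ((5 * (k + 1) : ℕ) : ℝ) ≤ 5 * K := by
      exact_mod_cast Nat.mul_le_mul_left 5 (mem_range.1 hk)
    rw [div_le_iff₀ (by positivity)] at hn
    push_cast at h5 h6 ⊢
    nlinarith
  have h5 : 2 / δ ≤ μ := by
    refine le_trans ?_ h4
    have h7 : ∀ k ∈ range K, (1 / (k + 1) : ℝ) * (1 / 4) ≤ (1 / (2 * (k + 1)) : ℝ) *
        ((((2 * cycleCount τ 2 - 5 * (k + 1) : ℕ) : ℝ) / n) *
        (((2 * cycleCount τ' 2 - 5 * (k + 1) : ℕ) : ℝ) / n)) ^ (k + 1) := by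
      intro k hk
      have e1 := hb τ h2 k hk
      have e2 := hb τ' h2' k hk
      have hk' : ((k : ℝ) + 1) ≤ K := by exact_mod_cast mem_range.1 hk
      have e3 : (1 / 2 : ℝ) ≤ ((1 - 3 * η) * (1 - 3 * η)) ^ (k + 1) := by
        rw [← sq, ← pow_mul]
        have := one_add_mul_le_pow (a := -(3 * η)) (by linarith) (2 * (k + 1))
        rw [← sub_eq_add_neg] at this
        refine le_trans ?_ this
        push_cast
        have : η * K = 1 / 12 := by rw [hη]; field_simp
        have : η * (k + 1) ≤ 1 / 12 := by
          rw [← this]; exact mul_le_mul_of_nonneg_left hk' (by positivity)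
        linarith
      have e4 : ((1 - 3 * η) * (1 - 3 * η)) ^ (k + 1) ≤
          ((((2 * cycleCount τ 2 - 5 * (k + 1) : ℕ) : ℝ) / n) *
          (((2 * cycleCount τ' 2 - 5 * (k + 1) : ℕ) : ℝ) / n)) ^ (k + 1) := by
        refine pow_le_pow_left₀ (mul_nonneg (by linarith) (by linarith)) ?_ _
        exact mul_le_mul e1 e2 (by linarith) (by linarith)
      have e5 : (1 / (2 * (k + 1)) : ℝ) = 1 / (k + 1) * (1 / 2) := by field_simp
      rw [e5, mul_assoc]
      refine mul_le_mul_of_nonneg_left ?_ (by positivity)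
      linarith
    refine le_trans ?_ (sum_le_sum h7)
    rw [← sum_mul]
    have : 2 / δ = 8 / δ * (1 / 4) := by ring
    rw [this]
    exact mul_le_mul_of_nonneg_right hK (by norm_num)
  refine le_trans ?_ (ge_of_second_moment (by positivity) (by positivity) h5 h3)
  rw [le_div_iff₀ (by positivity)]
  have : δ * (2 / δ) = 2 := by field_simp
  have h3 : 0 < 2 / δ := by positivity
  nlinarith

theorem intrans_ge_of_two' {η : ℝ} (hη : 0 < η) :
    ∃ δ : ℝ, 0 < δ ∧ ∀ᶠ n : ℕ in atTop, ∀ τ τ' : Perm (Fin n),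
      η * n ≤ cycleCount τ 2 → η * n ≤ cycleCount τ' 2 → δ ≤ pr (Intrans τ τ') := by
  set m : ℝ := 1 / 2 * (η * η) with hm
  have hm0 : 0 < m := by positivity
  refine ⟨m / (1 + (1 + 1) * m), by positivity, ?_⟩
  filter_upwards [eventually_le_natCast (5 / η), eventually_ge_atTop 3,
    eventually_factorial_ratio 2 (show (0 : ℝ) < 1 by positivity)] with n hn hn2 hr τ τ' h2 h2'
  obtain ⟨μ, h3, h4⟩ := second_moment_rings 1 τ τ' (by positivity) (by omega) hr
  refine ge_of_second_moment (by positivity) hm0 (le_trans ?_ h4) h3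
  have hn0 : (0 : ℝ) < n := Nat.cast_pos.2 (by omega)
  have hb : ∀ τ : Perm (Fin n), η * n ≤ cycleCount τ 2 →
      η ≤ (((2 * cycleCount τ 2 - 5 * (0 + 1) : ℕ) : ℝ) / n) := by
    intro τ hτ
    rw [le_div_iff₀ hn0]
    have h5 := natCast_sub_le (2 * cycleCount τ 2) (5 * (0 + 1))
    rw [div_le_iff₀ hη] at hn
    push_cast at h5 ⊢
    nlinarith
  rw [sum_range_one, hm]
  simp only [CharP.cast_eq_zero, zero_add, pow_one, mul_one]
  have := hb τ h2
  have := hb τ' h2'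
  norm_num only [zero_add] at *
  gcongr

theorem genProb_add_intrans_le {n : ℕ} (hn : 3 ≤ n) (τ τ' : Perm (Fin n)) :
    genProb n τ τ' ≤ 1 - pr (Intrans τ τ') := by
  rw [genProb_eq_pr, ← pr_not]
  exact pr_mono fun σ h h' => h'.not_alternatingGroup_le hn h

section Necessity

variable {π π' : (n : ℕ) → Perm (Fin n)}

theorem isLittleO_one_of_tendsto
    (h1 : ∀ n, cycleCount (π n) 1 = cycleCount (π' n) 1)
    (h : Tendsto (fun n => genProb n (π n) (π' n)) atTop (nhds 1)) :
    (fun n => (cycleCount (π n) 1 : ℝ)) =o[atTop] fun n => √n := by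
  rw [isLittleO_iff]
  intro ε hε
  obtain ⟨δ, hδ, hev⟩ := intrans_ge_of_fixed' (η := ε ^ 2) (by positivity)
  filter_upwards [hev, h.eventually (lt_mem_nhds (show 1 - δ < 1 by linarith)),
    eventually_ge_atTop 3] with n hn hP hn3
  by_contra! hcon
  rw [Real.norm_natCast, Real.norm_of_nonneg (by positivity)] at hcon
  have hn0 : (0 : ℝ) < n := Nat.cast_pos.2 (by omega)
  have := hn (π n) (π' n) (by
    rw [← h1, le_div_iff₀ hn0]
    calc ε ^ 2 * n = (ε * √n) * (ε * √n) := by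
          rw [mul_mul_mul_comm, Real.mul_self_sqrt hn0.le, sq]
      _ ≤ _ := by gcongr)
  have := genProb_add_intrans_le hn3 (π n) (π' n)
  linarith

theorem isLittleO_two_of_tendsto
    (h2 : ∀ n, cycleCount (π n) 2 = cycleCount (π' n) 2)
    (h : Tendsto (fun n => genProb n (π n) (π' n)) atTop (nhds 1)) :
    (fun n => (cycleCount (π n) 2 : ℝ)) =o[atTop] fun n => (n : ℝ) := by
  rw [isLittleO_iff]
  intro ε hε
  obtain ⟨δ, hδ, hev⟩ := intrans_ge_of_two' hε
  filter_upwards [hev, h.eventually (lt_mem_nhds (show 1 - δ < 1 by linarith)),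
    eventually_ge_atTop 3] with n hn hP hn3
  by_contra! hcon
  rw [Real.norm_natCast, Real.norm_of_nonneg (by positivity)] at hcon
  have := hn (π n) (π' n) hcon.le (by rw [← h2]; exact hcon.le)
  have := genProb_add_intrans_le hn3 (π n) (π' n)
  linarith

theorem isBigO_one_of_eventually
    (h1 : ∀ n, cycleCount (π n) 1 = cycleCount (π' n) 1)
    {p : ℝ} (hp : 0 < p)
    (h : ∀ᶠ n in atTop, p < genProb n (π n) (π' n)) :
    (fun n => (cycleCount (π n) 1 : ℝ)) =O[atTop] fun n => √n := by
  obtain ⟨M, hM, hev⟩ := intrans_ge_of_fixed hp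
  refine IsBigO.of_bound (√M) ?_
  filter_upwards [hev, h, eventually_ge_atTop 3] with n hn hP hn3
  by_contra! hcon
  rw [Real.norm_natCast, Real.norm_of_nonneg (by positivity)] at hcon
  have hn0 : (0 : ℝ) < n := Nat.cast_pos.2 (by omega)
  have := hn (π n) (π' n) (by
    rw [← h1, le_div_iff₀ hn0]
    calc M * n = (√M * √n) * (√M * √n) := by
          rw [mul_mul_mul_comm, Real.mul_self_sqrt hn0.le, Real.mul_self_sqrt hM.le]
      _ ≤ _ := by gcongr)
  have := genProb_add_intrans_le hn3 (π n) (π' n)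
  linarith

theorem limsup_two_of_eventually
    (h2 : ∀ n, cycleCount (π n) 2 = cycleCount (π' n) 2)
    {p : ℝ} (hp : 0 < p)
    (h : ∀ᶠ n in atTop, p < genProb n (π n) (π' n)) :
    limsup (fun n => (cycleCount (π n) 2 : ℝ) / n) atTop < 1 / 2 := by
  obtain ⟨η, hη, hev⟩ := intrans_ge_of_two hp
  refine lt_of_le_of_lt (limsup_le_of_le (a := 1 / 2 - η) ?_ ?_) (by linarith)
  · refine isCoboundedUnder_le_of_le (x := 0) atTop fun n => ?_
    positivity
  · filter_upwards [hev, h, eventually_ge_atTop 3] with n hn hP hn3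
    by_contra! hcon
    have hn0 : (0 : ℝ) < n := Nat.cast_pos.2 (by omega)
    rw [lt_div_iff₀ hn0] at hcon
    have := hn (π n) (π' n) hcon.le (by rw [← h2]; exact hcon.le)
    have := genProb_add_intrans_le hn3 (π n) (π' n)
    linarith

end Necessity

section Orbits

variable {n : ℕ}

/-- The set of cycles of `τ`, including fixed points. -/
abbrev Cyc (τ : Perm (Fin n)) := Quotient (SameCycle.setoid τ)

noncomputable instance (τ : Perm (Fin n)) : Fintype (Cyc τ) := Fintype.ofFinite _

/-- The cycle of a point. -/
def cyc (τ : Perm (Fin n)) (x : Fin n) : Cyc τ := Quotient.mk (SameCycle.setoid τ) x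

theorem cyc_eq_iff {τ : Perm (Fin n)} {x y : Fin n} : cyc τ x = cyc τ y ↔ τ.SameCycle x y :=
  Quotient.eq (r := SameCycle.setoid τ)

theorem cyc_surj (τ : Perm (Fin n)) (c : Cyc τ) : ∃ x, cyc τ x = c := Quotient.exists_rep c

open Classical in
/-- The points of a cycle. -/
noncomputable def cycPts (τ : Perm (Fin n)) (c : Cyc τ) : Finset (Fin n) :=
  univ.filter fun x => cyc τ x = c

theorem mem_cycPts {τ : Perm (Fin n)} {c : Cyc τ} {x : Fin n} : x ∈ cycPts τ c ↔ cyc τ x = c := by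
  simp [cycPts]

theorem cyc_apply (τ : Perm (Fin n)) (x : Fin n) : cyc τ (τ x) = cyc τ x :=
  cyc_eq_iff.2 (sameCycle_apply_left.2 (SameCycle.refl _ _))

theorem iff_of_cyc_eq {τ : Perm (Fin n)} {P : Fin n → Prop} (hP : ∀ x, P x → P (τ x)) {x y : Fin n}
    (h : cyc τ x = cyc τ y) : P x ↔ P y := by
  have key : ∀ x y, cyc τ x = cyc τ y → P x → P y := by
    intro x y h hx
    obtain ⟨i, _, rfl⟩ := (cyc_eq_iff.1 h).exists_pow_eq'
    have : ∀ i : ℕ, P ((τ ^ i) x) := by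
      intro i
      induction i with
      | zero => exact hx
      | succ i ih => rw [pow_succ', Perm.mul_apply]; exact hP _ ih
    exact this i
  exact ⟨key x y h, key y x h.symm⟩

theorem prod_cyc_le (τ : Perm (Fin n)) {F : ℕ → ℝ} {b₁ b₂ b₃ : ℝ} (hF : ∀ m, 0 ≤ F m)
    (h1 : F 1 ≤ b₁) (h2 : F 2 ≤ b₂ ^ 2) (h3 : ∀ m, 3 ≤ m → F m ≤ b₃ ^ m) :
    ∏ c : Cyc τ, F #(cycPts τ c) ≤ b₁ ^ cycleCount τ 1 * (b₂ ^ 2) ^ cycleCount τ 2 *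
      b₃ ^ (n - cycleCount τ 1 - 2 * cycleCount τ 2) := by
  classical
  set β : Fin n → ℝ := fun x => if x ∈ fixSet τ then b₁ else if x ∈ twoSet τ then b₂ else b₃ with hβ
  have hfix : ∀ x, x ∈ fixSet τ → τ x ∈ fixSet τ := by
    intro x hx; rw [mem_fixSet] at *; rw [hx, hx]
  have htwo : ∀ x, x ∈ twoSet τ → τ x ∈ twoSet τ := by
    intro x hx; rw [mem_twoSet] at *
    exact ⟨fun h => hx.1 (τ.injective h), by rw [hx.2]⟩
  have hc : ∀ c : Cyc τ, F #(cycPts τ c) ≤ ∏ x ∈ cycPts τ c, β x := by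
    intro c
    obtain ⟨x, rfl⟩ := cyc_surj τ c
    by_cases hx1 : x ∈ fixSet τ
    · have : cycPts τ (cyc τ x) = {x} := by
        ext y
        rw [mem_cycPts, mem_singleton, eq_comm]
        constructor
        · intro h
          exact ((iff_of_cyc_eq (P := fun y => y = x) (fun y hy => by
            rw [hy]; exact mem_fixSet.1 hx1) h).1 rfl)
        · rintro rfl; rfl
      rw [this, card_singleton, prod_singleton]
      simpa [hβ, hx1] using h1
    have hn1 : ∀ y, cyc τ x = cyc τ y → y ∉ fixSet τ := fun y hy h =>
      hx1 ((iff_of_cyc_eq hfix hy).2 h)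
    by_cases hx2 : x ∈ twoSet τ
    · have h2' := mem_twoSet.1 hx2
      have : cycPts τ (cyc τ x) = {x, τ x} := by
        ext y
        rw [mem_cycPts, mem_insert, mem_singleton, eq_comm]
        constructor
        · intro h
          exact ((iff_of_cyc_eq (P := fun y => y = x ∨ y = τ x) (fun y hy => by
            rcases hy with rfl | rfl
            · exact Or.inr rfl
            · exact Or.inl h2'.2) h).1 (Or.inl rfl))
        · rintro (rfl | rfl)
          · rfl
          · exact (cyc_apply τ x).symm
      rw [this, card_pair h2'.1.symm, prod_pair h2'.1.symm]
      have e1 : β x = b₂ := by simp [hβ, hx1, hx2]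
      have e2 : β (τ x) = b₂ := by
        simp [hβ, hn1 (τ x) (cyc_apply τ x).symm, htwo x hx2]
      rw [e1, e2, ← sq]; exact h2
    · have hβx : ∀ y ∈ cycPts τ (cyc τ x), β y = b₃ := by
        intro y hy
        rw [mem_cycPts] at hy
        have : y ∉ twoSet τ := fun h => hx2 ((iff_of_cyc_eq htwo hy).1 h)
        simp [hβ, hn1 y hy.symm, this]
      rw [prod_congr rfl hβx, prod_const]
      refine h3 _ ?_
      have hx1' : τ x ≠ x := fun h => hx1 (mem_fixSet.2 h)
      have hx2' : τ (τ x) ≠ x := fun h => hx2 (mem_twoSet.2 ⟨hx1', h⟩)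
      have : ({x, τ x, τ (τ x)} : Finset (Fin n)) ⊆ cycPts τ (cyc τ x) := by
        intro y hy
        simp only [mem_insert, mem_singleton] at hy
        rw [mem_cycPts]
        rcases hy with rfl | rfl | rfl
        · rfl
        · exact cyc_apply _ _
        · rw [cyc_apply, cyc_apply]
      refine le_trans (le_of_eq ?_) (card_le_card this)
      rw [card_eq_three.2 ⟨x, τ x, τ (τ x), hx1'.symm, hx2'.symm,
        fun h => hx1' (τ.injective h).symm, rfl⟩]
  refine (prod_le_prod (fun c _ => hF _) fun c _ => hc c).trans (le_of_eq ?_)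
  have e0 : ∏ c : Cyc τ, ∏ x ∈ cycPts τ c, β x = ∏ x, β x := by
    simp only [cycPts]
    exact prod_fiberwise univ (fun x => cyc τ x) β
  have hdisj : _root_.Disjoint (fixSet τ) (twoSet τ) := by
    rw [disjoint_left]
    intro x h1 h2
    exact (mem_twoSet.1 h2).1 (mem_fixSet.1 h1)
  have e1 : filter (fun x => x ∈ twoSet τ) (filter (fun x => x ∉ fixSet τ) univ) = twoSet τ := by
    ext x
    simp only [mem_filter, mem_univ, true_and, and_iff_right_iff_imp]
    exact fun h2 h1 => disjoint_left.1 hdisj h1 h2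
  have e2 : filter (fun x => x ∉ twoSet τ) (filter (fun x => x ∉ fixSet τ) univ) =
      univ \ (fixSet τ ∪ twoSet τ) := by
    ext x
    simp only [mem_filter, mem_univ, true_and, Finset.mem_sdiff, mem_union, not_or]
  rw [e0, hβ, prod_ite, prod_ite, prod_const, prod_const, prod_const, e1, e2, filter_mem_eq_inter,
    univ_inter, card_fixSet, card_twoSet, card_sdiff_of_subset (subset_univ _),
    card_union_of_disjoint hdisj, card_fixSet, card_twoSet, card_univ, Fintype.card_fin, pow_mul,
    Nat.sub_sub, mul_assoc]

open Classical in
/-- The `τ`-invariant sets of size `a`. -/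
noncomputable def invSets (τ : Perm (Fin n)) (a : ℕ) : Finset (Finset (Fin n)) :=
  univ.filter fun S => #S = a ∧ ∀ x ∈ S, τ x ∈ S

theorem mem_invSets {τ : Perm (Fin n)} {a : ℕ} {S : Finset (Fin n)} :
    S ∈ invSets τ a ↔ #S = a ∧ ∀ x ∈ S, τ x ∈ S := by simp [invSets]

theorem card_invSets_mul_pow_le (τ : Perm (Fin n)) (a : ℕ) {z : ℝ} (hz : 0 ≤ z) :
    #(invSets τ a) * z ^ a ≤ ∏ c : Cyc τ, (1 + z ^ #(cycPts τ c)) := by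
  classical
  rw [prod_one_add, ← nsmul_eq_mul, ← sum_const]
  have hmem : ∀ S ∈ invSets τ a, ∀ x, x ∈ S ↔ cyc τ x ∈ S.image (cyc τ) := by
    intro S hS x
    refine ⟨fun h => mem_image_of_mem _ h, fun h => ?_⟩
    obtain ⟨y, hy, hyx⟩ := mem_image.1 h
    exact (iff_of_cyc_eq (mem_invSets.1 hS).2 hyx).1 hy
  have hinj : Set.InjOn (fun S : Finset (Fin n) => S.image (cyc τ)) (invSets τ a) := by
    intro S hS T hT h
    ext x
    rw [hmem S hS, hmem T hT]
    dsimp only at h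
    rw [h]
  have h1 : ∀ S ∈ invSets τ a, z ^ a = ∏ c ∈ S.image (cyc τ), z ^ #(cycPts τ c) := by
    intro S hS
    rw [prod_pow_eq_pow_sum]
    congr 1
    rw [← (mem_invSets.1 hS).1, card_eq_sum_card_fiberwise (f := cyc τ) (t := S.image (cyc τ))
      (fun x hx => mem_image_of_mem _ hx)]
    refine sum_congr rfl fun c hc => ?_
    congr 1
    ext x
    rw [mem_filter, mem_cycPts]
    constructor
    · exact fun h => h.2
    · intro h
      exact ⟨(hmem S hS x).2 (h ▸ hc), h⟩
  rw [sum_congr rfl h1, ← sum_image (f := fun Q => ∏ c ∈ Q, z ^ #(cycPts τ c)) hinj]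
  refine sum_le_sum_of_subset_of_nonneg (fun Q _ => mem_powerset.2 (subset_univ _)) fun Q _ _ => ?_
  positivity

theorem card_invSets_le (τ : Perm (Fin n)) (a : ℕ) {z b₂ b₃ : ℝ} (hz : 0 ≤ z) (hz1 : z ≤ 1)
    (hb₂ : 0 ≤ b₂) (hb₃ : 0 ≤ b₃) (h2 : 1 + z ^ 2 = b₂ ^ 2) (h3 : 1 + z ^ 3 = b₃ ^ 3) :
    #(invSets τ a) * z ^ a ≤ (1 + z) ^ cycleCount τ 1 * (1 + z ^ 2) ^ cycleCount τ 2 *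
      b₃ ^ (n - cycleCount τ 1 - 2 * cycleCount τ 2) := by
  refine (card_invSets_mul_pow_le τ a hz).trans ?_
  rw [h2]
  have hb31 : 1 ≤ b₃ := by
    by_contra! h
    have := pow_lt_one₀ hb₃ h (show 3 ≠ 0 by norm_num)
    have : 0 ≤ z ^ 3 := by positivity
    linarith
  refine prod_cyc_le τ (F := fun m => 1 + z ^ m) (fun m => by positivity) (by simp) h2.le ?_
  intro m hm
  calc 1 + z ^ m ≤ 1 + z ^ 3 := by
        have := pow_le_pow_of_le_one hz hz1 hm
        linarith
    _ = b₃ ^ 3 := h3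
    _ ≤ b₃ ^ m := pow_le_pow_right₀ hb31 hm

theorem pr_exists_inv_le (τ τ' : Perm (Fin n)) (a : ℕ) :
    pr (fun σ => ∃ Y : Finset (Fin n), #Y = a ∧ Inv τ τ' σ Y) ≤
      #(invSets τ a) * #(invSets τ' a) / n.choose a := by
  classical
  have h1 : pr (fun σ => ∃ Y : Finset (Fin n), #Y = a ∧ Inv τ τ' σ Y) ≤
      pr (fun σ => ∃ p ∈ invSets τ a ×ˢ invSets τ' a, p.1.image σ = p.2) := by
    refine pr_mono ?_
    rintro σ ⟨Y, hY, hinv⟩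
    refine ⟨(Y.image ⇑σ⁻¹, Y), mem_product.2 ⟨mem_invSets.2 ⟨?_, ?_⟩, mem_invSets.2 ⟨hY, ?_⟩⟩, ?_⟩
    · rw [card_image_of_injective _ (σ⁻¹).injective, hY]
    · intro x hx
      obtain ⟨y, hy, rfl⟩ := mem_image.1 hx
      refine mem_image.2 ⟨σ (τ (σ⁻¹ y)), (hinv y hy).1, ?_⟩
      exact σ.symm_apply_apply _
    · exact fun y hy => (hinv y hy).2
    · dsimp only
      rw [image_image]
      ext y
      simp
  refine h1.trans ((pr_exists_le _ _).trans ?_)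
  have h2 : ∀ p ∈ invSets τ a ×ˢ invSets τ' a,
      pr (fun σ : Perm (Fin n) => p.1.image σ = p.2) = 1 / n.choose a := by
    intro p hp
    obtain ⟨h, h'⟩ := mem_product.1 hp
    rw [mem_invSets] at h h'
    rw [pr_image_eq (h.1.trans h'.1.symm), h.1]
  rw [sum_congr rfl h2, sum_const, card_product, nsmul_eq_mul, Nat.cast_mul, mul_one_div]

end Orbits

theorem le_factorial_sqrt (n : ℕ) : √n * (n / Real.exp 1) ^ n ≤ n.factorial := by
  refine le_trans ?_ (Stirling.le_factorial_stirling n)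
  refine mul_le_mul_of_nonneg_right (Real.sqrt_le_sqrt ?_) (by positivity)
  have := Real.pi_gt_three
  have : (0 : ℝ) ≤ n := Nat.cast_nonneg n
  nlinarith

theorem factorial_le_sqrt {n : ℕ} (hn : n ≠ 0) :
    (n.factorial : ℝ) ≤ Real.exp 1 * √n * (n / Real.exp 1) ^ n := by
  obtain ⟨m, rfl⟩ := Nat.exists_eq_succ_of_ne_zero hn
  have h := Stirling.stirlingSeq'_antitone (Nat.zero_le m)
  simp only [Function.comp] at h
  rw [show Nat.succ 0 = 1 from rfl, Stirling.stirlingSeq_one, Stirling.stirlingSeq] at h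
  rw [div_le_iff₀ (by positivity)] at h
  refine h.trans (le_of_eq ?_)
  rw [Real.sqrt_mul (by norm_num)]
  have : Real.sqrt 2 ≠ 0 := by positivity
  field_simp

theorem pow_le_choose_mul {a b : ℕ} (ha : a ≠ 0) (hb : b ≠ 0) :
    ((a + b : ℕ) : ℝ) ^ (a + b) ≤
      (a + b).choose a * (a ^ a * b ^ b) * (Real.exp 2 * √a) := by
  have h1 := le_factorial_sqrt (a + b)
  have h2 := factorial_le_sqrt ha
  have h3 := factorial_le_sqrt hb
  have e1 : ((a + b).choose a * a.factorial * b.factorial : ℝ) = (a + b).factorial := by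
    have := Nat.choose_mul_factorial_mul_factorial (Nat.le_add_right a b)
    rw [Nat.add_sub_cancel_left] at this
    exact_mod_cast this
  rw [← e1] at h1
  obtain ⟨C, hC⟩ : ∃ C : ℝ, C = ((a + b).choose a : ℕ) := ⟨_, rfl⟩
  rw [← hC] at h1 ⊢
  have hC0 : 0 ≤ C := hC ▸ Nat.cast_nonneg _
  set e := Real.exp 1 with he
  have he0 : 0 < e := Real.exp_pos 1
  have he2 : Real.exp 2 = e * e := by rw [he, ← Real.exp_add]; norm_num
  have h4 : C * a.factorial * b.factorial ≤
      C * (e * √a * (a / e) ^ a) * (e * √b * (b / e) ^ b) := by gcongr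
  have h5 := h1.trans h4
  have hs : √b ≤ √((a + b : ℕ) : ℝ) := Real.sqrt_le_sqrt (by push_cast; linarith [(Nat.cast_nonneg a : (0:ℝ) ≤ a)])
  have hs0 : 0 < √((a + b : ℕ) : ℝ) := by
    apply Real.sqrt_pos.2; exact_mod_cast (by omega : 0 < a + b)
  have h6 : √((a + b : ℕ) : ℝ) * (((a + b : ℕ) : ℝ) / e) ^ (a + b) ≤
      √((a + b : ℕ) : ℝ) * (C * (e * √a * (a / e) ^ a) * (e * (b / e) ^ b)) := by
    refine h5.trans ?_
    calc _ = √b * (C * (e * √a * (a / e) ^ a) * (e * (b / e) ^ b)) := by ring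
      _ ≤ _ := mul_le_mul_of_nonneg_right hs (by positivity)
  have h7 := le_of_mul_le_mul_left h6 hs0
  rw [div_pow, div_le_iff₀ (by positivity)] at h7
  refine h7.trans (le_of_eq ?_)
  rw [he2, div_pow, div_pow, pow_add]
  field_simp

theorem exists_root {y : ℝ} (hy : 0 ≤ y) {k : ℕ} (hk : k ≠ 0) : ∃ b : ℝ, 0 ≤ b ∧ y = b ^ k :=
  ⟨y ^ (1 / (k : ℝ)), by positivity, by
    rw [← Real.rpow_natCast, ← Real.rpow_mul hy, one_div_mul_cancel (by exact_mod_cast hk),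
      Real.rpow_one]⟩

section

variable {n : ℕ}

theorem cycleCount_sum_le (τ : Perm (Fin n)) : cycleCount τ 1 + 2 * cycleCount τ 2 ≤ n := by
  rw [← card_fixSet, ← card_twoSet, ← card_union_of_disjoint]
  · exact (card_le_univ _).trans (by simp)
  · rw [disjoint_left]
    intro x h1 h2
    exact (mem_twoSet.1 h2).1 (mem_fixSet.1 h1)

theorem card_invSets_le_exp (τ : Perm (Fin n)) (a : ℕ) {z : ℝ} (hz : 0 ≤ z) (hz1 : z ≤ 1) :
    #(invSets τ a) * z ^ a ≤ Real.exp (z * cycleCount τ 1 + z ^ 2 * cycleCount τ 2 +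
      z ^ 3 * n) := by
  obtain ⟨b₂, hb₂, e2⟩ := exists_root (show 0 ≤ 1 + z ^ 2 by positivity) (k := 2) (by norm_num)
  obtain ⟨b₃, hb₃, e3⟩ := exists_root (show 0 ≤ 1 + z ^ 3 by positivity) (k := 3) (by norm_num)
  refine (card_invSets_le τ a hz hz1 hb₂ hb₃ e2 e3).trans ?_
  have hexp : ∀ y : ℝ, 1 + y ≤ Real.exp y := fun y => by
    have := Real.add_one_le_exp y; linarith
  have hb3 : b₃ ≤ Real.exp (z ^ 3) := by
    have h1 : 1 ≤ b₃ := by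
      by_contra! h
      have := pow_lt_one₀ hb₃ h (show 3 ≠ 0 by norm_num)
      have : 0 ≤ z ^ 3 := by positivity
      linarith
    calc b₃ ≤ b₃ ^ 3 := le_self_pow₀ h1 (by norm_num)
      _ = 1 + z ^ 3 := e3.symm
      _ ≤ _ := hexp _
  rw [Real.exp_add, Real.exp_add, mul_comm z, mul_comm (z ^ 2), mul_comm (z ^ 3), Real.exp_nat_mul,
    Real.exp_nat_mul, Real.exp_nat_mul]
  refine mul_le_mul (mul_le_mul (pow_le_pow_left₀ (by positivity) (hexp _) _)
    (pow_le_pow_left₀ (by positivity) (hexp _) _) (by positivity) (by positivity)) ?_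
    (by positivity) (by positivity)
  refine (pow_le_pow_left₀ hb₃ hb3 _).trans ?_
  exact pow_le_pow_right₀ (Real.one_le_exp (by positivity)) (by omega)

theorem card_invSets_le_exp' (τ : Perm (Fin n)) (a : ℕ) {z : ℝ} (hz : 0 ≤ z) (hz1 : z ≤ 1) :
    (#(invSets τ a) * z ^ a) ^ 2 ≤ Real.exp (2 * z * cycleCount τ 1 -
      z ^ 2 / 24 * (n - cycleCount τ 1 - 2 * cycleCount τ 2 : ℝ)) * (1 + z ^ 2) ^ n := by
  obtain ⟨b₂, hb₂, e2⟩ := exists_root (show 0 ≤ 1 + z ^ 2 by positivity) (k := 2) (by norm_num)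
  obtain ⟨b₃, hb₃, e3⟩ := exists_root (show 0 ≤ 1 + z ^ 3 by positivity) (k := 3) (by norm_num)
  have hexp : ∀ y : ℝ, 1 + y ≤ Real.exp y := fun y => by
    have := Real.add_one_le_exp y; linarith
  have h3 : b₃ ^ 2 ≤ Real.exp (-(z ^ 2 / 24)) * (1 + z ^ 2) := by
    have h1 : (b₃ ^ 2) ^ 3 ≤ (Real.exp (-(z ^ 2 / 24)) * (1 + z ^ 2)) ^ 3 := by
      rw [← pow_mul, mul_comm 2 3, pow_mul, ← e3, mul_pow, ← Real.exp_nat_mul]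
      have h2 : (1 + z ^ 3) ^ 2 + z ^ 2 ≤ (1 + z ^ 2) ^ 3 := by
        have : z ^ 3 ≤ z ^ 2 := pow_le_pow_of_le_one hz hz1 (by norm_num)
        have : 0 ≤ z ^ 4 := by positivity
        nlinarith
      have h4 : (1 + z ^ 2) ^ 3 ≤ 8 := by
        have : 1 + z ^ 2 ≤ 2 := by nlinarith
        calc (1 + z ^ 2) ^ 3 ≤ 2 ^ 3 := pow_le_pow_left₀ (by positivity) this _
          _ = 8 := by norm_num
      have h5 := hexp (-(z ^ 2 / 8))
      have e : ((3 : ℕ) : ℝ) * (-(z ^ 2 / 24)) = -(z ^ 2 / 8) := by push_cast; ring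
      rw [e]
      have h6 : 0 ≤ (1 + z ^ 2) ^ 3 := by positivity
      have h7 := mul_le_mul_of_nonneg_right h5 h6
      have : 0 ≤ z ^ 2 := by positivity
      nlinarith
    exact le_of_pow_le_pow_left₀ (by norm_num) (by positivity) h1
  have hle := cycleCount_sum_le τ
  have hsub : ((n - cycleCount τ 1 - 2 * cycleCount τ 2 : ℕ) : ℝ) =
      n - cycleCount τ 1 - 2 * cycleCount τ 2 := by
    rw [Nat.sub_sub, Nat.cast_sub hle]; push_cast; ring
  rw [← hsub]
  set m := n - cycleCount τ 1 - 2 * cycleCount τ 2 with hm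
  calc (#(invSets τ a) * z ^ a) ^ 2
      ≤ ((1 + z) ^ cycleCount τ 1 * (1 + z ^ 2) ^ cycleCount τ 2 * b₃ ^ m) ^ 2 :=
        pow_le_pow_left₀ (by positivity) (card_invSets_le τ a hz hz1 hb₂ hb₃ e2 e3) 2
    _ = ((1 + z) ^ 2) ^ cycleCount τ 1 * (1 + z ^ 2) ^ (2 * cycleCount τ 2) * (b₃ ^ 2) ^ m := by
        rw [mul_pow, mul_pow, ← pow_mul, ← pow_mul, ← pow_mul, ← pow_mul, ← pow_mul]
        ring_nf
    _ ≤ (Real.exp (2 * z)) ^ cycleCount τ 1 * (1 + z ^ 2) ^ (2 * cycleCount τ 2) *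
        (Real.exp (-(z ^ 2 / 24)) * (1 + z ^ 2)) ^ m := by
        gcongr
        rw [two_mul, Real.exp_add, sq]
        exact mul_le_mul (hexp z) (hexp z) (by positivity) (by positivity)
    _ = Real.exp (2 * z * cycleCount τ 1 - z ^ 2 / 24 * m) * (1 + z ^ 2) ^ (2 * cycleCount τ 2 + m) := by
        rw [mul_pow, ← Real.exp_nat_mul, ← Real.exp_nat_mul, sub_eq_add_neg, Real.exp_add, pow_add]
        have e1 : 2 * z * (cycleCount τ 1 : ℝ) = cycleCount τ 1 * (2 * z) := by ring
        have e2 : -(z ^ 2 / 24 * (m : ℝ)) = m * -(z ^ 2 / 24) := by ring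
        rw [e1, e2]
        ring
    _ ≤ _ := by
        refine mul_le_mul_of_nonneg_left (pow_le_pow_right₀ ?_ (by omega)) (by positivity)
        nlinarith

end

/-- The expected number of invariant sets of size `a`. -/
noncomputable def expInv {n : ℕ} (τ τ' : Perm (Fin n)) (a : ℕ) : ℝ :=
  #(invSets τ a) * #(invSets τ' a) / n.choose a

theorem expInv_le_exp {x ε : ℝ} (hx : 0 ≤ x) (hε : 0 < ε) : ∃ D : ℝ, 0 < D ∧
    ∀ᶠ n : ℕ in atTop, ∀ τ τ' : Perm (Fin n), (cycleCount τ 1 : ℝ) ≤ x * √n →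
      (cycleCount τ' 1 : ℝ) ≤ x * √n → (cycleCount τ 2 : ℝ) ≤ (1 / 2 - ε) * n →
      (cycleCount τ' 2 : ℝ) ≤ (1 / 2 - ε) * n → ∀ a : ℕ, 1 ≤ a → 2 * a ≤ n →
      expInv τ τ' a ≤ D * Real.exp (-(ε / 48 * a)) := by
  set y : ℝ := 1 + 4 * x with hy
  refine ⟨Real.exp 2 * Real.exp (12 * y ^ 2 / ε), by positivity, ?_⟩
  filter_upwards [eventually_le_natCast ((x / ε) ^ 2)] with n hn τ τ' h1 h1' h2 h2' a ha han
  obtain ⟨b, rfl⟩ : ∃ b, n = a + b := ⟨n - a, by omega⟩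
  set N : ℝ := ((a + b : ℕ) : ℝ) with hN
  have ha0 : (0 : ℝ) < a := Nat.cast_pos.2 ha
  have hb0 : (0 : ℝ) < b := Nat.cast_pos.2 (by omega)
  have hab : (a : ℝ) ≤ b := by exact_mod_cast (show a ≤ b by omega)
  have hNab : N = a + b := by rw [hN]; push_cast; ring
  have hN0 : 0 < N := by rw [hNab]; positivity
  have hxn : x * √N ≤ ε * N := by
    have h3 : x / ε ≤ √N := Real.le_sqrt_of_sq_le hn
    rw [div_le_iff₀ hε] at h3
    nlinarith [Real.mul_self_sqrt hN0.le, Real.sqrt_nonneg N]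
  set z : ℝ := √(a / b) with hz
  have hz0 : 0 ≤ z := Real.sqrt_nonneg _
  have hz2 : z ^ 2 = a / b := Real.sq_sqrt (by positivity)
  have hz1 : z ≤ 1 := Real.sqrt_le_one.2 (by rw [div_le_one hb0]; exact hab)
  have hzN : z * √N ≤ 2 * √a := by
    rw [hz, ← Real.sqrt_mul (by positivity), show (2 : ℝ) = Real.sqrt 4 by
      rw [show (4 : ℝ) = 2 ^ 2 by norm_num]; exact (Real.sqrt_sq (by norm_num)).symm,
      ← Real.sqrt_mul (by norm_num)]
    apply Real.sqrt_le_sqrt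
    rw [div_mul_eq_mul_div, div_le_iff₀ hb0, hNab]
    nlinarith
  have hzN2 : a ≤ z ^ 2 * N := by
    rw [hz2, hNab, div_mul_eq_mul_div, le_div_iff₀ hb0]; nlinarith
  have key : ∀ τ : Perm (Fin (a + b)), (cycleCount τ 1 : ℝ) ≤ x * √N →
      (cycleCount τ 2 : ℝ) ≤ (1 / 2 - ε) * N →
      #(invSets τ a) * z ^ a ≤
        √(Real.exp (4 * x * √a - ε / 24 * a) * (1 + z ^ 2) ^ (a + b)) := by
    intro τ h1 h2
    refine Real.le_sqrt_of_sq_le ((card_invSets_le_exp' τ a hz0 hz1).trans ?_)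
    refine mul_le_mul_of_nonneg_right (Real.exp_le_exp.2 ?_) (by positivity)
    have e1 : z * cycleCount τ 1 ≤ 2 * x * √a := by
      calc z * cycleCount τ 1 ≤ z * (x * √N) := by gcongr
        _ = x * (z * √N) := by ring
        _ ≤ x * (2 * √a) := by gcongr
        _ = _ := by ring
    have e2 : ε * N ≤ N - cycleCount τ 1 - 2 * cycleCount τ 2 := by linarith
    have e3 : ε * a ≤ z ^ 2 * (N - cycleCount τ 1 - 2 * cycleCount τ 2) := by
      calc ε * a ≤ ε * (z ^ 2 * N) := by gcongr
        _ = z ^ 2 * (ε * N) := by ring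
        _ ≤ _ := by gcongr
    have hcast : (((a + b : ℕ) : ℝ)) = N := rfl
    rw [hcast]
    linarith
  have hprod := mul_le_mul (key τ h1 h2) (key τ' h1' h2') (by positivity) (by positivity)
  rw [Real.mul_self_sqrt (by positivity)] at hprod
  have hz2' : 1 + z ^ 2 = N / b := by rw [hz2, hNab]; field_simp; ring
  rw [hz2', mul_mul_mul_comm, ← mul_pow, ← sq, hz2, div_pow, div_pow] at hprod
  have hst := pow_le_choose_mul (a := a) (b := b) (by omega) (by omega)
  have hC : (0 : ℝ) < (a + b).choose a := by exact_mod_cast Nat.choose_pos (by omega)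
  set II : ℝ := #(invSets τ a) * #(invSets τ' a) with hII
  set X := Real.exp (4 * x * √a - ε / 24 * a) with hX
  have h5 : II ≤ (a + b).choose a * (X * (Real.exp 2 * √a)) := by
    have h6 : II * ((a : ℝ) ^ a / b ^ a) ≤
        X * (((a + b).choose a * (a ^ a * b ^ b) * (Real.exp 2 * √a)) / b ^ (a + b)) := by
      refine hprod.trans ?_
      gcongr
    have h7 : X * (((a + b).choose a * ((a : ℝ) ^ a * b ^ b) * (Real.exp 2 * √a)) / b ^ (a + b)) =
        ((a + b).choose a * (X * (Real.exp 2 * √a))) * ((a : ℝ) ^ a / b ^ a) := by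
      rw [pow_add]; field_simp
    rw [h7] at h6
    exact le_of_mul_le_mul_right h6 (by positivity)
  rw [expInv, div_le_iff₀ hC, mul_comm _ (((a + b).choose a : ℕ) : ℝ)]
  refine h5.trans (mul_le_mul_of_nonneg_left ?_ hC.le)
  have h8 : √a ≤ Real.exp (√a) := by
    have := Real.add_one_le_exp (√a); linarith
  calc X * (Real.exp 2 * √a) ≤ X * (Real.exp 2 * Real.exp (√a)) := by gcongr
    _ = Real.exp 2 * Real.exp (y * √a - ε / 24 * a) := by
        rw [hX, mul_left_comm, ← Real.exp_add]; congr 2; rw [hy]; ring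
    _ ≤ Real.exp 2 * Real.exp (12 * y ^ 2 / ε + -(ε / 48 * a)) := by
        gcongr
        have h9 : y * √a ≤ 12 * y ^ 2 / ε + ε / 48 * a := by
          have h10 := Real.sq_sqrt ha0.le
          rw [div_add' _ _ _ hε.ne', le_div_iff₀ hε]
          have h11 : ε ^ 2 * √a ^ 2 = ε ^ 2 * a := by rw [h10]
          nlinarith [sq_nonneg (24 * y - ε * √a)]
        linarith
    _ = _ := by rw [Real.exp_add]; ring

theorem Intrans.exists_card {n : ℕ} {τ τ' σ : Perm (Fin n)} (h : Intrans τ τ' σ) :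
    ∃ a ∈ Icc 1 (n / 2), ∃ Y : Finset (Fin n), #Y = a ∧ Inv τ τ' σ Y := by
  obtain ⟨Y, hne, hY, hinv⟩ := h
  have hY1 := hne.card_pos
  have hY2 : #Y < n := by
    have := card_lt_card (ssubset_univ_iff.2 hY)
    rwa [card_univ, Fintype.card_fin] at this
  rcases le_or_gt (#Y) (n / 2) with h2 | h2
  · exact ⟨#Y, mem_Icc.2 ⟨hY1, h2⟩, Y, rfl, hinv⟩
  · refine ⟨#Yᶜ, ?_, Yᶜ, rfl, ?_⟩
    · rw [card_compl, Fintype.card_fin, mem_Icc]; omega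
    · intro y hy
      rw [mem_compl] at hy
      constructor
      · rw [mem_compl]
        intro h
        exact hy ((perm_apply_mem_iff (g := σ * τ * σ⁻¹) (fun y hy => (hinv y hy).1) y).1 h)
      · rw [mem_compl]
        intro h
        exact hy ((perm_apply_mem_iff (g := τ') (fun y hy => (hinv y hy).2) y).1 h)

theorem pr_intrans_le {n : ℕ} (τ τ' : Perm (Fin n)) :
    pr (Intrans τ τ') ≤ ∑ a ∈ Icc 1 (n / 2), expInv τ τ' a :=
  (pr_mono fun _ => Intrans.exists_card).trans ((pr_exists_le _ _).trans
    (sum_le_sum fun a _ => pr_exists_inv_le τ τ' a))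

theorem exists_tail_le (D : ℝ) {κ δ : ℝ} (hκ : 0 < κ) (hδ : 0 < δ) :
    ∃ K : ℕ, ∀ s : Finset ℕ, (∀ a ∈ s, K < a) → ∑ a ∈ s, D * Real.exp (-(κ * a)) ≤ δ := by
  have hs : Summable fun a : ℕ => D * Real.exp (-(κ * a)) := by
    refine Summable.mul_left _ ?_
    have := Real.summable_exp_nat_mul_iff.2 (neg_lt_zero.2 hκ)
    refine this.congr fun a => ?_
    ring_nf
  obtain ⟨s, hs⟩ := summable_iff_vanishing_norm.1 hs δ hδ
  refine ⟨s.sup id, fun t ht => (le_abs_self _).trans (hs t ?_).le⟩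
  rw [disjoint_left]
  intro a ha has
  exact absurd (le_sup (f := id) has) (not_le.2 (ht a ha))

theorem half_pow_le_choose_mul {n a : ℕ} (h : 2 * a ≤ n) :
    ((n : ℝ) / 2) ^ a ≤ n.choose a * a.factorial := by
  have h1 := Nat.pow_le_choose (α := ℝ) a n
  have h2 : ((n : ℝ) / 2) ≤ ((n + 1 - a : ℕ) : ℝ) := by
    have : (n : ℝ) ≤ ((2 * (n + 1 - a) : ℕ) : ℝ) := by exact_mod_cast (by omega)
    push_cast at this ⊢
    linarith
  have h3 : ((n : ℝ) / 2) ^ a ≤ ((n + 1 - a : ℕ) : ℝ) ^ a := by gcongr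
  have h4 : (0 : ℝ) < a.factorial := Nat.cast_pos.2 a.factorial_pos
  have h5 := (div_le_iff₀ h4).1 h1
  exact h3.trans h5

theorem expInv_le_of_exponent {n : ℕ} {τ τ' : Perm (Fin n)} {a : ℕ} {M B : ℝ} (h2a : 2 * a ≤ n)
    (hn : 0 < n) (hM : 0 < M) (hMn : M ≤ √n)
    (h : M / √n * cycleCount τ 1 + (M / √n) ^ 2 * cycleCount τ 2 +
      (M / √n) ^ 3 * n ≤ B)
    (h' : M / √n * cycleCount τ' 1 + (M / √n) ^ 2 * cycleCount τ' 2 +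
      (M / √n) ^ 3 * n ≤ B) :
    expInv τ τ' a ≤ Real.exp B ^ 2 * a.factorial * (2 / M ^ 2) ^ a := by
  have hs : 0 < √n := Real.sqrt_pos.2 (by exact_mod_cast hn)
  have hz : 0 < M / √n := by positivity
  have hz1 : M / √n ≤ 1 := (div_le_one hs).2 hMn
  have e1 := (card_invSets_le_exp τ a hz.le hz1).trans (Real.exp_le_exp.2 h)
  have e2 := (card_invSets_le_exp τ' a hz.le hz1).trans (Real.exp_le_exp.2 h')
  have hsq : √n ^ 2 = n := Real.sq_sqrt (by positivity)
  have hch : (0 : ℝ) < n.choose a := by exact_mod_cast Nat.choose_pos (by omega)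
  have h3 := half_pow_le_choose_mul h2a
  have hfa : (0 : ℝ) < a.factorial := Nat.cast_pos.2 a.factorial_pos
  rw [expInv, div_le_iff₀ hch]
  have e3 : (#(invSets τ a) : ℝ) * #(invSets τ' a) * ((M / √n) ^ a * (M / √n) ^ a)
      ≤ Real.exp B ^ 2 := by
    have := mul_le_mul e1 e2 (by positivity) (by positivity)
    calc _ = _ := by ring
      _ ≤ _ := this
      _ = _ := by ring
  have e4 : (M / √n) ^ a * (M / √n) ^ a = (M ^ 2 / n) ^ a := by
    rw [← mul_pow, div_mul_div_comm, ← sq, ← sq, hsq]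
  rw [e4] at e3
  have hnR : (0 : ℝ) < n := Nat.cast_pos.2 hn
  have e5 : (M ^ 2 / n) ^ a * ((n / 2 : ℝ) ^ a * (2 / M ^ 2) ^ a) = 1 := by
    rw [← mul_pow, ← mul_pow, show M ^ 2 / n * (n / 2 * (2 / M ^ 2)) = 1 by field_simp]
    exact one_pow a
  calc (#(invSets τ a) : ℝ) * #(invSets τ' a)
      = #(invSets τ a) * #(invSets τ' a) * (M ^ 2 / n) ^ a * ((n / 2 : ℝ) ^ a * (2 / M ^ 2) ^ a) := by
        rw [mul_assoc _ ((M ^ 2 / n) ^ a), e5, mul_one]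
    _ ≤ Real.exp B ^ 2 * ((n.choose a * a.factorial) * (2 / M ^ 2) ^ a) := by gcongr
    _ = _ := by ring

theorem pr_intrans_small {δ : ℝ} (hδ : 0 < δ) : ∃ η : ℝ, 0 < η ∧ ∀ᶠ n : ℕ in atTop,
    ∀ τ τ' : Perm (Fin n), cycleCount τ 1 ≤ η * √n → cycleCount τ' 1 ≤ η * √n →
      cycleCount τ 2 ≤ η * n → cycleCount τ' 2 ≤ η * n → pr (Intrans τ τ') ≤ δ := by
  obtain ⟨D, hD, htail⟩ := expInv_le_exp (x := 1) (ε := 1 / 4) zero_le_one (by norm_num)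
  obtain ⟨K, hK⟩ := exists_tail_le D (κ := 1 / 4 / 48) (δ := δ / 2) (by norm_num) (by linarith)
  obtain ⟨M, hM1, hM2⟩ : ∃ M : ℝ, 2 ≤ M ∧ 2 * K * (Real.exp 3 ^ 2 * K.factorial * 2) ≤ δ * M := by
    refine ⟨max 2 (2 * K * (Real.exp 3 ^ 2 * K.factorial * 2) / δ), le_max_left _ _, ?_⟩
    rw [← div_le_iff₀' hδ]
    exact le_max_right _ _
  have hM0 : 0 < M := by linarith
  refine ⟨min (1 / 4) (1 / M ^ 2), by positivity, ?_⟩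
  filter_upwards [htail, eventually_ge_atTop (2 * K + 1), eventually_le_natCast (M ^ 6)] with n hn hnK hnM
  intro τ τ' h1 h1' h2 h2'
  have hn0 : (0 : ℝ) < n := Nat.cast_pos.2 (by omega)
  have hs0 : 0 < √n := Real.sqrt_pos.2 hn0
  have hsq : √n ^ 2 = n := Real.sq_sqrt (by positivity)
  have hM3 : M ^ 3 ≤ √n := Real.le_sqrt_of_sq_le (by rw [← pow_mul]; exact hnM)
  have hMn : M ≤ √n := by nlinarith [sq_nonneg M]
  have hmin1 := min_le_left (1 / 4 : ℝ) (1 / M ^ 2)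
  have hmin2 := min_le_right (1 / 4 : ℝ) (1 / M ^ 2)
  generalize min (1 / 4 : ℝ) (1 / M ^ 2) = η at *
  have hexp : ∀ ρ : Perm (Fin n), cycleCount ρ 1 ≤ η * √n → cycleCount ρ 2 ≤ η * n →
      M / √n * cycleCount ρ 1 + (M / √n) ^ 2 * cycleCount ρ 2 +
      (M / √n) ^ 3 * n ≤ 3 := by
    intro ρ h1 h2
    have e1 : M / √n * cycleCount ρ 1 ≤ 1 := by
      calc _ ≤ M / √n * (1 / M ^ 2 * √n) := by
            gcongr; exact h1.trans (by gcongr)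
        _ = 1 / M := by field_simp
        _ ≤ 1 := by rw [div_le_one hM0]; linarith
    have e2 : (M / √n) ^ 2 * cycleCount ρ 2 ≤ 1 := by
      calc _ ≤ (M / √n) ^ 2 * (1 / M ^ 2 * n) := by
            gcongr; exact h2.trans (by gcongr)
        _ = 1 := by rw [div_pow, hsq]; field_simp
    have e3 : (M / √n) ^ 3 * n ≤ 1 := by
      calc _ = M ^ 3 / √n := by
            rw [div_pow, pow_succ (√n), hsq]; field_simp
        _ ≤ 1 := by rw [div_le_one hs0]; exact hM3
    linarith
  have htop : ∀ ρ : Perm (Fin n), (cycleCount ρ 1 : ℝ) ≤ η * √n →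
      (cycleCount ρ 1 : ℝ) ≤ 1 * √n := by
    intro ρ h; exact h.trans (by gcongr; linarith)
  have htop2 : ∀ ρ : Perm (Fin n), (cycleCount ρ 2 : ℝ) ≤ η * n →
      (cycleCount ρ 2 : ℝ) ≤ (1 / 2 - 1 / 4) * n := by
    intro ρ h; exact h.trans (by gcongr; linarith)
  refine (pr_intrans_le τ τ').trans ?_
  rw [← sum_filter_add_sum_filter_not (Icc 1 (n / 2)) (fun a => K < a)]
  have t1 : ∑ a ∈ (Icc 1 (n / 2)).filter (fun a => K < a), expInv τ τ' a ≤ δ / 2 := by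
    refine le_trans (sum_le_sum fun a ha => ?_) (hK _ fun a ha => (mem_filter.1 ha).2)
    rw [mem_filter, mem_Icc] at ha
    exact hn τ τ' (htop _ h1) (htop _ h1') (htop2 _ h2) (htop2 _ h2') a ha.1.1 (by omega)
  have t2 : ∑ a ∈ (Icc 1 (n / 2)).filter (fun a => ¬ K < a), expInv τ τ' a ≤ δ / 2 := by
    have hb : ∀ a ∈ (Icc 1 (n / 2)).filter (fun a => ¬ K < a),
        expInv τ τ' a ≤ Real.exp 3 ^ 2 * K.factorial * 2 / M := by
      intro a ha
      rw [mem_filter, mem_Icc] at ha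
      refine (expInv_le_of_exponent (by omega) (by omega) hM0 hMn (hexp τ h1 h2)
        (hexp τ' h1' h2')).trans ?_
      have : (2 / M ^ 2) ^ a ≤ 2 / M := by
        have h0 : 2 / M ^ 2 ≤ 1 := by rw [div_le_one (by positivity)]; nlinarith
        calc (2 / M ^ 2) ^ a ≤ (2 / M ^ 2) ^ 1 :=
              pow_le_pow_of_le_one (by positivity) h0 ha.1.1
          _ ≤ 2 / M := by
              rw [pow_one]; exact div_le_div_of_nonneg_left (by norm_num) hM0 (by nlinarith)
      have hfac : (a.factorial : ℝ) ≤ K.factorial := by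
        exact_mod_cast Nat.factorial_le (by omega)
      calc _ ≤ Real.exp 3 ^ 2 * K.factorial * (2 / M) := by gcongr
        _ = _ := by ring
    refine (sum_le_card_nsmul _ _ _ hb).trans ?_
    have hc : #((Icc 1 (n / 2)).filter (fun a => ¬ K < a)) ≤ K := by
      calc _ ≤ #(Icc 1 K) := card_le_card fun a ha => by
            rw [mem_filter, mem_Icc] at ha; rw [mem_Icc]; omega
        _ = K := by simp
    rw [nsmul_eq_mul]
    calc _ ≤ (K : ℝ) * (Real.exp 3 ^ 2 * K.factorial * 2 / M) := by gcongr
      _ ≤ δ / 2 := by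
          rw [← mul_div_assoc, div_le_iff₀ hM0]; linarith
  linarith

section LocalLemma

variable {n : ℕ} {ι : Type*} [DecidableEq ι]

theorem pr_insert_ge {A : ι → Perm (Fin n) → Prop} {J : Finset ι} {i : ι} {q : ℝ}
    (h : pr (fun σ => A i σ ∧ ∀ j ∈ J, ¬ A j σ) ≤ q * pr fun σ => ∀ j ∈ J, ¬ A j σ) :
    (1 - q) * (pr fun σ => ∀ j ∈ J, ¬ A j σ) ≤ pr fun σ => ∀ j ∈ insert i J, ¬ A j σ := by
  have h1 : (pr fun σ => ∀ j ∈ J, ¬ A j σ) ≤ (pr fun σ => A i σ ∧ ∀ j ∈ J, ¬ A j σ) +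
      pr fun σ => ∀ j ∈ insert i J, ¬ A j σ := by
    refine le_trans (pr_mono fun σ hσ => ?_) (pr_or_le _ _)
    by_cases hi : A i σ
    · exact Or.inl ⟨hi, hσ⟩
    · refine Or.inr fun j hj => ?_
      rcases mem_insert.1 hj with rfl | hj
      · exact hi
      · exact hσ j hj
  linarith

/-- A lopsided form of the Lovász local lemma. -/
theorem local_lemma {I : Finset ι} {A : ι → Perm (Fin n) → Prop} {R : ι → ι → Prop} [DecidableRel R]
    {p : ι → ℝ} (hp : ∀ i, 0 ≤ p i)
    (hneg : ∀ i ∈ I, ∀ J ⊆ I, (∀ j ∈ J, ¬ R i j) →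
      pr (fun σ => A i σ ∧ ∀ j ∈ J, ¬ A j σ) ≤ p i * pr fun σ => ∀ j ∈ J, ¬ A j σ)
    (hrefl : ∀ i ∈ I, R i i) (hsum : ∀ i ∈ I, ∑ j ∈ I with R i j, p j ≤ 1 / 4) :
    ∏ i ∈ I, (1 - 2 * p i) ≤ pr fun σ => ∀ i ∈ I, ¬ A i σ := by
  have key : ∀ m : ℕ, ∀ J ⊆ I, #J ≤ m → ∀ i ∈ I,
      pr (fun σ => A i σ ∧ ∀ j ∈ J, ¬ A j σ) ≤ 2 * p i * pr fun σ => ∀ j ∈ J, ¬ A j σ := by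
    intro m
    induction m with
    | zero =>
      intro J hJ hm i hi
      have hJ0 : J = ∅ := by rw [← card_eq_zero]; omega
      refine (hneg i hi J hJ (by simp [hJ0])).trans ?_
      have := mul_nonneg (hp i) (pr_nonneg fun σ : Perm (Fin n) => ∀ j ∈ J, ¬ A j σ)
      linarith
    | succ m ih =>
      intro J hJ hm i hi
      have h2 := hneg i hi (J.filter fun j => ¬ R i j) ((filter_subset _ _).trans hJ)
        fun j hj => (mem_filter.1 hj).2
      have h3 : pr (fun σ => A i σ ∧ ∀ j ∈ J, ¬ A j σ) ≤
          pr (fun σ => A i σ ∧ ∀ j ∈ J.filter fun j => ¬ R i j, ¬ A j σ) :=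
        pr_mono fun σ h => ⟨h.1, fun j hj => h.2 j (mem_filter.1 hj).1⟩
      suffices h4 : (pr fun σ => ∀ j ∈ J.filter fun j => ¬ R i j, ¬ A j σ) ≤
          2 * pr fun σ => ∀ j ∈ J, ¬ A j σ by
        calc _ ≤ _ := h3.trans h2
          _ ≤ p i * (2 * pr fun σ => ∀ j ∈ J, ¬ A j σ) := by gcongr; exact hp i
          _ = _ := by ring
      by_cases hne : ∃ j ∈ J, R i j
      · obtain ⟨j₀, hj₀, hR⟩ := hne
        have hlt : #(J.filter fun j => ¬ R i j) < #J :=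
          card_lt_card ((filter_ssubset).2 ⟨j₀, hj₀, by simpa using hR⟩)
        have ih' := ih (J.filter fun j => ¬ R i j) ((filter_subset _ _).trans hJ) (by omega)
        set N := pr fun σ => ∀ j ∈ J.filter fun j => ¬ R i j, ¬ A j σ with hN
        have h5 : N ≤ (pr fun σ => ∃ k ∈ J.filter fun j => R i j, A k σ ∧
            ∀ j ∈ J.filter fun j => ¬ R i j, ¬ A j σ) + pr fun σ => ∀ j ∈ J, ¬ A j σ := by
          refine le_trans (pr_mono fun σ hσ => ?_) (pr_or_le _ _)
          by_cases h : ∀ j ∈ J, ¬ A j σ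
          · exact Or.inr h
          · push Not at h
            obtain ⟨j, hj, hA⟩ := h
            refine Or.inl ⟨j, mem_filter.2 ⟨hj, ?_⟩, hA, hσ⟩
            by_contra hc
            exact hσ j (mem_filter.2 ⟨hj, hc⟩) hA
        have h6 : (pr fun σ => ∃ k ∈ J.filter fun j => R i j, A k σ ∧
            ∀ j ∈ J.filter fun j => ¬ R i j, ¬ A j σ) ≤ 1 / 2 * N := by
          refine (pr_exists_le _ _).trans ?_
          calc _ ≤ ∑ k ∈ J.filter fun j => R i j, 2 * p k * N :=
                sum_le_sum fun k hk => ih' k (hJ (mem_filter.1 hk).1)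
            _ = 2 * N * ∑ k ∈ J.filter fun j => R i j, p k := by
                rw [mul_sum]; exact sum_congr rfl fun _ _ => by ring
            _ ≤ 2 * N * (1 / 4) := by
                have hN0 : 0 ≤ N := pr_nonneg _
                gcongr
                exact (sum_le_sum_of_subset_of_nonneg (filter_subset_filter _ hJ)
                  fun _ _ _ => hp _).trans (hsum i hi)
            _ = _ := by ring
        linarith
      · push Not at hne
        rw [filter_true_of_mem hne]
        have := pr_nonneg fun σ : Perm (Fin n) => ∀ j ∈ J, ¬ A j σ
        linarith
  have hp4 : ∀ i ∈ I, p i ≤ 1 / 4 := fun i hi =>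
    (single_le_sum (fun j _ => hp j) (mem_filter.2 ⟨hi, hrefl i hi⟩)).trans (hsum i hi)
  have main : ∀ J ⊆ I, ∏ i ∈ J, (1 - 2 * p i) ≤ pr fun σ => ∀ i ∈ J, ¬ A i σ := by
    intro J
    induction J using Finset.induction_on with
    | empty =>
      intro _
      have h : (pr fun σ : Perm (Fin n) => ∀ i ∈ (∅ : Finset ι), ¬ A i σ) = 1 := by
        rw [pr_eq_card]
        simp [Fintype.card_perm, Nat.factorial_ne_zero]
      rw [h, prod_empty]
    | insert i J hi ih =>
      intro hJ
      rw [prod_insert hi]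
      have hiI := hJ (mem_insert_self i J)
      have hJI := (subset_insert i J).trans hJ
      refine le_trans ?_ (pr_insert_ge (key (#J) J hJI le_rfl i hiI))
      have := hp4 i hiI
      exact mul_le_mul_of_nonneg_left (ih hJI) (by linarith)
  exact main I subset_rfl

theorem exp_neg_le_prod {I : Finset ι} {p : ι → ℝ} (hp : ∀ i ∈ I, 0 ≤ p i)
    (hp4 : ∀ i ∈ I, p i ≤ 1 / 4) :
    Real.exp (-(4 * ∑ i ∈ I, p i)) ≤ ∏ i ∈ I, (1 - 2 * p i) := by
  rw [mul_sum, ← sum_neg_distrib, Real.exp_sum]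
  refine prod_le_prod (fun i _ => (Real.exp_pos _).le) fun i hi => ?_
  have h0 := hp i hi
  have h1 := hp4 i hi
  rw [Real.exp_neg, inv_le_comm₀ (Real.exp_pos _) (by linarith)]
  have h2 : (1 - 2 * p i)⁻¹ ≤ 1 + 4 * p i := by
    rw [inv_le_iff_one_le_mul₀ (by linarith)]; nlinarith
  exact h2.trans (by linarith [Real.add_one_le_exp (4 * p i)])

theorem exists_perm_image_eq {T U : Finset (Fin n)} (h : #T = #U) :
    ∃ ρ : Perm (Fin n), T.image ρ = U ∧ ∀ x, x ∉ T → x ∉ U → ρ x = x := by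
  have e : {x // x ∈ T} ≃ {x // x ∈ U} := Fintype.equivOfCardEq (by simp [h])
  set f : Fin n → Fin n := fun x => if hx : x ∈ T then e ⟨x, hx⟩ else x with hf
  have hfT : ∀ x (hx : x ∈ T), f x = e ⟨x, hx⟩ := fun x hx => by simp [hf, hx]
  have hfn : ∀ x, x ∉ T → f x = x := fun x hx => by simp [hf, hx]
  have hinj : Set.InjOn f (T ∪ (T ∪ U)ᶜ : Finset (Fin n)) := by
    intro x hx y hy hxy
    simp only [coe_union, Set.mem_union, mem_coe, mem_compl, mem_union, not_or, coe_compl,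
      Set.mem_compl_iff] at hx hy
    by_cases hxT : x ∈ T <;> by_cases hyT : y ∈ T
    · rw [hfT x hxT, hfT y hyT] at hxy
      have := e.injective (Subtype.ext hxy)
      exact congrArg Subtype.val this
    · rw [hfT x hxT, hfn y hyT] at hxy
      have h2 := (e ⟨x, hxT⟩).2
      rw [hxy] at h2
      tauto
    · rw [hfn x hxT, hfT y hyT] at hxy
      have h2 := (e ⟨y, hyT⟩).2
      rw [← hxy] at h2
      tauto
    · rwa [hfn x hxT, hfn y hyT] at hxy
  have hcard := card_perm_extending _ hinj
  have hpos : 0 < #(univ.filter fun σ : Perm (Fin n) => ∀ x ∈ T ∪ (T ∪ U)ᶜ, σ x = f x) := by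
    refine lt_of_lt_of_eq (Nat.factorial_pos _) (hcard.symm.trans ?_)
    congr!
  obtain ⟨ρ, hρ⟩ := card_pos.1 hpos
  simp only [mem_filter, mem_univ, true_and] at hρ
  refine ⟨ρ, ?_, fun x hT hU => ?_⟩
  · refine eq_of_subset_of_card_le ?_ (by rw [card_image_of_injective _ ρ.injective, h])
    intro y hy
    obtain ⟨x, hx, rfl⟩ := mem_image.1 hy
    rw [hρ x (mem_union_left _ hx), hfT x hx]
    exact (e ⟨x, hx⟩).2
  · rw [hρ x (mem_union_right _ (by simp [hT, hU])), hfn x hT]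

theorem pr_image_eq_and_le {S T : Finset (Fin n)} (h : #S = #T) {J : Finset (Finset (Fin n) × Finset (Fin n))}
    (hJ : ∀ j ∈ J, _root_.Disjoint S j.1 ∧ _root_.Disjoint T j.2) :
    (pr fun σ : Perm (Fin n) => S.image σ = T ∧ ∀ j ∈ J, ¬ j.1.image σ = j.2) ≤
      1 / n.choose #S * pr fun σ : Perm (Fin n) => ∀ j ∈ J, ¬ j.1.image σ = j.2 := by
  have hle : #S ≤ n := by simpa using card_le_univ S
  have hch : (0 : ℝ) < n.choose #S := by exact_mod_cast Nat.choose_pos hle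
  rw [div_mul_eq_mul_div, one_mul, le_div_iff₀ hch]
  have h1 : ∀ U ∈ powersetCard #S (univ : Finset (Fin n)),
      #(univ.filter fun σ : Perm (Fin n) => S.image σ = T ∧ ∀ j ∈ J, ¬ j.1.image σ = j.2) ≤
      #(univ.filter fun σ : Perm (Fin n) => S.image σ = U ∧ ∀ j ∈ J, ¬ j.1.image σ = j.2) := by
    intro U hU
    rw [mem_powersetCard] at hU
    obtain ⟨ρ, hρ, hfix⟩ := exists_perm_image_eq (h.symm.trans hU.2.symm)
    refine card_le_card_of_injOn (fun σ => ρ * σ) ?_ fun _ _ _ _ h => mul_left_cancel h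
    intro σ hσ
    simp only [mem_coe, mem_filter, mem_univ, true_and] at hσ ⊢
    have him : ∀ X : Finset (Fin n), X.image (ρ * σ : Perm (Fin n)) = (X.image σ).image ρ := by
      intro X; rw [image_image]; rfl
    have hSU : S.image (ρ * σ : Perm (Fin n)) = U := by rw [him, hσ.1, hρ]
    refine ⟨hSU, fun j hj hjE => hσ.2 j hj ?_⟩
    have hd := hJ j hj
    have hfixT : ∀ y ∈ j.2, ρ y = y := by
      intro y hy
      refine hfix y (fun hyT => disjoint_left.1 hd.2 hyT hy) fun hyU => ?_
      rw [← hSU] at hyU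
      rw [← hjE] at hy
      obtain ⟨a, ha, hay⟩ := mem_image.1 hyU
      obtain ⟨b, hb, hby⟩ := mem_image.1 hy
      have := (ρ * σ).injective (hay.trans hby.symm)
      exact disjoint_left.1 hd.1 ha (this ▸ hb)
    have : (j.1.image σ).image ρ = j.2.image ρ := by
      rw [← him, hjE]
      conv_lhs => rw [← image_id (s := j.2)]
      exact image_congr fun y hy => (hfixT y hy).symm
    exact image_injective ρ.injective this
  have h2 : #(univ.filter fun σ : Perm (Fin n) => S.image σ = T ∧ ∀ j ∈ J, ¬ j.1.image σ = j.2) *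
      n.choose #S ≤ #(univ.filter fun σ : Perm (Fin n) => ∀ j ∈ J, ¬ j.1.image σ = j.2) := by
    calc _ = ∑ U ∈ powersetCard #S (univ : Finset (Fin n)),
          #(univ.filter fun σ : Perm (Fin n) => S.image σ = T ∧ ∀ j ∈ J, ¬ j.1.image σ = j.2) := by
          rw [sum_const, card_powersetCard, card_univ, Fintype.card_fin, smul_eq_mul, mul_comm]
      _ ≤ ∑ U ∈ powersetCard #S (univ : Finset (Fin n)),
          #(univ.filter fun σ : Perm (Fin n) => S.image σ = U ∧ ∀ j ∈ J, ¬ j.1.image σ = j.2) :=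
          sum_le_sum h1
      _ = _ := by
          rw [card_eq_sum_card_fiberwise (f := fun σ : Perm (Fin n) => S.image σ)
            (t := powersetCard #S univ)]
          · refine sum_congr rfl fun U _ => ?_
            rw [filter_filter]
            congr 1
            ext σ
            simp only [mem_filter, mem_univ, true_and, and_comm]
          · intro σ _
            rw [mem_coe, mem_powersetCard]
            exact ⟨subset_univ _, card_image_of_injective _ σ.injective⟩
  rw [pr_eq_card, pr_eq_card, div_mul_eq_mul_div]
  gcongr
  have h3 := (Nat.cast_le (α := ℝ)).2 h2
  rw [Nat.cast_mul] at h3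
  convert h3 <;> rfl

end LocalLemma

variable {n : ℕ}

theorem card_invSets_le_sqrt {τ : Perm (Fin n)} {x : ℝ} (hn : 0 < n)
    (h : cycleCount τ 1 ≤ x * √n) (b : ℕ) :
    (#(invSets τ b) : ℝ) ≤ Real.exp (x + 2) * √n ^ b := by
  have hn0 : (1 : ℝ) ≤ n := by exact_mod_cast hn
  have hs1 : 1 ≤ √n := Real.one_le_sqrt.2 hn0
  have hs0 : 0 < √n := by linarith
  have hsq : √n ^ 2 = n := Real.sq_sqrt (by positivity)
  have h2 : 2 * (cycleCount τ 2 : ℝ) ≤ n := by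
    have := cycleCount_sum_le τ
    exact_mod_cast (by omega : 2 * cycleCount τ 2 ≤ n)
  have h1 := card_invSets_le_exp τ b (z := 1 / √n) (by positivity)
    (by rw [div_le_one hs0]; exact hs1)
  have e1 : 1 / √n * cycleCount τ 1 ≤ x := by
    rw [div_mul_eq_mul_div, one_mul, div_le_iff₀ hs0]; exact h
  have e2 : (1 / √n) ^ 2 * cycleCount τ 2 ≤ 1 := by
    rw [div_pow, hsq, one_pow, div_mul_eq_mul_div, one_mul, div_le_one (by linarith)]; linarith
  have e3 : (1 / √n) ^ 3 * n ≤ 1 := by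
    rw [div_pow, pow_succ (√n), hsq, one_pow, div_mul_eq_mul_div, one_mul, div_le_one (by positivity)]
    nlinarith
  have h3 := h1.trans (Real.exp_le_exp.2 (show _ ≤ x + 2 by linarith))
  rw [div_pow, one_pow, mul_one_div, div_le_iff₀ (by positivity)] at h3
  exact h3

theorem card_invSets_through_le (τ : Perm (Fin n)) (a : ℕ) (s : Fin n) :
    #((invSets τ a).filter fun S => s ∈ S) ≤ ∑ b ∈ range a, #(invSets τ b) := by
  refine le_trans ?_ card_biUnion_le
  have hsub : ∀ S ∈ invSets τ a, s ∈ S → cycPts τ (cyc τ s) ⊆ S := by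
    intro S hS hs y hy
    rw [mem_invSets] at hS
    exact (iff_of_cyc_eq (P := fun x => x ∈ S) hS.2 (mem_cycPts.1 hy)).2 hs
  refine card_le_card_of_injOn (fun S => S \ cycPts τ (cyc τ s)) ?_ ?_
  · intro S hS
    rw [mem_coe, mem_filter] at hS
    have hS' := mem_invSets.1 hS.1
    rw [mem_coe, mem_biUnion]
    refine ⟨_, ?_, mem_invSets.2 ⟨rfl, ?_⟩⟩
    · rw [mem_range, ← hS'.1]
      refine card_lt_card ((ssubset_iff_of_subset sdiff_subset).2 ⟨s, hS.2, ?_⟩)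
      simp [mem_cycPts]
    · intro y hy
      rw [Finset.mem_sdiff] at hy ⊢
      refine ⟨hS'.2 y hy.1, fun h => hy.2 ?_⟩
      rw [mem_cycPts, cyc_apply] at h
      exact mem_cycPts.2 h
  · intro S hS S' hS' h
    rw [mem_coe, mem_filter] at hS hS'
    rw [← sdiff_union_of_subset (hsub S hS.1 hS.2), ← sdiff_union_of_subset (hsub S' hS'.1 hS'.2)]
    exact congrArg (fun X => X ∪ cycPts τ (cyc τ s)) h

theorem card_through_le_sqrt {τ : Perm (Fin n)} {x : ℝ} (hn : 0 < n)
    (h : cycleCount τ 1 ≤ x * √n) {a : ℕ} (ha : 1 ≤ a) (s : Fin n) :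
    (#((invSets τ a).filter fun S => s ∈ S) : ℝ) * √n ≤
      a * Real.exp (x + 2) * √n ^ a := by
  have hs1 : 1 ≤ √n := Real.one_le_sqrt.2 (by exact_mod_cast hn)
  have h1 : (#((invSets τ a).filter fun S => s ∈ S) : ℝ) ≤
      a * (Real.exp (x + 2) * √n ^ (a - 1)) := by
    calc _ ≤ ((∑ b ∈ range a, #(invSets τ b) : ℕ) : ℝ) := by
          exact_mod_cast card_invSets_through_le τ a s
      _ = ∑ b ∈ range a, (#(invSets τ b) : ℝ) := by push_cast; rfl
      _ ≤ ∑ b ∈ range a, Real.exp (x + 2) * √n ^ (a - 1) := by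
          refine sum_le_sum fun b hb => (card_invSets_le_sqrt hn h b).trans ?_
          rw [mem_range] at hb
          gcongr
          omega
      _ = _ := by rw [sum_const, card_range, nsmul_eq_mul]
  calc _ ≤ a * (Real.exp (x + 2) * √n ^ (a - 1)) * √n := by gcongr
    _ = a * Real.exp (x + 2) * (√n ^ (a - 1) * √n) := by ring
    _ = _ := by rw [← pow_succ, Nat.sub_add_cancel ha]

/-- The pairs of invariant sets of equal size between `1` and `K`. -/
noncomputable def invPairs (τ τ' : Perm (Fin n)) (K : ℕ) : Finset (Finset (Fin n) × Finset (Fin n)) :=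
  (Icc 1 K).biUnion fun a => invSets τ a ×ˢ invSets τ' a

theorem mem_invPairs {τ τ' : Perm (Fin n)} {K : ℕ} {j : Finset (Fin n) × Finset (Fin n)} :
    j ∈ invPairs τ τ' K ↔ (1 ≤ #j.1 ∧ #j.1 ≤ K) ∧ #j.1 = #j.2 ∧ (∀ x ∈ j.1, τ x ∈ j.1) ∧
      ∀ x ∈ j.2, τ' x ∈ j.2 := by
  simp only [invPairs, mem_biUnion, mem_Icc, mem_product, mem_invSets]
  constructor
  · rintro ⟨a, ha, h1, h2⟩
    exact ⟨by rw [h1.1]; exact ha, by rw [h1.1, h2.1], h1.2, h2.2⟩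
  · rintro ⟨h1, h2, h3, h4⟩
    exact ⟨_, h1, ⟨rfl, h3⟩, h2.symm, h4⟩

theorem sum_invPairs_filter (τ τ' : Perm (Fin n)) (K : ℕ)
    (Q : Finset (Fin n) × Finset (Fin n) → Prop) [DecidablePred Q] :
    ∑ j ∈ invPairs τ τ' K with Q j, (1 : ℝ) / n.choose #j.1 =
      ∑ a ∈ Icc 1 K, (#((invSets τ a ×ˢ invSets τ' a).filter Q) : ℝ) / n.choose a := by
  rw [invPairs, filter_biUnion, sum_biUnion]
  · refine sum_congr rfl fun a _ => ?_
    rw [sum_congr rfl fun j hj => ?_, sum_const, nsmul_eq_mul, mul_one_div]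
    rw [mem_filter, mem_product, mem_invSets] at hj
    rw [hj.1.1.1]
  · intro a _ b _ hab
    rw [Function.onFun, disjoint_left]
    intro j hj hj'
    rw [mem_filter, mem_product, mem_invSets] at hj hj'
    exact hab (hj.1.1.1.symm.trans hj'.1.1.1)

theorem one_sub_pr_intrans_ge {τ τ' : Perm (Fin n)} {K : ℕ}
    (hnbr : ∀ i ∈ invPairs τ τ' K, ∑ j ∈ invPairs τ τ' K with
      (¬ _root_.Disjoint i.1 j.1 ∨ ¬ _root_.Disjoint i.2 j.2), (1 : ℝ) / n.choose #j.1 ≤ 1 / 4) :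
    Real.exp (-(4 * ∑ a ∈ Icc 1 K, expInv τ τ' a)) -
      ∑ a ∈ (Icc 1 (n / 2)).filter (fun a => K < a), expInv τ τ' a ≤ 1 - pr (Intrans τ τ') := by
  classical
  set p : Finset (Fin n) × Finset (Fin n) → ℝ := fun j => 1 / n.choose #j.1 with hp
  have hp0 : ∀ j, 0 ≤ p j := fun j => by positivity
  have hrefl : ∀ i ∈ invPairs τ τ' K, ¬ _root_.Disjoint i.1 i.1 ∨ ¬ _root_.Disjoint i.2 i.2 := by
    intro i hi
    rw [mem_invPairs] at hi
    left
    rw [disjoint_self_iff_empty, ← card_eq_zero]; omega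
  have hLLL := local_lemma (I := invPairs τ τ' K)
    (A := fun j (σ : Perm (Fin n)) => j.1.image σ = j.2)
    (R := fun i j => ¬ _root_.Disjoint i.1 j.1 ∨ ¬ _root_.Disjoint i.2 j.2) (p := p) hp0
    (by
      intro i hi J _ hR
      refine pr_image_eq_and_le (mem_invPairs.1 hi).2.1 fun j hj => ?_
      have := hR j hj
      tauto)
    hrefl hnbr
  have hexp := exp_neg_le_prod (I := invPairs τ τ' K) (p := p) (fun j _ => hp0 j) fun i hi =>
    (single_le_sum (fun j _ => hp0 j) (mem_filter.2 ⟨hi, hrefl i hi⟩)).trans (hnbr i hi)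
  have hsum : ∑ i ∈ invPairs τ τ' K, p i = ∑ a ∈ Icc 1 K, expInv τ τ' a := by
    have := sum_invPairs_filter τ τ' K fun _ => True
    simp only [filter_true, card_product, Nat.cast_mul] at this
    exact this
  rw [hsum] at hexp
  have htail : (pr fun σ => ∃ a ∈ (Icc 1 (n / 2)).filter (fun a => K < a),
      ∃ Y : Finset (Fin n), #Y = a ∧ Inv τ τ' σ Y) ≤
      ∑ a ∈ (Icc 1 (n / 2)).filter (fun a => K < a), expInv τ τ' a :=
    (pr_exists_le _ _).trans (sum_le_sum fun a _ => pr_exists_inv_le τ τ' a)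
  have hcov : pr (Intrans τ τ') ≤
      (pr fun σ => ¬ ∀ i ∈ invPairs τ τ' K, ¬ i.1.image σ = i.2) +
      pr fun σ => ∃ a ∈ (Icc 1 (n / 2)).filter (fun a => K < a),
      ∃ Y : Finset (Fin n), #Y = a ∧ Inv τ τ' σ Y := by
    refine le_trans (pr_mono fun σ hσ => ?_) (pr_or_le _ _)
    obtain ⟨a, ha, Y, hYa, hY⟩ := hσ.exists_card
    by_cases haK : K < a
    · exact Or.inr ⟨a, mem_filter.2 ⟨ha, haK⟩, Y, hYa, hY⟩
    · left
      push Not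
      refine ⟨(Y.image (σ⁻¹ : Perm (Fin n)), Y), mem_invPairs.2 ⟨?_, ?_, ?_, fun y hy => (hY y hy).2⟩, ?_⟩
      · rw [card_image_of_injective _ (Equiv.injective _), hYa]
        rw [mem_Icc] at ha; omega
      · exact card_image_of_injective _ (Equiv.injective _)
      · intro x hx
        obtain ⟨y, hy, rfl⟩ := mem_image.1 hx
        refine mem_image.2 ⟨_, (hY y hy).1, ?_⟩
        simp
      · rw [image_image]
        have : ((σ : Fin n → Fin n) ∘ (σ⁻¹ : Perm (Fin n))) = id := by
          ext x
          simp
        rw [this, image_id]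
  rw [pr_not] at hcov
  linarith

theorem card_neighbours_le {τ τ' : Perm (Fin n)} {x : ℝ} (hn : 0 < n)
    (h : cycleCount τ 1 ≤ x * √n) (h' : cycleCount τ' 1 ≤ x * √n)
    {K a : ℕ} (ha : 1 ≤ a) {S T : Finset (Fin n)} (hS : #S ≤ K) (hT : #T ≤ K) :
    (#((invSets τ a ×ˢ invSets τ' a).filter fun j =>
      ¬ _root_.Disjoint S j.1 ∨ ¬ _root_.Disjoint T j.2) : ℝ) * √n ≤
      2 * K * (a * Real.exp (x + 2) ^ 2 * n ^ a) := by
  classical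
  have hsub : ((invSets τ a ×ˢ invSets τ' a).filter fun j =>
      ¬ _root_.Disjoint S j.1 ∨ ¬ _root_.Disjoint T j.2) ⊆
      (S.biUnion fun s => ((invSets τ a).filter fun X => s ∈ X) ×ˢ invSets τ' a) ∪
      (T.biUnion fun t => invSets τ a ×ˢ ((invSets τ' a).filter fun X => t ∈ X)) := by
    intro j hj
    rw [mem_filter, mem_product] at hj
    obtain ⟨⟨h1, h2⟩, h3 | h3⟩ := hj
    · obtain ⟨s, hs, hs'⟩ := not_disjoint_iff.1 h3
      exact mem_union_left _ (mem_biUnion.2 ⟨s, hs, mem_product.2 ⟨mem_filter.2 ⟨h1, hs'⟩, h2⟩⟩)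
    · obtain ⟨s, hs, hs'⟩ := not_disjoint_iff.1 h3
      exact mem_union_right _ (mem_biUnion.2 ⟨s, hs, mem_product.2 ⟨h1, mem_filter.2 ⟨h2, hs'⟩⟩⟩)
  have hc := (card_le_card hsub).trans ((card_union_le _ _).trans
    (add_le_add card_biUnion_le card_biUnion_le))
  simp only [card_product] at hc
  have hsq : √n ^ a * √n ^ a = (n : ℝ) ^ a := by
    rw [← mul_pow, Real.mul_self_sqrt (by positivity)]
  have hmul : ∀ y z : ℝ, 0 ≤ z → y * √n ≤ a * Real.exp (x + 2) * √n ^ a →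
      z ≤ Real.exp (x + 2) * √n ^ a → y * z * √n ≤ a * Real.exp (x + 2) ^ 2 * n ^ a := by
    intro y z hz hy hz'
    rw [← hsq]
    calc _ = y * √n * z := by ring
      _ ≤ _ := mul_le_mul hy hz' hz (by positivity)
      _ = _ := by ring
  have hcR := (Nat.cast_le (α := ℝ)).2 hc
  push_cast at hcR
  calc _ ≤ (∑ s ∈ S, (#((invSets τ a).filter fun X => s ∈ X) : ℝ) * #(invSets τ' a) +
        ∑ s ∈ T, (#(invSets τ a) : ℝ) * #((invSets τ' a).filter fun X => s ∈ X)) * √n := by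
        gcongr
    _ ≤ ∑ s ∈ S, (a * Real.exp (x + 2) ^ 2 * n ^ a : ℝ) +
        ∑ s ∈ T, (a * Real.exp (x + 2) ^ 2 * n ^ a : ℝ) := by
        rw [add_mul, sum_mul, sum_mul]
        exact add_le_add
          (sum_le_sum fun s _ => hmul _ _ (by positivity) (card_through_le_sqrt hn h ha s)
            (card_invSets_le_sqrt hn h' a))
          (sum_le_sum fun s _ => by
            rw [mul_comm (#(invSets τ a) : ℝ)]
            exact hmul _ _ (by positivity) (card_through_le_sqrt hn h' ha s)
              (card_invSets_le_sqrt hn h a))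
    _ ≤ K * (a * Real.exp (x + 2) ^ 2 * n ^ a) + K * (a * Real.exp (x + 2) ^ 2 * n ^ a) := by
        rw [sum_const, sum_const, nsmul_eq_mul, nsmul_eq_mul]
        gcongr
    _ = _ := by ring

theorem pr_intrans_le_one_sub {x ε : ℝ} (hx : 0 ≤ x) (hε : 0 < ε) : ∃ c : ℝ, 0 < c ∧
    ∀ᶠ n : ℕ in atTop, ∀ τ τ' : Perm (Fin n),
      cycleCount τ 1 ≤ x * √n → cycleCount τ' 1 ≤ x * √n →
      cycleCount τ 2 ≤ (1 / 2 - ε) * n → cycleCount τ' 2 ≤ (1 / 2 - ε) * n →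
      pr (Intrans τ τ') ≤ 1 - c := by
  obtain ⟨D, hD, htail⟩ := expInv_le_exp hx hε
  have hκ : 0 < ε / 48 := by positivity
  obtain ⟨K₁, hK₁⟩ := exists_tail_le D hκ zero_lt_one
  set Λ : ℝ := 1 + (K₁ + 1) * D with hΛ
  have hc : 0 < Real.exp (-(4 * Λ)) / 2 := by positivity
  obtain ⟨K, hK⟩ := exists_tail_le D hκ hc
  refine ⟨_, hc, ?_⟩
  set Q : ℝ := K * (2 * K * (K * Real.exp (x + 2) ^ 2 * (2 ^ K * K.factorial))) with hQ
  filter_upwards [htail, eventually_ge_atTop (2 * K + 1),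
    (Real.tendsto_sqrt_atTop.comp
      (tendsto_natCast_atTop_atTop (R := ℝ))).eventually_ge_atTop (4 * Q)] with n hn hnK hnQ
  intro τ τ' h1 h1' h2 h2'
  have hn0 : 0 < n := by omega
  have hnR : (0 : ℝ) < n := Nat.cast_pos.2 hn0
  have hs : 0 < √n := Real.sqrt_pos.2 hnR
  simp only [Function.comp] at hnQ
  have hexp := hn τ τ' h1 h1' h2 h2'
  have key := one_sub_pr_intrans_ge (τ := τ) (τ' := τ') (K := K) (by
    intro i hi
    rw [mem_invPairs] at hi
    classical
    rw [sum_invPairs_filter]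
    have hterm : ∀ a ∈ Icc 1 K, (#((invSets τ a ×ˢ invSets τ' a).filter fun j =>
        ¬ _root_.Disjoint i.1 j.1 ∨ ¬ _root_.Disjoint i.2 j.2) : ℝ) / n.choose a ≤
        2 * K * (K * Real.exp (x + 2) ^ 2 * (2 ^ K * K.factorial)) / √n := by
      intro a ha
      rw [mem_Icc] at ha
      have hb := card_neighbours_le (K := K) hn0 h1 h1' ha.1 (S := i.1) (T := i.2) hi.1.2
        (by rw [← hi.2.1]; exact hi.1.2)
      have hch : (0 : ℝ) < n.choose a := by exact_mod_cast Nat.choose_pos (by omega)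
      rw [div_le_div_iff₀ hch hs]
      refine hb.trans ?_
      have h3 := half_pow_le_choose_mul (show 2 * a ≤ n by omega)
      rw [div_pow, div_le_iff₀ (by positivity)] at h3
      have h4 : (a : ℝ) ≤ K := by exact_mod_cast ha.2
      have h5 : (a.factorial : ℝ) ≤ K.factorial := by exact_mod_cast Nat.factorial_le ha.2
      have h6 : (2 : ℝ) ^ a ≤ 2 ^ K := pow_le_pow_right₀ (by norm_num) ha.2
      calc _ ≤ 2 * K * (K * Real.exp (x + 2) ^ 2 * (n.choose a * K.factorial * 2 ^ K)) := by
            gcongr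
            refine h3.trans ?_
            gcongr
        _ = _ := by ring
    refine (sum_le_sum hterm).trans ?_
    rw [sum_const, Nat.card_Icc, nsmul_eq_mul, Nat.add_sub_cancel, ← mul_div_assoc,
      div_le_iff₀ hs]
    linarith)
  have hΛle : ∑ a ∈ Icc 1 K, expInv τ τ' a ≤ Λ := by
    have hD' : ∀ a ∈ Icc 1 K, expInv τ τ' a ≤ D * Real.exp (-(ε / 48 * a)) := fun a ha => by
      rw [mem_Icc] at ha
      exact hexp a ha.1 (by omega)
    refine (sum_le_sum hD').trans ?_
    rw [← sum_filter_add_sum_filter_not (Icc 1 K) (fun a => K₁ < a)]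
    refine add_le_add (hK₁ _ fun a ha => (mem_filter.1 ha).2) ?_
    refine (sum_le_card_nsmul _ _ D fun a _ => ?_).trans ?_
    · have : Real.exp (-(ε / 48 * a)) ≤ 1 := Real.exp_le_one_iff.2 (by
        have : 0 ≤ ε / 48 * (a : ℝ) := by positivity
        linarith)
      nlinarith
    · rw [nsmul_eq_mul]
      gcongr
      have : #((Icc 1 K).filter fun a => ¬ K₁ < a) ≤ K₁ + 1 := by
        calc _ ≤ #(range (K₁ + 1)) := card_le_card fun a ha => by
              rw [mem_filter] at ha; rw [mem_range]; omega
          _ = _ := card_range _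
      exact_mod_cast this
  have ht : ∑ a ∈ (Icc 1 (n / 2)).filter (fun a => K < a), expInv τ τ' a ≤
      Real.exp (-(4 * Λ)) / 2 := by
    refine (sum_le_sum fun a ha => ?_).trans (hK _ fun a ha => (mem_filter.1 ha).2)
    rw [mem_filter, mem_Icc] at ha
    exact hexp a ha.1.1 (by omega)
  have hlast : Real.exp (-(4 * Λ)) ≤ Real.exp (-(4 * ∑ a ∈ Icc 1 K, expInv τ τ' a)) :=
    Real.exp_le_exp.2 (by linarith)
  linarith

end RandGen

namespace RandGen

open Equiv Equiv.Perm Finset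
open scoped Pointwise

section Blocks

variable {n : ℕ}

theorem exists_blockMap {G : Subgroup (Perm (Fin n))} (hT : MulAction.IsPretransitive G (Fin n))
    (hP : ¬ MulAction.IsPreprimitive G (Fin n)) :
    ∃ (a b : ℕ) (f : Fin n → Fin b), 2 ≤ a ∧ 2 ≤ b ∧ (∀ i, #(univ.filter fun x => f x = i) = a) ∧
      ∀ g ∈ G, ∃ ρ : Perm (Fin b), ∀ y, f (g y) = ρ (f y) := by
  classical
  obtain ⟨B, hB, hBt⟩ : ∃ B : Set (Fin n), MulAction.IsBlock G B ∧
      ¬ MulAction.IsTrivialBlock B := by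
    by_contra! hcon
    exact hP { isTrivialBlock_of_isBlock := fun {B} hB => hcon B hB }
  rw [MulAction.IsTrivialBlock, not_or] at hBt
  obtain ⟨hsub, huniv⟩ := hBt
  rw [Set.not_subsingleton_iff] at hsub
  obtain ⟨x₀, hx₀⟩ := hsub.nonempty
  have hex : ∀ x : Fin n, ∃ g : G, g • x₀ = x := fun x => MulAction.exists_smul_eq G x₀ x
  choose γ hγ using hex
  set f₀ : Fin n → MulAction.orbit G B := fun x => ⟨γ x • B, MulAction.mem_orbit _ _⟩ with hf₀
  have hmem : ∀ x, x ∈ (f₀ x : Set (Fin n)) := fun x => by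
    have := Set.smul_mem_smul_set (a := γ x) hx₀
    rwa [hγ] at this
  have huniq : ∀ (s t : MulAction.orbit G B) (x : Fin n), x ∈ (s : Set (Fin n)) →
      x ∈ (t : Set (Fin n)) → s = t := by
    rintro ⟨_, g, rfl⟩ ⟨_, h, rfl⟩ x hs ht
    refine Subtype.ext ?_
    by_contra hne
    have := hB hne
    exact Set.disjoint_left.1 this hs ht
  have hfib : ∀ t : MulAction.orbit G B, ∀ x, f₀ x = t ↔ x ∈ (t : Set (Fin n)) := fun t x =>
    ⟨fun h => h ▸ hmem x, fun h => huniq _ _ x (hmem x) h⟩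
  haveI : Fintype (MulAction.orbit G B) := Fintype.ofFinite _
  set e := Fintype.equivFin (MulAction.orbit G B)
  have hcard : ∀ t : MulAction.orbit G B, (t : Set (Fin n)).ncard = B.ncard := by
    rintro ⟨_, g, rfl⟩
    exact Set.ncard_image_of_injective B (MulAction.injective g)
  refine ⟨B.ncard, _, fun x => e (f₀ x), ?_, ?_, ?_, ?_⟩
  · have := (Set.one_lt_ncard_iff_nontrivial (s := B)).2 hsub
    omega
  · have hne : ∃ y, y ∉ B := by
      by_contra! hcon
      exact huniv (Set.eq_univ_of_forall hcon)
    obtain ⟨y, hy⟩ := hne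
    have h1 : f₀ x₀ = ⟨B, MulAction.mem_orbit_self B⟩ := (hfib _ _).2 hx₀
    have : Nontrivial (MulAction.orbit G B) := ⟨f₀ y, f₀ x₀, fun h => hy (by
      have := hmem y
      rw [h, h1] at this
      exact this)⟩
    exact Fintype.one_lt_card
  · intro i
    obtain ⟨t, rfl⟩ := e.surjective i
    rw [← hcard t, Set.ncard_eq_toFinset_card']
    congr 1
    ext x
    simp [hfib]
  · intro g hg
    refine ⟨(e.symm.trans (MulAction.toPerm (⟨g, hg⟩ : G))).trans e, fun y => ?_⟩
    simp only [Equiv.trans_apply, Equiv.symm_apply_apply, MulAction.toPerm_apply,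
      EmbeddingLike.apply_eq_iff_eq]
    rw [hfib]
    exact Set.smul_mem_smul_set (a := (⟨g, hg⟩ : G)) (hmem y)

theorem card_colourings_le {b : ℕ} (τ : Perm (Fin n)) (ρ : Perm (Fin b)) :
    #(univ.filter fun f : Fin n → Fin b => ∀ x, f (τ x) = ρ (f x)) ≤ b ^ Fintype.card (Cyc τ) := by
  classical
  choose r hr using cyc_surj τ
  have e : b ^ Fintype.card (Cyc τ) = #(univ : Finset (Cyc τ → Fin b)) := by simp
  rw [e]
  refine card_le_card_of_injOn (fun f c => f (r c)) (fun _ _ => mem_univ _) ?_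
  intro f hf f' hf' h
  simp only [mem_coe, mem_filter, mem_univ, true_and] at hf hf'
  funext x
  refine (iff_of_cyc_eq (P := fun x => f x = f' x) (fun y hy => ?_) (hr (cyc τ x))).1
    (congrFun h (cyc τ x))
  rw [hf, hf', hy]

theorem card_comp_eq_le {a b : ℕ} {f f' : Fin n → Fin b}
    (hf : ∀ i, #(univ.filter fun x => f x = i) = a) :
    #(univ.filter fun σ : Perm (Fin n) => ∀ x, f (σ x) = f' x) ≤ a.factorial ^ b := by
  classical
  have h := DomMulAct.stabilizer_card f
  have h1 : ∀ i, Fintype.card {x // f x = i} = a := fun i => by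
    rw [Fintype.card_subtype]; exact hf i
  simp only [h1, prod_const, card_univ, Fintype.card_fin] at h
  rw [← h, Fintype.card_subtype]
  by_cases hne : ∃ σ₀ : Perm (Fin n), ∀ x, f (σ₀ x) = f' x
  · obtain ⟨σ₀, h₀⟩ := hne
    refine card_le_card_of_injOn (fun σ => σ * σ₀⁻¹) ?_ fun _ _ _ _ h => mul_right_cancel h
    intro σ hσ
    simp only [mem_coe, mem_filter, mem_univ, true_and] at hσ ⊢
    funext x
    have := h₀ (σ₀⁻¹ x)
    rw [show σ₀ (σ₀⁻¹ x) = x from σ₀.apply_symm_apply x] at this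
    rw [Function.comp, Perm.mul_apply, hσ, ← this]
  · rw [filter_false_of_mem fun σ _ h => hne ⟨σ, h⟩]
    simp

/-- The group generated by `σ τ σ⁻¹` and `τ'` permutes the fibres of a map to `b` labels, with
all fibres of size `a`. -/
def HasBlocks (τ τ' : Perm (Fin n)) (a b : ℕ) (σ : Perm (Fin n)) : Prop :=
  ∃ (f : Fin n → Fin b) (ρ ρ' : Perm (Fin b)), (∀ i, #(univ.filter fun x => f x = i) = a) ∧
    (∀ y, f (σ (τ (σ⁻¹ y))) = ρ (f y)) ∧ ∀ y, f (τ' y) = ρ' (f y)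

theorem pr_hasBlocks_le (τ τ' : Perm (Fin n)) (a b : ℕ) :
    pr (HasBlocks τ τ' a b) ≤ (b.factorial : ℝ) ^ 2 *
      (b ^ Fintype.card (Cyc τ) * b ^ Fintype.card (Cyc τ')) * a.factorial ^ b / n.factorial := by
  classical
  set I : Finset (Perm (Fin b) × Perm (Fin b)) := univ
  set F : Perm (Fin b) × Perm (Fin b) → Finset ((Fin n → Fin b) × (Fin n → Fin b)) := fun r =>
    (univ.filter fun f : Fin n → Fin b => ∀ x, f (τ x) = r.1 (f x)) ×ˢ
      (univ.filter fun f : Fin n → Fin b => ∀ x, f (τ' x) = r.2 (f x))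
  have h1 : pr (HasBlocks τ τ' a b) ≤ pr fun σ => ∃ r ∈ I, ∃ f ∈ F r,
      (∀ i, #(univ.filter fun x => f.2 x = i) = a) ∧ ∀ x, f.2 (σ x) = f.1 x := by
    refine pr_mono fun σ h => ?_
    obtain ⟨f, ρ, ρ', hf, h, h'⟩ := h
    refine ⟨(ρ, ρ'), mem_univ _, (f ∘ σ, f), ?_, hf, fun x => rfl⟩
    simp only [F, mem_product, mem_filter, mem_univ, true_and, Function.comp]
    refine ⟨fun x => ?_, h'⟩
    have := h (σ x)
    rwa [show σ⁻¹ (σ x) = x from σ.symm_apply_apply x] at this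
  have h2 : ∀ r ∈ I, ∀ f ∈ F r, (pr fun σ => (∀ i, #(univ.filter fun x => f.2 x = i) = a) ∧
      ∀ x, f.2 (σ x) = f.1 x) ≤ (a.factorial : ℝ) ^ b / n.factorial := by
    intro r _ f _
    by_cases hf : ∀ i, #(univ.filter fun x => f.2 x = i) = a
    · rw [pr_eq_card]
      gcongr
      have := card_comp_eq_le (f' := f.1) hf
      refine le_trans (Nat.cast_le.2 ?_) (le_of_eq (Nat.cast_pow _ _))
      refine le_trans (card_le_card fun σ hσ => ?_) this
      simp only [mem_filter, mem_univ, true_and] at hσ ⊢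
      exact hσ.2
    · have : (pr fun σ => (∀ i, #(univ.filter fun x => f.2 x = i) = a) ∧
          ∀ x, f.2 (σ x) = f.1 x) ≤ 0 := by
        rw [pr_eq_card]
        simp [hf]
      exact this.trans (by positivity)
  have h3 : ∀ r ∈ I, (#(F r) : ℝ) ≤ (b ^ Fintype.card (Cyc τ) * b ^ Fintype.card (Cyc τ') : ℝ) := by
    intro r _
    have : #(F r) ≤ b ^ Fintype.card (Cyc τ) * b ^ Fintype.card (Cyc τ') := by
      rw [card_product]
      exact Nat.mul_le_mul (card_colourings_le τ r.1) (card_colourings_le τ' r.2)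
    exact_mod_cast this
  refine h1.trans ((pr_exists_le _ _).trans ?_)
  calc _ ≤ ∑ r ∈ I, (b ^ Fintype.card (Cyc τ) * b ^ Fintype.card (Cyc τ') : ℝ) *
        ((a.factorial : ℝ) ^ b / n.factorial) := by
        refine sum_le_sum fun r hr => (pr_exists_le _ _).trans ?_
        refine (sum_le_card_nsmul _ _ _ (h2 r hr)).trans ?_
        rw [nsmul_eq_mul]
        gcongr
        exact h3 r hr
    _ = _ := by
        rw [sum_const, nsmul_eq_mul]
        simp only [I, card_univ, Fintype.card_prod, Fintype.card_perm, Fintype.card_fin]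
        push_cast
        ring

end Blocks

end RandGen

namespace RandGen

open Equiv Equiv.Perm Finset

variable {n : ℕ}

theorem card_cyc_le (τ : Perm (Fin n)) :
    3 * Fintype.card (Cyc τ) ≤ n + 2 * cycleCount τ 1 + cycleCount τ 2 := by
  have h := prod_cyc_le τ (F := fun _ => 64) (b₁ := 64) (b₂ := 8) (b₃ := 4) (by norm_num)
    le_rfl (by norm_num) (fun m hm => by
      calc (64 : ℝ) = 4 ^ 3 := by norm_num
        _ ≤ 4 ^ m := pow_le_pow_right₀ (by norm_num) hm)
  rw [prod_const, card_univ] at h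
  have h2 : 2 ^ (6 * Fintype.card (Cyc τ)) ≤ 2 ^ (6 * cycleCount τ 1 + 6 * cycleCount τ 2 +
      2 * (n - cycleCount τ 1 - 2 * cycleCount τ 2)) := by
    have : (2 : ℝ) ^ (6 * Fintype.card (Cyc τ)) ≤ 2 ^ (6 * cycleCount τ 1 + 6 * cycleCount τ 2 +
        2 * (n - cycleCount τ 1 - 2 * cycleCount τ 2)) := by
      rw [pow_add, pow_add, pow_mul, pow_mul, pow_mul, pow_mul]
      norm_num at h ⊢
      exact h
    exact_mod_cast this
  have h3 := (Nat.pow_le_pow_iff_right (by norm_num)).1 h2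
  have := cycleCount_sum_le τ
  omega

theorem factorial_pow_div_le {a b : ℕ} (ha : 0 < a) (hb : 0 < b) :
    (a.factorial : ℝ) ^ b / (a * b).factorial ≤
      Real.exp (b * √a - (a * b : ℕ) * Real.log b) := by
  have h1 := factorial_le_sqrt ha.ne'
  have h2 := le_factorial_sqrt (a * b)
  have haR : (0 : ℝ) < a := Nat.cast_pos.2 ha
  have hbR : (0 : ℝ) < b := Nat.cast_pos.2 hb
  have hs : 1 ≤ √((a * b : ℕ) : ℝ) :=
    Real.one_le_sqrt.2 (by exact_mod_cast Nat.mul_pos ha hb)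
  have h3 : Real.exp 1 * √a ≤ Real.exp (√a) := by
    have := Real.add_one_le_exp (√a - 1)
    calc _ ≤ Real.exp 1 * Real.exp (√a - 1) := by gcongr; linarith
      _ = _ := by rw [← Real.exp_add]; congr 1; ring
  have h4 : (a.factorial : ℝ) ^ b ≤ Real.exp (b * √a) * (a / Real.exp 1) ^ (a * b) := by
    rw [Real.exp_nat_mul, pow_mul, ← mul_pow]
    gcongr
    exact h1.trans (by gcongr)
  have h5 : (((a * b : ℕ) : ℝ) / Real.exp 1) ^ (a * b) ≤ (a * b).factorial :=
    le_trans (le_mul_of_one_le_left (by positivity) hs) h2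
  rw [div_le_iff₀ (by positivity)]
  refine h4.trans ?_
  rw [Real.exp_sub, Real.exp_nat_mul, Real.exp_nat_mul (Real.log b), Real.exp_log hbR, div_mul_eq_mul_div,
    le_div_iff₀ (by positivity), mul_assoc]
  gcongr
  refine le_trans (le_of_eq ?_) h5
  rw [← mul_pow]
  congr 1
  push_cast
  ring

theorem pr_hasBlocks_le_exp {τ τ' : Perm (Fin n)} {a b : ℕ} {x ε A : ℝ} (hε : 0 < ε)
    (h1 : cycleCount τ 1 ≤ x * √n) (h1' : cycleCount τ' 1 ≤ x * √n)
    (h2 : cycleCount τ 2 ≤ (1 / 2 - ε) * n) (h2' : cycleCount τ' 2 ≤ (1 / 2 - ε) * n)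
    (hn : 8 * x * √n ≤ ε * n) (hA : 12 ≤ ε * A) (hA0 : 0 < A) (hA2 : 12 ≤ ε * √A)
    (haA : A ≤ a) (hb : 2 ≤ b) (hab : a * b = n) :
    pr (HasBlocks τ τ' a b) ≤ Real.exp (-(ε / 12 * n)) := by
  have haR : (0 : ℝ) < a := lt_of_lt_of_le hA0 haA
  have ha : 0 < a := by exact_mod_cast haR
  have hbR : (0 : ℝ) < b := by exact_mod_cast (by omega : 0 < b)
  have hnab : (n : ℝ) = a * b := by rw [← hab]; push_cast; ring
  have hn0 : (0 : ℝ) < n := by rw [hnab]; positivity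
  have hL : 1 / 2 ≤ Real.log b := by
    have : Real.log 2 ≤ Real.log b := Real.log_le_log (by norm_num) (by exact_mod_cast hb)
    have := Real.log_two_gt_d9
    linarith
  have c1 := (Nat.cast_le (α := ℝ)).2 (card_cyc_le τ)
  have c2 := (Nat.cast_le (α := ℝ)).2 (card_cyc_le τ')
  push_cast at c1 c2
  refine (pr_hasBlocks_le τ τ' a b).trans ?_
  rw [mul_div_assoc]
  have hfac := factorial_pow_div_le ha (show 0 < b by omega)
  rw [hab] at hfac
  have hf : (b.factorial : ℝ) ^ 2 ≤ Real.exp ((2 * b : ℕ) * Real.log b) := by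
    rw [Real.exp_nat_mul, Real.exp_log hbR, mul_comm, pow_mul]
    gcongr
    exact_mod_cast Nat.factorial_le_pow b
  have hc : ((b : ℝ) ^ Fintype.card (Cyc τ) * b ^ Fintype.card (Cyc τ')) =
      Real.exp ((Fintype.card (Cyc τ) + Fintype.card (Cyc τ') : ℕ) * Real.log b) := by
    rw [Real.exp_nat_mul, Real.exp_log hbR, pow_add]
  rw [hc]
  refine (mul_le_mul (mul_le_mul_of_nonneg_right hf (Real.exp_pos _).le)
    hfac (by positivity) (by positivity)).trans ?_
  rw [← Real.exp_add, ← Real.exp_add, Real.exp_le_exp]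
  push_cast
  have e1 : (b : ℝ) * √a ≤ ε / 12 * n := by
    have hs : √A ≤ √a := Real.sqrt_le_sqrt haA
    have hsq : √a * √a = a := Real.mul_self_sqrt haR.le
    have hs0 : 0 < √a := Real.sqrt_pos.2 haR
    have : 12 ≤ ε * √a := hA2.trans (by gcongr)
    have e : ε / 12 * n = ε * √a / 12 * (b * √a) := by
      rw [hnab]
      nth_rewrite 1 [← hsq]
      ring
    rw [e]
    exact le_mul_of_one_le_left (by positivity) (by linarith)
  have e2 : 2 * (b : ℝ) ≤ ε / 6 * n := by
    have : 12 ≤ ε * a := hA.trans (by gcongr)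
    rw [hnab]
    nlinarith
  set L := Real.log b
  set k := (Fintype.card (Cyc τ) : ℝ)
  set k' := (Fintype.card (Cyc τ') : ℝ)
  have e3 : 2 * b + (k + k') - n ≤ -(ε / 3 * n) := by nlinarith
  have e4 : (2 * b + (k + k') - n) * L ≤ -(ε / 3 * n) * (1 / 2) := by
    have : 0 < ε / 3 * n := by positivity
    nlinarith
  linarith

theorem pr_hasBlocks_small {x ε : ℝ} (hε : 0 < ε) : ∃ A : ℕ, 1 ≤ A ∧ ∀ δ : ℝ, 0 < δ →
    ∀ᶠ n : ℕ in atTop, ∀ τ τ' : Perm (Fin n),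
      cycleCount τ 1 ≤ x * √n → cycleCount τ' 1 ≤ x * √n →
      cycleCount τ 2 ≤ (1 / 2 - ε) * n → cycleCount τ' 2 ≤ (1 / 2 - ε) * n →
      pr (fun σ => ∃ a b, A ≤ a ∧ 2 ≤ b ∧ HasBlocks τ τ' a b σ) ≤ δ := by
  obtain ⟨A, hA⟩ := exists_nat_ge (max 1 (max (12 / ε) ((12 / ε) ^ 2)))
  have hA1 := (le_max_left _ _).trans hA
  have hA2 := (le_max_left _ _).trans ((le_max_right _ _).trans hA)
  have hA3 := (le_max_right _ _).trans ((le_max_right _ _).trans hA)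
  have hA3' := Real.le_sqrt_of_sq_le hA3
  rw [div_le_iff₀' hε] at hA2 hA3'
  refine ⟨A, by exact_mod_cast hA1, fun δ hδ => ?_⟩
  have hlim : Tendsto (fun n : ℕ => (n + 1 : ℝ) * Real.exp (-(ε / 12 * n))) atTop (nhds 0) := by
    have h1 := Real.tendsto_pow_mul_exp_neg_atTop_nhds_zero 1
    have h0 := Real.tendsto_exp_neg_atTop_nhds_zero
    have ht : Tendsto (fun n : ℕ => ε / 12 * (n : ℝ)) atTop atTop :=
      tendsto_natCast_atTop_atTop.const_mul_atTop (by positivity)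
    have := ((h1.comp ht).const_mul (12 / ε)).add (h0.comp ht)
    simp only [mul_zero, add_zero] at this
    refine this.congr fun n => ?_
    simp only [Function.comp]
    field_simp
  filter_upwards [hlim.eventually (gt_mem_nhds hδ), eventually_gt_atTop 0,
    (Real.tendsto_sqrt_atTop.comp
      (tendsto_natCast_atTop_atTop (R := ℝ))).eventually_ge_atTop (8 * x / ε)] with n hn hn0 hns
  intro τ τ' h1 h1' h2 h2'
  have hns' : 8 * x * √n ≤ ε * n := by
    simp only [Function.comp] at hns
    rw [div_le_iff₀' hε] at hns
    calc _ ≤ ε * √n * √n := by gcongr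
      _ = _ := by rw [mul_assoc, Real.mul_self_sqrt (by positivity)]
  have hsub : ∀ σ, (∃ a b, A ≤ a ∧ 2 ≤ b ∧ HasBlocks τ τ' a b σ) →
      ∃ b ∈ range (n + 1), ∃ a ∈ (range (n + 1)).filter (fun a => A ≤ a ∧ 2 ≤ b ∧ a * b = n),
        HasBlocks τ τ' a b σ := by
    rintro σ ⟨a, b, ha, hb, h⟩
    have hab : a * b = n := by
      obtain ⟨f, _, _, hf, _⟩ := h
      have := card_eq_sum_card_fiberwise (s := univ) (t := univ) (f := f) (by simp)
      rw [sum_congr rfl fun i _ => hf i] at this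
      simp only [card_univ, Fintype.card_fin, sum_const, smul_eq_mul] at this
      rw [this, mul_comm]
    have hA0 : 1 ≤ A := by exact_mod_cast hA1
    refine ⟨b, ?_, a, mem_filter.2 ⟨?_, ha, hb, hab⟩, h⟩
    · rw [mem_range]; nlinarith
    · rw [mem_range]; nlinarith
  refine (pr_mono hsub).trans ((pr_exists_le _ _).trans ?_)
  have hterm : ∀ b ∈ range (n + 1), (pr fun σ => ∃ a ∈ (range (n + 1)).filter
      (fun a => A ≤ a ∧ 2 ≤ b ∧ a * b = n), HasBlocks τ τ' a b σ) ≤ Real.exp (-(ε / 12 * n)) := by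
    intro b _
    refine (pr_exists_le _ _).trans ((sum_le_card_nsmul _ _ (Real.exp (-(ε / 12 * n))) ?_).trans ?_)
    · intro a ha
      rw [mem_filter] at ha
      exact pr_hasBlocks_le_exp hε h1 h1' h2 h2' hns' hA2 (by linarith) hA3'
        (by exact_mod_cast ha.2.1) ha.2.2.1 ha.2.2.2
    · rw [nsmul_eq_mul]
      refine mul_le_of_le_one_left (Real.exp_pos _).le ?_
      have : #((range (n + 1)).filter (fun a => A ≤ a ∧ 2 ≤ b ∧ a * b = n)) ≤ 1 := by
        rw [card_le_one]
        intro a ha a' ha'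
        rw [mem_filter] at ha ha'
        exact Nat.eq_of_mul_eq_mul_right (show 0 < b by omega) (ha.2.2.2.trans ha'.2.2.2.symm)
      exact_mod_cast this
  refine (sum_le_card_nsmul _ _ _ hterm).trans ?_
  rw [card_range, nsmul_eq_mul]
  push_cast
  exact hn.le

end RandGen

namespace RandGen

open Equiv Equiv.Perm Finset

section Primitive

variable {α : Type*} [Fintype α] [DecidableEq α]

theorem mul_mul_inv_mul_inv_eq_swap_mul_swap {g h : Perm α} {c : α}
    (hg : g c ≠ c) (hgh : ∀ y, g y ≠ y → h y ≠ y → y = c) :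
    g * h * g⁻¹ * h⁻¹ = swap c (g c) * swap (h c) (g c) := by
  have hfix : h (g c) = g c := by
    by_contra hne
    exact hg (hgh (g c) (fun e => hg (g.injective e)) hne)
  have hdisj : Disjoint ((swap c (g c))⁻¹ * g) h := by
    intro y
    by_cases hy : h y = y
    · exact Or.inr hy
    · left
      by_cases hyc : y = c
      · subst hyc; simp
      · have hgy : g y = y := by
          by_contra hne
          exact hyc (hgh y hne hy)
        have hygc : y ≠ g c := by
          rintro rfl
          exact hy hfix
        simp [hgy, swap_apply_of_ne_of_ne hyc hygc]
  have hcomm := hdisj.commute.eq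
  have h1 : g * h * g⁻¹ = swap c (g c) * h * swap c (g c) := by
    have : g = swap c (g c) * ((swap c (g c))⁻¹ * g) := by group
    set s := swap c (g c) with hs
    set t := s⁻¹ * g with ht
    have hgt : g = s * t := by rw [ht]; group
    have hss : s⁻¹ = s := by rw [hs]; simp
    calc g * h * g⁻¹ = s * (t * h) * t⁻¹ * s⁻¹ := by rw [hgt]; group
      _ = s * (h * t) * t⁻¹ * s⁻¹ := by rw [hcomm]
      _ = s * h * s⁻¹ := by group
      _ = s * h * s := by rw [hss]
  rw [h1, mul_assoc, mul_assoc, ← mul_assoc h, ← hfix, mul_swap_eq_swap_mul]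
  simp [hfix]

/-- Two-point homogeneity in the strong sense, for a permutation group. -/
def TwoTrans (G : Subgroup (Perm α)) : Prop :=
  ∀ a b c d : α, a ≠ b → c ≠ d → ∃ x ∈ G, x a = c ∧ x b = d

open Classical in
theorem exists_conj_inter_singleton {G : Subgroup (Perm α)} (h2 : TwoTrans G) (Δ : Finset α)
    {c : α} (hc : c ∈ Δ) (hn : (#Δ) ^ 2 + 1 < Fintype.card α) :
    ∃ x ∈ G, x c = c ∧ ∀ y ∈ Δ, x y ∈ Δ → y = c := by
  set X : Finset (Perm α) := univ.filter fun x => x ∈ G ∧ x c = c with hX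
  have hXne : 0 < #X := card_pos.2 ⟨1, by simp [hX, G.one_mem]⟩
  have hcard : ∀ y ≠ c, ∀ d ≠ c,
      (Fintype.card α - 1) * #(X.filter fun x => x y = d) = #X := by
    intro y hy d hd
    have h1 : ∀ d' ∈ univ.erase c, #(X.filter fun x => x y = d') =
        #(X.filter fun x => x y = d) := by
      intro d' hd'
      obtain ⟨z, hzG, hzc, hzd⟩ := h2 c d' c d (ne_of_mem_erase hd').symm hd.symm
      refine card_bij (fun x _ => z * x) ?_ ?_ ?_
      · intro x hx
        simp only [hX, mem_filter, mem_univ, true_and] at hx ⊢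
        refine ⟨⟨G.mul_mem hzG hx.1.1, ?_⟩, ?_⟩ <;> simp [hx, hzc, hzd]
      · intro x _ x' _ h
        exact mul_left_cancel h
      · intro x hx
        simp only [hX, mem_filter, mem_univ, true_and] at hx
        refine ⟨z⁻¹ * x, ?_, by group⟩
        simp only [hX, mem_filter, mem_univ, true_and]
        refine ⟨⟨G.mul_mem (G.inv_mem hzG) hx.1.1, ?_⟩, ?_⟩
        · simp [hx, Equiv.symm_apply_eq, hzc]
        · simp [hx, Equiv.symm_apply_eq, hzd]
    have h3 := card_eq_sum_card_fiberwise (s := X) (t := univ.erase c) (f := fun x => x y) (by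
      intro x hx
      simp only [hX, coe_filter, mem_univ, true_and, Set.mem_setOf_eq] at hx
      simp only [coe_erase, coe_univ, Set.mem_diff, Set.mem_univ, Set.mem_singleton_iff, true_and]
      intro h
      exact hy (x.injective (h.trans hx.2.symm)))
    rw [h3, sum_congr rfl h1, sum_const, card_erase_of_mem (mem_univ _), card_univ, smul_eq_mul]
  by_contra! hcon
  have hcov : X ⊆ ((Δ.erase c) ×ˢ (Δ.erase c)).biUnion fun p => X.filter fun x => x p.1 = p.2 := by
    intro x hx
    have hx' := hx
    simp only [hX, mem_filter, mem_univ, true_and] at hx'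
    obtain ⟨y, hy, hxy, hyc⟩ := hcon x hx'.1 hx'.2
    simp only [mem_biUnion, mem_product, mem_erase]
    refine ⟨(y, x y), ⟨⟨hyc, hy⟩, fun h => hyc (x.injective (h.trans hx'.2.symm)), hxy⟩, ?_⟩
    simp [hx]
  have h5 := (card_le_card hcov).trans card_biUnion_le
  have h6 : (Fintype.card α - 1) * #X ≤ ((#Δ - 1) * (#Δ - 1)) * #X := by
    calc (Fintype.card α - 1) * #X
        ≤ (Fintype.card α - 1) * ∑ p ∈ (Δ.erase c) ×ˢ (Δ.erase c),
            #(X.filter fun x => x p.1 = p.2) := Nat.mul_le_mul_left _ h5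
      _ = ∑ p ∈ (Δ.erase c) ×ˢ (Δ.erase c), #X := by
          rw [mul_sum]
          refine sum_congr rfl fun p hp => ?_
          simp only [mem_product, mem_erase] at hp
          exact hcard _ hp.1.1 _ hp.2.1
      _ = _ := by
          rw [sum_const, card_product, card_erase_of_mem hc, smul_eq_mul]
  have h7 := Nat.le_of_mul_le_mul_right h6 hXne
  have h8 : (#Δ - 1) * (#Δ - 1) ≤ #Δ ^ 2 := by
    rw [sq]; exact Nat.mul_le_mul (Nat.sub_le _ _) (Nat.sub_le _ _)
  omega

theorem exists_isThreeCycle_of_twoTrans {G : Subgroup (Perm α)} (h2 : TwoTrans G) {g : Perm α}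
    (hg : g ∈ G) (hg1 : g ≠ 1) (hn : (#g.support) ^ 2 + 1 < Fintype.card α) :
    ∃ k ∈ G, IsThreeCycle k := by
  obtain ⟨c, hc⟩ : ∃ c, g c ≠ c := by
    by_contra! h
    exact hg1 (Perm.ext h)
  obtain ⟨x, hxG, hxc, hx⟩ := exists_conj_inter_singleton h2 g.support (mem_support.2 hc) hn
  set h := x * g * x⁻¹ with hh
  have hhG : h ∈ G := G.mul_mem (G.mul_mem hxG hg) (G.inv_mem hxG)
  have hxc' : x⁻¹ c = c := by rw [Perm.inv_eq_iff_eq, hxc]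
  have hhc : h c = x (g c) := by rw [hh, Perm.mul_apply, Perm.mul_apply, hxc']
  have hsupp : ∀ y, g y ≠ y → h y ≠ y → y = c := by
    intro y hy hy'
    have h1 : g (x⁻¹ y) ≠ x⁻¹ y := by
      intro e
      apply hy'
      rw [hh, Perm.mul_apply, Perm.mul_apply, e]; simp
    have := hx (x⁻¹ y) (mem_support.2 h1) (by simpa using hy)
    rw [← hxc, ← this]; simp
  refine ⟨g * h * g⁻¹ * h⁻¹, G.mul_mem (G.mul_mem (G.mul_mem hg hhG) (G.inv_mem hg))
    (G.inv_mem hhG), ?_⟩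
  rw [mul_mul_inv_mul_inv_eq_swap_mul_swap hc hsupp, swap_comm c, swap_comm (h c)]
  have hhc' : h c ≠ c := by
    rw [hhc]; intro e; apply hc; exact x.injective (e.trans hxc.symm)
  refine isThreeCycle_swap_mul_swap_same hc ?_ hhc'.symm
  intro e
  have h3 : g (g c) ≠ g c := fun e => hc (g.injective e)
  have h4 : h (g c) ≠ g c := by rw [e]; exact fun e => hhc' (h.injective e)
  exact hc (hsupp _ h3 h4)

theorem rel_of_isPreprimitive {G : Subgroup (Perm α)} [MulAction.IsPreprimitive G α]
    {r : α → α → Prop} (hr : Equivalence r) (hG : ∀ x ∈ G, ∀ a b, r a b → r (x a) (x b))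
    {a b : α} (hab : a ≠ b) (h : r a b) (c d : α) : r c d := by
  have hinv : ∀ x ∈ G, ∀ a b, r (x a) (x b) → r a b := by
    intro x hx a b h
    simpa using hG x⁻¹ (G.inv_mem hx) _ _ h
  have hB : MulAction.IsBlock G {y | r a y} := by
    rw [MulAction.isBlock_iff_smul_eq_or_disjoint]
    rintro ⟨x, hx⟩
    by_cases hxa : r a (x a)
    · left
      ext y
      constructor
      · rintro ⟨z, hz, rfl⟩
        exact hr.trans hxa (hG x hx _ _ hz)
      · intro hy
        refine ⟨x⁻¹ y, ?_, by change x (x⁻¹ y) = y; simp⟩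
        refine hinv x hx _ _ ?_
        simp only [Perm.coe_inv, apply_symm_apply]
        exact hr.trans (hr.symm hxa) hy
    · right
      rw [Set.disjoint_left]
      rintro _ ⟨z, hz, rfl⟩ hz'
      exact hxa (hr.trans hz' (hr.symm (hG x hx _ _ hz)))
  have huniv : {y | r a y} = Set.univ := by
    rcases MulAction.IsPreprimitive.isTrivialBlock_of_isBlock hB with h' | h'
    · exact absurd (h' (hr.refl a) h) hab
    · exact h'
  have h1 : ∀ y, r a y := fun y => (Set.ext_iff.1 huniv y).2 trivial
  exact hr.trans (hr.symm (h1 c)) (h1 d)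

/-- `c` and `d` lie in the same orbit of the stabilizer of `z`. -/
def SameColor (G : Subgroup (Perm α)) (z c d : α) : Prop := ∃ x ∈ G, x z = z ∧ x c = d

variable {G : Subgroup (Perm α)}

theorem SameColor.refl (z c : α) : SameColor G z c c := ⟨1, G.one_mem, rfl, rfl⟩

theorem SameColor.symm {z c d : α} (h : SameColor G z c d) : SameColor G z d c := by
  obtain ⟨x, hx, hz, hc⟩ := h
  exact ⟨x⁻¹, G.inv_mem hx, by rw [Perm.inv_eq_iff_eq, hz], by rw [Perm.inv_eq_iff_eq, hc]⟩

theorem SameColor.trans {z c d e : α} (h : SameColor G z c d) (h' : SameColor G z d e) :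
    SameColor G z c e := by
  obtain ⟨x, hx, hz, hc⟩ := h
  obtain ⟨y, hy, hz', hc'⟩ := h'
  exact ⟨y * x, G.mul_mem hy hx, by simp [hz, hz'], by simp [hc, hc']⟩

theorem SameColor.map {z c d : α} (h : SameColor G z c d) {y : Perm α} (hy : y ∈ G) :
    SameColor G (y z) (y c) (y d) := by
  obtain ⟨x, hx, hz, hc⟩ := h
  exact ⟨y * x * y⁻¹, G.mul_mem (G.mul_mem hy hx) (G.inv_mem hy), by simp [hz], by simp [hc]⟩

theorem sameColor_map_iff {z c d : α} {y : Perm α} (hy : y ∈ G) :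
    SameColor G (y z) (y c) (y d) ↔ SameColor G z c d :=
  ⟨fun h => by simpa using h.map (G.inv_mem hy), fun h => h.map hy⟩

open Classical in
/-- The points `z` whose stabilizer does not move `c` to `d`. -/
noncomputable def distSet (G : Subgroup (Perm α)) (c d : α) : Finset α :=
  univ.filter fun z => ¬ SameColor G z c d

open Classical in
/-- The orbit of `c` under the stabilizer of `z`. -/
noncomputable def colorOrbit (G : Subgroup (Perm α)) (z c : α) : Finset α :=
  univ.filter fun d => SameColor G z c d

theorem mem_distSet {c d z : α} : z ∈ distSet G c d ↔ ¬ SameColor G z c d := by simp [distSet]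

theorem mem_colorOrbit {c d z : α} : d ∈ colorOrbit G z c ↔ SameColor G z c d := by
  simp [colorOrbit]

theorem distSet_comm (c d : α) : distSet G c d = distSet G d c := by
  ext z
  rw [mem_distSet, mem_distSet, not_iff_not]
  exact ⟨SameColor.symm, SameColor.symm⟩

theorem distSet_subset_union (c d e : α) : distSet G c e ⊆ distSet G c d ∪ distSet G d e := by
  intro z
  rw [mem_union, mem_distSet, mem_distSet, mem_distSet]
  intro h
  by_contra! hcon
  exact h (hcon.1.trans hcon.2)

theorem card_distSet_le_add (c d e : α) : #(distSet G c e) ≤ #(distSet G c d) + #(distSet G d e) :=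
  (card_le_card (distSet_subset_union c d e)).trans (card_union_le _ _)

theorem distSet_subset_support {x : Perm α} (hx : x ∈ G) (c : α) :
    distSet G c (x c) ⊆ x.support := by
  intro z hz
  rw [mem_distSet] at hz
  rw [mem_support]
  intro h
  exact hz ⟨x, hx, h, rfl⟩

theorem card_distSet_map {y : Perm α} (hy : y ∈ G) (c d : α) :
    #(distSet G (y c) (y d)) = #(distSet G c d) := by
  symm
  refine card_bij (fun z _ => y z) ?_ (fun _ _ _ _ h => y.injective h) ?_
  · intro z hz
    rw [mem_distSet] at hz ⊢
    rwa [sameColor_map_iff hy]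
  · intro z hz
    refine ⟨y⁻¹ z, ?_, by simp⟩
    rw [mem_distSet] at hz ⊢
    rw [← sameColor_map_iff hy]
    simpa using hz

theorem card_colorOrbit_map {y : Perm α} (hy : y ∈ G) (c d : α) :
    #(colorOrbit G (y c) (y d)) = #(colorOrbit G c d) := by
  symm
  refine card_bij (fun z _ => y z) ?_ (fun _ _ _ _ h => y.injective h) ?_
  · intro z hz
    rw [mem_colorOrbit] at hz ⊢
    rwa [sameColor_map_iff hy]
  · intro z hz
    refine ⟨y⁻¹ z, ?_, by simp⟩
    rw [mem_colorOrbit] at hz ⊢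
    rw [← sameColor_map_iff hy]
    simpa using hz

theorem colorOrbit_eq_of_sameColor {z c d : α} (h : SameColor G z c d) :
    colorOrbit G z c = colorOrbit G z d := by
  ext e
  rw [mem_colorOrbit, mem_colorOrbit]
  exact ⟨fun h' => h.symm.trans h', fun h' => h.trans h'⟩

open Classical in
theorem card_colorOrbit_mul (z c : α) :
    #(colorOrbit G z c) * #(univ.filter fun x : Perm α => x ∈ G ∧ x z = z ∧ x c = c) =
      #(univ.filter fun x : Perm α => x ∈ G ∧ x z = z) := by
  rw [card_eq_sum_card_fiberwise (s := univ.filter fun x : Perm α => x ∈ G ∧ x z = z)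
    (t := colorOrbit G z c) (f := fun x => x c), ← smul_eq_mul, ← sum_const]
  · refine sum_congr rfl fun d hd => ?_
    obtain ⟨y, hy, hyz, hyc⟩ := mem_colorOrbit.1 hd
    refine card_bij (fun x _ => y * x) ?_ (fun _ _ _ _ h => mul_left_cancel h) ?_
    · intro x hx
      simp only [mem_filter, mem_univ, true_and] at hx ⊢
      refine ⟨⟨G.mul_mem hy hx.1, ?_⟩, ?_⟩ <;> simp [hx, hyz, hyc]
    · intro x hx
      simp only [mem_filter, mem_univ, true_and] at hx
      refine ⟨y⁻¹ * x, ?_, by group⟩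
      simp only [mem_filter, mem_univ, true_and]
      refine ⟨G.mul_mem (G.inv_mem hy) hx.1.1, ?_, ?_⟩
      · simp [hx, Equiv.symm_apply_eq, hyz]
      · simp [hx, Equiv.symm_apply_eq, hyc]
  · intro x hx
    simp only [coe_filter, mem_univ, true_and, Set.mem_setOf_eq] at hx
    exact mem_colorOrbit.2 ⟨x, hx.1, hx.2, rfl⟩

open Classical in
theorem card_stab_eq [MulAction.IsPretransitive G α] (z c : α) :
    #(univ.filter fun x : Perm α => x ∈ G ∧ x z = z) =
      #(univ.filter fun x : Perm α => x ∈ G ∧ x c = c) := by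
  obtain ⟨⟨y, hy⟩, hyz⟩ := MulAction.exists_smul_eq G z c
  change y z = c at hyz
  refine card_bij (fun x _ => y * x * y⁻¹) ?_ ?_ ?_
  · intro x hx
    simp only [mem_filter, mem_univ, true_and] at hx ⊢
    refine ⟨G.mul_mem (G.mul_mem hy hx.1) (G.inv_mem hy), ?_⟩
    rw [← hyz]; simp [hx]
  · intro _ _ _ _ h
    exact mul_left_cancel (mul_right_cancel h)
  · intro x hx
    simp only [mem_filter, mem_univ, true_and] at hx
    refine ⟨y⁻¹ * x * y, ?_, by group⟩
    simp only [mem_filter, mem_univ, true_and]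
    refine ⟨G.mul_mem (G.mul_mem (G.inv_mem hy) hx.1) hy, ?_⟩
    simp [hyz, hx, Equiv.symm_apply_eq]

theorem card_colorOrbit_comm [MulAction.IsPretransitive G α] (z c : α) :
    #(colorOrbit G z c) = #(colorOrbit G c z) := by
  classical
  have h1 := card_colorOrbit_mul (G := G) z c
  have h2 := card_colorOrbit_mul (G := G) c z
  rw [card_stab_eq z c, ← h2] at h1
  have h3 : (univ.filter fun x : Perm α => x ∈ G ∧ x z = z ∧ x c = c) =
      univ.filter fun x : Perm α => x ∈ G ∧ x c = c ∧ x z = z := by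
    ext x; simp; tauto
  rw [h3] at h1
  refine Nat.eq_of_mul_eq_mul_right (card_pos.2 ⟨1, ?_⟩) h1
  simp [G.one_mem]

/-- If every `distSet` is small, a primitive group has all stabilizer orbits either huge
or is two-transitive. -/
theorem twoTrans_of_card_distSet_le [MulAction.IsPreprimitive G α] {m : ℕ}
    (hD : ∀ c d, #(distSet G c d) ≤ 2 * m) (hn : 4 * m ^ 2 + 2 * m + 1 < Fintype.card α)
    (hn2 : 4 * m < Fintype.card α) : TwoTrans G := by
  classical
  set n := Fintype.card α with hnn
  have hbig : ∀ z, ∃ c, n ≤ #(colorOrbit G z c) + 2 * m := by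
    intro z
    by_contra! hcon
    set N : α → ℕ := fun z => #(univ.filter fun p : α × α => ¬ SameColor G z p.1 p.2) with hN
    have hNz : ∀ z', N z' = N z := by
      intro z'
      obtain ⟨⟨y, hy⟩, hyz⟩ := MulAction.exists_smul_eq G z' z
      change y z' = z at hyz
      refine card_bij (fun p _ => (y p.1, y p.2)) ?_ ?_ ?_
      · intro p hp
        simp only [mem_filter, mem_univ, true_and] at hp ⊢
        rwa [← hyz, sameColor_map_iff hy]
      · intro p _ p' _ h
        simp only [Prod.mk.injEq, EmbeddingLike.apply_eq_iff_eq] at h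
        exact Prod.ext h.1 h.2
      · intro p hp
        simp only [mem_filter, mem_univ, true_and] at hp
        refine ⟨(y⁻¹ p.1, y⁻¹ p.2), ?_, by simp⟩
        simp only [mem_filter, mem_univ, true_and]
        rw [← sameColor_map_iff hy, hyz]
        simpa using hp
    have h1 : ∑ z', N z' = ∑ p : α × α, #(distSet G p.1 p.2) := by
      simp only [hN, distSet, card_filter]
      rw [sum_comm]
    have h2 : n * N z ≤ n * n * (2 * m) := by
      calc n * N z = ∑ z' : α, N z' := by
            rw [sum_congr rfl fun z' _ => hNz z', sum_const, card_univ, smul_eq_mul]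
        _ ≤ ∑ p : α × α, 2 * m := by rw [h1]; exact sum_le_sum fun p _ => hD _ _
        _ = _ := by rw [sum_const, card_univ, Fintype.card_prod, smul_eq_mul]
    have hn0 : 0 < n := by omega
    have h3 : N z ≤ n * (2 * m) := by
      rw [mul_assoc] at h2; exact Nat.le_of_mul_le_mul_left h2 hn0
    have h4 : N z = ∑ c : α, #(univ.filter fun d => ¬ SameColor G z c d) := by
      simp only [hN, card_filter]
      rw [Fintype.sum_prod_type]
    have h5 : ∀ c : α, 2 * m + 1 ≤ #(univ.filter fun d => ¬ SameColor G z c d) := by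
      intro c
      have h6 := card_filter_add_card_filter_not (s := (univ : Finset α))
        (fun d => SameColor G z c d)
      rw [card_univ, ← hnn] at h6
      have h7 := hcon c
      rw [colorOrbit] at h7
      omega
    have h8 : n * (2 * m + 1) ≤ N z := by
      rw [h4]
      calc n * (2 * m + 1) = ∑ c : α, (2 * m + 1) := by
            rw [sum_const, card_univ, smul_eq_mul]
        _ ≤ _ := sum_le_sum fun c _ => h5 c
    nlinarith
  set E : α → α → Prop := fun z c => #(colorOrbit G z c) + 2 * m < n with hE
  have hE1 : ∀ z, #(univ.filter fun c => E z c) ≤ 2 * m := by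
    intro z
    obtain ⟨c, hc⟩ := hbig z
    have h1 : colorOrbit G z c ⊆ univ.filter fun c => ¬ E z c := by
      intro d hd
      simp only [mem_filter, mem_univ, true_and, hE, not_lt]
      rwa [← colorOrbit_eq_of_sameColor (mem_colorOrbit.1 hd)]
    have h2 := card_le_card h1
    have h6 := card_filter_add_card_filter_not (s := (univ : Finset α)) (fun c => E z c)
    rw [card_univ, ← hnn] at h6
    omega
  have hErefl : ∀ z, E z z := by
    intro z
    have : colorOrbit G z z ⊆ {z} := by
      intro d hd
      obtain ⟨x, _, hx, hx'⟩ := mem_colorOrbit.1 hd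
      rw [mem_singleton, ← hx', hx]
    have := card_le_card this
    rw [card_singleton] at this
    simp only [hE]
    nlinarith
  have hEsymm : ∀ z c, E z c → E c z := by
    intro z c h
    simp only [hE] at h ⊢
    rwa [card_colorOrbit_comm]
  have hEinv : ∀ x ∈ G, ∀ a b, E a b → E (x a) (x b) := by
    intro x hx a b h
    simp only [hE] at h ⊢
    rwa [card_colorOrbit_map hx]
  by_cases htr : ∀ a b c, E a b → E b c → E a c
  · have hEq : Equivalence E := ⟨hErefl, fun h => hEsymm _ _ h, fun h h' => htr _ _ _ h h'⟩
    have htriv : ∀ a b, E a b → a = b := by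
      intro a b hab
      by_contra hne
      have hall := rel_of_isPreprimitive hEq hEinv hne hab
      obtain ⟨c, hc⟩ := hbig a
      have := hall a c
      simp only [hE] at this
      omega
    have hsame : ∀ z c d, c ≠ z → d ≠ z → SameColor G z c d := by
      intro z c d hc hd
      have h1 : ¬ E z c := fun h => hc (htriv _ _ h).symm
      have h2 : ¬ E z d := fun h => hd (htriv _ _ h).symm
      simp only [hE, not_lt] at h1 h2
      obtain ⟨e, he⟩ : (colorOrbit G z c ∩ colorOrbit G z d).Nonempty := by
        rw [← card_pos]
        have h3 := card_union_add_card_inter (colorOrbit G z c) (colorOrbit G z d)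
        have h4 := card_le_univ (colorOrbit G z c ∪ colorOrbit G z d)
        omega
      rw [mem_inter, mem_colorOrbit, mem_colorOrbit] at he
      exact he.1.trans he.2.symm
    intro a b c d hab hcd
    obtain ⟨⟨y, hy⟩, hyz⟩ := MulAction.exists_smul_eq G a c
    change y a = c at hyz
    obtain ⟨x, hx, hxz, hxc⟩ := hsame c (y b) d
      (by rw [← hyz]; exact fun h => hab (y.injective h).symm) hcd.symm
    exact ⟨x * y, G.mul_mem hx hy, by simp [hyz, hxz], by simp [hxc]⟩
  · exfalso
    push Not at htr
    obtain ⟨z, b, c, hzb, hbc, hzc⟩ := htr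
    have hsub : colorOrbit G z c ⊆
        (univ.filter fun b => E z b).biUnion fun b => univ.filter fun c => E b c := by
      intro d hd
      obtain ⟨x, hx, hxz, hxc⟩ := mem_colorOrbit.1 hd
      simp only [mem_biUnion, mem_filter, mem_univ, true_and]
      refine ⟨x b, ?_, ?_⟩
      · have := hEinv x hx _ _ hzb
        rwa [hxz] at this
      · have := hEinv x hx _ _ hbc
        rwa [hxc] at this
    have h1 := (card_le_card hsub).trans (card_biUnion_le_card_mul _ _ _ fun b _ => hE1 b)
    have h2 := Nat.mul_le_mul_right (2 * m) (hE1 z)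
    simp only [hE, not_lt] at hzc
    nlinarith

theorem twoTrans_of_card_support [MulAction.IsPreprimitive G α] {g : Perm α} (hg : g ∈ G)
    (hg1 : g ≠ 1) (hn : 4 * #g.support ^ 2 + 2 * #g.support + 1 < Fintype.card α) :
    TwoTrans G := by
  classical
  set m := #g.support with hm
  set n := Fintype.card α with hnn
  have hm0 : 0 < m := card_pos.2 (by
    rw [nonempty_iff_ne_empty, Ne, support_eq_empty_iff]; exact hg1)
  obtain ⟨a, ha⟩ : ∃ a, g a ≠ a := by
    by_contra! h
    exact hg1 (Perm.ext h)
  set R : α → α → Prop := fun c d => ∃ y ∈ G, (c = y a ∧ d = y (g a)) ∨ (d = y a ∧ c = y (g a))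
    with hR
  have hRsymm : ∀ c d, R c d → R d c := by
    rintro c d ⟨y, hy, h⟩
    exact ⟨y, hy, h.symm⟩
  have hRinv : ∀ x ∈ G, ∀ c d, R c d → R (x c) (x d) := by
    rintro x hx c d ⟨y, hy, h⟩
    refine ⟨x * y, G.mul_mem hx hy, ?_⟩
    rcases h with ⟨rfl, rfl⟩ | ⟨rfl, rfl⟩
    · left; simp
    · right; simp
  have hRD : ∀ c d, R c d → #(distSet G c d) ≤ m := by
    rintro c d ⟨y, hy, h⟩
    have h1 : #(distSet G a (g a)) ≤ m := card_le_card (distSet_subset_support hg a)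
    rcases h with ⟨rfl, rfl⟩ | ⟨rfl, rfl⟩
    · rwa [card_distSet_map hy]
    · rwa [distSet_comm, card_distSet_map hy]
  have hconn : ∀ c d, Relation.ReflTransGen R c d := by
    have hsy : ∀ {c d}, Relation.ReflTransGen R c d → Relation.ReflTransGen R d c := by
      intro c d h
      induction h with
      | refl => exact Relation.ReflTransGen.refl
      | tail _ h ih => exact Relation.ReflTransGen.head (hRsymm _ _ h) ih
    refine rel_of_isPreprimitive (G := G) (r := Relation.ReflTransGen R)
      ⟨fun _ => Relation.ReflTransGen.refl, fun h => hsy h, fun h h' => h.trans h'⟩ ?_ ha.symm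
      (Relation.ReflTransGen.single ⟨1, G.one_mem, Or.inl ⟨rfl, rfl⟩⟩)
    intro x hx c d h
    induction h with
    | refl => exact Relation.ReflTransGen.refl
    | tail _ h ih => exact ih.tail (hRinv x hx _ _ h)
  have hclosed : ∀ (S : α → Prop) (c : α), S c → (∀ c d, S c → R c d → S d) → ∀ d, S d := by
    intro S c hc hS d
    induction hconn c d with
    | refl => exact hc
    | tail _ h ih => exact hS _ _ ih h
  have hval : ∀ c, n ≤ #(univ.filter fun d => R c d) * m + 1 := by
    intro c
    have hsub : univ.erase c ⊆ (univ.filter fun d => R c d).biUnion fun d => distSet G c d := by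
      intro z hz
      by_contra hcon
      simp only [mem_biUnion, mem_filter, mem_univ, true_and, not_exists, not_and,
        mem_distSet, not_not] at hcon
      have : ∀ d, SameColor G z c d := by
        refine hclosed _ c (SameColor.refl z c) ?_
        intro c' d' hc' hd'
        obtain ⟨x, hx, hxz, hxc⟩ := hc'
        have h1 := hRinv x⁻¹ (G.inv_mem hx) _ _ hd'
        have h2 : x⁻¹ c' = c := by rw [Perm.inv_eq_iff_eq, hxc]
        rw [h2] at h1
        have h3 := (hcon _ h1).map hx
        rw [hxz, hxc] at h3
        have h4 : x (x⁻¹ d') = d' := by simp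
        rw [h4] at h3
        exact (show SameColor G z c c' from ⟨x, hx, hxz, hxc⟩).trans h3
      obtain ⟨x, hx, hxz, hxc⟩ := this z
      exact (ne_of_mem_erase hz) (x.injective (hxz.trans hxc.symm))
    have h1 := (card_le_card hsub).trans (card_biUnion_le_card_mul _ _ m fun d hd => by
      exact hRD c d (by simpa using hd))
    rw [card_erase_of_mem (mem_univ _), card_univ] at h1
    omega
  set R2 : α → α → Prop := fun c d => c = d ∨ R c d ∨ ∃ e, R c e ∧ R e d with hR2
  by_cases hall : ∀ c d, R2 c d
  · refine twoTrans_of_card_distSet_le (m := m) ?_ (by omega) (by nlinarith)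
    intro c d
    rcases hall c d with rfl | h | ⟨e, h1, h2⟩
    · have : distSet G c c = ∅ := by
        ext z; simp [mem_distSet, SameColor.refl]
      simp [this]
    · have := hRD _ _ h; omega
    · have h3 := card_distSet_le_add (G := G) c e d
      have := hRD _ _ h1
      have := hRD _ _ h2
      omega
  · exfalso
    push Not at hall
    obtain ⟨c, d0, hcd0⟩ := hall
    obtain ⟨e, d, he, hed, hd⟩ : ∃ e d, R2 c e ∧ R e d ∧ ¬ R2 c d := by
      by_contra! hcon
      exact hcd0 (hclosed (fun d => R2 c d) c (Or.inl rfl) (fun e d he hed => hcon e d he hed) d0)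
    have hDcd : #(distSet G c d) ≤ 3 * m := by
      have h0 := card_distSet_le_add (G := G) c e d
      have h1 := hRD _ _ hed
      rcases he with rfl | h | ⟨f, h2, h3⟩
      · exact absurd (Or.inr (Or.inl hed)) hd
      · exact absurd (Or.inr (Or.inr ⟨e, h, hed⟩)) hd
      · have h4 := card_distSet_le_add (G := G) c f e
        have h5 := hRD _ _ h2
        have h6 := hRD _ _ h3
        omega
    have hsub : (univ.filter fun z => R c z) ⊆ distSet G c d := by
      intro z hz
      simp only [mem_filter, mem_univ, true_and] at hz
      rw [mem_distSet]
      rintro ⟨x, hx, hxz, hxc⟩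
      have := hRinv x hx _ _ hz
      rw [hxz, hxc] at this
      exact hd (Or.inr (Or.inr ⟨z, hz, hRsymm _ _ this⟩))
    have h7 := card_le_card hsub
    have h8 := hval c
    nlinarith

/-- A primitive permutation group containing a nontrivial element of small support contains
the alternating group. -/
theorem alternatingGroup_le_of_card_support (hG : MulAction.IsPreprimitive G α) {g : Perm α}
    (hg : g ∈ G) (hg1 : g ≠ 1) (hn : 4 * #g.support ^ 2 + 2 * #g.support + 1 < Fintype.card α) :
    alternatingGroup α ≤ G := by
  obtain ⟨k, hk, hk3⟩ := exists_isThreeCycle_of_twoTrans (twoTrans_of_card_support hg hg1 hn) hg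
    hg1 (by nlinarith)
  exact alternatingGroup_le_of_isPreprimitive_of_isThreeCycle_mem hG hk3 hk

end Primitive

section Matchings

variable {V : Type*} [Fintype V] [DecidableEq V]

/-- The involutions of `V` which exchange `A` and `B` and fix everything else. -/
def matchings (A B : Finset V) : Finset (Perm V) :=
  univ.filter fun m => (∀ x, m (m x) = x) ∧ (∀ x ∈ A, m x ∈ B) ∧ (∀ x ∈ B, m x ∈ A) ∧
    ∀ x, x ∉ A → x ∉ B → m x = x

theorem mem_matchings {A B : Finset V} {m : Perm V} :
    m ∈ matchings A B ↔ (∀ x, m (m x) = x) ∧ (∀ x ∈ A, m x ∈ B) ∧ (∀ x ∈ B, m x ∈ A) ∧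
      ∀ x, x ∉ A → x ∉ B → m x = x := by
  simp [matchings]

theorem matchings_comm (A B : Finset V) : matchings A B = matchings B A := by
  ext m
  simp only [mem_matchings]
  constructor
  · rintro ⟨h1, h2, h3, h4⟩
    exact ⟨h1, h3, h2, fun x hB hA => h4 x hA hB⟩
  · rintro ⟨h1, h2, h3, h4⟩
    exact ⟨h1, h3, h2, fun x hB hA => h4 x hA hB⟩

theorem apply_eq_self_of_mem_matchings {A B : Finset V} {m : Perm V} (hm : m ∈ matchings A B)
    {x : V} (hx : x ∉ A ∪ B) : m x = x := by
  rw [mem_union, not_or] at hx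
  exact (mem_matchings.1 hm).2.2.2 x hx.1 hx.2

theorem mul_swap_mem_matchings {A B : Finset V} (hAB : _root_.Disjoint A B) {e f : V} (he : e ∈ A)
    (hf : f ∈ B) {m : Perm V} (hm : m ∈ matchings (A.erase e) (B.erase f)) :
    m * swap e f ∈ matchings A B ∧ (m * swap e f) e = f := by
  have hef : e ≠ f := fun h => Finset.disjoint_left.1 hAB he (h ▸ hf)
  have heB : e ∉ B := Finset.disjoint_left.1 hAB he
  have hfA : f ∉ A := fun h => Finset.disjoint_left.1 hAB h hf
  obtain ⟨h1, h2, h3, h4⟩ := mem_matchings.1 hm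
  have hme : m e = e := h4 e (by simp) (by simp [heB])
  have hmf : m f = f := h4 f (by simp [hfA]) (by simp)
  have hs : ∀ x, x ≠ e → x ≠ f → m x ≠ e ∧ m x ≠ f := fun x hxe hxf =>
    ⟨fun h => hxe (m.injective (h.trans hme.symm)), fun h => hxf (m.injective (h.trans hmf.symm))⟩
  have key : ∀ x, x ≠ e → x ≠ f → (m * swap e f) x = m x := fun x hxe hxf => by
    rw [Perm.mul_apply, swap_apply_of_ne_of_ne hxe hxf]
  have ke : (m * swap e f) e = f := by rw [Perm.mul_apply, swap_apply_left, hmf]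
  have kf : (m * swap e f) f = e := by rw [Perm.mul_apply, swap_apply_right, hme]
  refine ⟨mem_matchings.2 ⟨fun x => ?_, fun x hx => ?_, fun x hx => ?_, fun x hA hB => ?_⟩, ke⟩
  · by_cases hxe : x = e
    · rw [hxe, ke, kf]
    by_cases hxf : x = f
    · rw [hxf, kf, ke]
    rw [key x hxe hxf, key _ (hs x hxe hxf).1 (hs x hxe hxf).2, h1]
  · by_cases hxe : x = e
    · rw [hxe, ke]
      exact hf
    have hxf : x ≠ f := fun h => hfA (h ▸ hx)
    rw [key x hxe hxf]
    exact mem_of_mem_erase (h2 x (mem_erase.2 ⟨hxe, hx⟩))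
  · by_cases hxf : x = f
    · rw [hxf, kf]
      exact he
    have hxe : x ≠ e := fun h => heB (h ▸ hx)
    rw [key x hxe hxf]
    exact mem_of_mem_erase (h3 x (mem_erase.2 ⟨hxf, hx⟩))
  · have hxe : x ≠ e := fun h => hA (h ▸ he)
    have hxf : x ≠ f := fun h => hB (h ▸ hf)
    rw [key x hxe hxf]
    exact h4 x (fun h => hA (mem_of_mem_erase h)) fun h => hB (mem_of_mem_erase h)

theorem mul_swap_mem_matchings_erase {A B : Finset V} (hAB : _root_.Disjoint A B) {e f : V}
    (he : e ∈ A) (hf : f ∈ B) {m : Perm V} (hm : m ∈ matchings A B) (hmef : m e = f) :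
    m * swap e f ∈ matchings (A.erase e) (B.erase f) := by
  have hef : e ≠ f := fun h => Finset.disjoint_left.1 hAB he (h ▸ hf)
  have heB : e ∉ B := Finset.disjoint_left.1 hAB he
  have hfA : f ∉ A := fun h => Finset.disjoint_left.1 hAB h hf
  obtain ⟨h1, h2, h3, h4⟩ := mem_matchings.1 hm
  have hmf : m f = e := by rw [← hmef, h1]
  have hs : ∀ x, x ≠ e → x ≠ f → m x ≠ e ∧ m x ≠ f := fun x hxe hxf =>
    ⟨fun h => hxf (m.injective (h.trans hmf.symm)), fun h => hxe (m.injective (h.trans hmef.symm))⟩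
  have key : ∀ x, x ≠ e → x ≠ f → (m * swap e f) x = m x := fun x hxe hxf => by
    rw [Perm.mul_apply, swap_apply_of_ne_of_ne hxe hxf]
  have ke : (m * swap e f) e = e := by rw [Perm.mul_apply, swap_apply_left, hmf]
  have kf : (m * swap e f) f = f := by rw [Perm.mul_apply, swap_apply_right, hmef]
  refine mem_matchings.2 ⟨fun x => ?_, fun x hx => ?_, fun x hx => ?_, fun x hA hB => ?_⟩
  · by_cases hxe : x = e
    · rw [hxe, ke, ke]
    by_cases hxf : x = f
    · rw [hxf, kf, kf]
    rw [key x hxe hxf, key _ (hs x hxe hxf).1 (hs x hxe hxf).2, h1]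
  · obtain ⟨hxe, hx⟩ := mem_erase.1 hx
    have hxf : x ≠ f := fun h => hfA (h ▸ hx)
    rw [key x hxe hxf]
    exact mem_erase.2 ⟨(hs x hxe hxf).2, h2 x hx⟩
  · obtain ⟨hxf, hx⟩ := mem_erase.1 hx
    have hxe : x ≠ e := fun h => heB (h ▸ hx)
    rw [key x hxe hxf]
    exact mem_erase.2 ⟨(hs x hxe hxf).1, h3 x hx⟩
  · by_cases hxe : x = e
    · rw [hxe, ke]
    by_cases hxf : x = f
    · rw [hxf, kf]
    rw [key x hxe hxf]
    exact h4 x (fun h => hA (mem_erase.2 ⟨hxe, h⟩)) fun h => hB (mem_erase.2 ⟨hxf, h⟩)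

/-- Revealing the partner of `e`. -/
theorem sum_matchings {A B : Finset V} (hAB : _root_.Disjoint A B) {e : V} (he : e ∈ A)
    (g : Perm V → ℝ) :
    ∑ m ∈ matchings A B, g m =
      ∑ f ∈ B, ∑ m ∈ matchings (A.erase e) (B.erase f), g (m * swap e f) := by
  rw [← sum_fiberwise_of_maps_to (s := matchings A B) (t := B) (g := fun m => m e)
    (fun m hm => (mem_matchings.1 hm).2.1 e he)]
  refine sum_congr rfl fun f hf => ?_
  refine sum_bij' (fun m _ => m * swap e f) (fun m _ => m * swap e f) ?_ ?_ ?_ ?_ ?_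
  · intro m hm
    rw [mem_filter] at hm
    exact mul_swap_mem_matchings_erase hAB he hf hm.1 hm.2
  · intro m hm
    rw [mem_filter]
    exact mul_swap_mem_matchings hAB he hf hm
  · intro m _
    rw [mul_assoc, swap_mul_self, mul_one]
  · intro m _
    rw [mul_assoc, swap_mul_self, mul_one]
  · intro m _
    rw [mul_assoc, swap_mul_self, mul_one]

theorem card_matchings {A B : Finset V} (hAB : _root_.Disjoint A B) {r : ℕ} (hA : #A = r)
    (hB : #B = r) : #(matchings A B) = r.factorial := by
  induction r generalizing A B with
  | zero =>
    rw [card_eq_zero] at hA hB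
    subst hA hB
    rw [Nat.factorial_zero, card_eq_one]
    refine ⟨1, ?_⟩
    ext m
    rw [mem_singleton, mem_matchings]
    constructor
    · rintro ⟨-, -, -, h⟩
      ext x
      exact h x (by simp) (by simp)
    · rintro rfl
      simp
  | succ r ih =>
    obtain ⟨e, he⟩ : A.Nonempty := by
      rw [← card_pos]
      omega
    have h := sum_matchings hAB he (fun _ => 1)
    simp only [sum_const, nsmul_eq_mul, mul_one] at h
    have h2 : ∀ f ∈ B, ((#(matchings (A.erase e) (B.erase f)) : ℕ) : ℝ) = (r.factorial : ℝ) := by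
      intro f hf
      rw [ih (hAB.mono (erase_subset _ _) (erase_subset _ _)) (by rw [card_erase_of_mem he]; omega)
        (by rw [card_erase_of_mem hf]; omega)]
    rw [sum_congr rfl h2, sum_const, nsmul_eq_mul, hB] at h
    rw [Nat.factorial_succ]
    exact_mod_cast h

end Matchings

section SwapCycles

variable {V : Type*} [Fintype V] [DecidableEq V]

theorem swap_mul_apply_of_ne {Θ : Perm V} {e f x : V} (h1 : Θ x ≠ e) (h2 : Θ x ≠ f) :
    (swap e f * Θ) x = Θ x := by
  rw [Perm.mul_apply, swap_apply_of_ne_of_ne h1 h2]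

/-- A point not on the cycles of `e` and `f` keeps its cycle. -/
theorem sameCycle_swap_mul_of_not {Θ : Perm V} {e f x : V} (he : ¬ SameCycle Θ x e)
    (hf : ¬ SameCycle Θ x f) (y : V) : SameCycle (swap e f * Θ) x y ↔ SameCycle Θ x y := by
  have key : ∀ k : ℕ, ((swap e f * Θ) ^ k) x = (Θ ^ k) x := by
    intro k
    induction k with
    | zero => rfl
    | succ k ih =>
      rw [pow_succ', Perm.mul_apply, ih, pow_succ', Perm.mul_apply]
      have h : SameCycle Θ x (Θ ((Θ ^ k) x)) := ⟨(k + 1 : ℕ), by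
        rw [zpow_natCast, pow_succ', Perm.mul_apply]⟩
      exact swap_mul_apply_of_ne (fun h' => he (h' ▸ h)) fun h' => hf (h' ▸ h)
  constructor
  · intro h
    obtain ⟨k, -, hk⟩ := h.exists_pow_eq'
    exact ⟨k, by rw [zpow_natCast, ← key, hk]⟩
  · intro h
    obtain ⟨k, -, hk⟩ := h.exists_pow_eq'
    exact ⟨k, by rw [zpow_natCast, key, hk]⟩

/-- If `e` is not connected to `f`, the path of `e` from `e` on under `swap e f * Θ` covers the
`Θ`-cycle of `f`. -/
theorem sameCycle_swap_mul_left {Θ : Perm V} {e f : V} (h : ¬ SameCycle Θ e f) {y : V}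
    (hy : SameCycle Θ e y) : SameCycle (swap e f * Θ) e y := by
  obtain ⟨k, -, hk⟩ := hy.exists_pow_eq'
  have key : ∀ k : ℕ, SameCycle (swap e f * Θ) e ((Θ ^ k) e) := by
    intro k
    induction k with
    | zero => exact SameCycle.refl _ _
    | succ k ih =>
      rw [pow_succ', Perm.mul_apply]
      by_cases h1 : Θ ((Θ ^ k) e) = e
      · rw [h1]
      have h2 : Θ ((Θ ^ k) e) ≠ f := fun h2 => h ⟨(k + 1 : ℕ), by
        rw [zpow_natCast, pow_succ', Perm.mul_apply, h2]⟩
      rw [← swap_mul_apply_of_ne h1 h2]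
      exact ih.trans (sameCycle_apply_right.2 (SameCycle.refl _ _))
  rw [← hk]
  exact key k

theorem sameCycle_swap_mul_right {Θ : Perm V} {e f : V} (h : ¬ SameCycle Θ e f) {y : V}
    (hy : SameCycle Θ f y) : SameCycle (swap e f * Θ) f y := by
  rw [swap_comm]
  exact sameCycle_swap_mul_left (fun h' => h h'.symm) hy

theorem sameCycle_swap_mul_self {Θ : Perm V} {e f : V} (h : ¬ SameCycle Θ e f) :
    SameCycle (swap e f * Θ) e f := by
  have h1 : SameCycle (swap e f * Θ) f (Θ⁻¹ f) :=
    sameCycle_swap_mul_right h ⟨-1, by rw [zpow_neg_one]⟩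
  have h2 : (swap e f * Θ) (Θ⁻¹ f) = e := by
    rw [Perm.mul_apply, show Θ (Θ⁻¹ f) = f from Θ.apply_symm_apply f, swap_apply_right]
  have h3 : SameCycle (swap e f * Θ) (Θ⁻¹ f) e := by
    have h4 : SameCycle (swap e f * Θ) (Θ⁻¹ f) ((swap e f * Θ) (Θ⁻¹ f)) :=
      sameCycle_apply_right.2 (SameCycle.refl _ _)
    rwa [h2] at h4
  exact (h1.trans h3).symm

/-- Multiplying by a transposition of points on different cycles merges these two cycles. -/
theorem sameCycle_swap_mul_iff {Θ : Perm V} {e f : V} (h : ¬ SameCycle Θ e f) (x : V) :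
    SameCycle (swap e f * Θ) f x ↔ SameCycle Θ e x ∨ SameCycle Θ f x := by
  constructor
  · intro hx
    by_contra hno
    rw [not_or] at hno
    have h1 := (sameCycle_swap_mul_of_not (x := x) (fun h' => hno.1 h'.symm)
      (fun h' => hno.2 h'.symm) f).1 hx.symm
    exact hno.2 h1.symm
  · rintro (hx | hx)
    · exact (sameCycle_swap_mul_self h).symm.trans (sameCycle_swap_mul_left h hx)
    · exact sameCycle_swap_mul_right h hx

/-- The first time the path of `e` meets `f`. -/
theorem exists_first_pow {Θ : Perm V} {e f : V} (hef : e ≠ f) (h : SameCycle Θ e f) :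
    ∃ k : ℕ, 0 < k ∧ (Θ ^ k) e = f ∧ ∀ i, 0 < i → i < k → (Θ ^ i) e ≠ f ∧ (Θ ^ i) e ≠ e := by
  classical
  obtain ⟨k0, -, hk0⟩ := h.exists_pow_eq'
  have hex : ∃ k : ℕ, (Θ ^ k) e = f := ⟨k0, hk0⟩
  refine ⟨Nat.find hex, ?_, Nat.find_spec hex, fun i hi hik => ⟨Nat.find_min hex hik, fun he => ?_⟩⟩
  · rw [Nat.pos_iff_ne_zero]
    intro h0
    have := Nat.find_spec hex
    rw [h0, pow_zero] at this
    exact hef this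
  · have h1 : (Θ ^ (Nat.find hex - i)) e = f := by
      have := Nat.find_spec hex
      conv at this => lhs; rw [show Nat.find hex = (Nat.find hex - i) + i by omega, pow_add,
        Perm.mul_apply, he]
      exact this
    exact Nat.find_min hex (by omega) h1

/-- The cycle cut off by a transposition of two points on the same cycle. -/
theorem sameCycle_split_iff {Θ : Perm V} {e f : V} {k : ℕ} (hk : 0 < k) (hkf : (Θ ^ k) e = f)
    (hmin : ∀ i, 0 < i → i < k → (Θ ^ i) e ≠ f ∧ (Θ ^ i) e ≠ e) (x : V) :
    SameCycle (swap e f * Θ) e x ↔ ∃ i < k, (Θ ^ i) e = x := by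
  have h1 : ∀ i < k, ((swap e f * Θ) ^ i) e = (Θ ^ i) e := by
    intro i
    induction i with
    | zero => intro _; rfl
    | succ i ih =>
      intro hi
      have := hmin (i + 1) (by omega) hi
      rw [pow_succ', Perm.mul_apply] at this
      rw [pow_succ', Perm.mul_apply, ih (by omega), swap_mul_apply_of_ne this.2 this.1,
        pow_succ', Perm.mul_apply]
  have h2 : ((swap e f * Θ) ^ k) e = e := by
    obtain ⟨j, rfl⟩ : ∃ j, k = j + 1 := ⟨k - 1, by omega⟩
    rw [pow_succ', Perm.mul_apply] at hkf
    rw [pow_succ', Perm.mul_apply, h1 j (by omega), Perm.mul_apply, hkf, swap_apply_right]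
  constructor
  · intro hx
    obtain ⟨m, -, hm⟩ := hx.exists_pow_eq'
    refine ⟨m % k, Nat.mod_lt _ hk, ?_⟩
    rw [← h1 _ (Nat.mod_lt _ hk), ← hm]
    conv_rhs => rw [← Nat.mod_add_div m k, pow_add, Perm.mul_apply, pow_mul]
    have h3 : ∀ l : ℕ, (((swap e f * Θ) ^ k) ^ l) e = e := fun l => by
      induction l with
      | zero => rfl
      | succ l ih => rw [pow_succ', Perm.mul_apply, ih, h2]
    rw [h3]
  · rintro ⟨i, hi, rfl⟩
    exact ⟨i, by rw [zpow_natCast, h1 i hi]⟩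

theorem not_sameCycle_swap_mul {Θ : Perm V} {e f : V} (hef : e ≠ f) (h : SameCycle Θ e f) :
    ¬ SameCycle (swap e f * Θ) e f := by
  obtain ⟨k, hk, hkf, hmin⟩ := exists_first_pow hef h
  rw [sameCycle_split_iff hk hkf hmin]
  rintro ⟨i, hi, hif⟩
  rcases Nat.eq_zero_or_pos i with rfl | hi0
  · exact hef hif
  · exact (hmin i hi0 hi).1 hif

/-- Multiplying by a transposition of points on the same cycle splits this cycle. -/
theorem sameCycle_iff_split {Θ : Perm V} {e f : V} (hef : e ≠ f) (h : SameCycle Θ e f) (x : V) :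
    SameCycle Θ f x ↔ SameCycle (swap e f * Θ) e x ∨ SameCycle (swap e f * Θ) f x := by
  have := sameCycle_swap_mul_iff (not_sameCycle_swap_mul hef h) x
  rwa [← mul_assoc, swap_mul_self, one_mul] at this

/-- `v ∈ D` and `W` is the first return time of `v` to `D` under `Θ`. -/
def FirstReturn (Θ : Perm V) (D : Finset V) (v : V) (W : ℕ) : Prop :=
  v ∈ D ∧ 0 < W ∧ (Θ ^ W) v ∈ D ∧ ∀ k, 0 < k → k < W → (Θ ^ k) v ∉ D

theorem exists_firstReturn (Θ : Perm V) {D : Finset V} {v : V} (hv : v ∈ D) :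
    ∃ W, FirstReturn Θ D v W := by
  classical
  have hex : ∃ k : ℕ, 0 < k ∧ (Θ ^ k) v ∈ D :=
    ⟨orderOf Θ, orderOf_pos Θ, by rw [pow_orderOf_eq_one]; exact hv⟩
  refine ⟨Nat.find hex, hv, (Nat.find_spec hex).1, (Nat.find_spec hex).2, fun k hk hkW h => ?_⟩
  exact Nat.find_min hex hkW ⟨hk, h⟩

/-- As long as `Θ` stays outside the support of `m`, `m * Θ` follows `Θ`. -/
theorem mul_pow_apply_eq {Θ m : Perm V} {D : Finset V} (hm : ∀ x, x ∉ D → m x = x) {v : V} {W : ℕ}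
    (h : ∀ k, 0 < k → k < W → (Θ ^ k) v ∉ D) {k : ℕ} (hk : k < W) :
    ((m * Θ) ^ k) v = (Θ ^ k) v := by
  induction k with
  | zero => rfl
  | succ k ih =>
    have h1 := h (k + 1) (by omega) hk
    rw [pow_succ', Perm.mul_apply] at h1
    rw [pow_succ', Perm.mul_apply, ih (by omega), pow_succ', Perm.mul_apply, Perm.mul_apply, hm _ h1]

theorem minimalPeriod_pos_perm (Φ : Perm V) (v : V) : 0 < Function.minimalPeriod Φ v := by
  apply Function.minimalPeriod_pos_of_mem_periodicPts
  refine ⟨orderOf Φ, orderOf_pos Φ, ?_⟩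
  rw [Function.IsPeriodicPt, iterate_eq_pow, pow_orderOf_eq_one]
  rfl

theorem le_minimalPeriod {Φ : Perm V} {v : V} {W : ℕ}
    (h : ∀ k, 0 < k → k < W → (Φ ^ k) v ≠ v) : W ≤ Function.minimalPeriod Φ v := by
  by_contra hlt
  rw [not_le] at hlt
  refine h _ (minimalPeriod_pos_perm Φ v) hlt ?_
  rw [← iterate_eq_pow]
  exact Function.iterate_minimalPeriod

theorem minimalPeriod_eq_of_sameCycle {Φ : Perm V} {x y : V} (h : SameCycle Φ x y) :
    Function.minimalPeriod Φ x = Function.minimalPeriod Φ y := by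
  obtain ⟨k, -, hk⟩ := h.exists_pow_eq'
  rw [← hk, ← iterate_eq_pow, Function.minimalPeriod_apply_iterate]
  rw [← Function.minimalPeriod_pos_iff_mem_periodicPts]
  exact minimalPeriod_pos_perm Φ x

theorem FirstReturn.le_minimalPeriod {Θ m : Perm V} {D : Finset V} {v : V} {W : ℕ}
    (h : FirstReturn Θ D v W) (hm : ∀ x, x ∉ D → m x = x) :
    W ≤ Function.minimalPeriod (m * Θ : Perm V) v := by
  refine RandGen.le_minimalPeriod fun k hk hkW he => ?_
  rw [mul_pow_apply_eq hm h.2.2.2 hkW] at he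
  exact h.2.2.2 k hk hkW (by rw [he]; exact h.1)

/-- The stretch of `v` under `swap e f * Θ`, when `e` is the first return point of `v`. -/
theorem swap_mul_pow_apply {Θ : Perm V} {D : Finset V} {v f : V} {W : ℕ} (h : FirstReturn Θ D v W)
    (hf : f ∈ D) {k : ℕ} (hk : k ≤ W) :
    ((swap ((Θ ^ W) v) f * Θ) ^ k) v = if k = W then f else (Θ ^ k) v := by
  have h1 : ∀ k < W, ((swap ((Θ ^ W) v) f * Θ) ^ k) v = (Θ ^ k) v := by
    intro k hk
    refine mul_pow_apply_eq (D := D) (fun x hx => ?_) h.2.2.2 hk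
    exact swap_apply_of_ne_of_ne (fun he => hx (he ▸ h.2.2.1)) fun he => hx (he ▸ hf)
  split_ifs with hkW
  · subst hkW
    have hW := h.2.1
    obtain ⟨j, rfl⟩ : ∃ j, k = j + 1 := ⟨k - 1, by omega⟩
    rw [pow_succ', Perm.mul_apply, h1 j (by omega), Perm.mul_apply, pow_succ', Perm.mul_apply,
      swap_apply_left]
  · exact h1 k (by omega)

theorem sameCycle_swap_mul_firstReturn {Θ : Perm V} {D : Finset V} {v f : V} {W : ℕ}
    (h : FirstReturn Θ D v W) (hf : f ∈ D) : SameCycle (swap ((Θ ^ W) v) f * Θ) v f :=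
  ⟨W, by rw [zpow_natCast, swap_mul_pow_apply h hf le_rfl, if_pos rfl]⟩

/-- Closing the stretch. -/
theorem minimalPeriod_of_close {Θ m : Perm V} {D : Finset V} {v : V} {W : ℕ}
    (h : FirstReturn Θ D v W) (hm : ∀ x, x ∉ (D.erase ((Θ ^ W) v)).erase v → m x = x) :
    Function.minimalPeriod (m * (swap ((Θ ^ W) v) v * Θ) : Perm V) v = W := by
  have hp : ∀ k ≤ W, ((m * (swap ((Θ ^ W) v) v * Θ)) ^ k) v = if k = W then v else (Θ ^ k) v := by
    intro k hk
    rw [mul_pow_apply_eq (W := W + 1) (D := (D.erase ((Θ ^ W) v)).erase v) hm ?_ (by omega),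
      swap_mul_pow_apply h h.1 hk]
    intro k hk0 hkW
    rw [swap_mul_pow_apply h h.1 (by omega)]
    split_ifs with hh
    · simp
    · intro hmem
      exact h.2.2.2 k hk0 (by omega) (mem_of_mem_erase (mem_of_mem_erase hmem))
  apply le_antisymm
  · apply Function.IsPeriodicPt.minimalPeriod_le h.2.1
    rw [Function.IsPeriodicPt, iterate_eq_pow, Function.IsFixedPt, hp W le_rfl, if_pos rfl]
  · refine RandGen.le_minimalPeriod fun k hk hkW he => ?_
    rw [hp k hkW.le, if_neg (by omega)] at he
    exact h.2.2.2 k hk hkW (by rw [he]; exact h.1)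

/-- If the stretch does not close, it gets longer. -/
theorem exists_firstReturn_swap {Θ : Perm V} {D : Finset V} {v f : V} {W : ℕ}
    (h : FirstReturn Θ D v W) (hf : f ∈ D)
    (hx : ∃ x ∈ (D.erase ((Θ ^ W) v)).erase f, SameCycle (swap ((Θ ^ W) v) f * Θ) f x) :
    ∃ v' W', FirstReturn (swap ((Θ ^ W) v) f * Θ) ((D.erase ((Θ ^ W) v)).erase f) v' W' ∧
      W < W' ∧ SameCycle (swap ((Θ ^ W) v) f * Θ) v' f ∧
      ∀ m : Perm V, (∀ x, x ∉ (D.erase ((Θ ^ W) v)).erase f → m x = x) →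
        Function.minimalPeriod (m * (swap ((Θ ^ W) v) f * Θ) : Perm V) v =
          Function.minimalPeriod (m * (swap ((Θ ^ W) v) f * Θ) : Perm V) v' := by
  classical
  set Ψ := swap ((Θ ^ W) v) f * Θ with hΨ
  set D' := (D.erase ((Θ ^ W) v)).erase f with hD'
  have hvf : SameCycle Ψ v f := sameCycle_swap_mul_firstReturn h hf
  obtain ⟨x, hxD, hxf⟩ := hx
  obtain ⟨j0, -, hj0⟩ := ((hvf.trans hxf).symm).exists_pow_eq'
  have hex : ∃ j : ℕ, ∃ y ∈ D', (Ψ ^ j) y = v := ⟨j0, x, hxD, hj0⟩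
  obtain ⟨v', hv'D, hv'⟩ := Nat.find_spec hex
  set j := Nat.find hex with hj
  have hdead1 : ∀ k, 0 < k → k ≤ j → (Ψ ^ k) v' ∉ D' := by
    intro k hk hkj hmem
    refine Nat.find_min hex (m := j - k) (by omega) ⟨_, hmem, ?_⟩
    rw [← Perm.mul_apply, ← pow_add, show j - k + k = j by omega, hv']
  have hdead : ∀ k, 0 < k → k ≤ W + j → (Ψ ^ k) v' ∉ D' := by
    intro k hk hkj
    by_cases hk1 : k ≤ j
    · exact hdead1 k hk hk1
    rw [show k = (k - j) + j by omega, pow_add, Perm.mul_apply, hv',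
      swap_mul_pow_apply h hf (by omega)]
    split_ifs with hh
    · simp [hD']
    · intro hmem
      exact h.2.2.2 (k - j) (by omega) (by omega) (mem_of_mem_erase (mem_of_mem_erase hmem))
  obtain ⟨W', hW'⟩ := exists_firstReturn Ψ hv'D
  refine ⟨v', W', hW', ?_, ?_, fun m hm => ?_⟩
  · by_contra hle
    exact hdead W' hW'.2.1 (by omega) hW'.2.2.1
  · exact SameCycle.trans ⟨j, by rw [zpow_natCast, hv']⟩ hvf
  · refine (minimalPeriod_eq_of_sameCycle ⟨j, ?_⟩).symm
    rw [zpow_natCast, mul_pow_apply_eq (W := j + 1) hm (fun k hk hk' => hdead1 k hk (by omega))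
      (by omega), hv']

end SwapCycles

section Alive

variable {V : Type*} [Fintype V] [DecidableEq V]

/-- The points of `D` on the cycle of `x`. -/
def onCyc (Θ : Perm V) (D : Finset V) (x : V) : Finset V := D.filter fun y => SameCycle Θ x y

/-- The points of `D` which are alone in `D` on their cycle, off the cycle of `v`. -/
def offOne (Θ : Perm V) (D : Finset V) (v : V) : Finset V :=
  D.filter fun x => ¬ SameCycle Θ v x ∧ #(onCyc Θ D x) = 1

/-- The points of `B` on cycles with two points of `D`, off the cycle of `v`. -/
def offTwo (Θ : Perm V) (D B : Finset V) (v : V) : Finset V :=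
  B.filter fun x => ¬ SameCycle Θ v x ∧ #(onCyc Θ D x) = 2

variable {Θ : Perm V} {D : Finset V}

theorem mem_onCyc {x y : V} : y ∈ onCyc Θ D x ↔ y ∈ D ∧ SameCycle Θ x y := by
  simp [onCyc]

theorem sameCycle_congr {x y : V} (h : SameCycle Θ x y) (z : V) :
    SameCycle Θ x z ↔ SameCycle Θ y z := ⟨fun h' => h.symm.trans h', fun h' => h.trans h'⟩

theorem onCyc_congr {x y : V} (h : SameCycle Θ x y) : onCyc Θ D x = onCyc Θ D y := by
  ext z
  rw [mem_onCyc, mem_onCyc, sameCycle_congr h]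

theorem offOne_congr {x y : V} (h : SameCycle Θ x y) : offOne Θ D x = offOne Θ D y := by
  ext z
  simp only [offOne, mem_filter, sameCycle_congr h]

theorem offTwo_congr {B : Finset V} {x y : V} (h : SameCycle Θ x y) :
    offTwo Θ D B x = offTwo Θ D B y := by
  ext z
  simp only [offTwo, mem_filter, sameCycle_congr h]

theorem mem_erase_erase {e f x : V} : x ∈ (D.erase e).erase f ↔ x ≠ f ∧ x ≠ e ∧ x ∈ D := by
  rw [mem_erase, mem_erase]

theorem onCyc_swap_mul_of_not {e f x : V} (he : ¬ SameCycle Θ e x) (hf : ¬ SameCycle Θ f x) :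
    onCyc (swap e f * Θ) ((D.erase e).erase f) x = onCyc Θ D x := by
  ext y
  rw [mem_onCyc, mem_onCyc, mem_erase_erase,
    sameCycle_swap_mul_of_not (fun h => he h.symm) (fun h => hf h.symm)]
  constructor
  · exact fun h => ⟨h.1.2.2, h.2⟩
  · refine fun h => ⟨⟨fun hy => hf ?_, fun hy => he ?_, h.1⟩, h.2⟩
    · exact hy ▸ h.2.symm
    · exact hy ▸ h.2.symm

theorem card_onCyc_merge {e f : V} (h : ¬ SameCycle Θ e f) (he : e ∈ D) (hf : f ∈ D) :
    #(onCyc (swap e f * Θ) ((D.erase e).erase f) f) + 2 = #(onCyc Θ D e) + #(onCyc Θ D f) := by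
  have hd : _root_.Disjoint (onCyc Θ D e) (onCyc Θ D f) := by
    rw [Finset.disjoint_left]
    intro x hx hx'
    exact h ((mem_onCyc.1 hx).2.trans (mem_onCyc.1 hx').2.symm)
  have h1 : onCyc (swap e f * Θ) ((D.erase e).erase f) f =
      ((onCyc Θ D e ∪ onCyc Θ D f).erase e).erase f := by
    ext x
    rw [mem_onCyc, mem_erase_erase, mem_erase_erase, mem_union, mem_onCyc, mem_onCyc,
      sameCycle_swap_mul_iff h]
    tauto
  have hef : f ≠ e := fun h' => h (h' ▸ SameCycle.refl _ _)
  have m1 : e ∈ onCyc Θ D e ∪ onCyc Θ D f := mem_union_left _ (mem_onCyc.2 ⟨he, SameCycle.refl _ _⟩)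
  have m2 : f ∈ (onCyc Θ D e ∪ onCyc Θ D f).erase e :=
    mem_erase.2 ⟨hef, mem_union_right _ (mem_onCyc.2 ⟨hf, SameCycle.refl _ _⟩)⟩
  rw [h1, ← card_union_of_disjoint hd]
  have c1 := card_erase_add_one m1
  have c2 := card_erase_add_one m2
  omega

theorem off_of_merge {e f x : V} (h : ¬ SameCycle Θ e f) (hx : ¬ SameCycle (swap e f * Θ) f x) :
    ¬ SameCycle Θ e x ∧ ¬ SameCycle Θ f x := by
  rw [sameCycle_swap_mul_iff h] at hx
  tauto

theorem offOne_merge {e f : V} (h : ¬ SameCycle Θ e f) :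
    offOne (swap e f * Θ) ((D.erase e).erase f) f ⊆ offOne Θ D e := by
  intro x hx
  rw [offOne, mem_filter, mem_erase_erase] at hx
  obtain ⟨h1, h2⟩ := off_of_merge h hx.2.1
  rw [offOne, mem_filter, ← onCyc_swap_mul_of_not h1 h2]
  exact ⟨hx.1.2.2, h1, hx.2.2⟩

theorem offTwo_merge {e f : V} (h : ¬ SameCycle Θ e f) {B B' : Finset V} (hB : B' ⊆ B) :
    offTwo (swap e f * Θ) ((D.erase e).erase f) B' f ⊆ offTwo Θ D B e := by
  intro x hx
  rw [offTwo, mem_filter] at hx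
  obtain ⟨h1, h2⟩ := off_of_merge h hx.2.1
  rw [offTwo, mem_filter, ← onCyc_swap_mul_of_not h1 h2]
  exact ⟨hB hx.1, h1, hx.2.2⟩

theorem card_onCyc_split {e f : V} (hef : e ≠ f) (h : SameCycle Θ e f) (he : e ∈ D) (hf : f ∈ D) :
    #(onCyc Θ D e) = #(onCyc (swap e f * Θ) ((D.erase e).erase f) e) +
      #(onCyc (swap e f * Θ) ((D.erase e).erase f) f) + 2 := by
  have hn := not_sameCycle_swap_mul hef h
  have hd : _root_.Disjoint (onCyc (swap e f * Θ) ((D.erase e).erase f) e)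
      (onCyc (swap e f * Θ) ((D.erase e).erase f) f) := by
    rw [Finset.disjoint_left]
    intro x hx hx'
    exact hn ((mem_onCyc.1 hx).2.trans (mem_onCyc.1 hx').2.symm)
  rw [onCyc_congr h]
  have h1 : onCyc (swap e f * Θ) ((D.erase e).erase f) e ∪
      onCyc (swap e f * Θ) ((D.erase e).erase f) f = ((onCyc Θ D f).erase e).erase f := by
    ext x
    rw [mem_union, mem_onCyc, mem_onCyc, mem_erase_erase, mem_erase_erase, mem_onCyc,
      sameCycle_iff_split hef h]
    tauto
  have m1 : e ∈ onCyc Θ D f := mem_onCyc.2 ⟨he, h.symm⟩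
  have m2 : f ∈ (onCyc Θ D f).erase e := mem_erase.2 ⟨hef.symm, mem_onCyc.2 ⟨hf, SameCycle.refl _ _⟩⟩
  rw [← card_union_of_disjoint hd, h1]
  have c1 := card_erase_add_one m1
  have c2 := card_erase_add_one m2
  omega

theorem off_of_split {e f x : V} (hef : e ≠ f) (h : SameCycle Θ e f)
    (hx : ¬ SameCycle (swap e f * Θ) f x) (hx' : ¬ SameCycle (swap e f * Θ) e x) :
    ¬ SameCycle Θ e x ∧ ¬ SameCycle Θ f x := by
  have := sameCycle_iff_split hef h x
  rw [sameCycle_congr h]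
  tauto

theorem offOne_split {e f : V} (hef : e ≠ f) (h : SameCycle Θ e f) :
    #(offOne (swap e f * Θ) ((D.erase e).erase f) f) ≤ #(offOne Θ D e) +
      if #(onCyc (swap e f * Θ) ((D.erase e).erase f) e) = 1 then 1 else 0 := by
  have hsub : offOne (swap e f * Θ) ((D.erase e).erase f) f ⊆ offOne Θ D e ∪
      if #(onCyc (swap e f * Θ) ((D.erase e).erase f) e) = 1 then
        onCyc (swap e f * Θ) ((D.erase e).erase f) e else ∅ := by
    intro x hx
    rw [offOne, mem_filter] at hx
    rw [mem_union]
    by_cases hex : SameCycle (swap e f * Θ) e x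
    · right
      rw [onCyc_congr hex, if_pos hx.2.2, ← onCyc_congr hex]
      exact mem_onCyc.2 ⟨hx.1, hex⟩
    · left
      obtain ⟨h1, h2⟩ := off_of_split hef h hx.2.1 hex
      rw [offOne, mem_filter, ← onCyc_swap_mul_of_not h1 h2]
      exact ⟨(mem_erase_erase.1 hx.1).2.2, h1, hx.2.2⟩
  refine (card_le_card hsub).trans ((card_union_le _ _).trans ?_)
  split_ifs with h1
  · rw [h1]
  · simp

theorem offTwo_split {e f : V} (hef : e ≠ f) (h : SameCycle Θ e f) {B B' : Finset V} (hB : B' ⊆ B)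
    (hD : B' ⊆ (D.erase e).erase f) :
    #(offTwo (swap e f * Θ) ((D.erase e).erase f) B' f) ≤ #(offTwo Θ D B e) + 2 := by
  have hsub : offTwo (swap e f * Θ) ((D.erase e).erase f) B' f ⊆ offTwo Θ D B e ∪
      if #(onCyc (swap e f * Θ) ((D.erase e).erase f) e) = 2 then
        onCyc (swap e f * Θ) ((D.erase e).erase f) e else ∅ := by
    intro x hx
    rw [offTwo, mem_filter] at hx
    rw [mem_union]
    by_cases hex : SameCycle (swap e f * Θ) e x
    · right
      rw [onCyc_congr hex, if_pos hx.2.2, ← onCyc_congr hex]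
      exact mem_onCyc.2 ⟨hD hx.1, hex⟩
    · left
      obtain ⟨h1, h2⟩ := off_of_split hef h hx.2.1 hex
      rw [offTwo, mem_filter, ← onCyc_swap_mul_of_not h1 h2]
      exact ⟨hB hx.1, h1, hx.2.2⟩
  refine (card_le_card hsub).trans ((card_union_le _ _).trans ?_)
  split_ifs with h1
  · rw [h1]
  · simp

theorem onCyc_split_eq {e f : V} {k : ℕ} (hk : 0 < k) (hkf : (Θ ^ k) e = f)
    (hmin : ∀ i, 0 < i → i < k → (Θ ^ i) e ≠ f ∧ (Θ ^ i) e ≠ e) (y : V) :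
    y ∈ onCyc (swap e f * Θ) ((D.erase e).erase f) e ↔ y ∈ D ∧ ∃ i, 0 < i ∧ i < k ∧ (Θ ^ i) e = y := by
  rw [mem_onCyc, mem_erase_erase, sameCycle_split_iff hk hkf hmin]
  constructor
  · rintro ⟨⟨-, hye, hyD⟩, i, hi, rfl⟩
    refine ⟨hyD, i, Nat.pos_of_ne_zero fun h0 => hye ?_, hi, rfl⟩
    rw [h0]
    rfl
  · rintro ⟨hyD, i, hi0, hi, rfl⟩
    exact ⟨⟨(hmin i hi0 hi).1, (hmin i hi0 hi).2, hyD⟩, i, hi, rfl⟩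

/-- Different splitting points cut off different numbers of points of `D`. -/
theorem card_onCyc_split_injective {e f g : V} (hf : SameCycle Θ e f) (hg : SameCycle Θ e g)
    (hef : e ≠ f) (heg : e ≠ g) (hfD : f ∈ D) (hgD : g ∈ D)
    (h : #(onCyc (swap e f * Θ) ((D.erase e).erase f) e) =
      #(onCyc (swap e g * Θ) ((D.erase e).erase g) e)) : f = g := by
  obtain ⟨k, hk, hkf, hmin⟩ := exists_first_pow hef hf
  obtain ⟨l, hl, hlg, hmin'⟩ := exists_first_pow heg hg
  have key : ∀ {f g : V} {k l : ℕ}, f ∈ D → 0 < k → (Θ ^ k) e = f →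
      (∀ i, 0 < i → i < k → (Θ ^ i) e ≠ f ∧ (Θ ^ i) e ≠ e) → 0 < l → (Θ ^ l) e = g →
      (∀ i, 0 < i → i < l → (Θ ^ i) e ≠ g ∧ (Θ ^ i) e ≠ e) → k < l →
      #(onCyc (swap e f * Θ) ((D.erase e).erase f) e) <
      #(onCyc (swap e g * Θ) ((D.erase e).erase g) e) := by
    intro f g k l hfD hk hkf hmin hl hlg hmin' hkl
    apply card_lt_card
    rw [Finset.ssubset_iff_of_subset]
    · refine ⟨f, (onCyc_split_eq hl hlg hmin' f).2 ⟨hfD, k, hk, hkl, hkf⟩, fun hmem => ?_⟩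
      obtain ⟨-, i, hi0, hi, hif⟩ := (onCyc_split_eq hk hkf hmin f).1 hmem
      exact (hmin i hi0 hi).1 hif
    · intro y hy
      obtain ⟨hyD, i, hi0, hi, hiy⟩ := (onCyc_split_eq hk hkf hmin y).1 hy
      exact (onCyc_split_eq hl hlg hmin' y).2 ⟨hyD, i, hi0, hi.trans hkl, hiy⟩
  rcases lt_trichotomy k l with hkl | hkl | hkl
  · exact absurd h (key hfD hk hkf hmin hl hlg hmin' hkl).ne
  · rw [← hkf, ← hlg, hkl]
  · exact absurd h (key hgD hl hlg hmin' hk hkf hmin hkl).ne'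

end Alive

section Explore

variable {V : Type*} [Fintype V] [DecidableEq V]

/-- The bound for the mean of `ψ` at the length of a cycle which is explored from a stretch of
length `W` with `s` free points, when there are `F` free points alone on other cycles. -/
noncomputable def exploreBound (ρ l : ℝ) (K M : ℕ) (ψ φ : ℕ → ℝ) (W s F : ℕ) : ℝ :=
  (∑ N ∈ Icc W M, ψ N) / ρ + 2 * l / ρ * ∑ N ∈ Icc W M, φ N + l ^ s * φ W +
    φ 0 * (2 ^ F / 2 ^ K) * (1 + 1 / ρ) ^ (M + 1 - W)

theorem sum_pow_le_of_injOn {ι : Type*} {T : Finset ι} {s : ι → ℕ} {l : ℝ} (hl : 0 < l)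
    (hl2 : l ≤ 1 / 2) (hs : Set.InjOn s T) (h1 : ∀ f ∈ T, 1 ≤ s f) :
    ∑ f ∈ T, l ^ s f ≤ 2 * l := by
  have h2 : ∑ f ∈ T, l ^ s f = l * ∑ j ∈ T.image fun f => s f - 1, l ^ j := by
    rw [sum_image, mul_sum]
    · refine sum_congr rfl fun f hf => ?_
      have := h1 f hf
      rw [← pow_succ', Nat.sub_add_cancel this]
    · intro f hf g hg hfg
      have hf' := h1 f hf
      have hg' := h1 g hg
      apply hs hf hg
      simp only at hfg
      omega
  have h3 : ∑ j ∈ T.image fun f => s f - 1, l ^ j ≤ (1 - l)⁻¹ := by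
    rw [← tsum_geometric_of_lt_one hl.le (by linarith)]
    exact (summable_geometric_of_lt_one hl.le (by linarith)).sum_le_tsum _
      fun i _ => pow_nonneg hl.le i
  have h4 : (1 - l)⁻¹ ≤ 2 := by
    rw [inv_le_comm₀ (by linarith) (by norm_num)]
    linarith
  rw [h2]
  nlinarith

theorem union_erase_erase {A B : Finset V} (hAB : _root_.Disjoint A B) {e f : V} (he : e ∈ A)
    (hf : f ∈ B) : ((A ∪ B).erase e).erase f = A.erase e ∪ B.erase f := by
  have heB : e ∉ B := Finset.disjoint_left.1 hAB he
  have hfA : f ∉ A := fun h => Finset.disjoint_left.1 hAB h hf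
  ext x
  rw [mem_erase_erase, mem_union, mem_union, mem_erase, mem_erase]
  constructor
  · tauto
  · rintro (⟨h1, h2⟩ | ⟨h1, h2⟩)
    · exact ⟨fun h => hfA (h ▸ h2), h1, Or.inl h2⟩
    · exact ⟨h1, fun h => heB (h ▸ h2), Or.inr h2⟩

variable {ρ l η : ℝ} {K M : ℕ} {ψ φ : ℕ → ℝ}

/-- The weights of the free points that can be joined to `e`. -/
theorem sum_pow_onCyc_le (hρ : 0 < ρ) (hl : 0 < l) (hl2 : l ≤ 1 / 2)
    (hη : K / (ρ * l) + η + l ≤ 1) {Θ : Perm V} {D B : Finset V} {v : V} {W : ℕ}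
    (h : FirstReturn Θ D v W) (hBD : B ⊆ D) (heB : (Θ ^ W) v ∉ B) (hρB : ρ ≤ #B)
    (hF : #(offOne Θ D v) ≤ K) (hG : (#(offTwo Θ D B v) : ℝ) ≤ η * ρ) :
    ∑ f ∈ B.erase v, l ^ #(onCyc (swap ((Θ ^ W) v) f * Θ) ((D.erase ((Θ ^ W) v)).erase f) f) ≤
      2 * l + #B * l ^ #(onCyc Θ D v) := by
  set e := (Θ ^ W) v with he
  have hve : SameCycle Θ v e := ⟨W, by rw [zpow_natCast]⟩
  have heD : e ∈ D := h.2.2.1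
  have hne : ∀ f ∈ B, e ≠ f := fun f hf h => heB (h ▸ hf)
  have hs1 : 1 ≤ #(onCyc Θ D v) := card_pos.2 ⟨v, mem_onCyc.2 ⟨h.1, SameCycle.refl _ _⟩⟩
  rw [← sum_filter_add_sum_filter_not (B.erase v) fun f => SameCycle Θ e f]
  refine add_le_add ?_ ?_
  · apply sum_pow_le_of_injOn hl hl2
    · intro f hf g hg hfg
      rw [Finset.mem_coe, mem_filter, mem_erase] at hf hg
      have c1 := card_onCyc_split (hne f hf.1.2) hf.2 heD (hBD hf.1.2)
      have c2 := card_onCyc_split (hne g hg.1.2) hg.2 heD (hBD hg.1.2)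
      refine card_onCyc_split_injective hf.2 hg.2 (hne f hf.1.2) (hne g hg.1.2) (hBD hf.1.2)
        (hBD hg.1.2) ?_
      simp only at hfg
      omega
    · intro f hf
      rw [mem_filter, mem_erase] at hf
      refine card_pos.2 ⟨v, mem_onCyc.2 ⟨mem_erase_erase.2 ⟨fun h => hf.1.1 h.symm, ?_, h.1⟩,
        (sameCycle_swap_mul_firstReturn h (hBD hf.1.2)).symm⟩⟩
      intro hve'
      have h1 := sameCycle_swap_mul_firstReturn h (hBD hf.1.2)
      rw [← he, hve'] at h1
      exact not_sameCycle_swap_mul (hne f hf.1.2) hf.2 h1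
  · have hterm : ∀ f ∈ (B.erase v).filter fun f => ¬ SameCycle Θ e f,
        l ^ #(onCyc (swap e f * Θ) ((D.erase e).erase f) f) ≤ l ^ #(onCyc Θ D v) *
          ((if f ∈ offOne Θ D v then 1 / l else 0) + (if f ∈ offTwo Θ D B v then 1 else 0) + l) := by
      intro f hf
      rw [mem_filter, mem_erase] at hf
      have hfD := hBD hf.1.2
      have c := card_onCyc_merge hf.2 heD hfD
      rw [← onCyc_congr hve] at c
      have hvf : ¬ SameCycle Θ v f := fun h' => hf.2 (hve.symm.trans h')
      have ht1 : 1 ≤ #(onCyc Θ D f) := card_pos.2 ⟨f, mem_onCyc.2 ⟨hfD, SameCycle.refl _ _⟩⟩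
      set s' := #(onCyc (swap e f * Θ) ((D.erase e).erase f) f)
      set s := #(onCyc Θ D v)
      have m1 : f ∈ offOne Θ D v ↔ #(onCyc Θ D f) = 1 := by simp [offOne, hfD, hvf]
      have m2 : f ∈ offTwo Θ D B v ↔ #(onCyc Θ D f) = 2 := by simp [offTwo, hf.1.2, hvf]
      simp only [m1, m2]
      have hls : 0 < l ^ s := pow_pos hl s
      rcases Nat.lt_or_ge 2 #(onCyc Θ D f) with h3 | h3
      · rw [if_neg (by omega), if_neg (by omega), zero_add, zero_add, ← pow_succ]
        exact pow_le_pow_of_le_one hl.le (by linarith) (by omega)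
      · interval_cases #(onCyc Θ D f)
        · rw [if_pos rfl, if_neg (by omega), add_zero]
          have : l ^ s = l ^ s' * l := by rw [← pow_succ]; congr 1; omega
          rw [mul_add, this]
          have h0 : 0 < l ^ s' := pow_pos hl _
          have : l ^ s' * l * (1 / l) = l ^ s' := by field_simp
          nlinarith [mul_pos (mul_pos h0 hl) hl]
        · rw [if_neg (by omega), if_pos rfl, zero_add, show s' = s by omega]
          nlinarith
    refine (sum_le_sum hterm).trans ?_
    rw [← mul_sum, mul_comm (#B : ℝ)]
    refine mul_le_mul_of_nonneg_left ?_ (pow_nonneg hl.le _)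
    have hsub : (B.erase v).filter (fun f => ¬ SameCycle Θ e f) ⊆ B :=
      (filter_subset _ _).trans (erase_subset _ _)
    have hnn : ∀ f ∈ B, f ∉ (B.erase v).filter (fun f => ¬ SameCycle Θ e f) →
        0 ≤ (if f ∈ offOne Θ D v then 1 / l else 0) + (if f ∈ offTwo Θ D B v then 1 else 0) + l := by
      intro f _ _
      have : 0 < 1 / l := by positivity
      split_ifs <;> linarith
    refine (sum_le_sum_of_subset_of_nonneg hsub hnn).trans ?_
    rw [sum_add_distrib, sum_add_distrib, sum_const, nsmul_eq_mul, ← sum_filter, ← sum_filter,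
      sum_const, sum_const, nsmul_eq_mul, nsmul_eq_mul, mul_one]
    have k1 : (#(B.filter fun f => f ∈ offOne Θ D v) : ℝ) ≤ K := by
      refine le_trans ?_ (Nat.cast_le.2 hF)
      exact Nat.cast_le.2 (card_le_card fun x hx => (mem_filter.1 hx).2)
    have k2 : (#(B.filter fun f => f ∈ offTwo Θ D B v) : ℝ) ≤ η * ρ := by
      refine le_trans ?_ hG
      exact Nat.cast_le.2 (card_le_card fun x hx => (mem_filter.1 hx).2)
    have k3 : (#(B.filter fun f => f ∈ offOne Θ D v) : ℝ) * (1 / l) ≤ K * (1 / l) :=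
      mul_le_mul_of_nonneg_right k1 (by positivity)
    have k4 : (K : ℝ) * (1 / l) = K / (ρ * l) * ρ := by field_simp
    have k5 : (K / (ρ * l) + η) * ρ ≤ (K / (ρ * l) + η) * #B ∨ K / (ρ * l) + η ≤ 0 := by
      rcases le_total (K / (ρ * l) + η) 0 with h0 | h0
      · exact Or.inr h0
      · exact Or.inl (mul_le_mul_of_nonneg_left hρB h0)
    have hB0 : (0 : ℝ) < #B := hρ.trans_le hρB
    rcases k5 with k5 | k5
    · nlinarith
    · nlinarith [mul_nonneg hρ.le (neg_nonneg.2 k5)]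

theorem sum_two_pow_offOne_le {Θ : Perm V} {D B : Finset V} {v : V} {W : ℕ}
    (h : FirstReturn Θ D v W) (hBD : B ⊆ D) (heB : (Θ ^ W) v ∉ B) :
    ∑ f ∈ B, (2 : ℝ) ^ #(offOne (swap ((Θ ^ W) v) f * Θ) ((D.erase ((Θ ^ W) v)).erase f) f) ≤
      2 ^ #(offOne Θ D v) * (#B + 1) := by
  set e := (Θ ^ W) v with he
  have hve : SameCycle Θ v e := ⟨W, by rw [zpow_natCast]⟩
  have heD : e ∈ D := h.2.2.1
  have hne : ∀ f ∈ B, e ≠ f := fun f hf h => heB (h ▸ hf)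
  set T := B.filter fun f => SameCycle Θ e f ∧ #(onCyc (swap e f * Θ) ((D.erase e).erase f) e) = 1
  have hT : #T ≤ 1 := by
    rw [card_le_one]
    intro f hf g hg
    rw [mem_filter] at hf hg
    exact card_onCyc_split_injective hf.2.1 hg.2.1 (hne f hf.1) (hne g hg.1) (hBD hf.1) (hBD hg.1)
      (hf.2.2.trans hg.2.2.symm)
  have hterm : ∀ f ∈ B, (2 : ℝ) ^ #(offOne (swap e f * Θ) ((D.erase e).erase f) f) ≤
      2 ^ #(offOne Θ D v) * (1 + if f ∈ T then 1 else 0) := by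
    intro f hf
    have hT' : f ∈ T ↔ SameCycle Θ e f ∧ #(onCyc (swap e f * Θ) ((D.erase e).erase f) e) = 1 := by
      simp [T, hf]
    rw [offOne_congr hve]
    by_cases hc : SameCycle Θ e f
    · have h1 := offOne_split (D := D) (hne f hf) hc
      simp only [hT', hc, true_and]
      split_ifs at h1 ⊢ with h2
      · rw [show (1 : ℝ) + 1 = 2 by norm_num, ← pow_succ]
        exact pow_le_pow_right₀ (by norm_num) h1
      · rw [add_zero, mul_one]
        exact pow_le_pow_right₀ (by norm_num) h1
    · simp only [hT', hc, false_and, if_false, add_zero, mul_one]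
      exact pow_le_pow_right₀ (by norm_num) (card_le_card (offOne_merge hc))
  refine (sum_le_sum hterm).trans ?_
  rw [← mul_sum, sum_add_distrib, sum_const, nsmul_eq_mul, mul_one, ← sum_filter, sum_const,
    nsmul_eq_mul, mul_one]
  have h1 : #(B.filter fun f => f ∈ T) ≤ 1 :=
    (card_le_card fun x hx => (mem_filter.1 hx).2).trans hT
  have h2 : ((#(B.filter fun f => f ∈ T) : ℕ) : ℝ) ≤ 1 := by exact_mod_cast h1
  have h3 : (0 : ℝ) < 2 ^ #(offOne Θ D v) := by positivity
  nlinarith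

/-- The hypotheses under which a stretch of length `W` can be explored up to length `M`. -/
def Explorable (ρ η : ℝ) (M r : ℕ) (Θ : Perm V) (A B : Finset V) (v : V) (W : ℕ) : Prop :=
  W ≤ M → ρ + (M - W) ≤ r ∧ (#(offTwo Θ (A ∪ B) A v) : ℝ) + 2 * (M - W) ≤ η * ρ ∧
    (#(offTwo Θ (A ∪ B) B v) : ℝ) + 2 * (M - W) ≤ η * ρ

theorem Explorable.symm {r : ℕ} {Θ : Perm V} {A B : Finset V} {v : V} {W : ℕ}
    (h : Explorable ρ η M r Θ A B v W) : Explorable ρ η M r Θ B A v W := by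
  intro hW
  rw [union_comm B A]
  exact ⟨(h hW).1, (h hW).2.2, (h hW).2.1⟩

theorem card_offTwo_swap_le {Θ : Perm V} {D B B' : Finset V} {e f : V} (hef : e ≠ f) (hB : B' ⊆ B)
    (hD : B' ⊆ (D.erase e).erase f) :
    #(offTwo (swap e f * Θ) ((D.erase e).erase f) B' f) ≤ #(offTwo Θ D B e) + 2 := by
  by_cases hc : SameCycle Θ e f
  · exact offTwo_split hef hc hB hD
  · exact (card_le_card (offTwo_merge hc hB)).trans (by omega)

theorem exploreBound_succ_le {ρ l : ℝ} (hρ : 0 < ρ) (hl : 0 < l) (hφ : Antitone φ)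
    (hψ : ∀ N, 0 ≤ ψ N) (hψφ : ∀ N, ψ N ≤ φ N) {W W' s F : ℕ} (hW : W < W') :
    exploreBound ρ l K M ψ φ W' s F ≤
      (∑ N ∈ Icc (W + 1) M, ψ N) / ρ + 2 * l / ρ * ∑ N ∈ Icc (W + 1) M, φ N + l ^ s * φ W +
        φ 0 * (2 ^ F / 2 ^ K) * (1 + 1 / ρ) ^ (M - W) := by
  have hφ0 : ∀ N, 0 ≤ φ N := fun N => (hψ N).trans (hψφ N)
  have hsub : Icc W' M ⊆ Icc (W + 1) M := Icc_subset_Icc hW le_rfl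
  have hexp : M + 1 - W' ≤ M - W := by omega
  have hone : 1 ≤ 1 + 1 / ρ := by
    have : 0 < 1 / ρ := by positivity
    linarith
  rw [exploreBound]
  refine add_le_add (add_le_add (add_le_add ?_ ?_) ?_) ?_
  · exact div_le_div_of_nonneg_right (sum_le_sum_of_subset_of_nonneg hsub fun N _ _ => hψ N) hρ.le
  · exact mul_le_mul_of_nonneg_left (sum_le_sum_of_subset_of_nonneg hsub fun N _ _ => hφ0 N)
      (by positivity)
  · exact mul_le_mul_of_nonneg_left (hφ hW.le) (by positivity)
  · exact mul_le_mul_of_nonneg_left (pow_le_pow_right₀ hone hexp)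
      (mul_nonneg (hφ0 0) (by positivity))

theorem sum_psi_add_sum_phi_nonneg {ρ l : ℝ} (hρ : 0 < ρ) (hl : 0 < l) (hψ : ∀ N, 0 ≤ ψ N)
    (hφ0 : ∀ N, 0 ≤ φ N) (W : ℕ) :
    0 ≤ (∑ N ∈ Icc W M, ψ N) / ρ + 2 * l / ρ * ∑ N ∈ Icc W M, φ N :=
  add_nonneg (div_nonneg (sum_nonneg fun N _ => hψ N) hρ.le)
    (mul_nonneg (by positivity) (sum_nonneg fun N _ => hφ0 N))

theorem sum_matchings_erase_le (hρ : 0 < ρ) (hl : 0 < l) (hφ : Antitone φ)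
    (hψ : ∀ N, 0 ≤ ψ N) (hψφ : ∀ N, ψ N ≤ φ N) {r : ℕ}
    (ih : ∀ (Θ : Perm V) (A B : Finset V) (v : V) (W : ℕ), _root_.Disjoint A B → #A = r → #B = r →
      FirstReturn Θ (A ∪ B) v W → Explorable ρ η M r Θ A B v W →
      ∑ m ∈ matchings A B, ψ (Function.minimalPeriod (m * Θ : Perm V) v) ≤
        r.factorial * exploreBound ρ l K M ψ φ W #(onCyc Θ (A ∪ B) v) #(offOne Θ (A ∪ B) v))
    {Θ : Perm V} {A B : Finset V} {v : V} {W : ℕ} (hAB : _root_.Disjoint A B) (hA : #A = r + 1)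
    (hB : #B = r + 1) (h : FirstReturn Θ (A ∪ B) v W) (hW : W ≤ M)
    (hex : Explorable ρ η M (r + 1) Θ A B v W) (heA : (Θ ^ W) v ∈ A) {f : V} (hf : f ∈ B) :
    ∑ m ∈ matchings (A.erase ((Θ ^ W) v)) (B.erase f),
        ψ (Function.minimalPeriod (m * swap ((Θ ^ W) v) f * Θ : Perm V) v) ≤
      r.factorial * ((∑ N ∈ Icc (W + 1) M, ψ N) / ρ + 2 * l / ρ * ∑ N ∈ Icc (W + 1) M, φ N +
        l ^ #(onCyc (swap ((Θ ^ W) v) f * Θ) (((A ∪ B).erase ((Θ ^ W) v)).erase f) f) * φ W +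
        φ 0 * (2 ^ #(offOne (swap ((Θ ^ W) v) f * Θ) (((A ∪ B).erase ((Θ ^ W) v)).erase f) f) /
          2 ^ K) * (1 + 1 / ρ) ^ (M - W)) := by
  have hφ0 : ∀ N, 0 ≤ φ N := fun N => (hψ N).trans (hψφ N)
  have hD := union_erase_erase hAB heA hf
  have hdisj : _root_.Disjoint (A.erase ((Θ ^ W) v)) (B.erase f) :=
    hAB.mono (erase_subset _ _) (erase_subset _ _)
  have hA' : #(A.erase ((Θ ^ W) v)) = r := by rw [card_erase_of_mem heA]; omega
  have hB' : #(B.erase f) = r := by rw [card_erase_of_mem hf]; omega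
  have hef : (Θ ^ W) v ≠ f := fun h => Finset.disjoint_left.1 hAB heA (h ▸ hf)
  have hfD : f ∈ A ∪ B := mem_union_right _ hf
  have hve : SameCycle Θ v ((Θ ^ W) v) := ⟨W, by rw [zpow_natCast]⟩
  have hfix : ∀ m ∈ matchings (A.erase ((Θ ^ W) v)) (B.erase f),
      ∀ x, x ∉ ((A ∪ B).erase ((Θ ^ W) v)).erase f → m x = x := by
    intro m hm x hx
    rw [hD] at hx
    exact apply_eq_self_of_mem_matchings hm hx
  have hr : (0 : ℝ) < r.factorial := Nat.cast_pos.2 r.factorial_pos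
  rcases (onCyc (swap ((Θ ^ W) v) f * Θ) (((A ∪ B).erase ((Θ ^ W) v)).erase f) f).eq_empty_or_nonempty
    with h0 | ⟨x, hx⟩
  · rw [h0, card_empty, pow_zero, one_mul]
    have hle : ∑ m ∈ matchings (A.erase ((Θ ^ W) v)) (B.erase f),
        ψ (Function.minimalPeriod (m * swap ((Θ ^ W) v) f * Θ : Perm V) v) ≤ r.factorial * φ W := by
      rw [← card_matchings hdisj hA' hB', ← nsmul_eq_mul]
      refine sum_le_card_nsmul _ _ _ fun m hm => (hψφ _).trans (hφ ?_)
      refine h.le_minimalPeriod fun x hx => ?_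
      exact apply_eq_self_of_mem_matchings (mul_swap_mem_matchings hAB heA hf hm).1 hx
    refine hle.trans (mul_le_mul_of_nonneg_left ?_ hr.le)
    have e1 := sum_psi_add_sum_phi_nonneg (M := M) hρ hl hψ hφ0 (W + 1)
    have e3 : 0 ≤ φ 0 * ((2 : ℝ) ^ #(offOne (swap ((Θ ^ W) v) f * Θ)
        (((A ∪ B).erase ((Θ ^ W) v)).erase f) f) / 2 ^ K) * (1 + 1 / ρ) ^ (M - W) :=
      mul_nonneg (mul_nonneg (hφ0 0) (by positivity)) (by positivity)
    linarith
  · obtain ⟨v', W', hret, hWW, hv'f, hper⟩ :=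
      exists_firstReturn_swap h hfD ⟨x, (mem_onCyc.1 hx).1, (mem_onCyc.1 hx).2⟩
    have hcongr : ∑ m ∈ matchings (A.erase ((Θ ^ W) v)) (B.erase f),
        ψ (Function.minimalPeriod (m * swap ((Θ ^ W) v) f * Θ : Perm V) v) =
        ∑ m ∈ matchings (A.erase ((Θ ^ W) v)) (B.erase f),
        ψ (Function.minimalPeriod (m * (swap ((Θ ^ W) v) f * Θ) : Perm V) v') := by
      refine sum_congr rfl fun m hm => ?_
      rw [mul_assoc, hper m (hfix m hm)]
    rw [hcongr]
    refine (ih (swap ((Θ ^ W) v) f * Θ) _ _ v' W' hdisj hA' hB' (by rwa [← hD]) ?_).trans ?_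
    · intro hW'
      obtain ⟨h1, h2, h3⟩ := hex hW
      rw [← hD, offTwo_congr hv'f, offTwo_congr hv'f]
      rw [offTwo_congr hve] at h2 h3
      have hWW' : (W : ℝ) + 1 ≤ W' := by exact_mod_cast hWW
      have g1 := card_offTwo_swap_le (Θ := Θ) (D := A ∪ B) hef (erase_subset ((Θ ^ W) v) A)
        (by rw [hD]; exact subset_union_left)
      have g2 := card_offTwo_swap_le (Θ := Θ) (D := A ∪ B) hef (erase_subset f B)
        (by rw [hD]; exact subset_union_right)
      have g1' : ((#(offTwo (swap ((Θ ^ W) v) f * Θ) (((A ∪ B).erase ((Θ ^ W) v)).erase f)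
        (A.erase ((Θ ^ W) v)) f) : ℕ) : ℝ) ≤ #(offTwo Θ (A ∪ B) A ((Θ ^ W) v)) + 2 := by
        exact_mod_cast g1
      have g2' : ((#(offTwo (swap ((Θ ^ W) v) f * Θ) (((A ∪ B).erase ((Θ ^ W) v)).erase f)
        (B.erase f) f) : ℕ) : ℝ) ≤ #(offTwo Θ (A ∪ B) B ((Θ ^ W) v)) + 2 := by
        exact_mod_cast g2
      push_cast at h1
      refine ⟨by linarith, by linarith, by linarith⟩
    · rw [← hD, onCyc_congr hv'f, offOne_congr hv'f]
      exact mul_le_mul_of_nonneg_left (exploreBound_succ_le hρ hl hφ hψ hψφ hWW) hr.le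

theorem sum_Icc_eq_add {g : ℕ → ℝ} {W M : ℕ} (hW : W ≤ M) :
    ∑ N ∈ Icc W M, g N = g W + ∑ N ∈ Icc (W + 1) M, g N := by
  rw [← Finset.sum_Ioc_add_eq_sum_Icc hW, add_comm, ← Finset.Icc_add_one_left_eq_Ioc]

theorem exploreBound_nonneg (hρ : 0 < ρ) (hl : 0 < l) (hψ : ∀ N, 0 ≤ ψ N)
    (hψφ : ∀ N, ψ N ≤ φ N) (W s F : ℕ) : 0 ≤ exploreBound ρ l K M ψ φ W s F := by
  have hφ0 : ∀ N, 0 ≤ φ N := fun N => (hψ N).trans (hψφ N)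
  rw [exploreBound]
  exact add_nonneg (add_nonneg (sum_psi_add_sum_phi_nonneg hρ hl hψ hφ0 W)
    (mul_nonneg (by positivity) (hφ0 W)))
    (mul_nonneg (mul_nonneg (hφ0 0) (by positivity)) (by positivity))

/-- The cycle containing a given stretch of `Θ` in `m * Θ`, for a random matching `m`. -/
theorem explore (hρ : 0 < ρ) (hl : 0 < l) (hl2 : l ≤ 1 / 2) (hφ : Antitone φ)
    (hψ : ∀ N, 0 ≤ ψ N) (hψφ : ∀ N, ψ N ≤ φ N) (hM : ∀ N, M < N → ψ N = 0)
    (hη : K / (ρ * l) + η + l ≤ 1) (r : ℕ) :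
    ∀ (Θ : Perm V) (A B : Finset V) (v : V) (W : ℕ), _root_.Disjoint A B → #A = r → #B = r →
      FirstReturn Θ (A ∪ B) v W → Explorable ρ η M r Θ A B v W →
      ∑ m ∈ matchings A B, ψ (Function.minimalPeriod (m * Θ : Perm V) v) ≤
        r.factorial * exploreBound ρ l K M ψ φ W #(onCyc Θ (A ∪ B) v) #(offOne Θ (A ∪ B) v) := by
  have hφ0 : ∀ N, 0 ≤ φ N := fun N => (hψ N).trans (hψφ N)
  induction r with
  | zero =>
    intro Θ A B v W _ hA hB h _
    rw [card_eq_zero] at hA hB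
    have := h.1
    rw [hA, hB] at this
    simp at this
  | succ r ih =>
    intro Θ A B v W hAB hA hB h hex
    wlog heA : (Θ ^ W) v ∈ A generalizing A B
    · have heB : (Θ ^ W) v ∈ B := (mem_union.1 h.2.2.1).resolve_left heA
      have := this B A hAB.symm hB hA (by rwa [union_comm]) hex.symm heB
      rwa [matchings_comm, union_comm B A] at this
    have hQ := exploreBound_nonneg (K := K) (M := M) hρ hl hψ hψφ W #(onCyc Θ (A ∪ B) v)
      #(offOne Θ (A ∪ B) v)
    rcases Nat.lt_or_ge M W with hMW | hW
    · refine le_trans (le_of_eq ?_) (mul_nonneg (Nat.cast_nonneg _) hQ)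
      refine sum_eq_zero fun m hm => hM _ (hMW.trans_le ?_)
      exact h.le_minimalPeriod fun x hx => apply_eq_self_of_mem_matchings hm hx
    rcases Nat.lt_or_ge K #(offOne Θ (A ∪ B) v) with hF | hF
    · have h1 : ∑ m ∈ matchings A B, ψ (Function.minimalPeriod (m * Θ : Perm V) v) ≤
          (r + 1).factorial * φ 0 := by
        rw [← card_matchings hAB hA hB, ← nsmul_eq_mul]
        exact sum_le_card_nsmul _ _ _ fun m _ => (hψφ _).trans (hφ (Nat.zero_le _))
      refine h1.trans (mul_le_mul_of_nonneg_left ?_ (Nat.cast_nonneg _))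
      rw [exploreBound]
      have e1 := sum_psi_add_sum_phi_nonneg (M := M) hρ hl hψ hφ0 W
      have e4 : 0 ≤ l ^ #(onCyc Θ (A ∪ B) v) * φ W := mul_nonneg (by positivity) (hφ0 W)
      have e5 : (1 : ℝ) ≤ 2 ^ #(offOne Θ (A ∪ B) v) / 2 ^ K := by
        rw [one_le_div (by positivity)]
        exact pow_le_pow_right₀ (by norm_num) hF.le
      have e6 : (1 : ℝ) ≤ (1 + 1 / ρ) ^ (M + 1 - W) := by
        apply one_le_pow₀
        have : 0 < 1 / ρ := by positivity
        linarith
      have e7 : φ 0 ≤ φ 0 * (2 ^ #(offOne Θ (A ∪ B) v) / 2 ^ K) := le_mul_of_one_le_right (hφ0 0) e5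
      have e8 : φ 0 * (2 ^ #(offOne Θ (A ∪ B) v) / 2 ^ K) ≤
          φ 0 * (2 ^ #(offOne Θ (A ∪ B) v) / 2 ^ K) * (1 + 1 / ρ) ^ (M + 1 - W) :=
        le_mul_of_one_le_right ((hφ0 0).trans e7) e6
      linarith
    obtain ⟨hr1, -, hGB⟩ := hex hW
    have hMW : (0 : ℝ) ≤ (M : ℝ) - W := by
      rw [sub_nonneg]
      exact_mod_cast hW
    have heB : (Θ ^ W) v ∉ B := Finset.disjoint_left.1 hAB heA
    have hBr : (#B : ℝ) = r + 1 := by rw [hB]; push_cast; ring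
    have hρB : ρ ≤ #B := by rw [hB]; linarith
    have hL := sum_pow_onCyc_le hρ hl hl2 hη h subset_union_right heB hρB hF (by linarith)
    have h2 := sum_two_pow_offOne_le h (subset_union_right (s₁ := A)) heB
    rw [hBr] at hL h2
    rw [hB] at hρB
    push_cast at hρB
    rw [sum_matchings hAB heA]
    set e := (Θ ^ W) v with he
    set s := #(onCyc Θ (A ∪ B) v)
    set F := #(offOne Θ (A ∪ B) v)
    set base := (∑ N ∈ Icc (W + 1) M, ψ N) / ρ + 2 * l / ρ * ∑ N ∈ Icc (W + 1) M, φ N with hbase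
    have hbase0 : 0 ≤ base := sum_psi_add_sum_phi_nonneg hρ hl hψ hφ0 _
    have hfac : (0 : ℝ) < r.factorial := Nat.cast_pos.2 r.factorial_pos
    set c := φ 0 * (1 + 1 / ρ) ^ (M - W) / 2 ^ K with hc
    have hc0 : 0 ≤ c := by
      have : 0 ≤ (1 + 1 / ρ) ^ (M - W) := by positivity
      exact div_nonneg (mul_nonneg (hφ0 0) this) (by positivity)
    have hterm : ∀ f ∈ B, ∑ m ∈ matchings (A.erase e) (B.erase f),
        ψ (Function.minimalPeriod (m * swap e f * Θ : Perm V) v) ≤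
        r.factorial * ((if f = v then ψ W else 0) + base + (if f = v then 0 else
          l ^ #(onCyc (swap e f * Θ) (((A ∪ B).erase e).erase f) f)) * φ W +
          c * 2 ^ #(offOne (swap e f * Θ) (((A ∪ B).erase e).erase f) f)) := by
      intro f hf
      by_cases hfv : f = v
      · rw [if_pos hfv, if_pos hfv, zero_mul, add_zero]
        have h3 : ∑ m ∈ matchings (A.erase e) (B.erase f),
            ψ (Function.minimalPeriod (m * swap e f * Θ : Perm V) v) ≤ r.factorial * ψ W := by
          rw [← card_matchings (hAB.mono (erase_subset e _) (erase_subset f _))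
            (by rw [card_erase_of_mem heA]; omega) (by rw [card_erase_of_mem hf]; omega),
            ← nsmul_eq_mul]
          refine sum_le_card_nsmul _ _ _ fun m hm => le_of_eq ?_
          rw [mul_assoc, hfv, he, minimalPeriod_of_close h]
          intro x hx
          rw [← he, ← hfv, union_erase_erase hAB heA hf] at hx
          exact apply_eq_self_of_mem_matchings hm hx
        refine h3.trans (mul_le_mul_of_nonneg_left ?_ hfac.le)
        have : 0 ≤ c * (2 : ℝ) ^ #(offOne (swap e f * Θ) (((A ∪ B).erase e).erase f) f) := by
          positivity
        linarith
      · rw [if_neg hfv, if_neg hfv, zero_add]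
        refine (sum_matchings_erase_le hρ hl hφ hψ hψφ ih hAB hA hB h hW hex heA hf).trans
          (le_of_eq ?_)
        rw [hc]
        ring
    refine (sum_le_sum hterm).trans ?_
    rw [← mul_sum, Nat.factorial_succ, Nat.cast_mul, mul_comm ((r + 1 : ℕ) : ℝ), mul_assoc]
    refine mul_le_mul_of_nonneg_left ?_ hfac.le
    rw [sum_add_distrib, sum_add_distrib, sum_add_distrib, sum_const, nsmul_eq_mul, hBr,
      ← sum_mul, ← mul_sum]
    have t1 : ∑ f ∈ B, (if f = v then ψ W else 0) ≤ ψ W := by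
      rw [sum_ite_eq' B v fun _ => ψ W]
      split_ifs
      · exact le_rfl
      · exact hψ W
    have t2 : ∑ f ∈ B, (if f = v then (0 : ℝ) else
        l ^ #(onCyc (swap e f * Θ) (((A ∪ B).erase e).erase f) f)) ≤ 2 * l + (r + 1) * l ^ s := by
      refine le_trans (le_of_eq ?_) hL
      by_cases hv : v ∈ B
      · rw [← add_sum_erase B _ hv, if_pos rfl, zero_add]
        refine sum_congr rfl fun f hf => ?_
        rw [if_neg (mem_erase.1 hf).1]
      · rw [erase_eq_of_notMem hv]
        refine sum_congr rfl fun f hf => ?_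
        rw [if_neg (fun hh : f = v => hv (hh ▸ hf))]
    have t3 := mul_le_mul_of_nonneg_right t2 (hφ0 W)
    have t4 := mul_le_mul_of_nonneg_left h2 hc0
    have hone : 1 ≤ ((r : ℝ) + 1) * (1 / ρ) := by
      rw [mul_one_div, one_le_div hρ]
      exact hρB
    have t5 : ψ W ≤ (r + 1) * (ψ W / ρ) := by
      have := mul_le_mul_of_nonneg_left hone (hψ W)
      calc ψ W ≤ ψ W * (((r : ℝ) + 1) * (1 / ρ)) := by linarith
        _ = _ := by ring
    have t6 : 2 * l * φ W ≤ (r + 1) * (2 * l / ρ * φ W) := by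
      have := mul_le_mul_of_nonneg_left hone (mul_nonneg (mul_nonneg zero_le_two hl.le) (hφ0 W))
      calc 2 * l * φ W ≤ 2 * l * φ W * (((r : ℝ) + 1) * (1 / ρ)) := by linarith
        _ = _ := by ring
    have t7 : c * (2 ^ F * ((r : ℝ) + 1 + 1)) ≤
        (r + 1) * (φ 0 * (2 ^ F / 2 ^ K) * (1 + 1 / ρ) ^ (M + 1 - W)) := by
      have e1 : M + 1 - W = M - W + 1 := by omega
      have e2 : 0 ≤ c * 2 ^ F := by positivity
      calc c * (2 ^ F * ((r : ℝ) + 1 + 1)) = c * 2 ^ F * ((r : ℝ) + 1 + 1) := by ring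
        _ ≤ c * 2 ^ F * ((r + 1) * (1 + 1 / ρ)) := mul_le_mul_of_nonneg_left (by linarith) e2
        _ = _ := by
          rw [hc, e1, pow_succ]
          ring
    rw [exploreBound, sum_Icc_eq_add hW, sum_Icc_eq_add hW]
    push_cast
    rw [hbase] at hbase0 ⊢
    calc _ ≤ (r + 1) * (ψ W / ρ) + (r + 1) * ((∑ N ∈ Icc (W + 1) M, ψ N) / ρ +
          2 * l / ρ * ∑ N ∈ Icc (W + 1) M, φ N) +
          ((r + 1) * (2 * l / ρ * φ W) + (r + 1) * (l ^ s * φ W)) +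
          (r + 1) * (φ 0 * (2 ^ F / 2 ^ K) * (1 + 1 / ρ) ^ (M + 1 - W)) := by
          refine add_le_add (add_le_add (add_le_add (t1.trans t5) le_rfl) (t3.trans ?_))
            (t4.trans t7)
          rw [add_mul]
          refine add_le_add t6 (le_of_eq (by ring))
      _ = _ := by ring

end Explore

section Initial

variable {V : Type*} [Fintype V] [DecidableEq V] {Θ₀ Q : Perm V} {Z D : Finset V}

theorem mul_apply_eq_of_mem (hQ : ∀ x ∉ Z, Q x = x) (hQZ : ∀ x ∈ Z, Q x ∈ Z) {x : V}
    (hx : (Q * Θ₀) x ∉ Z) : (Q * Θ₀) x = Θ₀ x := by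
  rw [Perm.mul_apply] at hx ⊢
  exact hQ _ fun h => hx (hQZ _ h)

theorem apply_eq_of_card_onCyc {Θ : Perm V} {x : V} (hx : x ∈ D) (h : #(onCyc Θ D x) = 1)
    (hD : Θ x ∈ D) : Θ x = x := by
  obtain ⟨a, ha⟩ := card_eq_one.1 h
  have h1 : x ∈ onCyc Θ D x := mem_onCyc.2 ⟨hx, SameCycle.refl _ _⟩
  have h2 : Θ x ∈ onCyc Θ D x := mem_onCyc.2 ⟨hD, ⟨1, by rw [zpow_one]⟩⟩
  rw [ha, mem_singleton] at h1 h2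
  exact h2.trans h1.symm

theorem card_alone_le (hQ : ∀ x ∉ Z, Q x = x) (hQZ : ∀ x ∈ Z, Q x ∈ Z) :
    #(Zᶜ.filter fun x => #(onCyc (Q * Θ₀) Zᶜ x) = 1) ≤
      #(univ.filter fun x => Θ₀ x = x) + #Z := by
  have hsub : (Zᶜ.filter fun x => #(onCyc (Q * Θ₀) Zᶜ x) = 1) ⊆
      (univ.filter fun x => Θ₀ x = x) ∪ Z.map (Q * Θ₀)⁻¹.toEmbedding := by
    intro x hx
    rw [mem_filter] at hx
    rw [mem_union, mem_filter, Finset.mem_map_equiv]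
    by_cases h : (Q * Θ₀) x ∈ Z
    · exact Or.inr h
    · left
      refine ⟨mem_univ _, ?_⟩
      rw [← mul_apply_eq_of_mem hQ hQZ h]
      exact apply_eq_of_card_onCyc hx.1 hx.2 (mem_compl.2 h)
  refine (card_le_card hsub).trans ((card_union_le _ _).trans ?_)
  rw [card_map]

theorem card_offOne_le (hQ : ∀ x ∉ Z, Q x = x) (hQZ : ∀ x ∈ Z, Q x ∈ Z) (v : V) :
    #(offOne (Q * Θ₀) Zᶜ v) ≤ #(univ.filter fun x => Θ₀ x = x) + #Z := by
  refine le_trans (card_le_card ?_) (card_alone_le hQ hQZ)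
  intro x hx
  rw [offOne, mem_filter] at hx
  exact mem_filter.2 ⟨hx.1, hx.2.2⟩

theorem card_onCyc_eq_one_le (hQ : ∀ x ∉ Z, Q x = x) (hQZ : ∀ x ∈ Z, Q x ∈ Z) :
    #(univ.filter fun x => #(onCyc (Q * Θ₀) Zᶜ x) = 1) ≤
      #(univ.filter fun x => Θ₀ x = x) + 2 * #Z := by
  have hsub : (univ.filter fun x => #(onCyc (Q * Θ₀) Zᶜ x) = 1) ⊆
      (Zᶜ.filter fun x => #(onCyc (Q * Θ₀) Zᶜ x) = 1) ∪ Z := by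
    intro x hx
    rw [mem_filter] at hx
    rw [mem_union, mem_filter, mem_compl]
    by_cases h : x ∈ Z
    · exact Or.inr h
    · exact Or.inl ⟨h, hx.2⟩
  have := card_alone_le (Θ₀ := Θ₀) hQ hQZ
  exact (card_le_card hsub).trans ((card_union_le _ _).trans (by omega))

theorem card_offTwo_le (hQ : ∀ x ∉ Z, Q x = x) (hQZ : ∀ x ∈ Z, Q x ∈ Z) {B : Finset V}
    (hB : B ⊆ Zᶜ) (v : V) :
    #(offTwo (Q * Θ₀) Zᶜ B v) ≤
      #(B.filter fun x => Θ₀ x ≠ x ∧ Θ₀ (Θ₀ x) = x) + 2 * #Z := by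
  set Θ := Q * Θ₀ with hΘ
  have hsub : offTwo Θ Zᶜ B v ⊆ (B.filter fun x => Θ₀ x ≠ x ∧ Θ₀ (Θ₀ x) = x) ∪
      (Z.map Θ⁻¹.toEmbedding ∪ Z.map (Θ * Θ)⁻¹.toEmbedding) := by
    intro x hx
    rw [offTwo, mem_filter] at hx
    rw [mem_union, mem_union, mem_filter, Finset.mem_map_equiv, Finset.mem_map_equiv]
    by_cases h : Θ x ∈ Z
    · exact Or.inr (Or.inl h)
    by_cases h' : (Θ * Θ) x ∈ Z
    · exact Or.inr (Or.inr h')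
    left
    rw [Perm.mul_apply] at h'
    have e1 : Θ x = Θ₀ x := mul_apply_eq_of_mem hQ hQZ h
    have e2 : Θ (Θ x) = Θ₀ (Θ₀ x) := by
      rw [← e1]
      exact mul_apply_eq_of_mem hQ hQZ h'
    have hxD := hB hx.1
    have m0 : x ∈ onCyc Θ Zᶜ x := mem_onCyc.2 ⟨hxD, SameCycle.refl _ _⟩
    have m1 : Θ x ∈ onCyc Θ Zᶜ x := mem_onCyc.2 ⟨mem_compl.2 h, ⟨1, by rw [zpow_one]⟩⟩
    have m2 : Θ (Θ x) ∈ onCyc Θ Zᶜ x := mem_onCyc.2 ⟨mem_compl.2 h', ⟨2, by rw [zpow_two]; rfl⟩⟩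
    have hne : Θ x ≠ x := by
      intro he
      have hone : onCyc Θ Zᶜ x ⊆ {x} := by
        intro y hy
        rw [mem_singleton]
        obtain ⟨k, -, hk⟩ := (mem_onCyc.1 hy).2.exists_pow_eq'
        rw [← hk, ← iterate_eq_pow, Function.iterate_fixed he]
      have := card_le_card hone
      rw [hx.2.2, card_singleton] at this
      omega
    refine ⟨hx.1, by rwa [← e1], ?_⟩
    rw [← e2]
    by_contra hne2
    have h3 : ({x, Θ x, Θ (Θ x)} : Finset V) ⊆ onCyc Θ Zᶜ x := by
      intro y hy
      simp only [mem_insert, mem_singleton] at hy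
      rcases hy with rfl | rfl | rfl
      · exact m0
      · exact m1
      · exact m2
    have := card_le_card h3
    rw [hx.2.2, card_eq_three.2 ⟨x, Θ x, Θ (Θ x), hne.symm, fun h => hne2 h.symm,
      fun h => hne (Θ.injective h).symm, rfl⟩] at this
    omega
  refine (card_le_card hsub).trans ((card_union_le _ _).trans ?_)
  have := card_union_le (Z.map Θ⁻¹.toEmbedding) (Z.map (Θ * Θ)⁻¹.toEmbedding)
  rw [card_map, card_map] at this
  omega

/-- Every cycle meeting `D` passes through a point of `D` shortly before `u`. -/
theorem exists_firstReturn_minimalPeriod {Θ : Perm V} {u y : V} (hy : y ∈ D)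
    (h : SameCycle Θ y u) : ∃ v W, FirstReturn Θ D v W ∧ SameCycle Θ v u ∧
      ∀ m : Perm V, (∀ x, x ∉ D → m x = x) →
        Function.minimalPeriod (m * Θ : Perm V) v = Function.minimalPeriod (m * Θ : Perm V) u := by
  classical
  have hex : ∃ k : ℕ, ∃ v ∈ D, (Θ ^ k) v = u := by
    obtain ⟨k, -, hk⟩ := h.exists_pow_eq'
    exact ⟨k, y, hy, hk⟩
  obtain ⟨v, hv, hk⟩ := Nat.find_spec hex
  set k := Nat.find hex with hkdef
  have hmin : ∀ i < k, ∀ v ∈ D, (Θ ^ i) v ≠ u := fun i hi v hv he =>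
    Nat.find_min hex hi ⟨v, hv, he⟩
  obtain ⟨W, hW⟩ := exists_firstReturn Θ hv
  have hkW : k < W := by
    by_contra hWk
    rw [not_lt] at hWk
    refine hmin (k - W) (by have := hW.2.1; omega) _ hW.2.2.1 ?_
    rw [← Perm.mul_apply, ← pow_add, Nat.sub_add_cancel hWk, hk]
  refine ⟨v, W, hW, ⟨k, by rw [zpow_natCast, hk]⟩, fun m hm => ?_⟩
  apply minimalPeriod_eq_of_sameCycle
  refine ⟨k, ?_⟩
  rw [zpow_natCast, mul_pow_apply_eq hm hW.2.2.2 hkW, hk]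

theorem exploreBound_le {ρ l : ℝ} {K M : ℕ} {ψ φ : ℕ → ℝ} (hρ : 0 < ρ) (hl : 0 < l)
    (hl1 : l ≤ 1) (hφ : Antitone φ) (hψ : ∀ N, 0 ≤ ψ N) (hψφ : ∀ N, ψ N ≤ φ N) {W s F F' : ℕ}
    (hs : 0 < s) (hF : F ≤ F') :
    exploreBound ρ l K M ψ φ W s F ≤
      (∑ N ∈ range (M + 1), ψ N) / ρ + 2 * l / ρ * ∑ N ∈ range (M + 1), φ N +
        φ 0 * (2 ^ F' / 2 ^ K) * (1 + 1 / ρ) ^ (M + 1) + φ 0 * l ^ 2 +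
        φ 0 * (if s = 1 then l else 0) := by
  have hφ0 : ∀ N, 0 ≤ φ N := fun N => (hψ N).trans (hψφ N)
  have hsub : Icc W M ⊆ range (M + 1) := by
    intro N hN
    rw [mem_Icc] at hN
    exact mem_range.2 (by omega)
  have hone : 1 ≤ 1 + 1 / ρ := by
    have : 0 < 1 / ρ := by positivity
    linarith
  have e1 : (∑ N ∈ Icc W M, ψ N) / ρ ≤ (∑ N ∈ range (M + 1), ψ N) / ρ :=
    div_le_div_of_nonneg_right (sum_le_sum_of_subset_of_nonneg hsub fun N _ _ => hψ N) hρ.le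
  have e2 : 2 * l / ρ * ∑ N ∈ Icc W M, φ N ≤ 2 * l / ρ * ∑ N ∈ range (M + 1), φ N :=
    mul_le_mul_of_nonneg_left (sum_le_sum_of_subset_of_nonneg hsub fun N _ _ => hφ0 N)
      (by positivity)
  have e3 : φ 0 * ((2 : ℝ) ^ F / 2 ^ K) * (1 + 1 / ρ) ^ (M + 1 - W) ≤
      φ 0 * (2 ^ F' / 2 ^ K) * (1 + 1 / ρ) ^ (M + 1) := by
    have h1 : (2 : ℝ) ^ F ≤ 2 ^ F' := pow_le_pow_right₀ (by norm_num) hF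
    have h2 : (1 + 1 / ρ) ^ (M + 1 - W) ≤ (1 + 1 / ρ) ^ (M + 1) :=
      pow_le_pow_right₀ hone (by omega)
    have := hφ0 0
    gcongr
  have e4 : l ^ s * φ W ≤ φ 0 * l ^ 2 + φ 0 * (if s = 1 then l else 0) := by
    have h1 : l ^ s * φ W ≤ l ^ s * φ 0 :=
      mul_le_mul_of_nonneg_left (hφ (Nat.zero_le _)) (by positivity)
    have h2 : l ^ s ≤ l ^ 2 + if s = 1 then l else 0 := by
      split_ifs with h
      · rw [h, pow_one]
        have := sq_nonneg l
        linarith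
      · rw [add_zero]
        exact pow_le_pow_of_le_one hl.le hl1 (by omega)
    have := mul_le_mul_of_nonneg_right h2 (hφ0 0)
    linarith
  rw [exploreBound]
  linarith

/-- The total contribution to the exploration bound of a family of starting points. -/
noncomputable def errorBound (ρ l : ℝ) (K M : ℕ) (φ : ℕ → ℝ) (N f z : ℕ) : ℝ :=
  N * (2 * l / ρ * ∑ N ∈ range (M + 1), φ N +
    φ 0 * (2 ^ (f + z) / 2 ^ K) * (1 + 1 / ρ) ^ (M + 1) + φ 0 * l ^ 2) + φ 0 * l * (f + 2 * z)

theorem sum_explore_le {ρ l η : ℝ} {K M : ℕ} {ψ φ : ℕ → ℝ} (hρ : 0 < ρ) (hl : 0 < l)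
    (hl2 : l ≤ 1 / 2) (hφ : Antitone φ) (hψ : ∀ N, 0 ≤ ψ N) (hψφ : ∀ N, ψ N ≤ φ N)
    (hM : ∀ N, M < N → ψ N = 0) (hη : K / (ρ * l) + η + l ≤ 1)
    (hQ : ∀ x ∉ Z, Q x = x) (hQZ : ∀ x ∈ Z, Q x ∈ Z) {A B : Finset V} {r : ℕ}
    (hAB : _root_.Disjoint A B) (hZ : A ∪ B = Zᶜ) (hA : #A = r) (hB : #B = r)
    (hr : ρ + M ≤ r)
    (h2A : (#(A.filter fun x => Θ₀ x ≠ x ∧ Θ₀ (Θ₀ x) = x) : ℝ) + 2 * #Z + 2 * M ≤ η * ρ)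
    (h2B : (#(B.filter fun x => Θ₀ x ≠ x ∧ Θ₀ (Θ₀ x) = x) : ℝ) + 2 * #Z + 2 * M ≤ η * ρ)
    (U : Finset V) (hU : ∀ u ∈ U, ∃ y ∉ Z, SameCycle (Q * Θ₀) y u) :
    ∑ u ∈ U, ∑ m ∈ matchings A B, ψ (Function.minimalPeriod (m * (Q * Θ₀) : Perm V) u) ≤
      r.factorial * (#U * ((∑ N ∈ range (M + 1), ψ N) / ρ) +
        errorBound ρ l K M φ #U #(univ.filter fun x => Θ₀ x = x) #Z) := by
  set Θ := Q * Θ₀ with hΘ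
  set f := #(univ.filter fun x => Θ₀ x = x)
  have hφ0 : 0 ≤ φ 0 := (hψ 0).trans (hψφ 0)
  have hterm : ∀ u ∈ U,
      ∑ m ∈ matchings A B, ψ (Function.minimalPeriod (m * Θ : Perm V) u) ≤
      r.factorial * ((∑ N ∈ range (M + 1), ψ N) / ρ + 2 * l / ρ * ∑ N ∈ range (M + 1), φ N +
        φ 0 * (2 ^ (f + #Z) / 2 ^ K) * (1 + 1 / ρ) ^ (M + 1) + φ 0 * l ^ 2 +
        φ 0 * (if #(onCyc Θ Zᶜ u) = 1 then l else 0)) := by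
    intro u hu
    obtain ⟨y, hy, hyu⟩ := hU u hu
    obtain ⟨v, W, hW, hvu, hper⟩ := exists_firstReturn_minimalPeriod (mem_compl.2 hy) hyu
    have h1 : ∑ m ∈ matchings A B, ψ (Function.minimalPeriod (m * Θ : Perm V) u) =
        ∑ m ∈ matchings A B, ψ (Function.minimalPeriod (m * Θ : Perm V) v) := by
      refine sum_congr rfl fun m hm => ?_
      rw [hper m fun x hx => apply_eq_self_of_mem_matchings hm (by rwa [hZ])]
    rw [h1]
    have hex : Explorable ρ η M r Θ A B v W := by
      intro hWM
      have hWM' : (W : ℝ) ≤ M := by exact_mod_cast hWM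
      have hW0 : (0 : ℝ) ≤ W := Nat.cast_nonneg _
      have g1 : ((#(offTwo Θ Zᶜ A v) : ℕ) : ℝ) ≤
          #(A.filter fun x => Θ₀ x ≠ x ∧ Θ₀ (Θ₀ x) = x) + 2 * #Z := by
        exact_mod_cast card_offTwo_le hQ hQZ (by rw [← hZ]; exact subset_union_left) v
      have g2 : ((#(offTwo Θ Zᶜ B v) : ℕ) : ℝ) ≤
          #(B.filter fun x => Θ₀ x ≠ x ∧ Θ₀ (Θ₀ x) = x) + 2 * #Z := by
        exact_mod_cast card_offTwo_le hQ hQZ (by rw [← hZ]; exact subset_union_right) v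
      rw [hZ]
      refine ⟨by linarith, by linarith, by linarith⟩
    have h2 := explore hρ hl hl2 hφ hψ hψφ hM hη r Θ A B v W hAB hA hB (by rwa [hZ]) hex
    refine h2.trans (mul_le_mul_of_nonneg_left ?_ (Nat.cast_nonneg _))
    rw [hZ, ← onCyc_congr hvu]
    refine exploreBound_le hρ hl (by linarith) hφ hψ hψφ ?_ (card_offOne_le hQ hQZ v)
    rw [onCyc_congr hvu, card_pos]
    exact ⟨y, mem_onCyc.2 ⟨mem_compl.2 hy, hyu.symm⟩⟩
  refine (sum_le_sum hterm).trans ?_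
  rw [← mul_sum]
  refine mul_le_mul_of_nonneg_left ?_ (Nat.cast_nonneg _)
  rw [sum_add_distrib, sum_const, ← mul_sum, ← sum_filter, sum_const, errorBound, nsmul_eq_mul,
    nsmul_eq_mul]
  have hc : ((#(U.filter fun u => #(onCyc Θ Zᶜ u) = 1) : ℕ) : ℝ) ≤ f + 2 * #Z := by
    have : #(U.filter fun u => #(onCyc Θ Zᶜ u) = 1) ≤ f + 2 * #Z :=
      (card_le_card (filter_subset_filter _ (subset_univ U))).trans (card_onCyc_eq_one_le hQ hQZ)
    exact_mod_cast this
  have := mul_le_mul_of_nonneg_left hc (mul_nonneg hφ0 hl.le)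
  nlinarith [this]

end Initial

end RandGen

namespace RandGen
open Equiv Equiv.Perm Finset
open scoped Fin.NatCast Fin.CommRing

section Joint

variable {n : ℕ} {τ τ' σ σ₀ : Perm (Fin n)}

/-- The involution matching each position to its value. -/
def matchPerm (σ : Perm (Fin n)) : Perm (Fin n ⊕ Fin n) :=
  (Equiv.sumCongr σ σ⁻¹).trans (Equiv.sumComm _ _)

@[simp] theorem matchPerm_inl (p : Fin n) : matchPerm σ (Sum.inl p) = Sum.inr (σ p) := rfl

@[simp] theorem matchPerm_inr (y : Fin n) : matchPerm σ (Sum.inr y) = Sum.inl (σ⁻¹ y) := rfl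

theorem matchPerm_matchPerm (z : Fin n ⊕ Fin n) : matchPerm σ (matchPerm σ z) = z := by
  rcases z with p | y
  · rw [matchPerm_inl, matchPerm_inr, show σ⁻¹ (σ p) = p from σ.symm_apply_apply p]
  · rw [matchPerm_inr, matchPerm_inl, show σ (σ⁻¹ y) = y from σ.apply_symm_apply y]

theorem matchPerm_injective : Function.Injective (matchPerm : Perm (Fin n) → _) := by
  intro σ σ' h
  ext1 p
  have := congrArg (fun m : Perm (Fin n ⊕ Fin n) => m (Sum.inl p)) h
  exact Sum.inr_injective this

/-- The permutation of positions and values whose square induces `word τ τ' σ` on values. -/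
def jointPerm (τ τ' σ : Perm (Fin n)) : Perm (Fin n ⊕ Fin n) := matchPerm σ * Equiv.sumCongr τ τ'

theorem jointPerm_inr (y : Fin n) : jointPerm τ τ' σ (Sum.inr y) = Sum.inl (σ⁻¹ (τ' y)) := rfl

theorem jointPerm_inl (y : Fin n) : jointPerm τ τ' σ (Sum.inl y) = Sum.inr (σ (τ y)) := rfl

theorem jointPerm_iterate (k : ℕ) (y : Fin n) :
    (jointPerm τ τ' σ)^[2 * k] (Sum.inr y) = Sum.inr ((word τ τ' σ)^[k] y) := by
  induction k with
  | zero => rfl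
  | succ k ih =>
    rw [show 2 * (k + 1) = 2 * k + 1 + 1 by ring, Function.iterate_succ_apply',
      Function.iterate_succ_apply', ih, jointPerm_inr, jointPerm_inl, Function.iterate_succ_apply']
    rfl

theorem minimalPeriod_jointPerm (y : Fin n) :
    Function.minimalPeriod (jointPerm τ τ' σ) (Sum.inr y) =
      2 * Function.minimalPeriod (word τ τ' σ) y := by
  apply Nat.dvd_antisymm
  · apply Function.IsPeriodicPt.minimalPeriod_dvd
    rw [Function.IsPeriodicPt, Function.IsFixedPt, jointPerm_iterate,
      Function.iterate_minimalPeriod]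
  · have hp := Function.iterate_minimalPeriod (f := jointPerm τ τ' σ) (x := Sum.inr y)
    set N := Function.minimalPeriod (jointPerm τ τ' σ) (Sum.inr y)
    rcases Nat.even_or_odd' N with ⟨k, hk | hk⟩
    · rw [hk]
      apply Nat.mul_dvd_mul_left
      apply Function.IsPeriodicPt.minimalPeriod_dvd
      rw [hk, jointPerm_iterate] at hp
      exact Sum.inr_injective hp
    · rw [hk, Function.iterate_succ_apply', jointPerm_iterate, jointPerm_inr] at hp
      exact absurd hp Sum.inl_ne_inr

end Joint

section Reveal

variable {n : ℕ} {τ τ' σ σ₀ : Perm (Fin n)} {S : Finset (Fin n)}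

/-- The points revealed by the values of `σ₀` on `S`. -/
def deadSet (S : Finset (Fin n)) (σ₀ : Perm (Fin n)) : Finset (Fin n ⊕ Fin n) :=
  S.disjSum (S.image σ₀)

theorem matchPerm_mem_deadSet {z : Fin n ⊕ Fin n} (hz : z ∈ deadSet S σ₀) :
    matchPerm σ₀ z ∈ deadSet S σ₀ := by
  rcases z with p | y
  · rw [deadSet, inl_mem_disjSum] at hz
    rw [matchPerm_inl, deadSet, inr_mem_disjSum]
    exact mem_image_of_mem _ hz
  · rw [deadSet, inr_mem_disjSum, mem_image] at hz
    obtain ⟨p, hp, rfl⟩ := hz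
    rw [matchPerm_inr, deadSet, inl_mem_disjSum, show σ₀⁻¹ (σ₀ p) = p from σ₀.symm_apply_apply p]
    exact hp

/-- The revealed part of the matching. -/
def revealed (S : Finset (Fin n)) (σ₀ : Perm (Fin n)) : Perm (Fin n ⊕ Fin n) :=
  Function.Involutive.toPerm (fun z => if z ∈ deadSet S σ₀ then matchPerm σ₀ z else z) (by
    intro z
    dsimp only
    by_cases hz : z ∈ deadSet S σ₀
    · rw [if_pos hz, if_pos (matchPerm_mem_deadSet hz), matchPerm_matchPerm]
    · rw [if_neg hz, if_neg hz])

theorem revealed_of_mem {z : Fin n ⊕ Fin n} (hz : z ∈ deadSet S σ₀) :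
    revealed S σ₀ z = matchPerm σ₀ z := if_pos hz

theorem revealed_of_notMem {z : Fin n ⊕ Fin n} (hz : z ∉ deadSet S σ₀) :
    revealed S σ₀ z = z := if_neg hz

theorem revealed_mul_self : revealed S σ₀ * revealed S σ₀ = 1 := by
  ext1 z
  by_cases hz : z ∈ deadSet S σ₀
  · rw [Perm.mul_apply, revealed_of_mem hz, revealed_of_mem (matchPerm_mem_deadSet hz),
      matchPerm_matchPerm]
    rfl
  · rw [Perm.mul_apply, revealed_of_notMem hz, revealed_of_notMem hz]
    rfl

theorem matchPerm_mul_revealed_mem (h : ∀ p ∈ S, σ p = σ₀ p) :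
    matchPerm σ * revealed S σ₀ ∈
      matchings (Sᶜ.map Function.Embedding.inl) ((S.image σ₀)ᶜ.map Function.Embedding.inr) := by
  have hinl : ∀ p ∈ S, (matchPerm σ * revealed S σ₀) (Sum.inl p) = Sum.inl p := by
    intro p hp
    have hz : (Sum.inl p : Fin n ⊕ Fin n) ∈ deadSet S σ₀ := by
      rw [deadSet, inl_mem_disjSum]
      exact hp
    rw [Perm.mul_apply, revealed_of_mem hz, matchPerm_inl, ← h p hp, ← matchPerm_inl,
      matchPerm_matchPerm]
  have hinr : ∀ p ∈ S, (matchPerm σ * revealed S σ₀) (Sum.inr (σ₀ p)) = Sum.inr (σ₀ p) := by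
    intro p hp
    have hz : (Sum.inr (σ₀ p) : Fin n ⊕ Fin n) ∈ deadSet S σ₀ := by
      rw [deadSet, inr_mem_disjSum]
      exact mem_image_of_mem _ hp
    rw [Perm.mul_apply, revealed_of_mem hz, matchPerm_inr,
      show σ₀⁻¹ (σ₀ p) = p from σ₀.symm_apply_apply p, matchPerm_inl, h p hp]
  have hinl' : ∀ p ∉ S, (matchPerm σ * revealed S σ₀) (Sum.inl p) = Sum.inr (σ p) := by
    intro p hp
    have hz : (Sum.inl p : Fin n ⊕ Fin n) ∉ deadSet S σ₀ := by
      rw [deadSet, inl_mem_disjSum]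
      exact hp
    rw [Perm.mul_apply, revealed_of_notMem hz, matchPerm_inl]
  have hinr' : ∀ y ∉ S.image σ₀,
      (matchPerm σ * revealed S σ₀) (Sum.inr y) = Sum.inl (σ⁻¹ y) := by
    intro y hy
    have hz : (Sum.inr y : Fin n ⊕ Fin n) ∉ deadSet S σ₀ := by
      rw [deadSet, inr_mem_disjSum]
      exact hy
    rw [Perm.mul_apply, revealed_of_notMem hz, matchPerm_inr]
  have hS : ∀ p, p ∈ S ↔ σ p ∈ S.image σ₀ := by
    intro p
    constructor
    · intro hp
      rw [h p hp]
      exact mem_image_of_mem _ hp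
    · intro hp
      obtain ⟨p', hp', he⟩ := mem_image.1 hp
      rw [← h p' hp'] at he
      rwa [← σ.injective he]
  have hS' : ∀ y, y ∈ S.image σ₀ ↔ σ⁻¹ y ∈ S := by
    intro y
    rw [hS, show σ (σ⁻¹ y) = y from σ.apply_symm_apply y]
  rw [mem_matchings]
  refine ⟨?_, ?_, ?_, ?_⟩
  · rintro (p | y)
    · by_cases hp : p ∈ S
      · rw [hinl p hp, hinl p hp]
      · rw [hinl' p hp, hinr' _ (fun h => hp ((hS p).2 h)),
          show σ⁻¹ (σ p) = p from σ.symm_apply_apply p]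
    · by_cases hy : y ∈ S.image σ₀
      · obtain ⟨p, hp, rfl⟩ := mem_image.1 hy
        rw [hinr p hp, hinr p hp]
      · rw [hinr' y hy, hinl' _ (fun h => hy ((hS' y).2 h)),
          show σ (σ⁻¹ y) = y from σ.apply_symm_apply y]
  · intro z hz
    obtain ⟨p, hp, rfl⟩ := mem_map.1 hz
    rw [mem_compl] at hp
    rw [Function.Embedding.inl_apply, hinl' p hp]
    exact mem_map_of_mem Function.Embedding.inr (mem_compl.2 fun h => hp ((hS p).2 h))
  · intro z hz
    obtain ⟨y, hy, rfl⟩ := mem_map.1 hz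
    rw [mem_compl] at hy
    rw [Function.Embedding.inr_apply, hinr' y hy]
    exact mem_map_of_mem Function.Embedding.inl (mem_compl.2 fun h => hy ((hS' y).2 h))
  · rintro (p | y) h1 h2
    · have hp : p ∈ S := by
        by_contra hp
        exact h1 (mem_map_of_mem Function.Embedding.inl (mem_compl.2 hp))
      exact hinl p hp
    · have hy : y ∈ S.image σ₀ := by
        by_contra hy
        exact h2 (mem_map_of_mem Function.Embedding.inr (mem_compl.2 hy))
      obtain ⟨p, hp, rfl⟩ := mem_image.1 hy
      exact hinr p hp

open Classical in
theorem sum_extending_le_sum_matchings (g : Perm (Fin n ⊕ Fin n) → ℝ) (hg : ∀ m, 0 ≤ g m) :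
    ∑ σ with ∀ p ∈ S, σ p = σ₀ p, g (jointPerm τ τ' σ) ≤
      ∑ m ∈ matchings (Sᶜ.map Function.Embedding.inl) ((S.image σ₀)ᶜ.map Function.Embedding.inr),
        g (m * (revealed S σ₀ * Equiv.sumCongr τ τ')) := by
  have h1 : ∀ σ : Perm (Fin n), g (jointPerm τ τ' σ) =
      g ((matchPerm σ * revealed S σ₀) * (revealed S σ₀ * Equiv.sumCongr τ τ')) := by
    intro σ
    rw [mul_assoc, ← mul_assoc (revealed S σ₀) (revealed S σ₀), revealed_mul_self, one_mul,
      jointPerm]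
  rw [sum_congr rfl fun σ _ => h1 σ]
  rw [← sum_image (s := univ.filter fun σ : Perm (Fin n) => ∀ p ∈ S, σ p = σ₀ p)
    (g := fun σ => matchPerm σ * revealed S σ₀)
    (f := fun m => g (m * (revealed S σ₀ * Equiv.sumCongr τ τ')))
    (fun σ _ σ' _ h => matchPerm_injective (mul_right_cancel h))]
  refine sum_le_sum_of_subset_of_nonneg ?_ fun m _ _ => hg _
  intro m hm
  obtain ⟨σ, hσ, rfl⟩ := mem_image.1 hm
  exact matchPerm_mul_revealed_mem (mem_filter.1 hσ).2

theorem card_filter_sumCongr (p : Fin n ⊕ Fin n → Prop) [DecidablePred p] :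
    #(univ.filter p) = #(univ.filter fun y => p (Sum.inl y)) +
      #(univ.filter fun y => p (Sum.inr y)) := by
  simp only [card_filter]
  rw [Fintype.sum_sum_type]

theorem card_fixed_sumCongr :
    #(univ.filter fun z : Fin n ⊕ Fin n => (Equiv.sumCongr τ τ') z = z) =
      cycleCount τ 1 + cycleCount τ' 1 := by
  rw [card_filter_sumCongr, ← card_fixSet, ← card_fixSet]
  congr 2
  · ext y
    rw [mem_filter, mem_fixSet]
    simp
  · ext y
    rw [mem_filter, mem_fixSet]
    simp

end Reveal

section Reach

variable {n k : ℕ} {τ τ' σ₀ : Perm (Fin n)} {U U' : Finset (Fin n)} {x q : Fin (k + 1) → Fin n}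

theorem mem_posSet {p : Fin n} : p ∈ posSet τ q ↔ ∃ i, q i = p ∨ τ (q i) = p := by
  rw [posSet, mem_image]
  constructor
  · rintro ⟨⟨i, b⟩, -, h⟩
    cases b
    · exact ⟨i, Or.inl h⟩
    · exact ⟨i, Or.inr h⟩
  · rintro ⟨i, h | h⟩
    · exact ⟨(i, false), mem_univ _, h⟩
    · exact ⟨(i, true), mem_univ _, h⟩

theorem Realizes.mem_image_posSet (h : Realizes τ τ' x q σ₀) {y : Fin n} :
    y ∈ (posSet τ q).image σ₀ ↔ ∃ i, τ' (x i) = y ∨ x i = y := by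
  rw [mem_image]
  constructor
  · rintro ⟨p, hp, rfl⟩
    obtain ⟨i, rfl | rfl⟩ := mem_posSet.1 hp
    · exact ⟨i, Or.inl (h i).1.symm⟩
    · exact ⟨i + 1, Or.inr (h i).2.symm⟩
  · rintro ⟨i, rfl | rfl⟩
    · exact ⟨q i, mem_posSet.2 ⟨i, Or.inl rfl⟩, (h i).1⟩
    · refine ⟨τ (q (i - 1)), mem_posSet.2 ⟨i - 1, Or.inr rfl⟩, ?_⟩
      rw [(h _).2, sub_add_cancel]

theorem Realizes.iff_forall_eq (h : Realizes τ τ' x q σ₀) (σ : Perm (Fin n)) :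
    Realizes τ τ' x q σ ↔ ∀ p ∈ posSet τ q, σ p = σ₀ p := by
  constructor
  · intro h' p hp
    obtain ⟨i, rfl | rfl⟩ := mem_posSet.1 hp
    · rw [(h i).1, (h' i).1]
    · rw [(h i).2, (h' i).2]
  · intro h' i
    rw [h' _ (mem_posSet.2 ⟨i, Or.inl rfl⟩), h' _ (mem_posSet.2 ⟨i, Or.inr rfl⟩)]
    exact h i

theorem eq_two_of_mem_image (hU' : ∀ y ∈ U', τ' y ≠ y) (hx : GoodSeq τ' U' x) {i j : Fin (k + 1)}
    (h : τ' (x j) = τ' (τ' (x i)) ∨ x j = τ' (τ' (x i))) : τ' (τ' (x i)) = x i := by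
  by_cases hij : i = j
  · subst hij
    rcases h with h | h
    · exact absurd (τ'.injective h).symm (hU' _ (hx.1 i))
    · exact h.symm
  · rcases h with h | h
    · exact absurd (τ'.injective h) (hx.2 i j hij).2.1
    · exact absurd h (hx.2 i j hij).2.2

theorem Realizes.exists_alive (h : Realizes τ τ' x q σ₀) (hU : ∀ y ∈ U, τ y ≠ y)
    (hU' : ∀ y ∈ U', τ' y ≠ y) (hq : GoodSeq τ U q) (hx : GoodSeq τ' U' x)
    (htwo : ∃ i, τ (τ (q i)) ≠ q i) {y : Fin n} (hy : ∀ i, x i ≠ y) :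
    ∃ z ∉ deadSet (posSet τ q) σ₀,
      SameCycle (revealed (posSet τ q) σ₀ * Equiv.sumCongr τ τ') z (Sum.inr y) := by
  set S := posSet τ q
  set Θ := revealed S σ₀ * Equiv.sumCongr τ τ' with hΘ
  by_contra! hno
  replace hno : ∀ z, SameCycle Θ (Sum.inr y) z → z ∈ deadSet S σ₀ := by
    intro z hz
    by_contra hzd
    exact hno z hzd hz.symm
  have hmemr : ∀ y, Sum.inr y ∈ deadSet S σ₀ ↔ ∃ i, τ' (x i) = y ∨ x i = y := by
    intro y
    rw [deadSet, inr_mem_disjSum, h.mem_image_posSet]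
  have hmeml : ∀ y, Sum.inl y ∈ deadSet S σ₀ ↔ ∃ i, q i = y ∨ τ (q i) = y := by
    intro y
    rw [deadSet, inl_mem_disjSum, mem_posSet]
  have hstep : ∀ z, SameCycle Θ (Sum.inr y) z → SameCycle Θ (Sum.inr y) (Θ z) := fun z hz =>
    sameCycle_apply_right.2 hz
  have hdead : ∀ z, SameCycle Θ (Sum.inr y) z → (Equiv.sumCongr τ τ') z ∈ deadSet S σ₀ := by
    intro z hz
    by_contra hzd
    have := hno _ (hstep z hz)
    rw [hΘ, Perm.mul_apply, revealed_of_notMem hzd] at this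
    exact hzd this
  have hback : ∀ i, SameCycle Θ (Sum.inr y) (Sum.inr (τ' (x i))) →
      SameCycle Θ (Sum.inr y) (Sum.inr (τ' (x (i - 1)))) ∧ τ (τ (q (i - 1))) = q (i - 1) := by
    intro i hi
    have h1 := hdead _ hi
    rw [Equiv.sumCongr_apply, Sum.map_inr, hmemr] at h1
    obtain ⟨j, hj⟩ := h1
    have h2 := eq_two_of_mem_image hU' hx hj
    have hd : Sum.inr (x i) ∈ deadSet S σ₀ := (hmemr _).2 ⟨i, Or.inr rfl⟩
    have h3 := hstep _ hi
    rw [hΘ, Perm.mul_apply, Equiv.sumCongr_apply, Sum.map_inr, h2, revealed_of_mem hd,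
      matchPerm_inr] at h3
    have h4 : σ₀⁻¹ (x i) = τ (q (i - 1)) := by
      rw [Perm.inv_eq_iff_eq, (h _).2, sub_add_cancel]
    rw [h4] at h3
    have h5 := hdead _ h3
    rw [Equiv.sumCongr_apply, Sum.map_inl, hmeml] at h5
    obtain ⟨j', hj'⟩ := h5
    have h6 := eq_two_of_mem_image hU hq hj'.symm
    refine ⟨?_, h6⟩
    have hd' : Sum.inl (q (i - 1)) ∈ deadSet S σ₀ := (hmeml _).2 ⟨_, Or.inl rfl⟩
    have h7 := hstep _ h3
    rw [hΘ, Perm.mul_apply, Equiv.sumCongr_apply, Sum.map_inl, h6, revealed_of_mem hd',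
      matchPerm_inl, (h _).1] at h7
    exact h7
  obtain ⟨i, hi⟩ := (hmemr y).1 (hno _ (SameCycle.refl _ _))
  have hi := hi.resolve_right (hy i)
  have hall : ∀ m : ℕ, SameCycle Θ (Sum.inr y) (Sum.inr (τ' (x (i - (m : Fin (k + 1)))))) := by
    intro m
    induction m with
    | zero =>
      rw [Nat.cast_zero, sub_zero, hi]
    | succ m ih =>
      have := (hback _ ih).1
      rwa [sub_sub, ← Nat.cast_succ] at this
  obtain ⟨j, hj⟩ := htwo
  refine hj ?_
  have h8 := (hback _ (hall (i - (j + 1) : Fin (k + 1)))).2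
  rw [Fin.cast_val_eq_self, sub_sub_cancel, add_sub_cancel_right] at h8
  exact h8

theorem errorBound_nonneg {ρ l : ℝ} {K M : ℕ} {φ : ℕ → ℝ} (hρ : 0 < ρ) (hl : 0 < l)
    (hφ0 : ∀ N, 0 ≤ φ N) (N f z : ℕ) : 0 ≤ errorBound ρ l K M φ N f z := by
  have h1 := sum_nonneg fun N (_ : N ∈ range (M + 1)) => hφ0 N
  have h2 := hφ0 0
  rw [errorBound]
  positivity

theorem errorBound_mono {ρ l : ℝ} {K M : ℕ} {φ : ℕ → ℝ} (hρ : 0 < ρ) (hl : 0 < l)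
    (hφ0 : ∀ N, 0 ≤ φ N) {N N' f f' z z' : ℕ} (hN : N ≤ N') (hf : f ≤ f') (hz : z ≤ z') :
    errorBound ρ l K M φ N f z ≤ errorBound ρ l K M φ N' f' z' := by
  have h1 := sum_nonneg fun N (_ : N ∈ range (M + 1)) => hφ0 N
  have h2 := hφ0 0
  rw [errorBound, errorBound]
  gcongr
  norm_num

theorem sum_realizes_le {ρ l η : ℝ} {K M : ℕ} {ψ φ : ℕ → ℝ} (hρ : 0 < ρ) (hl : 0 < l)
    (hl2 : l ≤ 1 / 2) (hφ : Antitone φ) (hψ : ∀ N, 0 ≤ ψ N) (hψφ : ∀ N, ψ N ≤ φ N)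
    (hM : ∀ N, M < N → ψ N = 0) (hη : K / (ρ * l) + η + l ≤ 1)
    (hr : ρ + M ≤ (n - 2 * (k + 1) : ℕ))
    (h2 : 2 * (cycleCount τ 2 : ℝ) + 8 * (k + 1) + 2 * M ≤ η * ρ)
    (h2' : 2 * (cycleCount τ' 2 : ℝ) + 8 * (k + 1) + 2 * M ≤ η * ρ)
    (hU : ∀ y ∈ U, τ y ≠ y) (hU' : ∀ y ∈ U', τ' y ≠ y) (hq : GoodSeq τ U q)
    (hx : GoodSeq τ' U' x) (htwo : ∃ i, τ (τ (q i)) ≠ q i) :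
    ex (fun σ => open Classical in if Realizes τ τ' x q σ then
      ∑ y with ∀ i, x i ≠ y, ψ (2 * Function.minimalPeriod (word τ τ' σ) y) else 0) ≤
      pr (Realizes τ τ' x q) * (n * ((∑ N ∈ range (M + 1), ψ N) / ρ) +
        errorBound ρ l K M φ n (cycleCount τ 1 + cycleCount τ' 1) (4 * (k + 1))) := by
  classical
  have hφ0 : ∀ N, 0 ≤ φ N := fun N => (hψ N).trans (hψφ N)
  have hR0 : 0 ≤ n * ((∑ N ∈ range (M + 1), ψ N) / ρ) +
      errorBound ρ l K M φ n (cycleCount τ 1 + cycleCount τ' 1) (4 * (k + 1)) := by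
    have h1 : 0 ≤ (∑ N ∈ range (M + 1), ψ N) / ρ := div_nonneg (sum_nonneg fun N _ => hψ N) hρ.le
    have h3 := errorBound_nonneg hρ hl hφ0 (K := K) (M := M) n
      (cycleCount τ 1 + cycleCount τ' 1) (4 * (k + 1))
    have := mul_nonneg (Nat.cast_nonneg n) h1
    linarith
  rw [pr_realizes hU hU' hq hx, ex, div_mul_eq_mul_div]
  refine div_le_div_of_nonneg_right ?_ (Nat.cast_nonneg _)
  by_cases hne : ∃ σ₀, Realizes τ τ' x q σ₀
  swap
  · rw [sum_eq_zero fun σ _ => if_neg fun h => hne ⟨σ, h⟩]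
    exact mul_nonneg (Nat.cast_nonneg _) hR0
  obtain ⟨σ₀, h⟩ := hne
  set S := posSet τ q with hS
  have hcS : #S = 2 * (k + 1) := card_posSet (posOf_injective hU hq)
  have hcS' : #(S.image σ₀) = 2 * (k + 1) := by rw [card_image_of_injective _ σ₀.injective, hcS]
  have hcZ : #(deadSet S σ₀) = 4 * (k + 1) := by
    rw [deadSet, card_disjSum, hcS, hcS']
    ring
  set W := (univ.filter fun y => ∀ i, x i ≠ y).map
    (Function.Embedding.inr : Fin n ↪ Fin n ⊕ Fin n) with hW
  have hcW : #W ≤ n := by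
    rw [hW, card_map]
    exact (card_le_univ _).trans (by rw [Fintype.card_fin])
  have hZc : (Sᶜ.map Function.Embedding.inl : Finset (Fin n ⊕ Fin n)) ∪
      ((S.image σ₀)ᶜ.map Function.Embedding.inr) = (deadSet S σ₀)ᶜ := by
    ext z
    rw [mem_union, mem_compl, deadSet]
    rcases z with p | y
    · simp
    · simp
  have hdisj : _root_.Disjoint (Sᶜ.map Function.Embedding.inl : Finset (Fin n ⊕ Fin n))
      ((S.image σ₀)ᶜ.map Function.Embedding.inr) := by
    rw [Finset.disjoint_left]
    intro z hz hz'
    obtain ⟨p, -, rfl⟩ := mem_map.1 hz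
    obtain ⟨y, -, he⟩ := mem_map.1 hz'
    exact Sum.inr_ne_inl he
  have main := sum_explore_le (Θ₀ := Equiv.sumCongr τ τ') (Q := revealed S σ₀)
    (Z := deadSet S σ₀) hρ hl hl2 hφ hψ hψφ hM hη (fun z hz => revealed_of_notMem hz)
    (fun z hz => by rw [revealed_of_mem hz]; exact matchPerm_mem_deadSet hz) hdisj hZc
    (r := n - 2 * (k + 1)) (by rw [card_map, card_compl, Fintype.card_fin, hcS])
    (by rw [card_map, card_compl, Fintype.card_fin, hcS']) hr ?_ ?_ W ?_
  · rw [card_fixed_sumCongr, hcZ] at main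
    have hsum : ∑ σ, (if Realizes τ τ' x q σ then
        ∑ y with ∀ i, x i ≠ y, ψ (2 * Function.minimalPeriod (word τ τ' σ) y) else 0) ≤
        ∑ u ∈ W, ∑ m ∈ matchings (Sᶜ.map Function.Embedding.inl)
          ((S.image σ₀)ᶜ.map Function.Embedding.inr),
          ψ (Function.minimalPeriod (m * (revealed S σ₀ * Equiv.sumCongr τ τ')) u) := by
      rw [← sum_filter, hW, sum_map, sum_comm]
      refine sum_le_sum fun y _ => ?_
      have := sum_extending_le_sum_matchings (τ := τ) (τ' := τ') (S := S) (σ₀ := σ₀)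
        (fun m => ψ (Function.minimalPeriod m (Sum.inr y))) fun m => hψ _
      simp only [minimalPeriod_jointPerm] at this
      rw [filter_congr fun σ _ => h.iff_forall_eq σ]
      exact this
    refine hsum.trans (main.trans (mul_le_mul_of_nonneg_left ?_ (Nat.cast_nonneg _)))
    have h1 : 0 ≤ (∑ N ∈ range (M + 1), ψ N) / ρ := div_nonneg (sum_nonneg fun N _ => hψ N) hρ.le
    have hcW' : (#W : ℝ) ≤ n := by exact_mod_cast hcW
    refine add_le_add (mul_le_mul_of_nonneg_right hcW' h1) ?_
    exact errorBound_mono hρ hl hφ0 hcW le_rfl le_rfl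
  · rw [hcZ]
    have hle : #((Sᶜ.map Function.Embedding.inl : Finset (Fin n ⊕ Fin n)).filter fun z =>
        (Equiv.sumCongr τ τ') z ≠ z ∧ (Equiv.sumCongr τ τ') ((Equiv.sumCongr τ τ') z) = z) ≤
        2 * cycleCount τ 2 := by
      rw [← card_twoSet, ← card_map (Function.Embedding.inl : Fin n ↪ Fin n ⊕ Fin n)]
      refine card_le_card fun z hz => ?_
      obtain ⟨hz, hz1, hz2⟩ := mem_filter.1 hz
      obtain ⟨p, -, rfl⟩ := mem_map.1 hz
      refine mem_map_of_mem _ (mem_twoSet.2 ⟨fun he => hz1 ?_, Sum.inl_injective hz2⟩)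
      exact congrArg Sum.inl he
    have hle' : ((#((Sᶜ.map Function.Embedding.inl : Finset (Fin n ⊕ Fin n)).filter fun z =>
        (Equiv.sumCongr τ τ') z ≠ z ∧ (Equiv.sumCongr τ τ') ((Equiv.sumCongr τ τ') z) = z) : ℕ) :
        ℝ) ≤ 2 * cycleCount τ 2 := by exact_mod_cast hle
    push_cast
    linarith
  · rw [hcZ]
    have hle : #(((S.image σ₀)ᶜ.map Function.Embedding.inr : Finset (Fin n ⊕ Fin n)).filter fun z =>
        (Equiv.sumCongr τ τ') z ≠ z ∧ (Equiv.sumCongr τ τ') ((Equiv.sumCongr τ τ') z) = z) ≤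
        2 * cycleCount τ' 2 := by
      rw [← card_twoSet, ← card_map (Function.Embedding.inr : Fin n ↪ Fin n ⊕ Fin n)]
      refine card_le_card fun z hz => ?_
      obtain ⟨hz, hz1, hz2⟩ := mem_filter.1 hz
      obtain ⟨p, -, rfl⟩ := mem_map.1 hz
      refine mem_map_of_mem _ (mem_twoSet.2 ⟨fun he => hz1 ?_, Sum.inr_injective hz2⟩)
      exact congrArg Sum.inr he
    have hle' : ((#(((S.image σ₀)ᶜ.map Function.Embedding.inr :
        Finset (Fin n ⊕ Fin n)).filter fun z =>
        (Equiv.sumCongr τ τ') z ≠ z ∧ (Equiv.sumCongr τ τ') ((Equiv.sumCongr τ τ') z) = z) : ℕ) :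
        ℝ) ≤ 2 * cycleCount τ' 2 := by exact_mod_cast hle
    push_cast
    linarith
  · intro u hu
    obtain ⟨y, hy, rfl⟩ := mem_map.1 hu
    exact h.exists_alive hU hU' hq hx htwo (mem_filter.1 hy).2

end Reach

section Gen

variable {n : ℕ} {τ τ' σ : Perm (Fin n)}

/-- Data prescribing a cycle of `word τ τ' σ`. -/
abbrev Pat (n : ℕ) := Σ k : ℕ, (Fin (k + 1) → Fin n) × (Fin (k + 1) → Fin n)

/-- The pattern `a` is followed by `σ`. -/
def Follows (τ τ' : Perm (Fin n)) (a : Pat n) (σ : Perm (Fin n)) : Prop :=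
  Realizes τ τ' a.2.1 a.2.2 σ

open Classical in
/-- The generic patterns with `k + 1` steps. -/
noncomputable def genPat (τ τ' : Perm (Fin n)) (k : ℕ) :
    Finset ((Fin (k + 1) → Fin n) × (Fin (k + 1) → Fin n)) :=
  univ.filter fun a => GoodSeq τ' (fixSet τ')ᶜ a.1 ∧ GoodSeq τ (fixSet τ)ᶜ a.2 ∧
    ∃ i, τ (τ (a.2 i)) ≠ a.2 i

/-- The generic patterns with number of steps in `Λ`. -/
noncomputable def genPats (τ τ' : Perm (Fin n)) (Λ : Finset ℕ) : Finset (Pat n) :=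
  Λ.sigma fun k => genPat τ τ' k

theorem mem_genPats {Λ : Finset ℕ} {a : Pat n} :
    a ∈ genPats τ τ' Λ ↔ a.1 ∈ Λ ∧ GoodSeq τ' (fixSet τ')ᶜ a.2.1 ∧
      GoodSeq τ (fixSet τ)ᶜ a.2.2 ∧ ∃ i, τ (τ (a.2.2 i)) ≠ a.2.2 i := by
  classical
  rw [genPats, mem_sigma, genPat, mem_filter]
  simp

/-- The length of the cycle of `y`. -/
noncomputable def len (τ τ' σ : Perm (Fin n)) (y : Fin n) : ℕ :=
  Function.minimalPeriod (word τ τ' σ) y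

theorem len_pos (y : Fin n) : 0 < len τ τ' σ y := minimalPeriod_pos_perm _ _

theorem len_eq_of_follows {Λ : Finset ℕ} {a : Pat n} (ha : a ∈ genPats τ τ' Λ)
    (h : Follows τ τ' a σ) (i : Fin (a.1 + 1)) : len τ τ' σ (a.2.1 i) = a.1 + 1 :=
  minimalPeriod_of_fin (mem_genPats.1 ha).2.1.injective (Realizes.word_apply h) i

theorem follows_injOn {Λ : Finset ℕ} {a b : Pat n} (ha : a ∈ genPats τ τ' Λ)
    (hb : b ∈ genPats τ τ' Λ) (hfa : Follows τ τ' a σ) (hfb : Follows τ τ' b σ)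
    (h : a.2.1 0 = b.2.1 0) : a = b := by
  have h1 := len_eq_of_follows ha hfa 0
  have h2 := len_eq_of_follows hb hfb 0
  rw [h, h2] at h1
  obtain ⟨k, x, q⟩ := a
  obtain ⟨k', x', q'⟩ := b
  have hk : k' = k := by simpa using h1
  subst hk
  obtain ⟨rfl, rfl⟩ := Realizes.eq_of_zero_eq hfa hfb h
  rfl

theorem sum_weight_le {Λ : Finset ℕ} {Γ : Finset (Pat n)} (hΓ : Γ ⊆ genPats τ τ' Λ)
    (hf : ∀ a ∈ Γ, Follows τ τ' a σ) {Y : Finset (Fin n)} (hY : ∀ a ∈ Γ, a.2.1 0 ∈ Y)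
    {ψ : ℕ → ℝ} (hψ0 : ∀ N, 0 ≤ ψ N) (hψ : ∀ k ∈ Λ, ψ (2 * (k + 1)) = 1 / (k + 1)) :
    ∑ a ∈ Γ, (1 : ℝ) / (a.1 + 1) ≤ ∑ y ∈ Y, ψ (2 * len τ τ' σ y) := by
  have h1 : ∑ a ∈ Γ, (1 : ℝ) / (a.1 + 1) = ∑ a ∈ Γ, ψ (2 * len τ τ' σ (a.2.1 0)) := by
    refine sum_congr rfl fun a ha => ?_
    rw [len_eq_of_follows (hΓ ha) (hf a ha), hψ _ (mem_genPats.1 (hΓ ha)).1]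
  rw [h1, ← sum_image (s := Γ) (g := fun a : Pat n => a.2.1 0)
    (f := fun y => ψ (2 * len τ τ' σ y))
    (fun a ha b hb h => follows_injOn (hΓ ha) (hΓ hb) (hf a ha) (hf b hb) h)]
  refine sum_le_sum_of_subset_of_nonneg ?_ fun y _ _ => hψ0 _
  intro y hy
  obtain ⟨a, ha, rfl⟩ := mem_image.1 hy
  exact hY a ha

theorem sum_range_follows {Λ : Finset ℕ} {a : Pat n} (ha : a ∈ genPats τ τ' Λ)
    (h : Follows τ τ' a σ) {ψ : ℕ → ℝ} (hψ : ψ (2 * (a.1 + 1)) = 1 / (a.1 + 1)) :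
    ∑ y ∈ univ.image a.2.1, ψ (2 * len τ τ' σ y) = 1 := by
  rw [sum_image fun i _ j _ hij => (mem_genPats.1 ha).2.1.injective hij]
  simp only [len_eq_of_follows ha h, hψ]
  rw [sum_const, card_univ, Fintype.card_fin, nsmul_eq_mul]
  push_cast
  field_simp

open Classical in
/-- The number of cycles following a generic pattern. -/
noncomputable def genCount (τ τ' : Perm (Fin n)) (Λ : Finset ℕ) (σ : Perm (Fin n)) : ℝ :=
  ∑ a ∈ genPats τ τ' Λ, if Follows τ τ' a σ then 1 / (a.1 + 1 : ℝ) else 0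

/-- The total weight of the cycles other than the one of the pattern `a`. -/
noncomputable def offSum (τ τ' : Perm (Fin n)) (ψ : ℕ → ℝ) (a : Pat n) (σ : Perm (Fin n)) : ℝ :=
  ∑ y with ∀ i, a.2.1 i ≠ y, ψ (2 * len τ τ' σ y)

theorem genCount_le_one_add {Λ : Finset ℕ} {a : Pat n} (ha : a ∈ genPats τ τ' Λ)
    (h : Follows τ τ' a σ) {ψ : ℕ → ℝ} (hψ0 : ∀ N, 0 ≤ ψ N)
    (hψ : ∀ k ∈ Λ, ψ (2 * (k + 1)) = 1 / (k + 1)) :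
    genCount τ τ' Λ σ ≤ 1 + offSum τ τ' ψ a σ := by
  classical
  have h1 : genCount τ τ' Λ σ ≤ ∑ y, ψ (2 * len τ τ' σ y) := by
    rw [genCount, ← sum_filter]
    exact sum_weight_le (filter_subset _ _) (fun a ha => (mem_filter.1 ha).2)
      (fun a _ => mem_univ _) hψ0 hψ
  refine h1.trans (le_of_eq ?_)
  rw [← sum_range_follows ha h (hψ _ (mem_genPats.1 ha).1), offSum,
    ← sum_filter_add_sum_filter_not univ (fun y => ∀ i, a.2.1 i ≠ y), add_comm]
  congr 1
  refine sum_congr ?_ fun _ _ => rfl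
  ext y
  simp

open Classical in
/-- The number of pairs of a generic cycle and another cycle, weighted by `ψ`. -/
noncomputable def badCount (τ τ' : Perm (Fin n)) (Λ : Finset ℕ) (ψ : ℕ → ℕ → ℝ)
    (σ : Perm (Fin n)) : ℝ :=
  ∑ a ∈ genPats τ τ' Λ, if Follows τ τ' a σ then 1 / (a.1 + 1 : ℝ) * offSum τ τ' (ψ a.1) a σ else 0

/-- The numerical conditions under which the exploration bounds apply. -/
structure Admissible (n d d' : ℕ) (ρ l η : ℝ) (K M : ℕ) (φ : ℕ → ℝ) (k : ℕ) : Prop where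
  ρ_pos : 0 < ρ
  l_pos : 0 < l
  l_le : l ≤ 1 / 2
  anti : Antitone φ
  eta : K / (ρ * l) + η + l ≤ 1
  room : ρ + M ≤ (n - 2 * (k + 1) : ℕ)
  two : 2 * (d : ℝ) + 8 * (k + 1) + 2 * M ≤ η * ρ
  two' : 2 * (d' : ℝ) + 8 * (k + 1) + 2 * M ≤ η * ρ

theorem ex_offSum_le {ρ l η : ℝ} {K M k₀ : ℕ} {ψ φ : ℕ → ℝ}
    (had : Admissible n (cycleCount τ 2) (cycleCount τ' 2)
      ρ l η K M φ k₀)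
    (hψ : ∀ N, 0 ≤ ψ N) (hψφ : ∀ N, ψ N ≤ φ N) (hM : ∀ N, M < N → ψ N = 0)
    {Λ : Finset ℕ} (hΛ : ∀ k ∈ Λ, k ≤ k₀) {a : Pat n} (ha : a ∈ genPats τ τ' Λ) :
    ex (fun σ => open Classical in if Follows τ τ' a σ then offSum τ τ' ψ a σ else 0) ≤
      pr (Follows τ τ' a) * (n * ((∑ N ∈ range (M + 1), ψ N) / ρ) +
        errorBound ρ l K M φ n (cycleCount τ 1 + cycleCount τ' 1) (4 * (k₀ + 1))) := by
  obtain ⟨hk, hx, hq, htwo⟩ := mem_genPats.1 ha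
  have hk := hΛ _ hk
  have hkR : (a.1 : ℝ) ≤ k₀ := by exact_mod_cast hk
  have hroom : ((n - 2 * (k₀ + 1) : ℕ) : ℝ) ≤ (n - 2 * (a.1 + 1) : ℕ) := by
    exact_mod_cast (by omega : n - 2 * (k₀ + 1) ≤ n - 2 * (a.1 + 1))
  have hfix : ∀ (τ : Perm (Fin n)), ∀ y ∈ (fixSet τ)ᶜ, τ y ≠ y := fun τ y hy => by
    rwa [mem_compl, mem_fixSet] at hy
  refine (sum_realizes_le had.ρ_pos had.l_pos had.l_le had.anti hψ hψφ hM had.eta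
    (had.room.trans hroom) (by linarith [had.two]) (by linarith [had.two']) (hfix τ) (hfix τ') hq hx
    htwo).trans ?_
  refine mul_le_mul_of_nonneg_left ?_ (pr_nonneg _)
  exact add_le_add le_rfl (errorBound_mono had.ρ_pos had.l_pos
    (fun N => (hψ N).trans (hψφ N)) le_rfl le_rfl (by omega))

end Gen

end RandGen

namespace RandGen
open Equiv Equiv.Perm Finset

section Isolated

variable {n : ℕ}

theorem iterate_eq_of_sameCycle {w : Perm (Fin n)} {x y : Fin n} (h : SameCycle w x y) :
    ∃ i < Function.minimalPeriod w x, w^[i] x = y := by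
  obtain ⟨k, -, hk⟩ := h.exists_pow_eq'
  refine ⟨k % Function.minimalPeriod w x, Nat.mod_lt _ (minimalPeriod_pos_perm w x), ?_⟩
  rw [Function.iterate_mod_minimalPeriod_eq, iterate_eq_pow, hk]

theorem sameCycle_iterate (w : Perm (Fin n)) (x : Fin n) (i : ℕ) : SameCycle w x (w^[i] x) :=
  ⟨i, by rw [iterate_eq_pow, zpow_natCast]⟩

theorem iterate_injOn (w : Perm (Fin n)) (x : Fin n) :
    Set.InjOn (fun i => w^[i] x) (range (Function.minimalPeriod w x) : Set ℕ) := by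
  intro i hi j hj h
  simp only [coe_range, Set.mem_Iio] at hi hj
  exact (Function.iterate_eq_iterate_iff_of_lt_minimalPeriod hi hj).1 h

open Classical in
theorem card_sameCycle (w : Perm (Fin n)) (x : Fin n) :
    #(univ.filter fun y => SameCycle w x y) = Function.minimalPeriod w x := by
  rw [← card_range (Function.minimalPeriod w x), ← card_image_of_injOn (iterate_injOn w x)]
  congr 1
  ext y
  simp only [mem_filter, mem_univ, true_and, mem_image, mem_range]
  constructor
  · exact iterate_eq_of_sameCycle
  · rintro ⟨i, -, rfl⟩
    exact sameCycle_iterate w x i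

open Classical in
/-- The number of points of a cycle with a given label. -/
theorem card_sameCycle_label {b : ℕ} {w : Perm (Fin n)} {ρ : Perm (Fin b)} {f : Fin n → Fin b}
    (h : ∀ y, f (w y) = ρ (f y)) (x : Fin n) :
    #(univ.filter fun y => SameCycle w x y ∧ f y = f x) * Function.minimalPeriod ρ (f x) =
      Function.minimalPeriod w x := by
  have hit : ∀ (i : ℕ) y, f (w^[i] y) = ρ^[i] (f y) := by
    intro i
    induction i with
    | zero => intro y; rfl
    | succ i ih => intro y; rw [Function.iterate_succ_apply', Function.iterate_succ_apply', h, ih]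
  set ℓ := Function.minimalPeriod w x with hℓ
  set d := Function.minimalPeriod ρ (f x) with hd
  have hd0 : 0 < d := minimalPeriod_pos_perm _ _
  have hdvd : d ∣ ℓ := by
    apply Function.IsPeriodicPt.minimalPeriod_dvd
    rw [Function.IsPeriodicPt, Function.IsFixedPt, ← hit, Function.iterate_minimalPeriod]
  obtain ⟨e, he⟩ := hdvd
  have himg : (univ.filter fun y => SameCycle w x y ∧ f y = f x) =
      (range e).image fun i => w^[d * i] x := by
    ext y
    simp only [mem_filter, mem_univ, true_and, mem_image, mem_range]
    constructor
    · rintro ⟨h1, h2⟩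
      obtain ⟨i, hi, rfl⟩ := iterate_eq_of_sameCycle h1
      rw [hit] at h2
      obtain ⟨j, rfl⟩ := Function.IsPeriodicPt.minimalPeriod_dvd (f := ρ) h2
      refine ⟨j, ?_, rfl⟩
      rw [← hℓ, he] at hi
      exact lt_of_mul_lt_mul_left hi (Nat.zero_le _)
    · rintro ⟨i, -, rfl⟩
      refine ⟨sameCycle_iterate _ _ _, ?_⟩
      rw [hit]
      exact (Function.isPeriodicPt_minimalPeriod ρ (f x)).mul_const i
  rw [himg, card_image_of_injOn, card_range, mul_comm, he]
  intro i hi j hj hij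
  simp only [coe_range, Set.mem_Iio] at hi hj
  have := iterate_injOn w x (x₁ := d * i) (x₂ := d * j)
    (by simp only [coe_range, Set.mem_Iio, ← hℓ, he]; exact Nat.mul_lt_mul_of_pos_left hi hd0)
    (by simp only [coe_range, Set.mem_Iio, ← hℓ, he]; exact Nat.mul_lt_mul_of_pos_left hj hd0) hij
  exact Nat.eq_of_mul_eq_mul_left hd0 this

/-- A transitive group containing an element with a cycle whose length has a prime factor dividing
no other cycle length contains the alternating group, if it has no system of large blocks. -/
theorem alternatingGroup_le_of_isolated {G : Subgroup (Perm (Fin n))}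
    (hT : MulAction.IsPretransitive G (Fin n)) {w : Perm (Fin n)} (hw : w ∈ G) {x : Fin n}
    {p m A : ℕ} (hp : p.Prime) (hpA : A ≤ p) (hℓ : Function.minimalPeriod w x = p * m)
    (hm : ∀ d, 2 ≤ d → d < A → ¬ d ∣ m)
    (hiso : ∀ y, ¬ SameCycle w x y → ¬ p ∣ Function.minimalPeriod w y)
    (hblocks : ∀ (a b : ℕ) (f : Fin n → Fin b), A ≤ a → 2 ≤ b →
      (∀ i, #(univ.filter fun x => f x = i) = a) →
      (∀ g ∈ G, ∃ ρ : Perm (Fin b), ∀ y, f (g y) = ρ (f y)) → False)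
    (hn : 4 * Function.minimalPeriod w x ^ 2 + 2 * Function.minimalPeriod w x + 1 < n) :
    alternatingGroup (Fin n) ≤ G := by
  classical
  set M := ∏ y with ¬ SameCycle w x y, Function.minimalPeriod w y with hM
  have hpM : ¬ p ∣ M := by
    rw [hM, hp.prime.dvd_finset_prod_iff]
    rintro ⟨y, hy, h⟩
    exact hiso y (mem_filter.1 hy).2 h
  have hfixed : ∀ y, ¬ SameCycle w x y → (w ^ M) y = y := by
    intro y hy
    rw [← iterate_eq_pow]
    exact (Function.isPeriodicPt_minimalPeriod w y).trans_dvd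
      (dvd_prod_of_mem _ (mem_filter.2 ⟨mem_univ _, hy⟩))
  have hmoved : ∀ y, SameCycle w x y → (w ^ M) y ≠ y := by
    intro y hy h
    rw [← iterate_eq_pow] at h
    have h1 := Function.IsPeriodicPt.minimalPeriod_dvd (f := w) h
    rw [← minimalPeriod_eq_of_sameCycle hy, hℓ] at h1
    exact hpM ((dvd_mul_right p m).trans h1)
  have hsupp : (w ^ M).support = univ.filter fun y => SameCycle w x y := by
    ext y
    rw [mem_support, mem_filter]
    exact ⟨fun h => ⟨mem_univ _, by_contra fun h' => h (hfixed y h')⟩, fun h => hmoved y h.2⟩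
  have hprim : MulAction.IsPreprimitive G (Fin n) := by
    by_contra hP
    obtain ⟨a, b, f, ha, hb, hf, hG⟩ := exists_blockMap hT hP
    rcases le_or_gt A a with hAa | haA
    · exact hblocks a b f hAa hb hf hG
    obtain ⟨ρ, hρ⟩ := hG w hw
    have hcard := card_sameCycle_label hρ x
    have hle : #(univ.filter fun y => SameCycle w x y ∧ f y = f x) ≤ a := by
      rw [← hf (f x)]
      exact card_le_card fun y hy => mem_filter.2 ⟨mem_univ _, (mem_filter.1 hy).2.2⟩
    have hpos : 0 < #(univ.filter fun y => SameCycle w x y ∧ f y = f x) :=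
      card_pos.2 ⟨x, mem_filter.2 ⟨mem_univ _, SameCycle.refl _ _, rfl⟩⟩
    rw [hℓ] at hcard
    have hpd : ¬ p ∣ #(univ.filter fun y => SameCycle w x y ∧ f y = f x) := fun h =>
      absurd (Nat.le_of_dvd hpos h) (by omega)
    have hpρ : p ∣ Function.minimalPeriod ρ (f x) :=
      ((hp.dvd_mul).1 (hcard ▸ dvd_mul_right p m)).resolve_left hpd
    have hit : ∀ (i : ℕ) y, f ((w ^ i) y) = (ρ ^ i) (f y) := by
      intro i
      induction i with
      | zero => intro y; rfl
      | succ i ih => intro y; rw [pow_succ', pow_succ', Perm.mul_apply, Perm.mul_apply, hρ, ih]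
    have hmove : (ρ ^ M) (f x) ≠ f x := by
      intro h
      rw [← iterate_eq_pow] at h
      exact hpM (hpρ.trans (Function.IsPeriodicPt.minimalPeriod_dvd (f := ρ) h))
    have heq : (univ.filter fun y => SameCycle w x y ∧ f y = f x) =
        univ.filter fun y => f y = f x := by
      ext y
      simp only [mem_filter, mem_univ, true_and, and_iff_right_iff_imp]
      intro hy
      by_contra h
      have := hit M y
      rw [hfixed y h, hy] at this
      exact hmove this.symm
    rw [heq, hf] at hcard hpd
    have hcop : Nat.Coprime a p := ((Nat.Prime.coprime_iff_not_dvd hp).2 hpd).symm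
    exact hm a ha haA (hcop.dvd_of_dvd_mul_left (hcard ▸ dvd_mul_right a _))
  refine alternatingGroup_le_of_card_support hprim (g := w ^ M) (G.pow_mem hw M) ?_ ?_
  · intro h
    exact hmoved x (SameCycle.refl _ _) (by rw [h]; rfl)
  · rw [hsupp, card_sameCycle, Fintype.card_fin]
    exact hn

end Isolated

end RandGen

namespace RandGen
open Equiv Equiv.Perm Finset
open scoped Fin.NatCast Fin.CommRing

section IsolatedPattern

variable {n : ℕ} {τ τ' σ : Perm (Fin n)} {Λ : Finset ℕ} {a : Pat n}

theorem sameCycle_follows_iff (h : Follows τ τ' a σ) (y : Fin n) :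
    SameCycle (word τ τ' σ) (a.2.1 0) y ↔ ∃ i, a.2.1 i = y := by
  have hit := iterate_apply_fin (Realizes.word_apply h) 0
  constructor
  · intro hy
    obtain ⟨i, -, rfl⟩ := iterate_eq_of_sameCycle hy
    exact ⟨_, (hit i).symm⟩
  · rintro ⟨i, rfl⟩
    have := sameCycle_iterate (word τ τ' σ) (a.2.1 0) (i : ℕ)
    rw [hit] at this
    simpa using this

theorem len_le (y : Fin n) : len τ τ' σ y ≤ n :=
  Function.minimalPeriod_le_card.trans_eq (Fintype.card_fin n)

/-- The weight of multiples of a prime up to a bound. -/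
noncomputable def badWeight (P : ℕ → ℕ) (L k N : ℕ) : ℝ :=
  if 2 * P k ∣ N ∧ N ≤ 2 * L then 2 / N else 0

theorem badWeight_nonneg (P : ℕ → ℕ) (L k N : ℕ) : 0 ≤ badWeight P L k N := by
  unfold badWeight
  split_ifs <;> positivity

/-- The pattern `a` is followed, and the prime divides no short cycle length elsewhere. -/
def GoodPat (τ τ' : Perm (Fin n)) (P : ℕ → ℕ) (L : ℕ) (a : Pat n) (σ : Perm (Fin n)) : Prop :=
  Follows τ τ' a σ ∧ ∀ y, (∀ i, a.2.1 i ≠ y) → P a.1 ∣ len τ τ' σ y → L < len τ τ' σ y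

theorem one_le_offSum {P : ℕ → ℕ} {L : ℕ} (h : Follows τ τ' a σ)
    (hbad : ¬ GoodPat τ τ' P L a σ) : 1 ≤ offSum τ τ' (badWeight P L a.1) a σ := by
  classical
  simp only [GoodPat, h, true_and] at hbad
  push Not at hbad
  obtain ⟨y, hy, hdvd, hle⟩ := hbad
  have hsub : (univ.filter fun z => SameCycle (word τ τ' σ) y z) ⊆
      univ.filter fun z => ∀ i, a.2.1 i ≠ z := by
    intro z hz
    refine mem_filter.2 ⟨mem_univ _, ?_⟩
    by_contra! hcon
    obtain ⟨i, hi⟩ := (sameCycle_follows_iff h y).1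
      (((sameCycle_follows_iff h z).2 hcon).trans (mem_filter.1 hz).2.symm)
    exact hy i hi
  have h0 : (0 : ℝ) < len τ τ' σ y := by exact_mod_cast len_pos y
  calc (1 : ℝ) = ∑ z ∈ univ.filter (fun z => SameCycle (word τ τ' σ) y z),
        (1 : ℝ) / len τ τ' σ y := by
        rw [sum_const, card_sameCycle, nsmul_eq_mul, ← len]
        field_simp
    _ = ∑ z ∈ univ.filter (fun z => SameCycle (word τ τ' σ) y z),
        badWeight P L a.1 (2 * len τ τ' σ z) := by
        refine sum_congr rfl fun z hz => ?_
        have he : len τ τ' σ z = len τ τ' σ y :=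
          (minimalPeriod_eq_of_sameCycle (mem_filter.1 hz).2).symm
        rw [he, badWeight, if_pos ⟨Nat.mul_dvd_mul_left 2 hdvd, by omega⟩]
        push_cast
        field_simp
    _ ≤ _ := sum_le_sum_of_subset_of_nonneg hsub fun _ _ _ => badWeight_nonneg _ _ _ _

open Classical in
theorem genCount_sub_badCount_le (P : ℕ → ℕ) (L : ℕ) :
    genCount τ τ' Λ σ - badCount τ τ' Λ (badWeight P L) σ ≤
      ∑ a ∈ (genPats τ τ' Λ).filter (fun a => GoodPat τ τ' P L a σ), (1 : ℝ) / (a.1 + 1) := by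
  rw [genCount, badCount, ← sum_sub_distrib, sum_filter]
  refine sum_le_sum fun a _ => ?_
  have hw : (0 : ℝ) ≤ 1 / (a.1 + 1) := by positivity
  by_cases h : Follows τ τ' a σ
  · rw [if_pos h, if_pos h]
    by_cases hg : GoodPat τ τ' P L a σ
    · rw [if_pos hg, sub_le_self_iff]
      exact mul_nonneg hw (sum_nonneg fun _ _ => badWeight_nonneg _ _ _ _)
    · rw [if_neg hg]
      nlinarith [one_le_offSum h hg]
  · rw [if_neg h, if_neg h, if_neg fun hg : GoodPat τ τ' P L a σ => h hg.1, sub_zero]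

open Classical in
/-- The total weight of the good cycles is at most the number of their primes. -/
theorem sum_good_le {P : ℕ → ℕ} {L : ℕ} (hP : ∀ k ∈ Λ, P k ∣ k + 1) (hL : ∀ k ∈ Λ, k + 1 ≤ L) :
    ∑ a ∈ (genPats τ τ' Λ).filter (fun a => GoodPat τ τ' P L a σ), (1 : ℝ) / (a.1 + 1) ≤
      #(((genPats τ τ' Λ).filter fun a => GoodPat τ τ' P L a σ).image fun a => P a.1) := by
  set Γ := (genPats τ τ' Λ).filter fun a => GoodPat τ τ' P L a σ with hΓ
  rw [card_eq_sum_ones, Nat.cast_sum,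
    ← sum_fiberwise_of_maps_to (g := fun a : Pat n => P a.1) fun a ha => mem_image_of_mem (fun a : Pat n => P a.1) ha]
  refine sum_le_sum fun p hp => ?_
  obtain ⟨b, hb, rfl⟩ := mem_image.1 hp
  have hb' := mem_filter.1 hb
  have hsub : (Γ.filter fun a => P a.1 = P b.1) ⊆ genPats τ τ' Λ :=
    (filter_subset _ _).trans (filter_subset _ _)
  have hψ : ∀ k : ℕ, (2 : ℝ) / ((2 * (k + 1) : ℕ) : ℝ) = 1 / (k + 1) := by
    intro k
    push_cast
    field_simp
  have h := sum_weight_le (σ := σ) (Y := univ.image b.2.1) hsub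
    (fun a ha => (mem_filter.1 (mem_filter.1 ha).1).2.1) ?_
    (ψ := fun N => (2 : ℝ) / N) (fun N => by positivity) fun k _ => hψ k
  · rw [sum_range_follows (ψ := fun N => (2 : ℝ) / N) hb'.1 hb'.2.1 (hψ _)] at h
    simpa using h
  · intro a ha
    obtain ⟨ha, hab⟩ := mem_filter.1 ha
    have ha' := mem_filter.1 ha
    by_contra hcon
    have hk := (mem_genPats.1 ha'.1).1
    have hlen := len_eq_of_follows ha'.1 ha'.2.1 0
    have := hb'.2.2 (a.2.1 0) (fun i hi => hcon (mem_image.2 ⟨i, mem_univ _, hi⟩))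
      (by rw [hlen, ← hab]; exact hP _ hk)
    rw [hlen] at this
    exact absurd (hL _ hk) (by omega)

theorem card_primes_dvd_le {D : Finset ℕ} {Q N : ℕ} (hD : ∀ p ∈ D, p.Prime ∧ Q ≤ p ∧ p ∣ N)
    (hN : 0 < N) (hNQ : N < Q ^ 5) : #D ≤ 4 := by
  by_contra! hcon
  have h1 : ∏ p ∈ D, p ∣ N :=
    Finset.prod_primes_dvd N (fun p hp => (hD p hp).1.prime) fun p hp => (hD p hp).2.2
  have h2 : Q ^ #D ≤ ∏ p ∈ D, p := by
    rw [← prod_const]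
    exact prod_le_prod' fun p hp => (hD p hp).2.1
  have hQ : 0 < Q := Nat.pos_of_ne_zero fun h => by simp [h] at hNQ
  have h3 : Q ^ 5 ≤ Q ^ #D := Nat.pow_le_pow_right hQ hcon
  exact absurd (Nat.le_of_dvd hN h1) (by omega)

open Classical in
/-- If there are many primes, some good cycle is isolated. -/
theorem exists_isolated {P : ℕ → ℕ} {Q L : ℕ} (hP : ∀ k ∈ Λ, (P k).Prime ∧ Q ≤ P k)
    (hnQ : n < Q ^ 5)
    (hcard : 4 * n < #(((genPats τ τ' Λ).filter fun a => GoodPat τ τ' P L a σ).image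
      fun a => P a.1) * L) :
    ∃ a ∈ genPats τ τ' Λ, Follows τ τ' a σ ∧
      ∀ y, (∀ i, a.2.1 i ≠ y) → ¬ P a.1 ∣ len τ τ' σ y := by
  by_contra! hcon
  set Γ := (genPats τ τ' Λ).filter fun a => GoodPat τ τ' P L a σ with hΓ
  set D := Γ.image fun a => P a.1 with hD
  have h1 : ∀ p ∈ D, L ≤ #(univ.filter fun y => p ∣ len τ τ' σ y) := by
    intro p hp
    obtain ⟨a, ha, rfl⟩ := mem_image.1 hp
    obtain ⟨ha, hg⟩ := mem_filter.1 ha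
    obtain ⟨y, hy, hdvd⟩ := hcon a ha hg.1
    refine (hg.2 y hy hdvd).le.trans ?_
    rw [len, ← card_sameCycle]
    refine card_le_card fun z hz => ?_
    rw [mem_filter] at hz ⊢
    refine ⟨hz.1, ?_⟩
    rwa [len, ← minimalPeriod_eq_of_sameCycle hz.2]
  have h2 : ∑ p ∈ D, #(univ.filter fun y => p ∣ len τ τ' σ y) =
      ∑ y, #(D.filter fun p => p ∣ len τ τ' σ y) :=
    sum_card_bipartiteAbove_eq_sum_card_bipartiteBelow _
  have h3 : ∀ y, #(D.filter fun p => p ∣ len τ τ' σ y) ≤ 4 := by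
    intro y
    refine card_primes_dvd_le (fun p hp => ?_) (len_pos (τ := τ) (τ' := τ') (σ := σ) y)
      ((len_le y).trans_lt hnQ)
    obtain ⟨hp, hdvd⟩ := mem_filter.1 hp
    obtain ⟨a, ha, rfl⟩ := mem_image.1 hp
    have := hP _ (mem_genPats.1 (mem_filter.1 ha).1).1
    exact ⟨this.1, this.2, hdvd⟩
  have h4 : #D * L ≤ n * 4 := by
    calc #D * L = ∑ p ∈ D, L := by rw [sum_const, smul_eq_mul]
      _ ≤ _ := sum_le_sum h1
      _ = _ := h2
      _ ≤ ∑ _y : Fin n, 4 := sum_le_sum fun y _ => h3 y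
      _ = n * 4 := by simp
  omega

theorem alternatingGroup_le_of_genCount {P : ℕ → ℕ} {Q L A S : ℕ} {t : ℝ}
    (hP : ∀ k ∈ Λ, (P k).Prime ∧ Q ≤ P k ∧
      ∃ m, k + 1 = P k * m ∧ ∀ d, 2 ≤ d → d < A → ¬ d ∣ m)
    (hS : ∀ k ∈ Λ, k + 1 ≤ S) (hSL : S ≤ L) (hAQ : A ≤ Q) (hnQ : n < Q ^ 5)
    (hSn : 4 * S ^ 2 + 2 * S + 1 < n) (ht : 4 * n ≤ t * L)
    (hcount : t < genCount τ τ' Λ σ - badCount τ τ' Λ (badWeight P L) σ)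
    (hI : ¬ Intrans τ τ' σ) (hB : ¬ ∃ a b, A ≤ a ∧ 2 ≤ b ∧ HasBlocks τ τ' a b σ) :
    alternatingGroup (Fin n) ≤ genGroup τ τ' σ := by
  classical
  have hL0 : 0 < L := by
    rcases Nat.eq_zero_or_pos L with rfl | h
    · simp only [CharP.cast_eq_zero, mul_zero] at ht
      have : (n : ℝ) ≤ 0 := by linarith
      have : n ≤ 0 := by exact_mod_cast this
      omega
    · exact h
  have h1 := hcount.trans_le ((genCount_sub_badCount_le P L).trans (sum_good_le
    (fun k hk => ?_) fun k hk => (hS k hk).trans hSL))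
  swap
  · obtain ⟨-, -, m, hm, -⟩ := hP k hk
    exact ⟨m, hm⟩
  have hL0' : (0 : ℝ) < L := Nat.cast_pos.2 hL0
  have h2 := ht.trans_lt (mul_lt_mul_of_pos_right h1 hL0')
  obtain ⟨a, ha, hf, hiso⟩ := exists_isolated (fun k hk => ⟨(hP k hk).1, (hP k hk).2.1⟩) hnQ
    (by exact_mod_cast h2)
  have hk := (mem_genPats.1 ha).1
  obtain ⟨hp, hQ, m, hm, hdvd⟩ := hP _ hk
  have hlen : Function.minimalPeriod (word τ τ' σ) (a.2.1 0) = a.1 + 1 := len_eq_of_follows ha hf 0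
  have hgen : σ * τ * σ⁻¹ ∈ genGroup τ τ' σ := Subgroup.subset_closure (by simp)
  have hgen' : τ' ∈ genGroup τ τ' σ := Subgroup.subset_closure (by simp)
  refine alternatingGroup_le_of_isolated (isPretransitive_of_not_intrans hI)
    (w := word τ τ' σ) (mul_mem hgen hgen') (x := a.2.1 0) hp (hAQ.trans hQ) (hlen.trans hm) hdvd
    (fun y hy => hiso y fun i hi => hy ((sameCycle_follows_iff hf y).2 ⟨i, hi⟩)) ?_ ?_
  · intro b c f hb hc hfib hG
    obtain ⟨ρ, hρ⟩ := hG _ hgen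
    obtain ⟨ρ', hρ'⟩ := hG _ hgen'
    exact hB ⟨b, c, hb, hc, f, ρ, ρ', hfib, hρ, hρ'⟩
  · rw [hlen]
    have := hS _ hk
    nlinarith

end IsolatedPattern

section Moments

variable {n : ℕ} {τ τ' : Perm (Fin n)} {Λ : Finset ℕ}

open Classical in
theorem ex_ite_follows (a : Pat n) (c : ℝ) :
    ex (fun σ => if Follows τ τ' a σ then c else 0) = c * pr (Follows τ τ' a) := by
  rw [pr_eq_ex, ← ex_const_mul]
  congr 1
  funext σ
  split_ifs <;> simp

theorem ex_genCount :
    ex (genCount τ τ' Λ) = ∑ a ∈ genPats τ τ' Λ, 1 / (a.1 + 1 : ℝ) * pr (Follows τ τ' a) := by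
  classical
  have : genCount τ τ' Λ = fun σ => ∑ a ∈ genPats τ τ' Λ,
    if Follows τ τ' a σ then 1 / (a.1 + 1 : ℝ) else 0 := rfl
  rw [this, ex_sum]
  exact sum_congr rfl fun a _ => ex_ite_follows a _

open Classical in
theorem ex_genCount_sq_le {ψ : ℕ → ℝ} {R : ℝ} (hψ0 : ∀ N, 0 ≤ ψ N)
    (hψ : ∀ k ∈ Λ, ψ (2 * (k + 1)) = 1 / (k + 1))
    (hR : ∀ a ∈ genPats τ τ' Λ, ex (fun σ => if Follows τ τ' a σ then offSum τ τ' ψ a σ else 0) ≤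
      pr (Follows τ τ' a) * R) :
    ex (fun σ => genCount τ τ' Λ σ ^ 2) ≤ ex (genCount τ τ' Λ) * (1 + R) := by
  have h1 : ∀ σ, genCount τ τ' Λ σ ^ 2 ≤ ∑ a ∈ genPats τ τ' Λ, 1 / (a.1 + 1 : ℝ) *
      ((if Follows τ τ' a σ then (1 : ℝ) else 0) +
        if Follows τ τ' a σ then offSum τ τ' ψ a σ else 0) := by
    intro σ
    rw [sq]
    nth_rewrite 1 [genCount]
    rw [sum_mul]
    refine sum_le_sum fun a ha => ?_
    by_cases h : Follows τ τ' a σ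
    · simp only [if_pos h]
      exact mul_le_mul_of_nonneg_left (genCount_le_one_add ha h hψ0 hψ) (by positivity)
    · simp [if_neg h]
  refine (ex_mono h1).trans ?_
  rw [ex_sum, ex_genCount, sum_mul]
  refine sum_le_sum fun a ha => ?_
  rw [ex_const_mul, ex_add, mul_assoc]
  refine mul_le_mul_of_nonneg_left ?_ (by positivity)
  rw [ex_ite_follows, mul_add, one_mul, mul_one]
  exact add_le_add le_rfl (hR a ha)

open Classical in
theorem ex_badCount_le {ψ : ℕ → ℕ → ℝ} {R : ℝ}
    (hR : ∀ a ∈ genPats τ τ' Λ, ex (fun σ => if Follows τ τ' a σ then offSum τ τ' (ψ a.1) a σ else 0) ≤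
      pr (Follows τ τ' a) * R) :
    ex (badCount τ τ' Λ ψ) ≤ ex (genCount τ τ' Λ) * R := by
  have : badCount τ τ' Λ ψ = fun σ => ∑ a ∈ genPats τ τ' Λ, 1 / (a.1 + 1 : ℝ) *
      if Follows τ τ' a σ then offSum τ τ' (ψ a.1) a σ else 0 := by
    funext σ
    rw [badCount]
    refine sum_congr rfl fun a _ => ?_
    split_ifs <;> simp
  rw [this, ex_sum, ex_genCount, sum_mul]
  refine sum_le_sum fun a ha => ?_
  rw [ex_const_mul, mul_assoc]
  exact mul_le_mul_of_nonneg_left (hR a ha) (by positivity)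

open Classical in
/-- Chebyshev's inequality for the weighted number of generic cycles, corrected by the number of
pairs. -/
theorem pr_genCount_sub_le {ψ : ℕ → ℝ} {χ : ℕ → ℕ → ℝ} {R R' : ℝ} (hψ0 : ∀ N, 0 ≤ ψ N)
    (hψ : ∀ k ∈ Λ, ψ (2 * (k + 1)) = 1 / (k + 1)) (hχ0 : ∀ k N, 0 ≤ χ k N)
    (hR : ∀ a ∈ genPats τ τ' Λ, ex (fun σ => if Follows τ τ' a σ then offSum τ τ' ψ a σ else 0) ≤
      pr (Follows τ τ' a) * R)
    (hR' : ∀ a ∈ genPats τ τ' Λ, ex (fun σ => if Follows τ τ' a σ then offSum τ τ' (χ a.1) a σ else 0) ≤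
      pr (Follows τ τ' a) * R') (hE : 0 < ex (genCount τ τ' Λ)) :
    pr (fun σ => genCount τ τ' Λ σ - badCount τ τ' Λ χ σ ≤ ex (genCount τ τ' Λ) / 4) ≤
      4 * (1 + R - ex (genCount τ τ' Λ)) / ex (genCount τ τ' Λ) + 4 * R' := by
  set E := ex (genCount τ τ' Λ) with hEdef
  have hB0 : ∀ σ, 0 ≤ badCount τ τ' Λ χ σ := by
    intro σ
    refine sum_nonneg fun a _ => ?_
    split_ifs
    · exact mul_nonneg (by positivity) (sum_nonneg fun _ _ => hχ0 _ _)
    · exact le_rfl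
  have h1 : pr (fun σ => E ^ 2 / 4 ≤ (genCount τ τ' Λ σ - E) ^ 2) ≤
      4 * (1 + R - E) / E := by
    refine (pr_le_ex_div (c := E ^ 2 / 4) (f := fun σ => (genCount τ τ' Λ σ - E) ^ 2) (by positivity)
      (fun σ => sq_nonneg _) fun σ h => h).trans ?_
    have h2 : ex (fun σ => (genCount τ τ' Λ σ - E) ^ 2) =
        ex (fun σ => genCount τ τ' Λ σ ^ 2) - E ^ 2 := by
      have : (fun σ => (genCount τ τ' Λ σ - E) ^ 2) = fun σ => (genCount τ τ' Λ σ ^ 2 + E ^ 2) -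
          2 * E * genCount τ τ' Λ σ := by
        funext σ
        ring
      rw [this, ex_sub, ex_add, ex_const, ex_const_mul, ← hEdef]
      ring
    rw [h2, div_le_div_iff₀ (by positivity) hE]
    have := ex_genCount_sq_le hψ0 hψ hR
    rw [← hEdef] at this
    nlinarith [mul_le_mul_of_nonneg_right this hE.le]
  have h2 : pr (fun σ => E / 4 ≤ badCount τ τ' Λ χ σ) ≤ 4 * R' := by
    refine (pr_le_ex_div (c := E / 4) (f := badCount τ τ' Λ χ) (by positivity) hB0
      fun σ h => h).trans ?_
    rw [div_le_iff₀ (by positivity)]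
    have := ex_badCount_le hR'
    rw [← hEdef] at this
    linarith
  refine (pr_mono (q := fun σ => E ^ 2 / 4 ≤ (genCount τ τ' Λ σ - E) ^ 2 ∨
    E / 4 ≤ badCount τ τ' Λ χ σ) fun σ h => ?_).trans ((pr_or_le _ _).trans (add_le_add h1 h2))
  by_cases hb : E / 4 ≤ badCount τ τ' Λ χ σ
  · exact Or.inr hb
  · left
    push Not at hb
    nlinarith

theorem goodSeqs_card_real (τ : Perm (Fin n)) (k : ℕ)
    (h : cycleCount τ 1 + 5 * k ≤ n) :
    ((n : ℝ) - cycleCount τ 1 - 5 * k) ^ k ≤ #(goodSeqs τ (fixSet τ)ᶜ k) := by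
  have h1 := card_goodSeqs_ge τ (fixSet τ)ᶜ k
  rw [card_compl, Fintype.card_fin, card_fixSet] at h1
  have h2 : ((n - cycleCount τ 1 - 5 * k : ℕ) : ℝ) = (n : ℝ) - cycleCount τ 1 - 5 * k := by
    rw [Nat.sub_sub, Nat.cast_sub h]
    push_cast
    ring
  rw [← h2]
  exact_mod_cast h1

theorem card_genPat_ge (k : ℕ) :
    ((#(goodSeqs τ' (fixSet τ')ᶜ (k + 1)) : ℕ) : ℝ) * (#(goodSeqs τ (fixSet τ)ᶜ (k + 1)) -
      (2 * cycleCount τ 2 : ℝ) ^ (k + 1)) ≤ #(genPat τ τ' k) := by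
  classical
  set B := Fintype.piFinset fun _ : Fin (k + 1) => twoSet τ with hB
  have hsub : goodSeqs τ' (fixSet τ')ᶜ (k + 1) ×ˢ (goodSeqs τ (fixSet τ)ᶜ (k + 1) \ B) ⊆
      genPat τ τ' k := by
    rintro ⟨x, q⟩ h
    obtain ⟨hx, hq⟩ := mem_product.1 h
    obtain ⟨hq, hqB⟩ := Finset.mem_sdiff.1 hq
    refine mem_filter.2 ⟨mem_univ _, mem_goodSeqs.1 hx, mem_goodSeqs.1 hq, ?_⟩
    by_contra! hcon
    refine hqB (Fintype.mem_piFinset.2 fun i => mem_twoSet.2 ⟨?_, hcon i⟩)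
    have := (mem_goodSeqs.1 hq).1 i
    rwa [mem_compl, mem_fixSet] at this
  have h1 := card_le_card hsub
  rw [card_product] at h1
  have h2 : (#(goodSeqs τ (fixSet τ)ᶜ (k + 1)) : ℝ) - (2 * cycleCount τ 2 : ℝ) ^ (k + 1) ≤
      #(goodSeqs τ (fixSet τ)ᶜ (k + 1) \ B) := by
    have h3 := card_le_card_sdiff_add_card (s := goodSeqs τ (fixSet τ)ᶜ (k + 1)) (t := B)
    rw [hB, Fintype.card_piFinset_const, card_twoSet] at h3
    have h4 : (#(goodSeqs τ (fixSet τ)ᶜ (k + 1)) : ℝ) ≤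
      #(goodSeqs τ (fixSet τ)ᶜ (k + 1) \ B) + (2 * cycleCount τ 2 : ℝ) ^ (k + 1) := by
      exact_mod_cast h3
    linarith
  calc _ ≤ (#(goodSeqs τ' (fixSet τ')ᶜ (k + 1)) : ℝ) * #(goodSeqs τ (fixSet τ)ᶜ (k + 1) \ B) :=
        mul_le_mul_of_nonneg_left h2 (Nat.cast_nonneg _)
    _ ≤ _ := by exact_mod_cast h1

theorem one_le_factorial_mul_pow {k : ℕ} (h : k ≤ n) :
    1 ≤ ((n - k).factorial / n.factorial : ℝ) * (n : ℝ) ^ k := by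
  rw [div_mul_eq_mul_div, one_le_div (by positivity)]
  have h1 := Nat.factorial_mul_descFactorial h
  have h2 := Nat.mul_le_mul_left (n - k).factorial (Nat.descFactorial_le_pow n k)
  rw [h1] at h2
  exact_mod_cast h2

/-- The weighted probability of following a generic pattern of given length. -/
theorem sum_genPat_ge (hn : 0 < n) (k : ℕ) (h : cycleCount τ 1 + 5 * (k + 1) ≤ n)
    (h' : cycleCount τ' 1 + 5 * (k + 1) ≤ n) :
    1 - (k + 1) * ((cycleCount τ 1 + cycleCount τ' 1 + 10 * (k + 1)) / n : ℝ) -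
      (2 * cycleCount τ 2 / n : ℝ) ^ (k + 1) ≤
    ∑ a ∈ genPat τ τ' k, pr (Follows τ τ' ⟨k, a⟩) := by
  have hn' : (0 : ℝ) < n := Nat.cast_pos.2 hn
  have hfix : ∀ (τ : Perm (Fin n)), ∀ y ∈ (fixSet τ)ᶜ, τ y ≠ y := fun τ y hy => by
    rwa [mem_compl, mem_fixSet] at hy
  have h1 : ∑ a ∈ genPat τ τ' k, pr (Follows τ τ' ⟨k, a⟩) =
      #(genPat τ τ' k) * ((n - 2 * (k + 1)).factorial / n.factorial) := by
    rw [← nsmul_eq_mul]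
    refine sum_eq_card_nsmul fun a ha => ?_
    classical
    obtain ⟨-, hx, hq, -⟩ := mem_filter.1 ha
    exact pr_realizes (hfix τ) (hfix τ') hq hx
  rw [h1]
  have hber : ∀ τ : Perm (Fin n), cycleCount τ 1 + 5 * (k + 1) ≤ n →
      1 - (k + 1) * ((cycleCount τ 1 + 5 * (k + 1)) / n : ℝ) ≤
        #(goodSeqs τ (fixSet τ)ᶜ (k + 1)) / (n : ℝ) ^ (k + 1) := by
    intro τ h
    have hR : ((cycleCount τ 1 + 5 * (k + 1)) / n : ℝ) ≤ 1 := by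
      rw [div_le_one hn']
      exact_mod_cast h
    have h2 := one_add_mul_le_pow (a := -((cycleCount τ 1 + 5 * (k + 1)) / n : ℝ))
      (by linarith) (k + 1)
    have h3 := goodSeqs_card_real τ (k + 1) h
    rw [le_div_iff₀ (by positivity)]
    refine le_trans ?_ h3
    calc _ ≤ (1 + -((cycleCount τ 1 + 5 * (k + 1)) / n : ℝ)) ^ (k + 1) * (n : ℝ) ^ (k + 1) := by
          refine mul_le_mul_of_nonneg_right ?_ (by positivity)
          push_cast at h2
          linarith
      _ = _ := by
          rw [← mul_pow]
          congr 1
          push_cast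
          field_simp
          ring
  have e1 := hber τ h
  have e2 := hber τ' h'
  set X := (#(goodSeqs τ (fixSet τ)ᶜ (k + 1)) : ℝ) / (n : ℝ) ^ (k + 1) with hX
  set X' := (#(goodSeqs τ' (fixSet τ')ᶜ (k + 1)) : ℝ) / (n : ℝ) ^ (k + 1) with hX'
  set z := (2 * cycleCount τ 2 / n : ℝ) ^ (k + 1) with hz
  have hz0 : 0 ≤ z := by positivity
  have hle : ∀ τ : Perm (Fin n), (#(goodSeqs τ (fixSet τ)ᶜ (k + 1)) : ℝ) / (n : ℝ) ^ (k + 1) ≤ 1 := by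
    intro τ
    rw [div_le_one (by positivity)]
    have : #(goodSeqs τ (fixSet τ)ᶜ (k + 1)) ≤ Fintype.card (Fin (k + 1) → Fin n) := card_le_univ _
    rw [Fintype.card_fun, Fintype.card_fin, Fintype.card_fin] at this
    exact_mod_cast this
  have e3 : X ≤ 1 := hle τ
  have e4 : X' ≤ 1 := hle τ'
  have e0 : 0 ≤ X' := by positivity
  have key : 1 - (k + 1) * ((cycleCount τ 1 + cycleCount τ' 1 + 10 * (k + 1)) / n : ℝ) - z ≤
      X' * (X - z) := by
    have : (k + 1) * ((cycleCount τ 1 + cycleCount τ' 1 + 10 * (k + 1)) / n : ℝ) =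
      (k + 1) * ((cycleCount τ 1 + 5 * (k + 1)) / n : ℝ) +
      (k + 1) * ((cycleCount τ' 1 + 5 * (k + 1)) / n : ℝ) := by ring
    nlinarith [mul_nonneg (sub_nonneg.2 e3) (sub_nonneg.2 e4), mul_nonneg (sub_nonneg.2 e4) hz0]
  rcases le_or_gt (X - z) 0 with hneg | hpos
  · exact (key.trans (mul_nonpos_of_nonneg_of_nonpos e0 hneg)).trans (by positivity)
  refine key.trans ?_
  have h2 := one_le_factorial_mul_pow (n := n) (k := 2 * (k + 1)) (by omega)
  have h3 := card_genPat_ge (τ := τ) (τ' := τ') k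
  have hP : (0 : ℝ) < (n : ℝ) ^ (k + 1) := by positivity
  calc X' * (X - z) ≤ X' * (X - z) * (((n - 2 * (k + 1)).factorial / n.factorial : ℝ) *
        (n : ℝ) ^ (2 * (k + 1))) := le_mul_of_one_le_right (mul_nonneg e0 hpos.le) h2
    _ = ((#(goodSeqs τ' (fixSet τ')ᶜ (k + 1)) : ℕ) : ℝ) * (#(goodSeqs τ (fixSet τ)ᶜ (k + 1)) -
      (2 * cycleCount τ 2 : ℝ) ^ (k + 1)) * ((n - 2 * (k + 1)).factorial / n.factorial) := by
        have e5 : (n : ℝ) ^ (2 * (k + 1)) = (n : ℝ) ^ (k + 1) * (n : ℝ) ^ (k + 1) := by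
          rw [two_mul (k + 1), pow_add (n : ℝ)]
        rw [hX, hX', hz, div_pow, e5]
        generalize (n : ℝ) ^ (k + 1) = y at hP ⊢
        field_simp
    _ ≤ _ := mul_le_mul_of_nonneg_right h3 (by positivity)

/-- A lower bound for the expected weight of the generic cycles. -/
theorem ex_genCount_ge {θ : ℝ} (hn : 0 < n)
    (h : ∀ k ∈ Λ, cycleCount τ 1 + 5 * (k + 1) ≤ n ∧ cycleCount τ' 1 + 5 * (k + 1) ≤ n ∧
      (k + 1) * ((cycleCount τ 1 + cycleCount τ' 1 + 10 * (k + 1)) / n : ℝ) +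
      (2 * cycleCount τ 2 / n : ℝ) ^ (k + 1) ≤ θ) :
    (1 - θ) * ∑ k ∈ Λ, (1 : ℝ) / (k + 1) ≤ ex (genCount τ τ' Λ) := by
  rw [ex_genCount, genPats, sum_sigma, mul_sum]
  refine sum_le_sum fun k hk => ?_
  obtain ⟨h1, h2, h3⟩ := h k hk
  simp only []
  rw [← mul_sum, mul_comm]
  refine mul_le_mul_of_nonneg_left ?_ (by positivity)
  have := sum_genPat_ge hn k h1 h2
  linarith

end Moments

end RandGen

namespace RandGen
open Finset

section Primes

/-- The sum of the reciprocals of the primes up to `N`. -/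
noncomputable def primeSum (N : ℕ) : ℝ := ∑ p ∈ Icc 0 N with p.Prime, (1 : ℝ) / p

theorem eventually_le_theta_sub :
    ∀ᶠ x : ℕ in atTop, (x : ℝ) ≤ Chebyshev.theta ((8 * x : ℕ) : ℝ) - Chebyshev.theta x := by
  have h1 : (fun x : ℝ => Real.log (x + 1)) =o[atTop] fun x => x := by
    have : (fun x : ℝ => Real.log (x + 1)) =o[atTop] fun x => x + 1 :=
      Real.isLittleO_log_id_atTop.comp_tendsto (tendsto_atTop_add_const_right _ _ tendsto_id)
    refine this.trans_isBigO ?_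
    refine IsBigO.of_bound 2 ?_
    filter_upwards [eventually_ge_atTop 1] with x hx
    rw [Real.norm_of_nonneg (by linarith), Real.norm_of_nonneg (by linarith)]
    linarith
  have h2 : (fun x : ℝ => 2 * √x * Real.log x) =o[atTop] fun x => x := by
    have h := (isLittleO_log_rpow_atTop (r := 1 / 2) (by norm_num)).const_mul_left 2
    have h' := (isBigO_refl (fun x : ℝ => √x) atTop).mul_isLittleO h
    refine (h'.congr' ?_ ?_)
    · exact Eventually.of_forall fun x => by ring
    · filter_upwards [eventually_ge_atTop 0] with x hx
      rw [← Real.sqrt_eq_rpow, Real.mul_self_sqrt hx]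
  have h3 := (h1.add h2).bound (c := 1 / 8) (by norm_num)
  have ht : Tendsto (fun x : ℕ => ((8 * x : ℕ) : ℝ)) atTop atTop :=
    tendsto_natCast_atTop_atTop.comp
      (tendsto_atTop_mono (fun x => by omega : ∀ x : ℕ, x ≤ 8 * x) tendsto_id)
  filter_upwards [ht.eventually h3] with x hx
  have h4 := Chebyshev.theta_ge (8 * x)
  have h5 := Chebyshev.theta_le_log4_mul_x (x := x) (Nat.cast_nonneg x)
  rw [Real.norm_of_nonneg (Nat.cast_nonneg (8 * x))] at hx
  have h6 := (le_abs_self _).trans hx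
  have h7 : Real.log 4 = 2 * Real.log 2 := by
    rw [show (4 : ℝ) = 2 ^ 2 by norm_num, Real.log_pow]
    norm_num
  rw [h7] at h5
  push_cast at h4 h6 ⊢
  have h8 := Real.log_two_gt_d9
  have h9 : (0 : ℝ) ≤ x := Nat.cast_nonneg x
  nlinarith [mul_le_mul_of_nonneg_right h8.le h9]

theorem primeSum_mono {M N : ℕ} (h : M ≤ N) : primeSum M ≤ primeSum N := by
  refine sum_le_sum_of_subset_of_nonneg (filter_subset_filter _ (Icc_subset_Icc_right h))
    fun _ _ _ => by positivity

theorem primeSum_sub {M N : ℕ} (h : M ≤ N) :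
    primeSum N - primeSum M = ∑ p ∈ Ioc M N with p.Prime, (1 : ℝ) / p := by
  rw [sub_eq_iff_eq_add, primeSum, primeSum, ← sum_union]
  · refine sum_congr ?_ fun _ _ => rfl
    ext p
    simp only [mem_filter, mem_union, mem_Icc, mem_Ioc]
    grind
  · rw [Finset.disjoint_left]
    intro p hp hp'
    simp only [mem_filter, mem_Icc, mem_Ioc] at hp hp'
    omega

theorem theta_sub {M N : ℕ} (h : M ≤ N) :
    Chebyshev.theta N - Chebyshev.theta M = ∑ p ∈ Ioc M N with p.Prime, Real.log p := by
  rw [sub_eq_iff_eq_add, Chebyshev.theta_eq_sum_Icc, Chebyshev.theta_eq_sum_Icc, Nat.floor_natCast,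
    Nat.floor_natCast, ← sum_union]
  · refine sum_congr ?_ fun _ _ => rfl
    ext p
    simp only [mem_filter, mem_union, mem_Icc, mem_Ioc]
    grind
  · rw [Finset.disjoint_left]
    intro p hp hp'
    simp only [mem_filter, mem_Icc, mem_Ioc] at hp hp'
    omega

theorem eventually_primeSum_step :
    ∀ᶠ x : ℕ in atTop, 1 / (8 * Real.log (8 * x : ℕ)) ≤ primeSum (8 * x) - primeSum x := by
  filter_upwards [eventually_le_theta_sub, eventually_ge_atTop 1] with x hx hx1
  rw [theta_sub (by omega)] at hx
  rw [primeSum_sub (by omega)]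
  have hx0 : (0 : ℝ) < x := Nat.cast_pos.2 hx1
  have hlog : 0 < Real.log (8 * x : ℕ) := Real.log_pos (by norm_cast; omega)
  have h : ∑ p ∈ Ioc x (8 * x) with p.Prime, Real.log p ≤
      8 * x * Real.log (8 * x : ℕ) * ∑ p ∈ Ioc x (8 * x) with p.Prime, (1 : ℝ) / p := by
    rw [mul_sum]
    refine sum_le_sum fun p hp => ?_
    simp only [mem_filter, mem_Ioc] at hp
    have hp0 : (0 : ℝ) < p := Nat.cast_pos.2 hp.2.pos
    have h1 : Real.log p ≤ Real.log (8 * x : ℕ) :=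
      Real.log_le_log hp0 (by exact_mod_cast hp.1.2)
    have h2 : (1 : ℝ) ≤ 8 * x * (1 / p) := by
      rw [mul_one_div, one_le_div hp0]
      exact_mod_cast hp.1.2
    nlinarith [mul_le_mul_of_nonneg_left h2 hlog.le]
  rw [div_le_iff₀ (by positivity)]
  have := hx.trans h
  have h3 : (x : ℝ) * 1 ≤ x * (8 * Real.log (8 * x : ℕ) *
      ∑ p ∈ Ioc x (8 * x) with p.Prime, (1 : ℝ) / p) := by linarith
  linarith [le_of_mul_le_mul_left h3 hx0]

/-- The reciprocals of the primes between `q ^ 5` and `q ^ 6` have a sum bounded below. -/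
theorem exists_le_sum_primes : ∃ c : ℝ, 0 < c ∧ ∀ᶠ q : ℕ in atTop,
    c ≤ ∑ p ∈ Ioc (q ^ 5) (q ^ 6) with p.Prime, (1 : ℝ) / p := by
  refine ⟨1 / (96 * Real.log 8), by have := Real.log_pos (x := 8) (by norm_num); positivity, ?_⟩
  obtain ⟨X, hX⟩ := eventually_atTop.1 eventually_primeSum_step
  filter_upwards [eventually_ge_atTop (max X 8)] with q hq
  have hqX : X ≤ q := (le_max_left _ _).trans hq
  have hq8 : 8 ≤ q := (le_max_right _ _).trans hq
  rw [← primeSum_sub (Nat.pow_le_pow_right (by omega) (by norm_num))]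
  set J := Nat.log 8 q with hJ
  have hJ1 : 1 ≤ J := Nat.log_pos (by norm_num) hq8
  have hJq : 8 ^ J ≤ q := Nat.pow_log_le_self 8 (by omega)
  have hqJ : q < 8 ^ (J + 1) := Nat.lt_pow_succ_log_self (by norm_num) q
  have hlq : 0 < Real.log q := Real.log_pos (by norm_cast; omega)
  have key : ∀ j ≤ J, primeSum (q ^ 5) + j * (1 / (48 * Real.log q)) ≤ primeSum (8 ^ j * q ^ 5) := by
    intro j
    induction j with
    | zero => intro _; simp
    | succ j ih =>
      intro hj
      have h1 := ih (by omega)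
      have h2 := hX (8 ^ j * q ^ 5) (hqX.trans ((Nat.le_self_pow (by norm_num) q).trans
        (Nat.le_mul_of_pos_left _ (by positivity))))
      have h3 : 8 * (8 ^ j * q ^ 5) ≤ q ^ 6 := by
        calc 8 * (8 ^ j * q ^ 5) = 8 ^ (j + 1) * q ^ 5 := by ring
          _ ≤ q * q ^ 5 := Nat.mul_le_mul_right _ ((Nat.pow_le_pow_right (by norm_num) hj).trans hJq)
          _ = q ^ 6 := by ring
      have h4 : Real.log (8 * (8 ^ j * q ^ 5) : ℕ) ≤ 6 * Real.log q := by
        rw [← Nat.cast_ofNat (n := 6), ← Real.log_pow]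
        refine Real.log_le_log ?_ ?_
        · exact_mod_cast (by positivity : 0 < 8 * (8 ^ j * q ^ 5))
        · exact_mod_cast h3
      have h5 : 0 < Real.log (8 * (8 ^ j * q ^ 5) : ℕ) := by
        refine Real.log_pos ?_
        have : 0 < 8 ^ j * q ^ 5 := by positivity
        exact_mod_cast (by omega : 1 < 8 * (8 ^ j * q ^ 5))
      have h6 : 1 / (48 * Real.log q) ≤ 1 / (8 * Real.log (8 * (8 ^ j * q ^ 5) : ℕ)) :=
        one_div_le_one_div_of_le (by positivity) (by linarith)
      rw [show 8 ^ (j + 1) * q ^ 5 = 8 * (8 ^ j * q ^ 5) by ring]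
      push_cast at h1 h2 h6 ⊢
      linarith
  have h1 := key J le_rfl
  have h2 : primeSum (8 ^ J * q ^ 5) ≤ primeSum (q ^ 6) := by
    refine primeSum_mono ?_
    calc 8 ^ J * q ^ 5 ≤ q * q ^ 5 := Nat.mul_le_mul_right _ hJq
      _ = q ^ 6 := by ring
  have h3 : Real.log q ≤ (J + 1) * Real.log 8 := by
    have : Real.log q ≤ Real.log ((8 : ℝ) ^ (J + 1)) :=
      Real.log_le_log (by norm_cast; omega) (by exact_mod_cast hqJ.le)
    rw [Real.log_pow] at this
    exact_mod_cast this
  have hl8 : 0 < Real.log 8 := Real.log_pos (by norm_num)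
  have hJR : (1 : ℝ) ≤ J := by exact_mod_cast hJ1
  have h4 : 1 / (96 * Real.log 8) ≤ J * (1 / (48 * Real.log q)) := by
    rw [mul_one_div, div_le_div_iff₀ (by positivity) (by positivity)]
    nlinarith
  linarith

end Primes

section Lengths

theorem exists_sum_progression_ge (B : ℕ) (hB : 1 ≤ B) (μ : ℝ) :
    ∃ J : ℕ, μ ≤ ∑ j ∈ range J, (1 : ℝ) / (1 + j * B) := by
  obtain ⟨J, hJ⟩ := (Real.tendsto_sum_range_one_div_nat_succ_atTop.eventually_ge_atTop
    (B * μ)).exists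
  refine ⟨J, ?_⟩
  have hB' : (1 : ℝ) ≤ B := by exact_mod_cast hB
  have h : ∑ i ∈ range J, (1 : ℝ) / (i + 1) ≤ B * ∑ j ∈ range J, (1 : ℝ) / (1 + j * B) := by
    rw [mul_sum]
    refine sum_le_sum fun j _ => ?_
    rw [mul_one_div, div_le_div_iff₀ (by positivity) (by positivity)]
    have : (0 : ℝ) ≤ j := Nat.cast_nonneg j
    nlinarith
  exact le_of_mul_le_mul_left (hJ.trans h) (by linarith)

/-- A set of cycle lengths, each a large prime times an integer without small divisors, whose
reciprocals have a large sum. -/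
theorem eventually_exists_lengths (A : ℕ) (μ : ℝ) : ∀ᶠ q : ℕ in atTop,
    ∃ (Λ : Finset ℕ) (P : ℕ → ℕ),
      (∀ k ∈ Λ, (P k).Prime ∧ q ^ 5 ≤ P k ∧ ∃ m, k + 1 = P k * m ∧
        ∀ d, 2 ≤ d → d < A → ¬ d ∣ m) ∧
      (∀ k ∈ Λ, k + 1 ≤ q ^ 7) ∧ μ ≤ ∑ k ∈ Λ, (1 : ℝ) / (k + 1) := by
  obtain ⟨c, hc, hev⟩ := exists_le_sum_primes
  obtain ⟨J, hJ⟩ := exists_sum_progression_ge A.factorial (Nat.factorial_pos A) (μ / c)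
  filter_upwards [hev, eventually_ge_atTop (1 + J * A.factorial)] with q hq hqJ
  classical
  set D := (Ioc (q ^ 5) (q ^ 6)).filter Nat.Prime with hD
  set m : ℕ → ℕ := fun j => 1 + j * A.factorial with hm
  have hq1 : 1 ≤ q := by omega
  have hmq : ∀ j ∈ range J, m j ≤ q := by
    intro j hj
    have := Nat.mul_le_mul_right A.factorial (mem_range.1 hj).le
    simp only [hm]
    omega
  have hmp : ∀ p ∈ D, ∀ j ∈ range J, ¬ p ∣ m j := by
    intro p hp j hj h
    have h1 := Nat.le_of_dvd (by simp only [hm]; omega) h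
    have h2 := (mem_Ioc.1 (mem_filter.1 hp).1).1
    have h3 := hmq j hj
    have h4 : q ≤ q ^ 5 := Nat.le_self_pow (by norm_num) q
    omega
  have hpos : ∀ p ∈ D, ∀ j, 0 < p * m j := fun p hp j =>
    Nat.mul_pos (mem_filter.1 hp).2.pos (by simp only [hm]; omega)
  have huniq : ∀ p ∈ D, ∀ j ∈ range J, ∀ p' ∈ D, p' ∣ p * m j → p' = p := by
    intro p hp j hj p' hp' h
    rcases ((mem_filter.1 hp').2.dvd_mul).1 h with h | h
    · exact (Nat.prime_dvd_prime_iff_eq (mem_filter.1 hp').2 (mem_filter.1 hp).2).1 h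
    · exact absurd h (hmp p' hp' j hj)
  have hP : ∀ k, ∃ p, (∃ p' ∈ D, p' ∣ k + 1) → p ∈ D ∧ p ∣ k + 1 := by
    intro k
    by_cases h : ∃ p' ∈ D, p' ∣ k + 1
    · obtain ⟨p', h1, h2⟩ := h
      exact ⟨p', fun _ => ⟨h1, h2⟩⟩
    · exact ⟨0, fun h' => absurd h' h⟩
  choose P hP using hP
  have hPeq : ∀ p ∈ D, ∀ j ∈ range J, P (p * m j - 1) = p := by
    intro p hp j hj
    have h1 : p * m j - 1 + 1 = p * m j := Nat.sub_add_cancel (hpos p hp j)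
    have h2 := hP (p * m j - 1) ⟨p, hp, by rw [h1]; exact dvd_mul_right p _⟩
    rw [h1] at h2
    exact huniq p hp j hj _ h2.1 h2.2
  have hinj : Set.InjOn (fun x : ℕ × ℕ => x.1 * m x.2 - 1) (D ×ˢ range J : Finset (ℕ × ℕ)) := by
    rintro ⟨p, j⟩ h ⟨p', j'⟩ h' heq
    simp only [coe_product, Set.mem_prod, mem_coe] at h h'
    simp only at heq
    have e1 := hPeq p h.1 j h.2
    rw [heq, hPeq p' h'.1 j' h'.2] at e1
    subst e1
    have h1 := hpos p' h.1 j
    have h2 := hpos p' h.1 j'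
    have h3 : p' * m j = p' * m j' := by omega
    have h4 := Nat.eq_of_mul_eq_mul_left (mem_filter.1 h.1).2.pos h3
    simp only [hm, add_right_inj] at h4
    rw [Nat.eq_of_mul_eq_mul_right (Nat.factorial_pos A) h4]
  refine ⟨(D ×ˢ range J).image fun x => x.1 * m x.2 - 1, P, ?_, ?_, ?_⟩
  · intro k hk
    obtain ⟨⟨p, j⟩, hx, rfl⟩ := mem_image.1 hk
    obtain ⟨hp, hj⟩ := mem_product.1 hx
    have h1 := mem_filter.1 hp
    simp only [hPeq p hp j hj]
    refine ⟨h1.2, (mem_Ioc.1 h1.1).1.le, m j, Nat.sub_add_cancel (hpos p hp j), ?_⟩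
    intro d hd hdA h
    have h2 : d ∣ j * A.factorial := (Nat.dvd_factorial (by omega) hdA.le).mul_left j
    have h3 := (Nat.dvd_add_left h2).1 h
    have := Nat.le_of_dvd one_pos h3
    omega
  · intro k hk
    obtain ⟨⟨p, j⟩, hx, rfl⟩ := mem_image.1 hk
    obtain ⟨hp, hj⟩ := mem_product.1 hx
    simp only
    rw [Nat.sub_add_cancel (hpos p hp j)]
    calc p * m j ≤ q ^ 6 * q :=
          Nat.mul_le_mul (mem_Ioc.1 (mem_filter.1 hp).1).2 (hmq j hj)
      _ = q ^ 7 := by ring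
  · rw [sum_image hinj, sum_product]
    have h1 : ∀ p ∈ D, ∀ j ∈ range J, (1 : ℝ) / ((p * m j - 1 : ℕ) + 1) =
        1 / p * (1 / (1 + j * A.factorial)) := by
      intro p hp j hj
      have h2 : (((p * m j - 1 : ℕ) : ℝ) + 1) = p * (1 + j * A.factorial) := by
        have : ((p * m j - 1 + 1 : ℕ) : ℝ) = (p * m j : ℕ) := by
          rw [Nat.sub_add_cancel (hpos p hp j)]
        push_cast at this
        rw [this]
        simp [hm]
      rw [h2, one_div_mul_one_div]
    rw [sum_congr rfl fun p hp => sum_congr rfl (h1 p hp)]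
    simp only [← mul_sum]
    rw [← sum_mul]
    have h0 : 0 ≤ ∑ j ∈ range J, (1 : ℝ) / (1 + j * A.factorial) :=
      sum_nonneg fun _ _ => by positivity
    calc μ = c * (μ / c) := by field_simp
      _ ≤ c * ∑ j ∈ range J, (1 : ℝ) / (1 + j * A.factorial) := mul_le_mul_of_nonneg_left hJ hc.le
      _ ≤ _ := mul_le_mul_of_nonneg_right hq h0

end Lengths

section Parameters

theorem sum_range_inv_le {M n q : ℕ} (hq : 1 ≤ q) (hn : n < (q + 1) ^ 20) (hM : M ≤ n) :
    ∑ j ∈ range (M + 1), (1 : ℝ) / j ≤ 41 * q := by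
  have hqR : (1 : ℝ) ≤ q := by exact_mod_cast hq
  have h1 : ∑ j ∈ range (M + 1), (1 : ℝ) / j = (harmonic M : ℝ) := by
    rw [sum_range_succ', harmonic]
    push_cast
    simp
  rw [h1]
  have h2 : Real.log M ≤ 20 * q := by
    rcases Nat.eq_zero_or_pos M with rfl | hM0
    · simp
    have h3 : Real.log M ≤ Real.log ((q + 1 : ℝ) ^ 20) :=
      Real.log_le_log (by exact_mod_cast hM0) (by exact_mod_cast hM.trans hn.le)
    rw [Real.log_pow] at h3
    have h4 := Real.log_le_sub_one_of_pos (show (0 : ℝ) < q + 1 by positivity)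
    push_cast at h3
    linarith
  linarith [harmonic_le_one_add_log M]

/-- An antitone majorant of the weights. -/
noncomputable def majorant (q N : ℕ) : ℝ := 2 / (max N (2 * q ^ 5) : ℕ)

theorem majorant_nonneg (q N : ℕ) : 0 ≤ majorant q N := by
  unfold majorant
  positivity

theorem majorant_antitone {q : ℕ} (hq : 1 ≤ q) : Antitone (majorant q) := by
  intro M N h
  have h1 : 0 < q ^ 5 := by positivity
  have h2 : max M (2 * q ^ 5) ≤ max N (2 * q ^ 5) := max_le_max h le_rfl
  have h3 : 0 < max M (2 * q ^ 5) := lt_max_of_lt_right (by omega)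
  unfold majorant
  exact div_le_div_of_nonneg_left (by norm_num) (by exact_mod_cast h3) (by exact_mod_cast h2)

theorem majorant_zero (q : ℕ) : majorant q 0 = 1 / (q : ℝ) ^ 5 := by
  rw [majorant, Nat.zero_max]
  push_cast
  rw [mul_comm, div_mul_eq_div_div_swap]
  norm_num

theorem two_div_le_majorant {q N : ℕ} (h : 2 * q ^ 5 ≤ N) : (2 : ℝ) / N ≤ majorant q N := by
  rw [majorant, max_eq_left h]

theorem sum_majorant_le {M n q : ℕ} (hq : 1 ≤ q) (hn : n < (q + 1) ^ 20) (hM : M ≤ n) :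
    ∑ N ∈ range (M + 1), majorant q N ≤ 83 * q := by
  have hqR : (1 : ℝ) ≤ q := by exact_mod_cast hq
  have h1 : ∀ N : ℕ, majorant q N ≤ (if N = 0 then 1 else 0) + 2 * (1 / (N : ℝ)) := by
    intro N
    rcases Nat.eq_zero_or_pos N with rfl | hN
    · rw [majorant_zero]
      simp only [if_pos, CharP.cast_eq_zero, div_zero, mul_zero, add_zero]
      rw [div_le_one (by positivity)]
      exact one_le_pow₀ hqR
    · rw [if_neg hN.ne', zero_add, mul_one_div, majorant]
      exact div_le_div_of_nonneg_left (by norm_num) (by exact_mod_cast hN)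
        (by exact_mod_cast le_max_left _ _)
  refine (sum_le_sum fun N _ => h1 N).trans ?_
  rw [sum_add_distrib, ← mul_sum, sum_ite_eq' (range (M + 1)) 0 fun _ => (1 : ℝ),
    if_pos (by simp)]
  linarith [sum_range_inv_le hq hn hM]

theorem errorBound_main_le {ρ S : ℝ} {n q : ℕ} (hq : 1 ≤ q) (hnρ : (n : ℝ) / ρ ≤ 2) (hS0 : 0 ≤ S)
    (hS : S ≤ 83 * q) : n * (2 * (1 / (q : ℝ) ^ 8) / ρ * S) ≤ 332 * (1 / q) := by
  have hqR : (1 : ℝ) ≤ q := by exact_mod_cast hq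
  have hq0 : (0 : ℝ) < q := by linarith
  have h7 : (1 : ℝ) ≤ (q : ℝ) ^ 6 := one_le_pow₀ hqR
  calc n * (2 * (1 / (q : ℝ) ^ 8) / ρ * S)
      = (n / ρ) * (2 * (1 / (q : ℝ) ^ 8)) * S := by ring
    _ ≤ 2 * (2 * (1 / (q : ℝ) ^ 8)) * (83 * q) := by
        refine mul_le_mul ?_ hS hS0 (by positivity)
        exact mul_le_mul_of_nonneg_right hnρ (by positivity)
    _ = 332 * (1 / q * (1 / (q : ℝ) ^ 6)) := by field_simp; norm_num
    _ ≤ 332 * (1 / q * 1) := by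
        have : 1 / (q : ℝ) ^ 6 ≤ 1 := (div_le_one (by positivity)).2 h7
        gcongr
    _ = 332 * (1 / q) := by rw [mul_one]

theorem two_pow_div_le {a b c : ℕ} (h : a + c ≤ b) : (2 : ℝ) ^ a / 2 ^ b ≤ 1 / 2 ^ c := by
  rw [div_le_div_iff₀ (by positivity) (by positivity), one_mul, ← pow_add]
  exact pow_le_pow_right₀ (by norm_num) h

theorem one_add_inv_pow_le {ρ : ℝ} {M n : ℕ} (hM : M ≤ n) (hn : (1 : ℝ) ≤ n)
    (hρ : (n : ℝ) / 2 ≤ ρ) : (1 + 1 / ρ) ^ (M + 1) ≤ 81 := by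
  have hρ0 : 0 < ρ := by linarith
  have h4 : (1 + 1 / ρ) ^ (M + 1) ≤ Real.exp 1 ^ 4 := by
    calc (1 + 1 / ρ) ^ (M + 1) ≤ Real.exp (1 / ρ) ^ (M + 1) := by
          refine pow_le_pow_left₀ (by positivity) ?_ _
          linarith [Real.add_one_le_exp (1 / ρ)]
      _ = Real.exp ((M + 1 : ℕ) * (1 / ρ)) := (Real.exp_nat_mul _ _).symm
      _ ≤ Real.exp ((4 : ℕ) * 1) := by
          refine Real.exp_le_exp.2 ?_
          rw [mul_one_div, div_le_iff₀ hρ0]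
          have : (M : ℝ) ≤ n := by exact_mod_cast hM
          push_cast
          linarith
      _ = Real.exp 1 ^ 4 := Real.exp_nat_mul _ _
  refine h4.trans ?_
  have := Real.exp_one_lt_d9
  calc Real.exp 1 ^ 4 ≤ 3 ^ 4 := pow_le_pow_left₀ (Real.exp_pos 1).le (by linarith) 4
    _ = 81 := by norm_num

theorem errorBound_expo_le {m u v w : ℝ} {C Q z : ℝ} (hm : m ≤ C * Q) (hu0 : 0 ≤ u) (hu : u ≤ 1)
    (hv0 : 0 ≤ v) (hv : v ≤ z) (hw0 : 0 ≤ w) (hw : w ≤ 81) (hCQ : 0 ≤ C * Q) :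
    m * (u * v * w) ≤ 81 * C * (Q * z) := by
  calc m * (u * v * w) ≤ C * Q * (1 * z * 81) := by
        have hz : 0 ≤ z := hv0.trans hv
        refine mul_le_mul hm ?_ (by positivity) hCQ
        exact mul_le_mul (mul_le_mul hu hv hv0 zero_le_one) hw hw0 (by positivity)
    _ = _ := by ring

theorem errorBound_square_le {m C : ℝ} {q : ℕ} (hq : 1 ≤ q) (hm : m ≤ C * (q : ℝ) ^ 20) :
    m * (1 / (q : ℝ) ^ 5 * (1 / (q : ℝ) ^ 8) ^ 2) ≤ C * (1 / q) := by
  have hq0 : (0 : ℝ) < q := Nat.cast_pos.2 hq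
  calc m * (1 / (q : ℝ) ^ 5 * (1 / (q : ℝ) ^ 8) ^ 2) ≤
        C * (q : ℝ) ^ 20 * (1 / (q : ℝ) ^ 5 * (1 / (q : ℝ) ^ 8) ^ 2) :=
        mul_le_mul_of_nonneg_right hm (by positivity)
    _ = C * (1 / q) := by field_simp

theorem errorBound_fixed_le {f C : ℝ} {q : ℕ} (hq : 1 ≤ q) (hC : 0 ≤ C)
    (hf : f ≤ C * (q : ℝ) ^ 10) :
    1 / (q : ℝ) ^ 5 * (1 / (q : ℝ) ^ 8) * (f + 2 * (4 * (q : ℝ) ^ 7)) ≤ (C + 8) * (1 / q) := by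
  have hqR : (1 : ℝ) ≤ q := by exact_mod_cast hq
  have hq0 : (0 : ℝ) < q := by linarith
  have h1 : f + 2 * (4 * (q : ℝ) ^ 7) ≤ (C + 8) * (q : ℝ) ^ 12 := by
    have h2 := mul_le_mul_of_nonneg_left
      (pow_le_pow_right₀ hqR (show 10 ≤ 12 by norm_num)) hC
    have h3 := pow_le_pow_right₀ hqR (show 7 ≤ 12 by norm_num)
    linarith
  calc _ ≤ 1 / (q : ℝ) ^ 5 * (1 / (q : ℝ) ^ 8) * ((C + 8) * (q : ℝ) ^ 12) :=
        mul_le_mul_of_nonneg_left h1 (by positivity)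
    _ = _ := by field_simp

theorem errorBound_le {x ρ : ℝ} {M n q f : ℕ} (hq : 1 ≤ q) (hqn : q ^ 20 ≤ n)
    (hn : n < (q + 1) ^ 20) (hM : M ≤ n) (hρ : (n : ℝ) / 2 ≤ ρ) (hx : 0 ≤ x)
    (hf : (f : ℝ) ≤ 2 * x * √n) (hK : 2 ^ 11 * x * q ^ 10 + 4 * q ^ 7 + q ≤ (q : ℝ) ^ 11) :
    errorBound ρ (1 / (q : ℝ) ^ 8) (q ^ 11) M (majorant q) n f (4 * q ^ 7) ≤
      (332 + 2 ^ 20 + 2 ^ 11 * x + 8) * (1 / q) + 81 * 2 ^ 20 * ((q : ℝ) ^ 20 * (1 / 2 ^ q)) := by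
  have hqR : (1 : ℝ) ≤ q := by exact_mod_cast hq
  have hnq : (n : ℝ) ≤ 2 ^ 20 * (q : ℝ) ^ 20 := by
    have h1 : (n : ℝ) ≤ (q + 1 : ℝ) ^ 20 := by exact_mod_cast hn.le
    rw [← mul_pow]
    exact h1.trans (pow_le_pow_left₀ (by positivity) (by linarith) 20)
  have hqn' : (q : ℝ) ^ 20 ≤ n := by exact_mod_cast hqn
  have hn1 : (1 : ℝ) ≤ n := (one_le_pow₀ hqR).trans hqn'
  have hρ0 : 0 < ρ := by linarith
  have hnρ : (n : ℝ) / ρ ≤ 2 := by rw [div_le_iff₀ hρ0]; linarith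
  have hsqrt : √n ≤ 2 ^ 10 * (q : ℝ) ^ 10 := by
    rw [Real.sqrt_le_left (by positivity), mul_pow, ← pow_mul, ← pow_mul]
    exact hnq
  have hf' : (f : ℝ) ≤ 2 ^ 11 * x * (q : ℝ) ^ 10 := by
    refine hf.trans ?_
    calc 2 * x * √n ≤ 2 * x * (2 ^ 10 * (q : ℝ) ^ 10) :=
          mul_le_mul_of_nonneg_left hsqrt (by positivity)
      _ = _ := by ring
  have h1 : majorant q 0 ≤ 1 := by
    rw [majorant_zero]
    exact (div_le_one (by positivity)).2 (one_le_pow₀ hqR)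
  have h2 : ((2 : ℝ) ^ (f + 4 * q ^ 7) / 2 ^ (q ^ 11)) ≤ 1 / 2 ^ q := by
    refine two_pow_div_le ?_
    rw [← Nat.cast_le (α := ℝ)]
    push_cast
    linarith
  have h0 : (0 : ℝ) ≤ (2 : ℝ) ^ (f + 4 * q ^ 7) / 2 ^ (q ^ 11) := by positivity
  have h3 : 0 ≤ (1 + 1 / ρ) ^ (M + 1) := by positivity
  have h4 : (0 : ℝ) ≤ 2 ^ 20 * (q : ℝ) ^ 20 := by positivity
  have h5 : (0 : ℝ) ≤ 2 ^ 11 * x := by positivity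
  have e1 := errorBound_main_le hq hnρ (sum_nonneg fun N _ => majorant_nonneg q N) (sum_majorant_le hq hn hM)
  have e2 := errorBound_expo_le hnq (majorant_nonneg q 0) h1 h0 h2 h3 (one_add_inv_pow_le hM hn1 hρ) h4
  have e3 := errorBound_square_le hq hnq
  have e4 := errorBound_fixed_le hq h5 hf'
  rw [← majorant_zero] at e3 e4
  have hcast : ((4 * q ^ 7 : ℕ) : ℝ) = 4 * (q : ℝ) ^ 7 := by push_cast; ring
  unfold errorBound
  rw [hcast, mul_add, mul_add]
  refine (add_le_add (add_le_add (add_le_add e1 e2) e3) e4).trans (le_of_eq ?_)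
  ring

end Parameters

end RandGen

namespace RandGen
open Equiv Equiv.Perm Finset

section Weights

/-- The weight `1 / (k + 1)` at `2 (k + 1)` for `k ∈ Λ`. -/
noncomputable def targetWeight (Λ : Finset ℕ) (N : ℕ) : ℝ :=
  ∑ k ∈ Λ, if N = 2 * (k + 1) then (1 : ℝ) / (k + 1) else 0

theorem targetWeight_nonneg (Λ : Finset ℕ) (N : ℕ) : 0 ≤ targetWeight Λ N :=
  sum_nonneg fun k _ => by split_ifs <;> positivity

theorem targetWeight_apply {Λ : Finset ℕ} {k : ℕ} (hk : k ∈ Λ) :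
    targetWeight Λ (2 * (k + 1)) = 1 / (k + 1) := by
  unfold targetWeight
  rw [sum_eq_single_of_mem k hk fun j _ hj => if_neg (by omega), if_pos rfl]

theorem targetWeight_eq_zero {Λ : Finset ℕ} {N : ℕ} (h : ∀ k ∈ Λ, N ≠ 2 * (k + 1)) :
    targetWeight Λ N = 0 :=
  sum_eq_zero fun k hk => if_neg (h k hk)

theorem targetWeight_le_majorant {Λ : Finset ℕ} {q : ℕ} (hΛ : ∀ k ∈ Λ, q ^ 5 ≤ k + 1) (N : ℕ) :
    targetWeight Λ N ≤ majorant q N := by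
  by_cases h : ∃ k ∈ Λ, N = 2 * (k + 1)
  · obtain ⟨k, hk, rfl⟩ := h
    rw [targetWeight_apply hk]
    refine le_trans (le_of_eq ?_) (two_div_le_majorant (Nat.mul_le_mul_left 2 (hΛ k hk)))
    push_cast
    field_simp
  · push Not at h
    rw [targetWeight_eq_zero h]
    exact majorant_nonneg q N

theorem sum_targetWeight_le (Λ : Finset ℕ) (M : ℕ) :
    ∑ N ∈ range (M + 1), targetWeight Λ N ≤ ∑ k ∈ Λ, (1 : ℝ) / (k + 1) := by
  unfold targetWeight
  rw [sum_comm]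
  refine sum_le_sum fun k _ => ?_
  rw [sum_ite_eq' (range (M + 1)) (2 * (k + 1)) fun _ => (1 : ℝ) / (k + 1)]
  split_ifs
  · exact le_rfl
  · positivity

theorem badWeight_le_majorant {P : ℕ → ℕ} {L k q : ℕ} (hP : q ^ 5 ≤ P k) (N : ℕ) :
    badWeight P L k N ≤ majorant q N := by
  unfold badWeight
  split_ifs with h
  · rcases Nat.eq_zero_or_pos N with rfl | hN
    · rw [Nat.cast_zero, div_zero]
      exact majorant_nonneg q 0
    · exact two_div_le_majorant ((Nat.mul_le_mul_left 2 hP).trans (Nat.le_of_dvd hN h.1))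
  · exact majorant_nonneg q N

theorem sum_badWeight_le {P : ℕ → ℕ} {L k : ℕ} (hP : 0 < P k) (M : ℕ) :
    ∑ N ∈ range (M + 1), badWeight P L k N ≤ 1 / P k * ∑ j ∈ range (M + 1), (1 : ℝ) / j := by
  have h1 : ∀ N, badWeight P L k N ≤ if 2 * P k ∣ N then (2 : ℝ) / N else 0 := by
    intro N
    unfold badWeight
    split_ifs with h h' h'
    · exact le_rfl
    · exact absurd h.1 h'
    · positivity
    · exact le_rfl
  refine (sum_le_sum fun N _ => h1 N).trans ?_
  rw [← sum_filter, mul_sum]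
  have h2 : (range (M + 1)).filter (fun N => 2 * P k ∣ N) ⊆
      (range (M + 1)).image fun j => 2 * P k * j := by
    intro N hN
    obtain ⟨hN, j, rfl⟩ := mem_filter.1 hN
    refine mem_image.2 ⟨j, mem_range.2 (lt_of_le_of_lt ?_ (mem_range.1 hN)), rfl⟩
    exact Nat.le_mul_of_pos_left j (by omega)
  refine (sum_le_sum_of_subset_of_nonneg h2 fun N _ _ => by positivity).trans ?_
  rw [sum_image fun a _ b _ h => Nat.eq_of_mul_eq_mul_left (by omega) h]
  refine sum_le_sum fun j _ => le_of_eq ?_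
  push_cast
  rw [mul_assoc, div_mul_eq_div_div, div_self two_ne_zero, one_div_mul_one_div]

end Weights

section Scale

/-- The quantitative relations between the degree `n`, the scale `q` (about `n ^ (1 / 20)`) and
the fixed parameters. -/
structure Scale (x ε c : ℝ) (n q : ℕ) : Prop where
  c_pos : 0 < c
  c_le : 10 * c ≤ 1
  c_eps : 8 * c ≤ ε
  x_nonneg : 0 ≤ x
  eps_le : ε ≤ 1 / 2
  q_ge : 16 ≤ q
  lower : q ^ 20 ≤ n
  upper : n < (q + 1) ^ 20
  cq : 200 ≤ c * q
  fixed : 2 ^ 11 * x * q ^ 10 + 4 * q ^ 7 + q ≤ (q : ℝ) ^ 11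
  err : (332 + 2 ^ 20 + 2 ^ 11 * x + 8) * (1 / q) +
    81 * 2 ^ 20 * ((q : ℝ) ^ 20 * (1 / 2 ^ q)) ≤ c
  theta : (2 * x + 10) * (1 / q) + (1 - 2 * ε) ^ q ≤ c

variable {x ε c : ℝ} {n q : ℕ}

namespace Scale

theorem one_le_q (h : Scale x ε c n q) : (1 : ℝ) ≤ q := by
  have := h.q_ge
  exact_mod_cast (by omega : 1 ≤ q)

theorem q_pos (h : Scale x ε c n q) : (0 : ℝ) < q := lt_of_lt_of_le one_pos h.one_le_q

theorem lower' (h : Scale x ε c n q) : (q : ℝ) ^ 20 ≤ n := by exact_mod_cast h.lower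

theorem one_le_n (h : Scale x ε c n q) : (1 : ℝ) ≤ n := (one_le_pow₀ h.one_le_q).trans h.lower'

theorem eight_pow_le (h : Scale x ε c n q) : 8 * (q : ℝ) ^ 7 ≤ c * n := by
  have h1 : (q : ℝ) ^ 8 ≤ n := (pow_le_pow_right₀ h.one_le_q (by norm_num)).trans h.lower'
  have h2 : (0 : ℝ) ≤ (q : ℝ) ^ 7 := pow_nonneg h.q_pos.le 7
  calc 8 * (q : ℝ) ^ 7 ≤ c * q * (q : ℝ) ^ 7 := mul_le_mul_of_nonneg_right (by linarith [h.cq]) h2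
    _ = c * (q : ℝ) ^ 8 := by ring
    _ ≤ c * n := mul_le_mul_of_nonneg_left h1 h.c_pos.le

theorem floor_le (h : Scale x ε c n q) : (⌊c * n⌋₊ : ℝ) ≤ c * n :=
  Nat.floor_le (mul_nonneg h.c_pos.le (Nat.cast_nonneg n))

theorem le_floor (h : Scale x ε c n q) : c * n / 2 ≤ (⌊c * n⌋₊ : ℝ) := by
  have h1 := Nat.lt_floor_add_one (c * n)
  have h2 := h.eight_pow_le
  have h3 : (1 : ℝ) ≤ (q : ℝ) ^ 7 := one_le_pow₀ h.one_le_q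
  linarith

theorem pow_le_floor (h : Scale x ε c n q) : q ^ 7 ≤ ⌊c * n⌋₊ := by
  refine Nat.le_floor ?_
  push_cast
  have := h.eight_pow_le
  have h3 : (0 : ℝ) ≤ (q : ℝ) ^ 7 := pow_nonneg h.q_pos.le 7
  linarith

theorem lt_pow (h : Scale x ε c n q) : n < (q ^ 5) ^ 5 := by
  refine h.upper.trans_le ?_
  have h1 : (q + 1) ^ 20 ≤ (2 * q) ^ 20 := Nat.pow_le_pow_left (by linarith [h.q_ge]) 20
  refine h1.trans ?_
  rw [mul_pow, ← pow_mul, show 5 * 5 = 5 + 20 by norm_num, pow_add]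
  refine Nat.mul_le_mul_right _ ?_
  calc 2 ^ 20 = 16 ^ 5 := by norm_num
    _ ≤ q ^ 5 := Nat.pow_le_pow_left h.q_ge 5

theorem square_lt (h : Scale x ε c n q) : 4 * (q ^ 7) ^ 2 + 2 * q ^ 7 + 1 < n := by
  refine lt_of_lt_of_le ?_ h.lower
  have h1 : 1 ≤ q ^ 7 := Nat.one_le_pow _ _ (by linarith [h.q_ge])
  have h2 : 16 ^ 6 ≤ q ^ 6 := Nat.pow_le_pow_left h.q_ge 6
  have h3 : q ^ 20 = q ^ 6 * (q ^ 7) ^ 2 := by ring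
  rw [h3]
  generalize q ^ 7 = y at *
  have h4 : 16 ^ 6 * y ^ 2 ≤ q ^ 6 * y ^ 2 := Nat.mul_le_mul_right _ h2
  nlinarith

theorem inv_le (h : Scale x ε c n q) : 1 / (q : ℝ) ≤ c / 200 := by
  rw [div_le_iff₀ h.q_pos]
  linarith [h.cq]

theorem half_le (h : Scale x ε c n q) : (n : ℝ) / 2 ≤ n * (1 - 3 * c) := by
  have := h.c_le
  have := h.one_le_n
  nlinarith

theorem two_floor_le (h : Scale x ε c n q) : 2 * ⌊c * n⌋₊ ≤ n := by
  rw [← Nat.cast_le (α := ℝ)]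
  push_cast
  have := h.floor_le
  have := h.c_le
  have := h.one_le_n
  nlinarith

theorem cast_pred_pow (h : Scale x ε c n q) : ((q ^ 7 - 1 : ℕ) : ℝ) + 1 = (q : ℝ) ^ 7 := by
  have h1 : 1 ≤ q ^ 7 := Nat.one_le_pow _ _ (by linarith [h.q_ge])
  rw [Nat.cast_sub h1]
  push_cast
  ring

theorem two_le (h : Scale x ε c n q) {d : ℕ} (hd : (d : ℝ) ≤ (1 / 2 - ε) * n) :
    2 * (d : ℝ) + 8 * (((q ^ 7 - 1 : ℕ) : ℝ) + 1) + 2 * (2 * ⌊c * n⌋₊ : ℕ) ≤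
      (1 - ε) * (n * (1 - 3 * c)) := by
  rw [h.cast_pred_pow]
  push_cast
  have h1 := h.eight_pow_le
  have h2 := h.floor_le
  have h3 := mul_le_mul_of_nonneg_right h.c_eps (Nat.cast_nonneg (α := ℝ) n)
  have h4 : 0 ≤ ε * (c * n) :=
    mul_nonneg (by linarith [h.c_eps, h.c_pos]) (mul_nonneg h.c_pos.le (Nat.cast_nonneg n))
  linarith

theorem room (h : Scale x ε c n q) :
    n * (1 - 3 * c) + ((2 * ⌊c * n⌋₊ : ℕ) : ℝ) ≤ (n - 2 * (q ^ 7 - 1 + 1) : ℕ) := by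
  have h1 : 1 ≤ q ^ 7 := Nat.one_le_pow _ _ (by linarith [h.q_ge])
  have h2 := h.eight_pow_le
  have h3 := h.floor_le
  have h4 : 2 * q ^ 7 ≤ n := by
    have := h.square_lt
    omega
  rw [Nat.sub_add_cancel h1, Nat.cast_sub h4]
  push_cast
  have : (0 : ℝ) ≤ (q : ℝ) ^ 7 := pow_nonneg h.q_pos.le 7
  linarith

theorem eta (h : Scale x ε c n q) :
    ((q ^ 11 : ℕ) : ℝ) / (n * (1 - 3 * c) * (1 / (q : ℝ) ^ 8)) + (1 - ε) + 1 / (q : ℝ) ^ 8 ≤ 1 := by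
  have hq := h.q_pos
  have hn : (0 : ℝ) < n := by linarith [h.one_le_n]
  have h1 : (1 : ℝ) / (q : ℝ) ^ 8 ≤ 1 / q := by
    refine one_div_le_one_div_of_le hq ?_
    simpa using pow_le_pow_right₀ h.one_le_q (show 1 ≤ 8 by norm_num)
  have h2 : ((q ^ 11 : ℕ) : ℝ) / (n * (1 - 3 * c) * (1 / (q : ℝ) ^ 8)) ≤ 2 * (1 / q) := by
    have h3 := h.half_le
    have h4 : (0 : ℝ) < n * (1 - 3 * c) := by linarith
    push_cast
    rw [mul_one_div, div_div_eq_mul_div, div_le_iff₀ h4]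
    calc (q : ℝ) ^ 11 * (q : ℝ) ^ 8 = (q : ℝ) ^ 20 * (1 / (q : ℝ)) := by field_simp
      _ ≤ (n : ℝ) * (1 / (q : ℝ)) := mul_le_mul_of_nonneg_right h.lower' (by positivity)
      _ ≤ _ := by
        have : 0 ≤ 1 / (q : ℝ) := by positivity
        nlinarith
  have := h.inv_le
  have := h.c_eps
  have := h.c_pos
  linarith

theorem admissible (h : Scale x ε c n q) {d d' : ℕ} (hd : (d : ℝ) ≤ (1 / 2 - ε) * n)
    (hd' : (d' : ℝ) ≤ (1 / 2 - ε) * n) :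
    Admissible n d d' (n * (1 - 3 * c)) (1 / (q : ℝ) ^ 8) (1 - ε) (q ^ 11) (2 * ⌊c * n⌋₊)
      (majorant q) (q ^ 7 - 1) where
  ρ_pos := by linarith [h.half_le, h.one_le_n]
  l_pos := one_div_pos.2 (pow_pos h.q_pos 8)
  l_le := by
    refine one_div_le_one_div_of_le two_pos ?_
    have h1 : (16 : ℝ) ≤ q := by exact_mod_cast h.q_ge
    have h2 := pow_le_pow_right₀ h.one_le_q (show 1 ≤ 8 by norm_num)
    rw [pow_one] at h2
    linarith
  anti := majorant_antitone (by linarith [h.q_ge])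
  eta := h.eta
  room := h.room
  two := h.two_le hd
  two' := h.two_le hd'

theorem sqrt_le (h : Scale x ε c n q) : √n ≤ n * (1 / (q : ℝ) ^ 10) := by
  have h1 : (q : ℝ) ^ 10 ≤ √n := by
    refine Real.le_sqrt_of_sq_le ?_
    rw [← pow_mul]
    exact h.lower'
  have h2 : (0 : ℝ) < (q : ℝ) ^ 10 := pow_pos h.q_pos 10
  rw [mul_one_div, le_div_iff₀ h2]
  calc √n * (q : ℝ) ^ 10 ≤ √n * √n :=
        mul_le_mul_of_nonneg_left h1 (Real.sqrt_nonneg _)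
    _ = n := Real.mul_self_sqrt (Nat.cast_nonneg n)

theorem density_le (h : Scale x ε c n q) {k f f' d : ℕ} (hk : k + 1 ≤ q ^ 7) (hqk : q ≤ k + 1)
    (hf : (f : ℝ) ≤ x * √n) (hf' : (f' : ℝ) ≤ x * √n)
    (hd : (d : ℝ) ≤ (1 / 2 - ε) * n) :
    f + 5 * (k + 1) ≤ n ∧ f' + 5 * (k + 1) ≤ n ∧
      (k + 1) * ((f + f' + 10 * (k + 1)) / n : ℝ) + (2 * d / n : ℝ) ^ (k + 1) ≤ c := by
  have hq := h.q_pos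
  have hn : (0 : ℝ) < n := by linarith [h.one_le_n]
  have hkR : ((k : ℝ) + 1) ≤ (q : ℝ) ^ 7 := by exact_mod_cast hk
  have h3 : (0 : ℝ) ≤ 1 / q := by positivity
  have hz : (1 - 2 * ε) ^ q ≤ c := by
    have := h.theta
    have := mul_nonneg (by linarith [h.x_nonneg] : 0 ≤ 2 * x + 10) h3
    linarith
  have hz0 : 0 ≤ 1 - 2 * ε := by linarith [h.eps_le]
  have h10 : (q : ℝ) ^ 7 ≤ n * (1 / (q : ℝ) ^ 10) := by
    rw [mul_one_div, le_div_iff₀ (by positivity)]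
    refine le_trans (le_of_eq ?_) ((pow_le_pow_right₀ h.one_le_q (show 17 ≤ 20 by norm_num)).trans
      h.lower')
    ring
  have hsum : (f : ℝ) + f' + 10 * (k + 1) ≤ (2 * x + 10) * (n * (1 / (q : ℝ) ^ 10)) := by
    have := mul_le_mul_of_nonneg_left h.sqrt_le h.x_nonneg
    linarith
  have hmain : ((k : ℝ) + 1) * ((f + f' + 10 * (k + 1)) / n : ℝ) ≤ (2 * x + 10) * (1 / q) := by
    have h1 : (f + f' + 10 * (k + 1)) / n ≤ (2 * x + 10) * (1 / (q : ℝ) ^ 10) := by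
      rw [div_le_iff₀ hn]
      linarith
    calc _ ≤ (q : ℝ) ^ 7 * ((2 * x + 10) * (1 / (q : ℝ) ^ 10)) :=
          mul_le_mul hkR h1 (by positivity) (by positivity)
      _ = (2 * x + 10) * (1 / q * (1 / (q : ℝ) ^ 2)) := by field_simp
      _ ≤ (2 * x + 10) * (1 / q * 1) := by
          refine mul_le_mul_of_nonneg_left (mul_le_mul_of_nonneg_left ?_ h3)
            (by linarith [h.x_nonneg])
          exact (div_le_one (by positivity)).2 (one_le_pow₀ h.one_le_q)
      _ = _ := by rw [mul_one]
  have hle : (f : ℝ) + f' + 10 * (k + 1) ≤ n := by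
    have h1 : (2 * x + 10) * (1 / (q : ℝ)) ≤ 1 := by
      have := h.theta
      have := pow_nonneg hz0 q
      linarith [h.c_le, h.c_pos]
    have h2 : ((f : ℝ) + f' + 10 * (k + 1)) / n ≤ 1 := by
      refine le_trans ?_ (hmain.trans h1)
      refine le_mul_of_one_le_left (by positivity) ?_
      linarith [Nat.cast_nonneg (α := ℝ) k]
    rwa [div_le_one hn] at h2
  have hle' : f + f' + 10 * (k + 1) ≤ n := by exact_mod_cast hle
  refine ⟨by omega, by omega, (add_le_add hmain ?_).trans h.theta⟩
  have h5 : 2 * (d : ℝ) / n ≤ 1 - 2 * ε := by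
    rw [div_le_iff₀ hn]
    linarith
  calc (2 * (d : ℝ) / n) ^ (k + 1) ≤ (1 - 2 * ε) ^ (k + 1) :=
        pow_le_pow_left₀ (by positivity) h5 _
    _ ≤ (1 - 2 * ε) ^ q :=
        pow_le_pow_of_le_one hz0 (by linarith [h.c_eps, h.c_pos]) hqk

end Scale

theorem Scale.pr_genCount_sub_le (h : Scale x ε c n q) {τ τ' : Perm (Fin n)} {Λ : Finset ℕ}
    {P : ℕ → ℕ} (hP : ∀ k ∈ Λ, q ^ 5 ≤ P k ∧ P k ≤ k + 1) (hΛ : ∀ k ∈ Λ, k + 1 ≤ q ^ 7)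
    (hμ : 64 / c ≤ ∑ k ∈ Λ, (1 : ℝ) / (k + 1))
    (h1 : (cycleCount τ 1 : ℝ) ≤ x * √n) (h1' : (cycleCount τ' 1 : ℝ) ≤ x * √n)
    (h2 : (cycleCount τ 2 : ℝ) ≤ (1 / 2 - ε) * n)
    (h2' : (cycleCount τ' 2 : ℝ) ≤ (1 / 2 - ε) * n) :
    pr (fun σ => genCount τ τ' Λ σ - badCount τ τ' Λ (badWeight P ⌊c * n⌋₊) σ ≤ 8 / c) ≤
      44 * c := by
  have hc := h.c_pos
  have hc10 := h.c_le
  have hn : (0 : ℝ) < n := by linarith [h.one_le_n]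
  have hq1 : 1 ≤ q := by linarith [h.q_ge]
  have hq7 : 1 ≤ q ^ 7 := Nat.one_le_pow _ _ hq1
  have hρ := h.half_le
  have hρ0 : (0 : ℝ) < n * (1 - 3 * c) := by linarith
  have hMn := h.two_floor_le
  set M := 2 * ⌊c * n⌋₊ with hM
  set μ := ∑ k ∈ Λ, (1 : ℝ) / (k + 1) with hμdef
  set ρ := (n : ℝ) * (1 - 3 * c) with hρdef
  set κ := errorBound ρ (1 / (q : ℝ) ^ 8) (q ^ 11) M (majorant q) n
    (cycleCount τ 1 + cycleCount τ' 1) (4 * (q ^ 7 - 1 + 1)) with hκdef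
  have hκ : κ ≤ c := by
    rw [hκdef, Nat.sub_add_cancel hq7]
    refine (errorBound_le hq1 h.lower h.upper hMn hρ h.x_nonneg ?_ h.fixed).trans h.err
    push_cast
    linarith
  have hq5 : ∀ k ∈ Λ, q ^ 5 ≤ k + 1 := fun k hk => (hP k hk).1.trans (hP k hk).2
  have hk₀ : ∀ k ∈ Λ, k ≤ q ^ 7 - 1 := fun k hk => by
    have := hΛ k hk
    omega
  have hMk : ∀ N, M < N → targetWeight Λ N = 0 := by
    intro N hN
    refine targetWeight_eq_zero fun k hk hNk => ?_
    have h3 := h.pow_le_floor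
    have h4 := hΛ k hk
    omega
  have had := h.admissible h2 h2'
  have hE : (1 - c) * μ ≤ ex (genCount τ τ' Λ) := by
    refine ex_genCount_ge (by exact_mod_cast hn) fun k hk => h.density_le (hΛ k hk) ?_ h1 h1' h2
    exact (Nat.le_self_pow (by norm_num) q).trans (hq5 k hk)
  have hR : ∀ a ∈ genPats τ τ' Λ,
      ex (fun σ => open Classical in if Follows τ τ' a σ then offSum τ τ' (targetWeight Λ) a σ else 0) ≤
        pr (Follows τ τ' a) * (n * (μ / ρ) + c) := by
    intro a ha
    refine (ex_offSum_le had (targetWeight_nonneg Λ) (targetWeight_le_majorant hq5) hMk hk₀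
      ha).trans (mul_le_mul_of_nonneg_left (add_le_add ?_ hκ) (pr_nonneg _))
    exact mul_le_mul_of_nonneg_left (div_le_div_of_nonneg_right (sum_targetWeight_le Λ M) hρ0.le) hn.le
  have hR' : ∀ a ∈ genPats τ τ' Λ,
      ex (fun σ => open Classical in
        if Follows τ τ' a σ then offSum τ τ' (badWeight P ⌊c * n⌋₊ a.1) a σ else 0) ≤
        pr (Follows τ τ' a) * (2 * c) := by
    intro a ha
    have hk := (mem_genPats.1 ha).1
    have hPk := (hP _ hk).1
    have hPpos : 0 < P a.1 := lt_of_lt_of_le (Nat.pow_pos hq1) hPk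
    refine (ex_offSum_le had (badWeight_nonneg P _ _) (badWeight_le_majorant hPk)
      (fun N hN => if_neg fun h3 => absurd h3.2 (by omega)) hk₀
      ha).trans (mul_le_mul_of_nonneg_left ?_ (pr_nonneg _))
    have h3 : ∑ N ∈ range (M + 1), badWeight P ⌊c * n⌋₊ a.1 N ≤ 41 * (1 / q) := by
      refine (sum_badWeight_le hPpos M).trans ?_
      have h4 : (1 : ℝ) / P a.1 ≤ 1 / (q : ℝ) ^ 5 :=
        one_div_le_one_div_of_le (pow_pos h.q_pos 5) (by exact_mod_cast hPk)
      have h5 := sum_range_inv_le hq1 h.upper hMn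
      have h6 : (1 : ℝ) / (q : ℝ) ^ 3 ≤ 1 :=
        (div_le_one (pow_pos h.q_pos 3)).2 (one_le_pow₀ h.one_le_q)
      calc _ ≤ 1 / (q : ℝ) ^ 5 * (41 * q) :=
            mul_le_mul h4 h5 (sum_nonneg fun j _ => by positivity) (by positivity)
        _ = 41 * (1 / (q : ℝ)) * (1 / (q : ℝ) ^ 3) := by
            have := h.q_pos
            field_simp
        _ ≤ 41 * (1 / (q : ℝ)) * 1 :=
            mul_le_mul_of_nonneg_left h6 (by have := h.q_pos; positivity)
        _ = _ := mul_one _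
    have h4 : n * ((∑ N ∈ range (M + 1), badWeight P ⌊c * n⌋₊ a.1 N) / ρ) ≤ c := by
      rw [mul_div_assoc', div_le_iff₀ hρ0]
      have h5 := h.inv_le
      have h6 : ∑ N ∈ range (M + 1), badWeight P ⌊c * n⌋₊ a.1 N ≤ c / 2 := by linarith
      have h7 := mul_le_mul_of_nonneg_left h6 hn.le
      have h8 := mul_le_mul_of_nonneg_left hρ hc.le
      linarith
    linarith
  have hμ' : 64 ≤ c * μ := by
    rw [div_le_iff₀ hc] at hμ
    linarith
  have hμ0 : 0 < μ := by
    by_contra h0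
    nlinarith
  have hE0 : 0 < ex (genCount τ τ' Λ) := lt_of_lt_of_le (mul_pos (by linarith) hμ0) hE
  refine (pr_mono fun σ hσ => ?_).trans ((RandGen.pr_genCount_sub_le (targetWeight_nonneg Λ)
    (fun k hk => targetWeight_apply hk) (badWeight_nonneg P _) hR hR' hE0).trans ?_)
  · refine hσ.trans ?_
    rw [div_le_iff₀ hc]
    nlinarith
  · have h3 : n * (μ / ρ) ≤ (1 + 6 * c) * μ := by
      rw [mul_div_assoc', div_le_iff₀ hρ0, hρdef]
      have : 1 ≤ (1 + 6 * c) * (1 - 3 * c) := by nlinarith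
      have := mul_le_mul_of_nonneg_right this (mul_pos hn hμ0).le
      linarith
    have h4 : 4 * (1 + (n * (μ / ρ) + c) - ex (genCount τ τ' Λ)) / ex (genCount τ τ' Λ) ≤
        36 * c := by
      rw [div_le_iff₀ hE0]
      have h5 := mul_le_mul_of_nonneg_left hE (by linarith : 0 ≤ 4 + 36 * c)
      have h6 : 0 ≤ c * μ * (1 - 9 * c) := mul_nonneg (by linarith) (by linarith)
      linarith
    linarith

theorem Scale.pr_not_alternatingGroup_le (h : Scale x ε c n q) {τ τ' : Perm (Fin n)}
    {Λ : Finset ℕ} {P : ℕ → ℕ} {A : ℕ} (hA : A ≤ q)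
    (hP : ∀ k ∈ Λ, (P k).Prime ∧ q ^ 5 ≤ P k ∧ ∃ m, k + 1 = P k * m ∧
      ∀ d, 2 ≤ d → d < A → ¬ d ∣ m)
    (hΛ : ∀ k ∈ Λ, k + 1 ≤ q ^ 7) (hμ : 64 / c ≤ ∑ k ∈ Λ, (1 : ℝ) / (k + 1))
    (h1 : (cycleCount τ 1 : ℝ) ≤ x * √n) (h1' : (cycleCount τ' 1 : ℝ) ≤ x * √n)
    (h2 : (cycleCount τ 2 : ℝ) ≤ (1 / 2 - ε) * n)
    (h2' : (cycleCount τ' 2 : ℝ) ≤ (1 / 2 - ε) * n) :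
    pr (fun σ => ¬ Intrans τ τ' σ ∧ ¬ alternatingGroup (Fin n) ≤ genGroup τ τ' σ) ≤
      44 * c + pr (fun σ => ∃ a b, A ≤ a ∧ 2 ≤ b ∧ HasBlocks τ τ' a b σ) := by
  have hP' : ∀ k ∈ Λ, q ^ 5 ≤ P k ∧ P k ≤ k + 1 := by
    intro k hk
    obtain ⟨-, h3, m, h4, -⟩ := hP k hk
    exact ⟨h3, Nat.le_of_dvd (by omega) ⟨m, h4⟩⟩
  refine le_trans ?_ (add_le_add_left (h.pr_genCount_sub_le hP' hΛ hμ h1 h1' h2 h2') _)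
  refine (pr_mono fun σ hσ => ?_).trans (pr_or_le _ _)
  by_contra! hcon
  refine hσ.2 (alternatingGroup_le_of_genCount hP hΛ h.pow_le_floor
    (hA.trans (Nat.le_self_pow (by norm_num) q)) h.lt_pow h.square_lt ?_ hcon.1 hσ.1 ?_)
  · have h3 := h.le_floor
    have h4 := mul_le_mul_of_nonneg_left h3 (show 0 ≤ 8 / c by have := h.c_pos; positivity)
    refine le_trans (le_of_eq ?_) h4
    have := h.c_pos.ne'
    field_simp
    ring
  · rintro ⟨a, b, ha, hb, hB⟩
    exact hcon.2 a b ha hb hB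

end Scale

section Assembly

theorem eventually_scale {x ε c : ℝ} (hc : 0 < c) (hc10 : 10 * c ≤ 1) (hcε : 8 * c ≤ ε)
    (hx : 0 ≤ x) (hε : ε ≤ 1 / 2) :
    ∀ᶠ q : ℕ in atTop, ∀ n, q ^ 20 ≤ n → n < (q + 1) ^ 20 → Scale x ε c n q := by
  have hinv : Tendsto (fun q : ℕ => 1 / (q : ℝ)) atTop (nhds 0) := tendsto_one_div_atTop_nhds_zero_nat
  have hexp : Tendsto (fun q : ℕ => (q : ℝ) ^ 20 * (1 / 2 ^ q)) atTop (nhds 0) := by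
    simpa only [mul_one_div] using
      tendsto_pow_const_div_const_pow_of_one_lt 20 (by norm_num : (1 : ℝ) < 2)
  have herr := (hinv.const_mul (332 + 2 ^ 20 + 2 ^ 11 * x + 8)).add (hexp.const_mul (81 * 2 ^ 20))
  have hgeo : Tendsto (fun q : ℕ => (1 - 2 * ε) ^ q) atTop (nhds 0) :=
    tendsto_pow_atTop_nhds_zero_of_lt_one (by linarith) (by linarith)
  have htheta := (hinv.const_mul (2 * x + 10)).add hgeo
  simp only [mul_zero, add_zero] at herr htheta
  filter_upwards [eventually_ge_atTop 16, eventually_ge_atTop ⌈200 / c⌉₊,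
    eventually_ge_atTop ⌈2 ^ 11 * x + 5⌉₊, herr.eventually (ge_mem_nhds hc),
    htheta.eventually (ge_mem_nhds hc)] with q h16 hcq hfix he ht n hl hu
  have hq1 : (1 : ℝ) ≤ q := by exact_mod_cast (by omega : 1 ≤ q)
  refine ⟨hc, hc10, hcε, hx, hε, h16, hl, hu, ?_, ?_, he, ht⟩
  · have := Nat.ceil_le.1 hcq
    rw [div_le_iff₀ hc] at this
    linarith
  · have h1 := Nat.ceil_le.1 hfix
    have h7 := pow_le_pow_right₀ hq1 (show 7 ≤ 10 by norm_num)
    have h2 := pow_le_pow_right₀ hq1 (show 1 ≤ 10 by norm_num)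
    rw [pow_one] at h2
    have h3 : (0 : ℝ) ≤ (q : ℝ) ^ 10 := by linarith
    have := mul_le_mul_of_nonneg_right h1 h3
    have h4 : (q : ℝ) ^ 11 = q * (q : ℝ) ^ 10 := by ring
    rw [h4]
    linarith

theorem exists_nat_root (n : ℕ) {k : ℕ} (hk : k ≠ 0) : ∃ q, q ^ k ≤ n ∧ n < (q + 1) ^ k := by
  classical
  have hex : ∃ q, n < (q + 1) ^ k :=
    ⟨n, (Nat.lt_succ_self n).trans_le (Nat.le_self_pow hk _)⟩
  refine ⟨Nat.find hex, ?_, Nat.find_spec hex⟩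
  rcases Nat.eq_zero_or_pos (Nat.find hex) with h | h
  · rw [h, zero_pow hk]
    exact Nat.zero_le n
  · have := Nat.find_min hex (Nat.sub_lt h one_pos)
    rw [Nat.sub_add_cancel (show 1 ≤ Nat.find hex from h)] at this
    omega

theorem eventually_of_root {p : ℕ → ℕ → Prop} {k : ℕ} (hk : k ≠ 0)
    (h : ∀ᶠ q in atTop, ∀ n, q ^ k ≤ n → n < (q + 1) ^ k → p n q) :
    ∀ᶠ n in atTop, ∃ q, p n q := by
  obtain ⟨Q, hQ⟩ := eventually_atTop.1 h
  filter_upwards [eventually_ge_atTop (Q ^ k)] with n hn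
  obtain ⟨q, h1, h2⟩ := exists_nat_root n hk
  exact ⟨q, hQ q (Nat.lt_succ_iff.1 ((Nat.pow_lt_pow_iff_left hk).1 (hn.trans_lt h2))) n h1 h2⟩

/-- Outside a small probability, the generated group is intransitive or contains the alternating
group. -/
theorem pr_not_alternatingGroup_small {x ε δ : ℝ} (hx : 0 ≤ x) (hε : 0 < ε) (hδ : 0 < δ) :
    ∀ᶠ n : ℕ in atTop, ∀ τ τ' : Perm (Fin n),
      cycleCount τ 1 ≤ x * √n → cycleCount τ' 1 ≤ x * √n →
      cycleCount τ 2 ≤ (1 / 2 - ε) * n → cycleCount τ' 2 ≤ (1 / 2 - ε) * n →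
      pr (fun σ => ¬ Intrans τ τ' σ ∧ ¬ alternatingGroup (Fin n) ≤ genGroup τ τ' σ) ≤ δ := by
  set e := min ε (1 / 2) with he
  have he0 : 0 < e := lt_min hε (by norm_num)
  set c := min (e / 8) (min (1 / 10) (δ / 88)) with hc
  have hc0 : 0 < c := lt_min (by linarith) (lt_min (by norm_num) (by linarith))
  have hc1 : c ≤ e / 8 := min_le_left _ _
  have hc2 : c ≤ 1 / 10 := (min_le_right _ _).trans (min_le_left _ _)
  have hc3 : c ≤ δ / 88 := (min_le_right _ _).trans (min_le_right _ _)
  obtain ⟨A, -, hA⟩ := pr_hasBlocks_small he0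
  have hq := eventually_of_root (p := fun n q => Scale x e c n q ∧ A ≤ q ∧
      ∃ (Λ : Finset ℕ) (P : ℕ → ℕ),
      (∀ k ∈ Λ, (P k).Prime ∧ q ^ 5 ≤ P k ∧ ∃ m, k + 1 = P k * m ∧
        ∀ d, 2 ≤ d → d < A → ¬ d ∣ m) ∧
      (∀ k ∈ Λ, k + 1 ≤ q ^ 7) ∧ 64 / c ≤ ∑ k ∈ Λ, (1 : ℝ) / (k + 1)) (k := 20) (by norm_num) (by
    filter_upwards [eventually_scale hc0 (by linarith) (by linarith) hx (min_le_right _ _),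
      eventually_ge_atTop A, eventually_exists_lengths A (64 / c)] with q h1 h2 h3 n hl hu
    exact ⟨h1 n hl hu, h2, h3⟩)
  filter_upwards [hq, hA (δ / 2) (by linarith)] with n ⟨q, hs, hAq, Λ, P, hP, hΛ, hμ⟩ hB τ τ' h1 h1' h2 h2'
  have hle : (1 / 2 - ε) * (n : ℝ) ≤ (1 / 2 - e) * n :=
    mul_le_mul_of_nonneg_right (by linarith [min_le_left ε (1 / 2 : ℝ)]) (Nat.cast_nonneg n)
  have h3 := h2.trans hle
  have h3' := h2'.trans hle
  have := hs.pr_not_alternatingGroup_le hAq hP hΛ hμ h1 h1' h3 h3'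
  have := hB τ τ' h1 h1' h3 h3'
  linarith

theorem one_sub_pr_sub_le_genProb {n : ℕ} (τ τ' : Perm (Fin n)) :
    1 - pr (Intrans τ τ') -
      pr (fun σ => ¬ Intrans τ τ' σ ∧ ¬ alternatingGroup (Fin n) ≤ genGroup τ τ' σ) ≤
        genProb n τ τ' := by
  have h1 := pr_not fun σ => alternatingGroup (Fin n) ≤ genGroup τ τ' σ
  have h2 : pr (fun σ => ¬ alternatingGroup (Fin n) ≤ genGroup τ τ' σ) ≤ _ :=
    (pr_mono (q := fun σ => Intrans τ τ' σ ∨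
      (¬ Intrans τ τ' σ ∧ ¬ alternatingGroup (Fin n) ≤ genGroup τ τ' σ)) fun σ hσ => by tauto).trans
      (pr_or_le _ _)
  rw [genProb_eq_pr]
  linarith

theorem genProb_le_one {n : ℕ} (τ τ' : Perm (Fin n)) : genProb n τ τ' ≤ 1 := by
  rw [genProb_eq_pr]
  exact pr_le_one _

theorem genProb_nonneg {n : ℕ} (τ τ' : Perm (Fin n)) : 0 ≤ genProb n τ τ' := by
  rw [genProb_eq_pr]
  exact pr_nonneg _

variable {π π' : (n : ℕ) → Perm (Fin n)}

theorem tendsto_genProb (hsym1 : ∀ n, cycleCount (π n) 1 = cycleCount (π' n) 1)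
    (hsym2 : ∀ n, cycleCount (π n) 2 = cycleCount (π' n) 2)
    (h1 : (fun n => (cycleCount (π n) 1 : ℝ)) =o[atTop] fun n => √n)
    (h2 : (fun n => (cycleCount (π n) 2 : ℝ)) =o[atTop] fun n => (n : ℝ)) :
    Tendsto (fun n => genProb n (π n) (π' n)) atTop (nhds 1) := by
  refine tendsto_order.2 ⟨fun a ha => ?_, fun a ha =>
    Eventually.of_forall fun n => (genProb_le_one _ _).trans_lt ha⟩
  set δ := (1 - a) / 3 with hδ
  have hδ0 : 0 < δ := by rw [hδ]; linarith
  obtain ⟨η, hη, hev⟩ := pr_intrans_small hδ0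
  have h1' := isLittleO_iff.1 h1 (lt_min hη one_pos)
  have h2' := isLittleO_iff.1 h2 (lt_min hη (show (0 : ℝ) < 1 / 4 by norm_num))
  filter_upwards [hev, h1', h2', pr_not_alternatingGroup_small (x := 1) (ε := 1 / 4) zero_le_one
    (by norm_num) hδ0] with n hn k1 k2 hnot
  rw [Real.norm_natCast, Real.norm_of_nonneg (Real.sqrt_nonneg _)] at k1
  rw [Real.norm_natCast, Real.norm_natCast] at k2
  have k3 := k1.trans (mul_le_mul_of_nonneg_right (min_le_left η 1) (Real.sqrt_nonneg n))
  have k4 := k1.trans (mul_le_mul_of_nonneg_right (min_le_right η 1) (Real.sqrt_nonneg n))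
  have k5 := k2.trans (mul_le_mul_of_nonneg_right (min_le_left η (1 / 4)) (Nat.cast_nonneg n))
  have k6 := k2.trans (mul_le_mul_of_nonneg_right
    ((min_le_right η (1 / 4)).trans (by norm_num : (1 : ℝ) / 4 ≤ 1 / 2 - 1 / 4)) (Nat.cast_nonneg n))
  have e1 := hn (π n) (π' n) k3 (hsym1 n ▸ k3) k5 (hsym2 n ▸ k5)
  have e2 := hnot (π n) (π' n) k4 (hsym1 n ▸ k4) k6 (hsym2 n ▸ k6)
  have e3 := one_sub_pr_sub_le_genProb (π n) (π' n)
  linarith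

theorem liminf_genProb_pos (hsym1 : ∀ n, cycleCount (π n) 1 = cycleCount (π' n) 1)
    (hsym2 : ∀ n, cycleCount (π n) 2 = cycleCount (π' n) 2)
    (h1 : (fun n => (cycleCount (π n) 1 : ℝ)) =O[atTop] fun n => √n)
    (h2 : limsup (fun n => (cycleCount (π n) 2 : ℝ) / n) atTop < 1 / 2) :
    0 < liminf (fun n => genProb n (π n) (π' n)) atTop := by
  obtain ⟨x, hx, h1⟩ := h1.exists_pos
  rw [isBigOWith_iff] at h1
  obtain ⟨b, hb, hb2⟩ := exists_between h2
  have hbdd : IsBoundedUnder (· ≤ ·) atTop fun n => (cycleCount (π n) 2 : ℝ) / n := by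
    refine isBoundedUnder_of ⟨1, fun n => div_le_one_of_le₀ ?_ (Nat.cast_nonneg n)⟩
    have := cycleCount_sum_le (π n)
    exact_mod_cast (by omega : cycleCount (π n) 2 ≤ n)
  have hev := eventually_lt_of_limsup_lt hb hbdd
  have hε : 0 < 1 / 2 - b := by linarith
  obtain ⟨c, hc, hI⟩ := pr_intrans_le_one_sub hx.le hε
  refine lt_of_lt_of_le (half_pos hc) (le_liminf_of_le ?_ ?_)
  · exact isCoboundedUnder_ge_of_le atTop (x := 1) fun n => genProb_le_one _ _
  filter_upwards [h1, hev, hI, pr_not_alternatingGroup_small hx.le hε (half_pos hc),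
    eventually_gt_atTop 0] with n k1 k2 hI hnot hn
  rw [Real.norm_natCast, Real.norm_of_nonneg (Real.sqrt_nonneg _)] at k1
  rw [div_lt_iff₀ (by exact_mod_cast hn)] at k2
  have k3 : (cycleCount (π n) 2 : ℝ) ≤ (1 / 2 - (1 / 2 - b)) * n := by linarith
  have e1 := hI (π n) (π' n) k1 (hsym1 n ▸ k1) k3 (hsym2 n ▸ k3)
  have e2 := hnot (π n) (π' n) k1 (hsym1 n ▸ k1) k3 (hsym2 n ▸ k3)
  have e3 := one_sub_pr_sub_le_genProb (π n) (π' n)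
  linarith

theorem eventually_lt_genProb (h : 0 < liminf (fun n => genProb n (π n) (π' n)) atTop) :
    ∃ p : ℝ, 0 < p ∧ ∀ᶠ n in atTop, p < genProb n (π n) (π' n) := by
  obtain ⟨p, hp, hp2⟩ := exists_between h
  exact ⟨p, hp, eventually_lt_of_lt_liminf hp2
    (isBoundedUnder_of ⟨0, fun n => genProb_nonneg _ _⟩)⟩

end Assembly

end RandGen

/-- The symmetric case: if `c₁ = c'₁` and `c₂ = c'₂`, then (1) the generation probability tends
to `1` iff `c₁ = o(n^{1/2})` and `c₂ = o(n)`; (2) it is bounded away from `0` iff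
`c₁ = O(n^{1/2})` and `limsup c₂/n < 1/2`. -/
theorem random_generation_symmetric_case
    (π π' : (n : ℕ) → Equiv.Perm (Fin n))
    (hsym1 : ∀ n, cycleCount (π n) 1 = cycleCount (π' n) 1)
    (hsym2 : ∀ n, cycleCount (π n) 2 = cycleCount (π' n) 2) :
    (Tendsto (fun n => genProb n (π n) (π' n)) atTop (nhds 1) ↔
      ((fun n => (cycleCount (π n) 1 : ℝ)) =o[atTop] fun n => Real.sqrt n) ∧
      ((fun n => (cycleCount (π n) 2 : ℝ)) =o[atTop] fun n => (n : ℝ))) ∧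
    (0 < liminf (fun n => genProb n (π n) (π' n)) atTop ↔
      ((fun n => (cycleCount (π n) 1 : ℝ)) =O[atTop] fun n => Real.sqrt n) ∧
      limsup (fun n => (cycleCount (π n) 2 : ℝ) / n) atTop < 1 / 2) := by
  refine ⟨⟨fun h => ⟨RandGen.isLittleO_one_of_tendsto hsym1 h,
    RandGen.isLittleO_two_of_tendsto hsym2 h⟩, fun h =>
    RandGen.tendsto_genProb hsym1 hsym2 h.1 h.2⟩, fun h => ?_, fun h =>
    RandGen.liminf_genProb_pos hsym1 hsym2 h.1 h.2⟩
  obtain ⟨p, hp, hev⟩ := RandGen.eventually_lt_genProb h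
  exact ⟨RandGen.isBigO_one_of_eventually hsym1 hp hev,
    RandGen.limsup_two_of_eventually hsym2 hp hev⟩
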